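/- (Bourgain's circular maximal function theorem.) Let σ denote the uniform probability measure on the unit circle S¹ ⊂ ℝ², and for t > 0 and f : ℝ² → ℂ set A_t f(x) := ∫_{S¹} f(x − ty) dσ(y). Then for every p > 2 there is a constant C such that (∫_{ℝ²} sup_{t>0} |A_t f(x)|^p dx)^{1/p} ≤ C ‖f‖_{L^p(ℝ²)} for all continuous compactly supported f : ℝ² → ℂ. -/

import Mathlib

open MeasureTheory
open scoped RealInnerProductSpace ENNReal

noncomputable section

/-- `ℝ²` as a euclidean space. -/
abbrev V2 := EuclideanSpace ℝ (Fin 2)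

/-- The point `(cos θ, sin θ)` on the unit circle `S¹ ⊂ ℝ²`. -/
def circleVec (θ : ℝ) : V2 :=
  (EuclideanSpace.equiv (Fin 2) ℝ).symm ![Real.cos θ, Real.sin θ]

/-- The circular average `A_t f(x) = ∫_{S¹} f(x − ty) dσ(y)`, where `σ` is the
normalised arc length (rotation-invariant probability) measure on `S¹`, realised via
the parametrisation `θ ↦ (cos θ, sin θ)`. -/
def circAvg (t : ℝ) (f : V2 → ℂ) (x : V2) : ℂ :=
  (((2 * Real.pi)⁻¹ : ℝ) : ℂ) * ∫ θ in (0 : ℝ)..(2 * Real.pi), f (x - t • circleVec θ)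

open scoped ContDiff
/-! ### Smooth kernels on the line -/

/-- A smooth function equal to `0` on `(-∞, -1]` and to `s` on `[1, ∞)`. -/
def ramp (s : ℝ) : ℝ := s * Real.smoothTransition ((s + 1) / 2)

/-- A smooth function of integral one supported in `[-1, 1]`. -/
def mollifier : ℝ → ℝ := deriv (deriv ramp)

/-- A second primitive of `osc`. -/
def osc2 (s : ℝ) : ℝ := ramp s - 2 * ramp (s / 2)

/-- A primitive of `osc`. -/
def osc1 : ℝ → ℝ := deriv osc2

/-- The difference of two consecutive dilates of the mollifier. -/
def osc : ℝ → ℝ := deriv osc1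

/-- The derivative of `osc`. -/
def oscDeriv : ℝ → ℝ := deriv osc

/-- `k` is the second derivative of `k₂`, with first derivative `k₁`; all of them are supported
in `[-2, 2]` and bounded by `M`. -/
structure IsOscKernel (k k₁ k₂ : ℝ → ℝ) (M : ℝ) : Prop where
  cont : Continuous k
  d₁ : ∀ s, HasDerivAt k₁ (k s) s
  d₂ : ∀ s, HasDerivAt k₂ (k₁ s) s
  supp : ∀ s, 2 < |s| → k s = 0 ∧ k₁ s = 0 ∧ k₂ s = 0
  bd : ∀ s, |k s| ≤ M ∧ |k₁ s| ≤ M ∧ |k₂ s| ≤ M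

lemma ramp_contDiff : ContDiff ℝ ∞ ramp := by
  unfold ramp
  exact contDiff_id.mul (Real.smoothTransition.contDiff.comp
    ((contDiff_id.add contDiff_const).div_const 2))

lemma ramp_of_le {s : ℝ} (h : s ≤ -1) : ramp s = 0 := by
  simp [ramp, Real.smoothTransition.zero_of_nonpos (show (s + 1) / 2 ≤ 0 by linarith)]

lemma ramp_of_ge {s : ℝ} (h : 1 ≤ s) : ramp s = s := by
  simp [ramp, Real.smoothTransition.one_of_one_le (show 1 ≤ (s + 1) / 2 by linarith)]

lemma osc2_contDiff : ContDiff ℝ ∞ osc2 := by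
  unfold osc2
  exact ramp_contDiff.sub (contDiff_const.mul (ramp_contDiff.comp (contDiff_id.div_const 2)))

lemma contDiff_deriv_top {f : ℝ → ℝ} (hf : ContDiff ℝ ∞ f) : ContDiff ℝ ∞ (deriv f) := by
  have := (contDiff_succ_iff_deriv (n := ∞) (f := f)).1 (by simpa using hf)
  exact this.2.2

lemma osc1_contDiff : ContDiff ℝ ∞ osc1 := contDiff_deriv_top osc2_contDiff
lemma osc_contDiff : ContDiff ℝ ∞ osc := contDiff_deriv_top osc1_contDiff
lemma oscDeriv_contDiff : ContDiff ℝ ∞ oscDeriv := contDiff_deriv_top osc_contDiff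
lemma mollifier_contDiff : ContDiff ℝ ∞ mollifier :=
  contDiff_deriv_top (contDiff_deriv_top ramp_contDiff)

lemma hasDerivAt_of_contDiff_top {f : ℝ → ℝ} (hf : ContDiff ℝ ∞ f) (s : ℝ) :
    HasDerivAt f (deriv f s) s :=
  (hf.differentiable (by simp) s).hasDerivAt

lemma deriv_eq_zero_of_eqOn {f : ℝ → ℝ} {U : Set ℝ} (hU : IsOpen U) (h : ∀ s ∈ U, f s = 0) :
    ∀ s ∈ U, deriv f s = 0 := by
  intro s hs
  have : f =ᶠ[nhds s] fun _ => 0 := Filter.eventually_of_mem (hU.mem_nhds hs) h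
  rw [this.deriv_eq, deriv_const]

lemma isOpen_two_lt_abs (a : ℝ) : IsOpen {s : ℝ | a < |s|} :=
  isOpen_lt continuous_const continuous_abs

lemma osc2_zero {s : ℝ} (h : 2 < |s|) : osc2 s = 0 := by
  rcases lt_abs.1 h with h | h
  · rw [osc2, ramp_of_ge (by linarith), ramp_of_ge (by linarith)]; ring
  · rw [osc2, ramp_of_le (by linarith), ramp_of_le (by linarith)]; ring

lemma osc1_zero {s : ℝ} (h : 2 < |s|) : osc1 s = 0 :=
  deriv_eq_zero_of_eqOn (isOpen_two_lt_abs 2) (fun _ h => osc2_zero h) s h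

lemma osc_zero {s : ℝ} (h : 2 < |s|) : osc s = 0 :=
  deriv_eq_zero_of_eqOn (isOpen_two_lt_abs 2) (fun _ h => osc1_zero h) s h

lemma oscDeriv_zero {s : ℝ} (h : 2 < |s|) : oscDeriv s = 0 :=
  deriv_eq_zero_of_eqOn (isOpen_two_lt_abs 2) (fun _ h => osc_zero h) s h

lemma mollifier_zero {s : ℝ} (h : 1 < |s|) : mollifier s = 0 := by
  rcases lt_abs.1 h with h | h
  · have h1 : ∀ s ∈ Set.Ioi (1 : ℝ), deriv (fun s => deriv ramp s - 1) s = 0 := by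
      apply deriv_eq_zero_of_eqOn isOpen_Ioi
      intro s hs
      have : ramp =ᶠ[nhds s] fun s => s :=
        Filter.eventually_of_mem (isOpen_Ioi.mem_nhds hs) fun t ht => ramp_of_ge (le_of_lt ht)
      rw [this.deriv_eq]; simp
    have := h1 s h
    rwa [deriv_sub_const] at this
  · apply deriv_eq_zero_of_eqOn (isOpen_Iio (a := (-1 : ℝ))) _ s (by simp; linarith)
    apply deriv_eq_zero_of_eqOn isOpen_Iio
    intro s hs
    exact ramp_of_le (le_of_lt hs)

lemma osc_eq (s : ℝ) : osc s = mollifier s - (1 / 2) * mollifier (s / 2) := by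
  have h1 : ∀ s, osc1 s = deriv ramp s - deriv ramp (s / 2) := by
    intro s
    have a := hasDerivAt_of_contDiff_top ramp_contDiff s
    have b := (hasDerivAt_of_contDiff_top ramp_contDiff (s / 2)).comp s
      ((hasDerivAt_id s).div_const 2)
    have c := (a.sub (b.const_mul 2)).deriv
    have : osc1 s = deriv (ramp - fun y => 2 * (ramp ∘ fun x => id x / 2) y) s := rfl
    rw [this, c]; ring
  have h2 : osc1 = fun s => deriv ramp s - deriv ramp (s / 2) := funext h1
  have hd := contDiff_deriv_top ramp_contDiff
  have a := hasDerivAt_of_contDiff_top hd s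
  have b := (hasDerivAt_of_contDiff_top hd (s / 2)).comp s ((hasDerivAt_id s).div_const 2)
  have c := (a.sub b).deriv
  have : osc s = deriv (deriv ramp - (deriv ramp ∘ fun x => id x / 2)) s := by
    rw [osc, h2]; rfl
  rw [this, c]; simp only [mollifier]; ring

lemma exists_bound_of_support {f : ℝ → ℝ} (hf : Continuous f) {a : ℝ}
    (h : ∀ s, a < |s| → f s = 0) : ∃ M, ∀ s, |f s| ≤ M := by
  obtain ⟨M, hM⟩ := (isCompact_Icc (a := -a) (b := a)).exists_bound_of_continuousOn hf.continuousOn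
  refine ⟨max M 0, fun s => ?_⟩
  by_cases hs : a < |s|
  · simp [h s hs]
  · exact (hM s (abs_le.1 (not_lt.1 hs))).trans (le_max_left _ _)

/-- A common bound for `osc2`, `osc1`, `osc` and `oscDeriv`. -/
lemma exists_osc_bound : ∃ M : ℝ, 0 < M ∧ IsOscKernel osc osc1 osc2 M ∧
    IsOscKernel oscDeriv osc osc1 M := by
  obtain ⟨a, ha⟩ := exists_bound_of_support osc2_contDiff.continuous fun _ h => osc2_zero h
  obtain ⟨b, hb⟩ := exists_bound_of_support osc1_contDiff.continuous fun _ h => osc1_zero h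
  obtain ⟨c, hc⟩ := exists_bound_of_support osc_contDiff.continuous fun _ h => osc_zero h
  obtain ⟨d, hd⟩ := exists_bound_of_support oscDeriv_contDiff.continuous fun _ h => oscDeriv_zero h
  have a0 := (abs_nonneg _).trans (ha 0)
  have b0 := (abs_nonneg _).trans (hb 0)
  have c0 := (abs_nonneg _).trans (hc 0)
  have d0 := (abs_nonneg _).trans (hd 0)
  refine ⟨a + b + c + d + 1, by positivity, ⟨osc_contDiff.continuous,
    hasDerivAt_of_contDiff_top osc1_contDiff, hasDerivAt_of_contDiff_top osc2_contDiff,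
    fun s h => ⟨osc_zero h, osc1_zero h, osc2_zero h⟩, fun s => ⟨?_, ?_, ?_⟩⟩,
    ⟨oscDeriv_contDiff.continuous,
    hasDerivAt_of_contDiff_top osc_contDiff, hasDerivAt_of_contDiff_top osc1_contDiff,
    fun s h => ⟨oscDeriv_zero h, osc_zero h, osc1_zero h⟩, fun s => ⟨?_, ?_, ?_⟩⟩⟩
  · linarith [hc s]
  · linarith [hb s]
  · linarith [ha s]
  · linarith [hd s]
  · linarith [hc s]
  · linarith [hb s]

lemma integral_mollifier : ∫ s, mollifier s = 1 := by
  have hd := contDiff_deriv_top ramp_contDiff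
  have h1 : ∫ s, mollifier s = ∫ s in (-2 : ℝ)..2, mollifier s := by
    rw [intervalIntegral.integral_of_le (by norm_num)]
    symm
    apply setIntegral_eq_integral_of_forall_compl_eq_zero
    intro x hx
    apply mollifier_zero
    by_contra hcon
    apply hx
    have := abs_le.1 (not_lt.1 hcon)
    constructor <;> linarith
  have h2 : ∫ s in (-2 : ℝ)..2, mollifier s = deriv ramp 2 - deriv ramp (-2) :=
    intervalIntegral.integral_eq_sub_of_hasDerivAt
      (fun x _ => hasDerivAt_of_contDiff_top hd x)
      (mollifier_contDiff.continuous.intervalIntegrable _ _)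
  rw [h1, h2]
  have a : ramp =ᶠ[nhds 2] fun s => s :=
    Filter.eventually_of_mem (isOpen_Ioi.mem_nhds (show (1 : ℝ) < 2 by norm_num))
      fun t ht => ramp_of_ge (le_of_lt ht)
  have b : ramp =ᶠ[nhds (-2)] fun _ => 0 :=
    Filter.eventually_of_mem (isOpen_Iio.mem_nhds (show (-2 : ℝ) < -1 by norm_num))
      fun t ht => ramp_of_le (le_of_lt ht)
  rw [a.deriv_eq, b.deriv_eq]; simp

/-! ### Integrability, polar coordinates and sublevel sets of the cosine -/

lemma integrable_of_bdd_support {α : Type*} [PseudoMetricSpace α] [ProperSpace α]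
    [MeasurableSpace α] {μ : Measure α} [IsFiniteMeasureOnCompacts μ]
    {f : α → ℝ} (hf : Measurable f) {M : ℝ} (hM : ∀ x, |f x| ≤ M) {s : Set α}
    (hs : Bornology.IsBounded s) (h0 : ∀ x, x ∉ s → f x = 0) : Integrable f μ := by
  rw [← integrableOn_iff_integrable_of_support_subset (s := s)]
  · exact Measure.integrableOn_of_bounded hs.measure_lt_top.ne hf.aestronglyMeasurable
      (Filter.Eventually.of_forall fun x => by simpa using hM x)
  · intro x hx
    by_contra hcon
    exact hx (h0 x hcon)

lemma lintegral_polar {f : ℂ → ℝ≥0∞} (hf : Measurable f) :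
    ∫⁻ p, f p = ∫⁻ r in Set.Ioi (0 : ℝ), ENNReal.ofReal r *
      ∫⁻ θ in Set.Ioo (-Real.pi) Real.pi, f (r * (Real.cos θ + Real.sin θ * Complex.I)) := by
  rw [← Complex.lintegral_comp_polarCoord_symm]
  have hm : Measurable fun p : ℝ × ℝ =>
      f ((p.1 : ℂ) * ((Real.cos p.2 : ℂ) + (Real.sin p.2 : ℂ) * Complex.I)) := by
    apply hf.comp; fun_prop
  have h1 : polarCoord.target = Set.Ioi (0 : ℝ) ×ˢ Set.Ioo (-Real.pi) Real.pi := rfl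
  rw [h1, Measure.volume_eq_prod, ← Measure.prod_restrict, lintegral_prod]
  · apply lintegral_congr
    intro r
    rw [← lintegral_const_mul]
    · apply lintegral_congr
      intro θ
      simp only [Complex.polarCoord_symm_apply, smul_eq_mul]
    · exact hm.comp (measurable_const.prodMk measurable_id)
  · apply Measurable.aemeasurable
    simp only [Complex.polarCoord_symm_apply, smul_eq_mul]
    exact (ENNReal.measurable_ofReal.comp measurable_fst).mul hm

lemma integral_polar {f : ℂ → ℝ} (hf : Measurable f) {M R : ℝ} (hM : ∀ x, |f x| ≤ M)
    (hR : ∀ x, R < ‖x‖ → f x = 0) :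
    ∫ p, f p = ∫ r in Set.Ioi (0 : ℝ), r *
      ∫ θ in Set.Ioo (-Real.pi) Real.pi, f (r * (Real.cos θ + Real.sin θ * Complex.I)) := by
  have hm : Measurable fun p : ℝ × ℝ =>
      f ((p.1 : ℂ) * ((Real.cos p.2 : ℂ) + (Real.sin p.2 : ℂ) * Complex.I)) := by
    apply hf.comp; fun_prop
  have hn : ∀ p : ℝ × ℝ, 0 < p.1 →
      ‖(p.1 : ℂ) * ((Real.cos p.2 : ℂ) + (Real.sin p.2 : ℂ) * Complex.I)‖ = p.1 := by
    intro p hp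
    rw [norm_mul, Complex.norm_of_nonneg hp.le]
    have : ((Real.cos p.2 : ℂ) + (Real.sin p.2 : ℂ) * Complex.I) = Complex.exp (p.2 * Complex.I) := by
      rw [Complex.exp_mul_I]; push_cast; ring
    rw [this, Complex.norm_exp_ofReal_mul_I, mul_one]
  rw [← Complex.integral_comp_polarCoord_symm]
  have h1 : polarCoord.target = Set.Ioi (0 : ℝ) ×ˢ Set.Ioo (-Real.pi) Real.pi := rfl
  rw [h1, Measure.volume_eq_prod, setIntegral_prod]
  · apply setIntegral_congr_fun measurableSet_Ioi
    intro r _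
    simp only [Complex.polarCoord_symm_apply, smul_eq_mul]
    rw [integral_const_mul]
  · simp only [Complex.polarCoord_symm_apply, smul_eq_mul]
    have hfin : (volume : Measure ℝ).prod volume
        ((Set.Ioc 0 R) ×ˢ Set.Ioo (-Real.pi) Real.pi) ≠ ⊤ := by
      rw [Measure.prod_prod]
      exact ENNReal.mul_ne_top (by simp) (by simp)
    have hM0 := (abs_nonneg _).trans (hM 0)
    have key : IntegrableOn (fun p : ℝ × ℝ => p.1 * f ((p.1 : ℂ) *
        ((Real.cos p.2 : ℂ) + (Real.sin p.2 : ℂ) * Complex.I)))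
        ((Set.Ioc 0 R) ×ˢ Set.Ioo (-Real.pi) Real.pi) ((volume : Measure ℝ).prod volume) := by
      refine Measure.integrableOn_of_bounded (M := |R| * M) hfin
        (measurable_fst.mul hm).aestronglyMeasurable ?_
      filter_upwards [ae_restrict_mem (measurableSet_Ioc.prod measurableSet_Ioo)] with p hp
      rw [Real.norm_eq_abs, abs_mul]
      have h2 : |p.1| ≤ |R| := by
        rw [abs_of_pos hp.1.1]; exact hp.1.2.trans (le_abs_self _)
      exact mul_le_mul h2 (hM _) (abs_nonneg _) (abs_nonneg _)
    refine key.of_forall_sdiff_eq_zero (measurableSet_Ioi.prod measurableSet_Ioo) ?_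
    rintro ⟨r, θ⟩ ⟨⟨h2, h3⟩, h4⟩
    have h5 : R < r := by
      by_contra hcon
      exact h4 ⟨⟨h2, not_lt.1 hcon⟩, h3⟩
    have := hR _ (by rw [hn (r, θ) h2]; exact h5)
    simp only at this
    simp only [this, mul_zero]

lemma sq_le_cos_sub_cos {a b : ℝ} (ha : 0 ≤ a) (hab : a ≤ b) (hb : b ≤ Real.pi) :
    2 * ((b - a) / Real.pi) ^ 2 ≤ Real.cos a - Real.cos b := by
  have hpi := Real.pi_pos
  rw [Real.cos_sub_cos]
  have h1 : 2 / Real.pi * ((b - a) / 2) ≤ Real.sin ((b - a) / 2) :=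
    Real.mul_le_sin (by linarith) (by linarith)
  have h0 : 0 ≤ (b - a) / Real.pi := div_nonneg (by linarith) hpi.le
  have h1' : (b - a) / Real.pi ≤ Real.sin ((b - a) / 2) := by
    convert h1 using 1; field_simp
  have h2 : Real.sin ((b - a) / 2) ≤ Real.sin ((a + b) / 2) := by
    rcases le_total ((a + b) / 2) (Real.pi / 2) with h | h
    · exact Real.sin_le_sin_of_le_of_le_pi_div_two (by linarith) h (by linarith)
    · rw [← Real.sin_pi_sub ((a + b) / 2)]
      exact Real.sin_le_sin_of_le_of_le_pi_div_two (by linarith) (by linarith) (by linarith)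
  have h3 : Real.sin ((a - b) / 2) = - Real.sin ((b - a) / 2) := by
    rw [← Real.sin_neg]; congr 1; ring
  rw [h3]
  nlinarith [mul_le_mul h1' (h1'.trans h2) h0 (h0.trans h1')]

lemma sq_le_abs_cos_sub_cos (j : ℤ) {a b : ℝ} (ha : a ∈ Set.Icc (j * Real.pi) ((j + 1) * Real.pi))
    (hb : b ∈ Set.Icc (j * Real.pi) ((j + 1) * Real.pi)) :
    2 * ((b - a) / Real.pi) ^ 2 ≤ |Real.cos a - Real.cos b| := by
  wlog hab : a ≤ b generalizing a b
  · rw [abs_sub_comm, show (b - a) / Real.pi = - ((a - b) / Real.pi) by ring, neg_sq]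
    exact this hb ha (le_of_not_ge hab)
  have h := sq_le_cos_sub_cos (a := a - j * Real.pi) (b := b - j * Real.pi)
    (by linarith [ha.1]) (by linarith) (by linarith [hb.2])
  rw [Real.cos_sub_int_mul_pi, Real.cos_sub_int_mul_pi, ← mul_sub] at h
  have h2 : |Real.cos a - Real.cos b| = |(-1 : ℝ) ^ j * (Real.cos a - Real.cos b)| := by
    rw [abs_mul, abs_zpow]; simp
  rw [h2]
  refine le_trans (le_of_eq ?_) (h.trans (le_abs_self _))
  congr 3; ring

lemma volume_cos_sublevel_piece (j : ℤ) (c ε : ℝ) :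
    volume ({φ : ℝ | |Real.cos φ - c| ≤ ε} ∩ Set.Icc (j * Real.pi) ((j + 1) * Real.pi)) ≤
      ENNReal.ofReal (Real.pi * √ε) := by
  refine (Real.volume_le_diam _).trans (Metric.ediam_le ?_)
  rintro a ⟨ha, ha'⟩ b ⟨hb, hb'⟩
  have h1 := sq_le_abs_cos_sub_cos j hb' ha'
  have h2 : |Real.cos b - Real.cos a| ≤ 2 * ε := by
    have h3 := abs_le.1 (show |Real.cos a - c| ≤ ε from ha)
    have h4 := abs_le.1 (show |Real.cos b - c| ≤ ε from hb)
    rw [abs_le]; constructor <;> linarith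
  rw [edist_dist, Real.dist_eq]
  apply ENNReal.ofReal_le_ofReal
  have h5 : ((a - b) / Real.pi) ^ 2 ≤ ε := by linarith
  have h6 := Real.abs_le_sqrt h5
  rw [abs_div, abs_of_pos Real.pi_pos, div_le_iff₀ Real.pi_pos] at h6
  linarith

/-- Sublevel sets of a shifted cosine on a period have measure at most a multiple of `√ε`. -/
lemma volume_cos_sublevel (c : ℝ) {θ₀ : ℝ} (ε : ℝ) (h₀ : |θ₀| ≤ Real.pi) :
    volume ({θ : ℝ | |Real.cos (θ - θ₀) - c| ≤ ε} ∩ Set.Ioo (-Real.pi) Real.pi) ≤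
      ENNReal.ofReal (4 * Real.pi * √ε) := by
  have hpi := Real.pi_pos
  have hle := abs_le.1 h₀
  have hsub : {θ : ℝ | |Real.cos (θ - θ₀) - c| ≤ ε} ∩ Set.Ioo (-Real.pi) Real.pi ⊆
      ⋃ j ∈ Finset.Ico (-2 : ℤ) 2, (fun θ => θ + (-θ₀)) ⁻¹'
        ({φ : ℝ | |Real.cos φ - c| ≤ ε} ∩ Set.Icc (j * Real.pi) ((j + 1) * Real.pi)) := by
    rintro θ ⟨h1, h2, h3⟩
    simp only [Set.mem_iUnion]
    refine ⟨⌊(θ - θ₀) / Real.pi⌋, ?_, ?_, ?_⟩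
    · rw [Finset.mem_Ico, Int.le_floor, Int.floor_lt, le_div_iff₀ hpi, div_lt_iff₀ hpi]
      push_cast
      constructor <;> linarith
    · simpa [sub_eq_add_neg] using h1
    · have h4 := Int.floor_le ((θ - θ₀) / Real.pi)
      have h5 := (Int.lt_floor_add_one ((θ - θ₀) / Real.pi)).le
      rw [le_div_iff₀ hpi] at h4
      rw [div_le_iff₀ hpi] at h5
      exact ⟨by linarith, by linarith⟩
  refine (measure_mono hsub).trans ((measure_biUnion_finset_le _ _).trans ?_)
  have hpc : ∀ j ∈ Finset.Ico (-2 : ℤ) 2, volume ((fun θ : ℝ => θ + (-θ₀)) ⁻¹'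
      ({φ : ℝ | |Real.cos φ - c| ≤ ε} ∩ Set.Icc (j * Real.pi) ((j + 1) * Real.pi))) ≤
      ENNReal.ofReal (Real.pi * √ε) := by
    intro j _
    rw [measure_preimage_add_right]
    exact volume_cos_sublevel_piece j c ε
  refine (Finset.sum_le_sum hpc).trans ?_
  rw [Finset.sum_const, nsmul_eq_mul, show (Finset.Ico (-2 : ℤ) 2).card = 4 by decide]
  rw [show (4 * Real.pi * √ε) = 4 * (Real.pi * √ε) by ring,
    ENNReal.ofReal_mul (by norm_num : (0 : ℝ) ≤ 4)]
  simp

lemma volume_phase_sublevel (A : ℝ) {B θ₀ : ℝ} (ε : ℝ) (hB : 0 < B) (h₀ : |θ₀| ≤ Real.pi) :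
    volume ({θ : ℝ | |A - B * Real.cos (θ - θ₀)| ≤ ε} ∩ Set.Ioo (-Real.pi) Real.pi) ≤
      ENNReal.ofReal (4 * Real.pi * √(ε / B)) := by
  refine (measure_mono ?_).trans
    (volume_cos_sublevel (A / B) (ε / B) h₀)
  rintro θ ⟨h1, h2⟩
  refine ⟨?_, h2⟩
  have : Real.cos (θ - θ₀) - A / B = - (A - B * Real.cos (θ - θ₀)) / B := by field_simp; ring
  simp only [Set.mem_ofPred_eq] at h1 ⊢
  rw [this, abs_div, abs_neg, abs_of_pos hB]
  gcongr

/-! ### Kernel estimates for the averaged `L²` bound -/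

lemma norm_sub_polar_sq (v : ℂ) (r θ : ℝ) :
    ‖v - r * (Real.cos θ + Real.sin θ * Complex.I)‖ ^ 2 =
      r ^ 2 + ‖v‖ ^ 2 - 2 * r * ‖v‖ * Real.cos (θ - Complex.arg v) := by
  have h1 : ‖v‖ * Real.cos (Complex.arg v) = v.re := Complex.norm_mul_cos_arg v
  have h2 : ‖v‖ * Real.sin (Complex.arg v) = v.im := Complex.norm_mul_sin_arg v
  rw [Real.cos_sub, Complex.sq_norm, Complex.sq_norm, Complex.normSq_apply, Complex.normSq_apply]
  simp only [Complex.sub_re, Complex.sub_im, Complex.mul_re, Complex.mul_im, Complex.add_re,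
    Complex.add_im, Complex.ofReal_re, Complex.ofReal_im, Complex.I_re, Complex.I_im]
  have h3 := Real.sin_sq_add_cos_sq θ
  have h4 : 2 * r * ‖v‖ * (Real.cos θ * Real.cos v.arg + Real.sin θ * Real.sin v.arg) =
    2 * r * (Real.cos θ * v.re + Real.sin θ * v.im) := by rw [← h1, ← h2]; ring
  rw [h4]
  nlinarith

lemma abs_arg_le (v : ℂ) : |Complex.arg v| ≤ Real.pi := Complex.abs_arg_le_pi v

lemma norm_polar (r θ : ℝ) (hr : 0 ≤ r) :
    ‖(r : ℂ) * (Real.cos θ + Real.sin θ * Complex.I)‖ = r := by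
  rw [norm_mul, Complex.norm_of_nonneg hr]
  have : ((Real.cos θ : ℂ) + (Real.sin θ : ℂ) * Complex.I) = Complex.exp (θ * Complex.I) := by
    rw [Complex.exp_mul_I]; push_cast; ring
  rw [this, Complex.norm_exp_ofReal_mul_I, mul_one]

lemma lintegral_min_sqrt {a : ℝ} (ha : 0 < a) :
    ∫⁻ r in Set.Ioi (0 : ℝ), ENNReal.ofReal (√r * min 1 ((a / r) ^ 2)) ≤
      ENNReal.ofReal (3 * (a * √a)) := by
  rw [← Set.Ioc_union_Ioi_eq_Ioi ha.le]
  refine (lintegral_union_le _ _ _).trans ?_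
  rw [show 3 * (a * √a) = a * √a + 2 * (a * √a) by ring, ENNReal.ofReal_add (by positivity)
    (by positivity)]
  gcongr
  · calc _ ≤ ∫⁻ r in Set.Ioc 0 a, ENNReal.ofReal (√a) := by
          refine setLIntegral_mono measurable_const fun r hr => ?_
          apply ENNReal.ofReal_le_ofReal
          calc √r * min 1 ((a / r) ^ 2) ≤ √a * 1 := by
                gcongr
                · exact hr.2
                · exact min_le_left _ _
            _ = √a := mul_one _
      _ = _ := by
          rw [setLIntegral_const, Real.volume_Ioc, sub_zero, ← ENNReal.ofReal_mul (by positivity),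
            mul_comm]
  · have hi := integrableOn_Ioi_rpow_of_lt (a := -(3 / 2 : ℝ)) (by norm_num) ha
    have hv := integral_Ioi_rpow_of_lt (a := -(3 / 2 : ℝ)) (by norm_num) ha
    calc _ ≤ ∫⁻ r in Set.Ioi a, ENNReal.ofReal (a ^ 2 * r ^ (-(3 / 2 : ℝ))) := by
          refine setLIntegral_mono (by fun_prop) fun r hr => ?_
          have hr0 : 0 < r := ha.trans hr
          apply ENNReal.ofReal_le_ofReal
          calc √r * min 1 ((a / r) ^ 2) ≤ √r * (a / r) ^ 2 := by
                gcongr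
                exact min_le_right _ _
            _ = a ^ 2 * r ^ (-(3 / 2 : ℝ)) := by
                rw [Real.sqrt_eq_rpow, show (-(3 / 2 : ℝ)) = 1 / 2 - (2 : ℕ) by norm_num,
                  Real.rpow_sub hr0, Real.rpow_natCast]
                field_simp
      _ = ENNReal.ofReal (∫ r in Set.Ioi a, a ^ 2 * r ^ (-(3 / 2 : ℝ))) := by
          rw [ofReal_integral_eq_lintegral_ofReal (hi.const_mul _)]
          filter_upwards [ae_restrict_mem measurableSet_Ioi] with r hr
          have hr0 : 0 < r := ha.trans hr
          positivity
      _ = _ := by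
          rw [integral_const_mul, hv]
          congr 1
          rw [Real.sqrt_eq_rpow, show (-(3 / 2 : ℝ)) + 1 = 1 / 2 - (1 : ℕ) by norm_num,
            Real.rpow_sub ha, Real.rpow_natCast]
          field_simp
          ring

lemma lintegral_annulus_weight {δ R : ℝ} (hδ : 0 < δ) (hR : 0 < R) {x y : ℂ}
    (hxy : 1 / 4 ≤ ‖x - y‖) :
    ∫⁻ y', Set.indicator {y' | |‖x - y'‖ ^ 2 - ‖x - y‖ ^ 2| ≤ 4 * δ}
      (fun y' => ENNReal.ofReal (min 1 ((δ / (R * ‖y - y'‖)) ^ 2))) y' ≤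
      ENNReal.ofReal (36 * Real.pi * (δ ^ 2 / (R * √R))) := by
  have hpi := Real.pi_pos
  rw [← lintegral_add_left_eq_self _ y, lintegral_polar]
  swap
  · apply Measurable.indicator
    · fun_prop
    · exact (isClosed_le (by fun_prop) continuous_const).measurableSet
  set v := x - y with hv
  have hv0 : 0 < ‖v‖ := by linarith
  calc _ ≤ ∫⁻ r in Set.Ioi (0 : ℝ), ENNReal.ofReal (12 * Real.pi * √δ) *
        ENNReal.ofReal (√r * min 1 (((δ / R) / r) ^ 2)) := by
        refine setLIntegral_mono (by fun_prop) fun r hr => ?_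
        have hr : 0 < r := hr
        have h1 : ∫⁻ θ in Set.Ioo (-Real.pi) Real.pi,
            Set.indicator {y' | |‖x - y'‖ ^ 2 - ‖x - y‖ ^ 2| ≤ 4 * δ}
            (fun y' => ENNReal.ofReal (min 1 ((δ / (R * ‖y - y'‖)) ^ 2)))
            (y + r * (Real.cos θ + Real.sin θ * Complex.I)) ≤
            ENNReal.ofReal (min 1 (((δ / R) / r) ^ 2)) *
              ENNReal.ofReal (4 * Real.pi * √((4 * δ) / (2 * r * ‖v‖))) := by
          calc _ ≤ ∫⁻ θ in Set.Ioo (-Real.pi) Real.pi, ENNReal.ofReal (min 1 (((δ / R) / r) ^ 2)) *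
                Set.indicator {θ : ℝ | |r ^ 2 - 2 * r * ‖v‖ * Real.cos (θ - v.arg)| ≤ 4 * δ} 1 θ := by
                refine lintegral_mono fun θ => ?_
                apply Set.indicator_apply_le'
                · intro h
                  have h2 : x - (y + r * (Real.cos θ + Real.sin θ * Complex.I)) =
                    v - r * (Real.cos θ + Real.sin θ * Complex.I) := by rw [hv]; ring
                  rw [Set.mem_ofPred_eq, h2, norm_sub_polar_sq] at h
                  rw [Set.indicator_of_mem (by
                    rw [Set.mem_ofPred_eq]; convert h using 2; ring)]
                  rw [Pi.one_apply, mul_one]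
                  rw [show y - (y + r * (Real.cos θ + Real.sin θ * Complex.I)) =
                    - (r * (Real.cos θ + Real.sin θ * Complex.I)) by ring, norm_neg,
                    norm_polar r θ hr.le, div_div]
                · intro _; exact zero_le
            _ = ENNReal.ofReal (min 1 (((δ / R) / r) ^ 2)) * volume
                ({θ : ℝ | |r ^ 2 - 2 * r * ‖v‖ * Real.cos (θ - v.arg)| ≤ 4 * δ} ∩
                  Set.Ioo (-Real.pi) Real.pi) := by
                have hms : MeasurableSet
                    {θ : ℝ | |r ^ 2 - 2 * r * ‖v‖ * Real.cos (θ - v.arg)| ≤ 4 * δ} :=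
                  (isClosed_le (by fun_prop) continuous_const).measurableSet
                rw [lintegral_const_mul _ (measurable_one.indicator hms), lintegral_indicator hms]
                simp [Measure.restrict_apply, hms]
            _ ≤ _ := by
                gcongr
                exact volume_phase_sublevel _ _ (by positivity) (abs_arg_le v)
        refine (mul_le_mul_right h1 _).trans ?_
        rw [← ENNReal.ofReal_mul (by positivity), ← ENNReal.ofReal_mul hr.le,
          ← ENNReal.ofReal_mul (by positivity)]
        apply ENNReal.ofReal_le_ofReal
        have h2 : √((4 * δ) / (2 * r * ‖v‖)) ≤ 3 * √δ / √r := by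
          rw [← Real.sqrt_sq (show (0 : ℝ) ≤ 3 by norm_num), ← Real.sqrt_mul (by norm_num),
            ← Real.sqrt_div' _ hr.le]
          apply Real.sqrt_le_sqrt
          rw [div_le_div_iff₀ (by positivity) hr]
          have : 0 < δ * r := by positivity
          nlinarith
        have h3 : √r * √r = r := Real.mul_self_sqrt hr.le
        calc _ ≤ r * (min 1 (((δ / R) / r) ^ 2) * (4 * Real.pi * (3 * √δ / √r))) := by gcongr
          _ = 12 * Real.pi * √δ * (√r * min 1 (((δ / R) / r) ^ 2)) := by
            have : r / √r = √r := Real.div_sqrt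
            linear_combination (12 * Real.pi * √δ * min 1 (((δ / R) / r) ^ 2)) * this
    _ ≤ ENNReal.ofReal (12 * Real.pi * √δ) * ENNReal.ofReal (3 * ((δ / R) * √(δ / R))) := by
        rw [lintegral_const_mul _ (by fun_prop)]
        gcongr
        exact lintegral_min_sqrt (by positivity)
    _ = _ := by
        rw [← ENNReal.ofReal_mul (by positivity), Real.sqrt_div hδ.le]
        congr 1
        have : √δ * √δ = δ := Real.mul_self_sqrt hδ.le
        have hs : 0 < √R := Real.sqrt_pos.2 hR
        field_simp
        linear_combination 36 * this

/-- A smooth function equal to `1` on `(-∞, 1/4]` and to `0` on `[3/4, ∞)`. -/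
def cutoff (q : ℝ) : ℝ := 1 - Real.smoothTransition (2 * q - 1 / 2)

lemma cutoff_contDiff : ContDiff ℝ ∞ cutoff := by
  unfold cutoff
  exact contDiff_const.sub (Real.smoothTransition.contDiff.comp
    ((contDiff_const.mul contDiff_id).sub contDiff_const))

lemma cutoff_of_le {q : ℝ} (h : q ≤ 1 / 4) : cutoff q = 1 := by
  rw [cutoff, Real.smoothTransition.zero_of_nonpos (by linarith), sub_zero]

lemma cutoff_of_ge {q : ℝ} (h : 3 / 4 ≤ q) : cutoff q = 0 := by
  rw [cutoff, Real.smoothTransition.one_of_one_le (by linarith), sub_self]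

lemma cutoff_nonneg (q : ℝ) : 0 ≤ cutoff q := by
  unfold cutoff; linarith [Real.smoothTransition.le_one (2 * q - 1 / 2)]

lemma cutoff_le_one (q : ℝ) : cutoff q ≤ 1 := by
  unfold cutoff; linarith [Real.smoothTransition.nonneg (2 * q - 1 / 2)]

lemma deriv_cutoff_zero {q : ℝ} (h : 3 / 4 < q) : deriv cutoff q = 0 :=
  deriv_eq_zero_of_eqOn (isOpen_Ioi (a := (3 / 4 : ℝ))) (fun _ h => cutoff_of_ge (le_of_lt h)) q h

lemma deriv_deriv_cutoff_zero {q : ℝ} (h : 3 / 4 < q) : deriv (deriv cutoff) q = 0 :=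
  deriv_eq_zero_of_eqOn (isOpen_Ioi (a := (3 / 4 : ℝ))) (fun _ h => deriv_cutoff_zero h) q h

lemma deriv_cutoff_zero' {q : ℝ} (h : q < 1 / 4) : deriv cutoff q = 0 := by
  have : cutoff =ᶠ[nhds q] fun _ => 1 :=
    Filter.eventually_of_mem (isOpen_Iio.mem_nhds (show q < 1 / 4 from h))
      fun t ht => cutoff_of_le (le_of_lt ht)
  rw [this.deriv_eq, deriv_const]

lemma exists_cutoff_bound : ∃ M : ℝ, 1 ≤ M ∧
    ∀ q, |deriv cutoff q| ≤ M ∧ |deriv (deriv cutoff) q| ≤ M := by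
  have h1 : ∀ s : ℝ, 1 < |s| → deriv cutoff s = 0 := by
    intro s hs
    rcases lt_abs.1 hs with h | h
    · exact deriv_cutoff_zero (by linarith)
    · exact deriv_cutoff_zero' (by linarith)
  have h2 : ∀ s : ℝ, 1 < |s| → deriv (deriv cutoff) s = 0 :=
    deriv_eq_zero_of_eqOn (isOpen_two_lt_abs 1) h1
  obtain ⟨a, ha⟩ := exists_bound_of_support (contDiff_deriv_top cutoff_contDiff).continuous h1
  obtain ⟨b, hb⟩ := exists_bound_of_support
    (contDiff_deriv_top (contDiff_deriv_top cutoff_contDiff)).continuous h2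
  have a0 := (abs_nonneg _).trans (ha 0)
  have b0 := (abs_nonneg _).trans (hb 0)
  exact ⟨a + b + 1, by linarith, fun q => ⟨by linarith [ha q], by linarith [hb q]⟩⟩

lemma IsOscKernel.continuous₁ {k k₁ k₂ : ℝ → ℝ} {M : ℝ} (h : IsOscKernel k k₁ k₂ M) :
    Continuous k₁ := continuous_iff_continuousAt.2 fun s => (h.d₁ s).continuousAt

lemma IsOscKernel.continuous₂ {k k₁ k₂ : ℝ → ℝ} {M : ℝ} (h : IsOscKernel k k₁ k₂ M) :
    Continuous k₂ := continuous_iff_continuousAt.2 fun s => (h.d₂ s).continuousAt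

lemma IsOscKernel.nonneg {k k₁ k₂ : ℝ → ℝ} {M : ℝ} (h : IsOscKernel k k₁ k₂ M) : 0 ≤ M :=
  (abs_nonneg _).trans (h.bd 0).1

lemma integral_eq_zero_of_hasLineDerivAt {E : Type*} [NormedAddCommGroup E] [NormedSpace ℝ E]
    [MeasurableSpace E] [BorelSpace E] [FiniteDimensional ℝ E] {μ : Measure E}
    [μ.IsAddHaarMeasure] {U U' : E → ℝ} {v : E} (h : ∀ x, HasLineDerivAt ℝ U (U' x) x v)
    (hU : Integrable U μ) (hU' : Integrable U' μ) : ∫ x, U' x ∂μ = 0 := by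
  have := integral_bilinear_hasLineDerivAt_right_eq_neg_left_of_integrable (μ := μ)
    (f := fun _ : E => (1 : ℝ)) (f' := fun _ => 0) (g := U) (g' := U') (v := v)
    (B := ContinuousLinearMap.mul ℝ ℝ) (by simp) (by simpa using hU') (by simpa using hU)
    (fun x _ => by simpa [HasLineDerivAt] using hasDerivAt_const (0 : ℝ) (1 : ℝ)) (fun x _ => h x)
  simpa using this

lemma abs_integral_le_of_support {α : Type*} [MeasurableSpace α] {μ : Measure α} {f : α → ℝ}
    {s : Set α} {M : ℝ} (hs : μ s ≠ ⊤) (hM : ∀ x, |f x| ≤ M)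
    (h0 : ∀ x, x ∉ s → f x = 0) : |∫ x, f x ∂μ| ≤ M * μ.real s := by
  rw [← setIntegral_eq_integral_of_forall_compl_eq_zero h0]
  have := norm_setIntegral_le_of_norm_le_const (μ := μ) (s := s) (f := f) (C := M)
    (lt_top_iff_ne_top.2 hs) (fun x _ => by simpa using hM x)
  simpa using this

lemma phase_line (x y y' : ℂ) :
    ∀ t : ℝ, ‖x + t • (y - y') - y'‖ ^ 2 - ‖x + t • (y - y') - y‖ ^ 2 =
      ‖x - y'‖ ^ 2 - ‖x - y‖ ^ 2 + t * (2 * ‖y - y'‖ ^ 2) := by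
  intro t
  simp only [Complex.sq_norm, Complex.normSq_apply, Complex.sub_re, Complex.sub_im, Complex.add_re,
    Complex.add_im, Complex.smul_re, Complex.smul_im, smul_eq_mul]
  ring

lemma volume_strip_ne_top (b : ℂ) (R : ℝ) (P : ℂ → Prop) :
    volume {x : ℂ | ‖x - b‖ ≤ R ∧ P x} ≠ ⊤ := by
  refine ((measure_mono ?_).trans_lt (measure_closedBall_lt_top (x := b) (r := R))).ne
  rintro x ⟨h, -⟩
  simpa [dist_eq_norm] using h

lemma abs_integral_cutoff_mul_le {k k₁ k₂ : ℝ → ℝ} {M Mg : ℝ} (hk : IsOscKernel k k₁ k₂ M)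
    (hMg : 1 ≤ Mg) (hg : ∀ q, |deriv cutoff q| ≤ Mg ∧ |deriv (deriv cutoff) q| ≤ Mg)
    {δ R : ℝ} (hδ : 0 < δ) (hR : 0 < R) (b : ℂ) {y y' : ℂ} (hy : y ≠ y')
    (s : ℝ) :
    |∫ x, cutoff (‖x - b‖ ^ 2 / R ^ 2) * k (s + (‖x - y'‖ ^ 2 - ‖x - y‖ ^ 2) / δ)| ≤
      2 * M * Mg * min 1 ((δ / (R * ‖y - y'‖)) ^ 2) *
      volume.real {x : ℂ | ‖x - b‖ ≤ R ∧ |s + (‖x - y'‖ ^ 2 - ‖x - y‖ ^ 2) / δ| ≤ 2} := by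
  have hM := hk.nonneg
  set Z := {x : ℂ | ‖x - b‖ ≤ R ∧ |s + (‖x - y'‖ ^ 2 - ‖x - y‖ ^ 2) / δ| ≤ 2} with hZ
  have hZt : volume Z ≠ ⊤ := volume_strip_ne_top b R _
  have hgc := cutoff_contDiff.continuous
  have hgc1 := (contDiff_deriv_top cutoff_contDiff).continuous
  have hgc2 := (contDiff_deriv_top (contDiff_deriv_top cutoff_contDiff)).continuous
  have hq : ∀ x : ℂ, ¬ ‖x - b‖ ≤ R → 3 / 4 < ‖x - b‖ ^ 2 / R ^ 2 := by
    intro x hx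
    rw [lt_div_iff₀ (by positivity)]
    push Not at hx
    nlinarith [mul_pos hR hR]
  have h1 : |∫ x, cutoff (‖x - b‖ ^ 2 / R ^ 2) * k (s + (‖x - y'‖ ^ 2 - ‖x - y‖ ^ 2) / δ)| ≤
      M * volume.real Z := by
    apply abs_integral_le_of_support hZt
    · intro x
      rw [abs_mul, abs_of_nonneg (cutoff_nonneg _)]
      calc _ ≤ 1 * M := mul_le_mul (cutoff_le_one _) (hk.bd _).1 (abs_nonneg _) zero_le_one
        _ = M := one_mul M
    · intro x hx
      by_cases h : ‖x - b‖ ≤ R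
      · have : ¬ |s + (‖x - y'‖ ^ 2 - ‖x - y‖ ^ 2) / δ| ≤ 2 := fun h' => hx ⟨h, h'⟩
        rw [(hk.supp _ (not_le.1 this)).1, mul_zero]
      · rw [cutoff_of_ge (hq x h).le, zero_mul]
  have hV0 : 0 < ‖y - y'‖ := norm_pos_iff.2 (sub_ne_zero.2 hy)
  set V := y - y' with hV
  set lam := 2 * ‖V‖ ^ 2 / δ with hlam
  have hlam0 : 0 < lam := by positivity
  set L : ℂ → ℝ := fun x => s + (‖x - y'‖ ^ 2 - ‖x - y‖ ^ 2) / δ with hL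
  have hLc : Continuous L := by fun_prop
  set q : ℂ → ℝ := fun x => ‖x - b‖ ^ 2 / R ^ 2 with hqd
  have hqc : Continuous q := by fun_prop
  set q' : ℂ → ℝ := fun x => 2 * inner ℝ (x - b) V / R ^ 2 with hq'd
  have hq'c : Continuous q' := by fun_prop
  set q'' : ℝ := 2 * ‖V‖ ^ 2 / R ^ 2 with hq''d
  have hk1 := hk.continuous₁
  have hk2 := hk.continuous₂
  have hk0 := hk.cont
  set U : ℂ → ℝ := fun x => lam⁻¹ * (cutoff (q x) * k₁ (L x)) -
    lam⁻¹ ^ 2 * (deriv cutoff (q x) * q' x * k₂ (L x)) with hU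
  set W : ℂ → ℝ := fun x => (deriv (deriv cutoff) (q x) * q' x ^ 2 + deriv cutoff (q x) * q'') *
    k₂ (L x) with hW
  have hqR : ∀ x, ¬ ‖x - b‖ ≤ R → 3 / 4 < q x := hq
  have hball : Bornology.IsBounded {x : ℂ | ‖x - b‖ ≤ R} := by
    have : {x : ℂ | ‖x - b‖ ≤ R} = Metric.closedBall b R := by
      ext x; simp [dist_eq_norm]
    rw [this]; exact Metric.isBounded_closedBall
  have hcpt : ∀ f : ℂ → ℝ, Continuous f → (∀ x, ¬ ‖x - b‖ ≤ R → f x = 0) → Integrable f := by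
    intro f hf h0
    apply hf.integrable_of_hasCompactSupport
    have : IsCompact {x : ℂ | ‖x - b‖ ≤ R} :=
      Metric.isCompact_of_isClosed_isBounded (isClosed_le (by fun_prop) continuous_const) hball
    exact HasCompactSupport.intro this fun x hx => h0 x hx
  have hderiv : ∀ x, HasLineDerivAt ℝ U
      (cutoff (q x) * k (L x) - lam⁻¹ ^ 2 * W x) x V := by
    intro x
    unfold HasLineDerivAt
    have e0 : x + (0 : ℝ) • V = x := by simp
    have hxb : HasDerivAt (fun t : ℝ => x + t • V - b) V 0 := by
      simpa using (((hasDerivAt_id (0 : ℝ)).smul_const V).const_add x).sub_const b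
    have hqd : HasDerivAt (fun t : ℝ => q (x + t • V)) (q' x) 0 := by
      have := (hxb.norm_sq).div_const (R ^ 2)
      simpa [q, q'] using this
    have hq'd : HasDerivAt (fun t : ℝ => q' (x + t • V)) q'' 0 := by
      have h := ((hxb.inner ℝ (hasDerivAt_const (0 : ℝ) V)).const_mul 2).div_const (R ^ 2)
      refine HasDerivAt.congr_deriv h ?_
      simp [q'']
    have hLd : HasDerivAt (fun t : ℝ => L (x + t • V)) lam 0 := by
      have h : (fun t : ℝ => L (x + t • V)) = fun t : ℝ => L x + t * lam := by
        ext t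
        simp only [hL, hV, phase_line, hlam]
        ring
      rw [h]
      simpa using ((hasDerivAt_id (0 : ℝ)).mul_const lam).const_add (L x)
    have d1 : HasDerivAt (fun t : ℝ => cutoff (q (x + t • V))) (deriv cutoff (q x) * q' x) 0 := by
      have h := hasDerivAt_of_contDiff_top cutoff_contDiff (q (x + (0 : ℝ) • V))
      have := h.comp (0 : ℝ) hqd
      simpa [Function.comp_def, e0] using this
    have d2 : HasDerivAt (fun t : ℝ => deriv cutoff (q (x + t • V)))
        (deriv (deriv cutoff) (q x) * q' x) 0 := by
      have h := hasDerivAt_of_contDiff_top (contDiff_deriv_top cutoff_contDiff)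
        (q (x + (0 : ℝ) • V))
      have := h.comp (0 : ℝ) hqd
      simpa [Function.comp_def, e0] using this
    have d3 : HasDerivAt (fun t : ℝ => k₁ (L (x + t • V))) (k (L x) * lam) 0 := by
      have h := hk.d₁ (L (x + (0 : ℝ) • V))
      have := h.comp (0 : ℝ) hLd
      simpa [Function.comp_def, e0] using this
    have d4 : HasDerivAt (fun t : ℝ => k₂ (L (x + t • V))) (k₁ (L x) * lam) 0 := by
      have h := hk.d₂ (L (x + (0 : ℝ) • V))
      have := h.comp (0 : ℝ) hLd
      simpa [Function.comp_def, e0] using this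
    have := ((d1.mul d3).const_mul lam⁻¹).sub (((d2.mul hq'd).mul d4).const_mul (lam⁻¹ ^ 2))
    refine HasDerivAt.congr_deriv this ?_
    simp only [hW, Pi.mul_apply, e0]
    field_simp
    ring
  have hI0 : Integrable fun x => cutoff (q x) * k (L x) := by
    apply hcpt _ (by fun_prop)
    intro x hx
    simp [cutoff_of_ge (hqR x hx).le]
  have hI1 : Integrable W := by
    apply hcpt _ (by fun_prop)
    intro x hx
    simp [hW, deriv_cutoff_zero (hqR x hx), deriv_deriv_cutoff_zero (hqR x hx)]
  have hIU : Integrable U := by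
    apply hcpt _ (by fun_prop)
    intro x hx
    simp [hU, deriv_cutoff_zero (hqR x hx), cutoff_of_ge (hqR x hx).le]
  have h0 := integral_eq_zero_of_hasLineDerivAt hderiv hIU (hI0.sub (hI1.const_mul _))
  rw [integral_sub hI0 (hI1.const_mul _), integral_const_mul, sub_eq_zero] at h0
  have hWb : ∀ x, |W x| ≤ 6 * Mg * ‖V‖ ^ 2 / R ^ 2 * M := by
    intro x
    by_cases hx : ‖x - b‖ ≤ R
    · rw [hW, abs_mul]
      refine mul_le_mul ?_ (hk.bd _).2.2 (abs_nonneg _) (by positivity)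
      have h1 : q' x ^ 2 ≤ 4 * ‖V‖ ^ 2 / R ^ 2 := by
        have h2 : |inner ℝ (x - b) V| ≤ R * ‖V‖ :=
          (abs_real_inner_le_norm _ _).trans (by gcongr)
        have h3 : (inner ℝ (x - b) V) ^ 2 ≤ (R * ‖V‖) ^ 2 := by
          rw [← sq_abs]; gcongr
        rw [hq'd]
        simp only
        rw [div_pow, mul_pow, div_le_div_iff₀ (by positivity) (by positivity)]
        calc _ ≤ 2 ^ 2 * (R * ‖V‖) ^ 2 * R ^ 2 := by gcongr
          _ = _ := by ring
      calc _ ≤ |deriv (deriv cutoff) (q x)| * q' x ^ 2 + |deriv cutoff (q x)| * q'' := by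
            refine (abs_add_le _ _).trans (le_of_eq ?_)
            rw [abs_mul, abs_mul, abs_of_nonneg (sq_nonneg (q' x)),
              abs_of_nonneg (show 0 ≤ q'' by positivity)]
        _ ≤ Mg * (4 * ‖V‖ ^ 2 / R ^ 2) + Mg * q'' := by
            have := hg (q x)
            gcongr
            · exact this.2
            · exact this.1
        _ = _ := by rw [hq''d]; ring
    · have : W x = 0 := by
        simp [hW, deriv_cutoff_zero (hqR x hx), deriv_deriv_cutoff_zero (hqR x hx)]
      rw [this, abs_zero]; positivity
  have hWi : |∫ x, W x| ≤ 6 * Mg * ‖V‖ ^ 2 / R ^ 2 * M * volume.real Z := by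
    apply abs_integral_le_of_support hZt hWb
    intro x hx
    by_cases h : ‖x - b‖ ≤ R
    · have : ¬ |L x| ≤ 2 := fun h' => hx ⟨h, h'⟩
      simp [hW, (hk.supp _ (not_le.1 this)).2.2]
    · simp [hW, deriv_cutoff_zero (hqR x h), deriv_deriv_cutoff_zero (hqR x h)]
  have hZ0 := measureReal_nonneg (μ := (volume : Measure ℂ)) (s := Z)
  have h2 : |∫ x, cutoff (q x) * k (L x)| ≤
      2 * M * Mg * (δ / (R * ‖V‖)) ^ 2 * volume.real Z := by
    rw [h0, abs_mul, abs_of_nonneg (by positivity)]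
    calc _ ≤ lam⁻¹ ^ 2 * (6 * Mg * ‖V‖ ^ 2 / R ^ 2 * M * volume.real Z) := by gcongr
      _ = (3 / 2) * M * Mg * (δ / (R * ‖V‖)) ^ 2 * volume.real Z := by
          rw [hlam]; field_simp; ring
      _ ≤ _ := by gcongr; norm_num
  rcases min_choice 1 ((δ / (R * ‖V‖)) ^ 2) with h | h
  · rw [h]
    refine h1.trans ?_
    have : M * 1 ≤ M * Mg := by gcongr
    have : 0 ≤ M * Mg := by positivity
    gcongr
    linarith
  · rw [h]; exact h2

/-! ### Annular averages and the local energy estimate -/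

/-- The average of `f` against the kernel `δ⁻¹ k((|x - y|² - w) / δ)`, concentrated on the annulus
of radius `√w` and width about `δ` centred at `x`. -/
def annAvg (k : ℝ → ℝ) (δ w : ℝ) (f : ℂ → ℝ) (x : ℂ) : ℝ :=
  ∫ y, δ⁻¹ * k ((‖x - y‖ ^ 2 - w) / δ) * f y

/-- Bounded measurable functions of bounded support. -/
structure IsNice (f : ℂ → ℝ) : Prop where
  meas : Measurable f
  bdd : ∃ M, ∀ x, |f x| ≤ M
  supp : ∃ R, ∀ x, R < ‖x‖ → f x = 0

lemma isBounded_norm_le (R : ℝ) : Bornology.IsBounded {x : ℂ | ‖x‖ ≤ R} := by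
  have : {x : ℂ | ‖x‖ ≤ R} = Metric.closedBall 0 R := by ext x; simp
  rw [this]; exact Metric.isBounded_closedBall

lemma IsNice.integrable {f : ℂ → ℝ} (hf : IsNice f) : Integrable f := by
  obtain ⟨M, hM⟩ := hf.bdd
  obtain ⟨R, hR⟩ := hf.supp
  exact integrable_of_bdd_support hf.meas hM (isBounded_norm_le R)
    fun x hx => hR x (not_le.1 hx)

lemma IsNice.mul {f g : ℂ → ℝ} (hf : IsNice f) (hg : Measurable g) {M : ℝ} (hM : ∀ x, |g x| ≤ M) :
    IsNice fun x => g x * f x := by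
  obtain ⟨M', hM'⟩ := hf.bdd
  obtain ⟨R, hR⟩ := hf.supp
  refine ⟨hg.mul hf.meas, ⟨M * M', fun x => ?_⟩, ⟨R, fun x hx => by simp [hR x hx]⟩⟩
  rw [abs_mul]
  exact mul_le_mul (hM x) (hM' x) (abs_nonneg _) ((abs_nonneg _).trans (hM x))

lemma IsNice.indicator {f : ℂ → ℝ} (hf : IsNice f) {s : Set ℂ} (hs : MeasurableSet s) :
    IsNice (s.indicator f) := by
  obtain ⟨M, hM⟩ := hf.bdd
  obtain ⟨R, hR⟩ := hf.supp
  refine ⟨hf.meas.indicator hs, ⟨M, fun x => ?_⟩, ⟨R, fun x hx => ?_⟩⟩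
  · by_cases h : x ∈ s
    · simpa [h] using hM x
    · simpa [h] using (abs_nonneg _).trans (hM x)
  · by_cases h : x ∈ s <;> simp [h, hR x hx]

lemma measurable_annAvg_kernel {k : ℝ → ℝ} (hk : Continuous k) {f : ℂ → ℝ} (hf : Measurable f)
    (δ : ℝ) : Measurable fun q : (ℂ × ℝ) × ℂ =>
      δ⁻¹ * k ((‖q.1.1 - q.2‖ ^ 2 - q.1.2) / δ) * f q.2 := by
  have h1 : Continuous fun q : (ℂ × ℝ) × ℂ => δ⁻¹ * k ((‖q.1.1 - q.2‖ ^ 2 - q.1.2) / δ) := by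
    fun_prop
  exact h1.measurable.mul (hf.comp measurable_snd)

lemma measurable_annAvg {k : ℝ → ℝ} (hk : Continuous k) {f : ℂ → ℝ} (hf : Measurable f) (δ : ℝ) :
    Measurable fun p : ℂ × ℝ => annAvg k δ p.2 f p.1 :=
  ((measurable_annAvg_kernel hk hf δ).stronglyMeasurable.integral_prod_right).measurable

lemma lintegral_schur {α : Type*} [MeasurableSpace α] {μ : Measure α} [SFinite μ]
    {h : α → ℝ≥0∞} {N : α → α → ℝ≥0∞} (hh : Measurable h)
    (hN : Measurable (Function.uncurry N)) (hsymm : ∀ x y, N x y = N y x) {D : ℝ≥0∞}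
    (hD : ∀ x, h x ≠ 0 → ∫⁻ y, N x y ∂μ ≤ D) :
    ∫⁻ q, h q.1 * h q.2 * N q.1 q.2 ∂(μ.prod μ) ≤ 2 * D * ∫⁻ x, h x ^ 2 ∂μ := by
  have hN' : ∀ x, Measurable (N x) := fun x => hN.comp (measurable_const.prodMk measurable_id)
  have hNu : Measurable fun q : α × α => N q.1 q.2 := hN
  have h1 : ∫⁻ q, h q.1 ^ 2 * N q.1 q.2 ∂(μ.prod μ) ≤ D * ∫⁻ x, h x ^ 2 ∂μ := by
    rw [lintegral_prod _ (by fun_prop), ← lintegral_const_mul _ (by fun_prop)]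
    refine lintegral_mono fun x => ?_
    simp only
    rw [lintegral_const_mul _ (hN' x)]
    by_cases h0 : h x = 0
    · simp [h0]
    · rw [mul_comm]
      exact mul_le_mul_left (hD x h0) _
  have h2 : ∫⁻ q, h q.2 ^ 2 * N q.1 q.2 ∂(μ.prod μ) ≤ D * ∫⁻ x, h x ^ 2 ∂μ := by
    rw [← lintegral_prod_swap]
    refine le_trans (le_of_eq ?_) h1
    refine lintegral_congr fun q => ?_
    simp only [Prod.fst_swap, Prod.snd_swap]
    rw [hsymm]
  calc _ ≤ ∫⁻ q, (h q.1 ^ 2 * N q.1 q.2 + h q.2 ^ 2 * N q.1 q.2) ∂(μ.prod μ) := by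
        refine lintegral_mono fun q => ?_
        rw [← add_mul]
        refine mul_le_mul_left ?_ _
        rcases le_total (h q.1) (h q.2) with hle | hle
        · calc h q.1 * h q.2 ≤ h q.2 * h q.2 := by gcongr
            _ ≤ _ := by rw [sq (h q.2)]; exact le_add_self
        · calc h q.1 * h q.2 ≤ h q.1 * h q.1 := by gcongr
            _ ≤ _ := by rw [sq (h q.1)]; exact le_self_add
    _ = _ := lintegral_add_left (by fun_prop) _
    _ ≤ _ := by
        rw [mul_assoc, two_mul]
        exact add_le_add h1 h2

/-- The kernel of the averaged square of `annAvg`. -/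
def energyKernel (k : ℝ → ℝ) (δ R : ℝ) (b y y' : ℂ) : ℝ :=
  ∫ p : ℂ × ℝ, cutoff (‖p.1 - b‖ ^ 2 / R ^ 2) * ((δ⁻¹ * k ((‖p.1 - y‖ ^ 2 - p.2) / δ)) *
    (δ⁻¹ * k ((‖p.1 - y'‖ ^ 2 - p.2) / δ)))

lemma cutoff_eq_zero_of_lt {R : ℝ} (hR : 0 < R) {b x : ℂ} (hx : R < ‖x - b‖) :
    cutoff (‖x - b‖ ^ 2 / R ^ 2) = 0 := by
  apply cutoff_of_ge
  rw [le_div_iff₀ (by positivity)]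
  nlinarith

lemma osc_arg_bound {k k₁ k₂ : ℝ → ℝ} {M : ℝ} (hk : IsOscKernel k k₁ k₂ M) {δ a w : ℝ} (hδ : 0 < δ)
    (h : k ((a - w) / δ) ≠ 0) : |a - w| ≤ 2 * δ := by
  by_contra hcon
  apply h
  apply (hk.supp _ _).1
  rw [abs_div, abs_of_pos hδ, lt_div_iff₀ hδ]
  exact not_le.1 hcon

lemma abs_energyKernel_le {k k₁ k₂ : ℝ → ℝ} {M Mg : ℝ} (hk : IsOscKernel k k₁ k₂ M)
    (hMg : 1 ≤ Mg) (hg : ∀ q, |deriv cutoff q| ≤ Mg ∧ |deriv (deriv cutoff) q| ≤ Mg)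
    {δ R : ℝ} (hδ : 0 < δ) (hR : 0 < R) (b : ℂ) {y y' : ℂ} (hy : y ≠ y') :
    |energyKernel k δ R b y y'| ≤ 8 * M ^ 2 * Mg / δ * min 1 ((δ / (R * ‖y - y'‖)) ^ 2) *
      volume.real {x : ℂ | ‖x - b‖ ≤ R ∧ |‖x - y'‖ ^ 2 - ‖x - y‖ ^ 2| ≤ 4 * δ} := by
  have hM := hk.nonneg
  have hkc := hk.cont
  have hgc := cutoff_contDiff.continuous
  set Z := {x : ℂ | ‖x - b‖ ≤ R ∧ |‖x - y'‖ ^ 2 - ‖x - y‖ ^ 2| ≤ 4 * δ} with hZ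
  have hZt : volume Z ≠ ⊤ := volume_strip_ne_top b R _
  set L : ℂ → ℝ := fun x => (‖x - y'‖ ^ 2 - ‖x - y‖ ^ 2) / δ with hL
  have hLc : Continuous L := by fun_prop
  have hball : ∀ x : ℂ, ‖x - b‖ ≤ R → ‖x‖ ≤ R + ‖b‖ := fun x hx => by
    have := norm_sub_norm_le x b
    linarith
  have hint : Integrable (fun p : ℂ × ℝ => cutoff (‖p.1 - b‖ ^ 2 / R ^ 2) *
      ((δ⁻¹ * k ((‖p.1 - y‖ ^ 2 - p.2) / δ)) * (δ⁻¹ * k ((‖p.1 - y'‖ ^ 2 - p.2) / δ))))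
      (volume.prod volume) := by
    have hs : Bornology.IsBounded ({x : ℂ | ‖x‖ ≤ R + ‖b‖} ×ˢ
        Set.Icc (-(2 * δ)) ((R + ‖b‖ + ‖y‖) ^ 2 + 2 * δ)) :=
      (isBounded_norm_le _).prod (Metric.isBounded_Icc _ _)
    refine integrable_of_bdd_support (M := 1 * ((δ⁻¹ * M) * (δ⁻¹ * M)))
      (Continuous.measurable (by fun_prop)) (fun p => ?_) hs (fun p hp => ?_)
    · rw [abs_mul, abs_mul, abs_mul, abs_mul, abs_of_nonneg (cutoff_nonneg _),
        abs_of_pos (inv_pos.2 hδ)]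
      have := (hk.bd ((‖p.1 - y‖ ^ 2 - p.2) / δ)).1
      have := (hk.bd ((‖p.1 - y'‖ ^ 2 - p.2) / δ)).1
      have := cutoff_le_one (‖p.1 - b‖ ^ 2 / R ^ 2)
      have := cutoff_nonneg (‖p.1 - b‖ ^ 2 / R ^ 2)
      gcongr
    · by_contra hne
      apply hp
      have h1 : ‖p.1 - b‖ ≤ R := by
        by_contra h; exact hne (by rw [cutoff_eq_zero_of_lt hR (not_le.1 h), zero_mul])
      have h2 : k ((‖p.1 - y‖ ^ 2 - p.2) / δ) ≠ 0 := fun h => hne (by rw [h]; ring)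
      have h3 := abs_le.1 (osc_arg_bound hk hδ h2)
      have h4 := hball _ h1
      refine ⟨h4, ?_, ?_⟩
      · nlinarith [sq_nonneg ‖p.1 - y‖]
      · have h5 : ‖p.1 - y‖ ≤ R + ‖b‖ + ‖y‖ := (norm_sub_le _ _).trans (by linarith)
        have h6 : ‖p.1 - y‖ ^ 2 ≤ (R + ‖b‖ + ‖y‖) ^ 2 := by gcongr
        linarith
  have hinner : ∀ x : ℂ, ∫ w : ℝ, cutoff (‖x - b‖ ^ 2 / R ^ 2) *
      ((δ⁻¹ * k ((‖x - y‖ ^ 2 - w) / δ)) * (δ⁻¹ * k ((‖x - y'‖ ^ 2 - w) / δ))) =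
      ∫ s : ℝ, δ⁻¹ * (k s * (cutoff (‖x - b‖ ^ 2 / R ^ 2) * k (s + L x))) := by
    intro x
    have h1 := integral_sub_left_eq_self (fun w : ℝ => cutoff (‖x - b‖ ^ 2 / R ^ 2) *
      ((δ⁻¹ * k (w / δ)) * (δ⁻¹ * k (w / δ + L x)))) volume (‖x - y‖ ^ 2)
    have h2 := Measure.integral_comp_div (fun s : ℝ => cutoff (‖x - b‖ ^ 2 / R ^ 2) *
      ((δ⁻¹ * k s) * (δ⁻¹ * k (s + L x)))) δ
    rw [h2, abs_of_pos hδ, smul_eq_mul, ← integral_const_mul] at h1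
    calc _ = _ := by
          refine integral_congr_ae (Filter.Eventually.of_forall fun w => ?_)
          simp only [hL]
          rw [show (‖x - y'‖ ^ 2 - w) / δ =
            (‖x - y‖ ^ 2 - w) / δ + (‖x - y'‖ ^ 2 - ‖x - y‖ ^ 2) / δ by ring]
      _ = _ := h1
      _ = _ := by
          refine integral_congr_ae (Filter.Eventually.of_forall fun s => ?_)
          simp only
          field_simp
  have hswap : energyKernel k δ R b y y' =
      ∫ s : ℝ, δ⁻¹ * (k s * ∫ x : ℂ, cutoff (‖x - b‖ ^ 2 / R ^ 2) * k (s + L x)) := by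
    rw [energyKernel, Measure.volume_eq_prod, integral_prod _ hint]
    simp only [hinner]
    rw [integral_integral_swap]
    · simp only [integral_const_mul]
    · have hs : Bornology.IsBounded ({x : ℂ | ‖x‖ ≤ R + ‖b‖} ×ˢ Set.Icc (-2 : ℝ) 2) :=
        (isBounded_norm_le _).prod (Metric.isBounded_Icc _ _)
      refine integrable_of_bdd_support (M := δ⁻¹ * (M * (1 * M)))
        (Continuous.measurable ?_) (fun p => ?_) hs (fun p hp => ?_)
      · simp only [Function.uncurry_def]; fun_prop
      · simp only [Function.uncurry_def]
        rw [abs_mul, abs_mul, abs_mul, abs_of_nonneg (cutoff_nonneg _), abs_of_pos (inv_pos.2 hδ)]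
        have := (hk.bd p.2).1
        have := (hk.bd (p.2 + L p.1)).1
        have := cutoff_le_one (‖p.1 - b‖ ^ 2 / R ^ 2)
        have := cutoff_nonneg (‖p.1 - b‖ ^ 2 / R ^ 2)
        gcongr
      · by_contra hne
        apply hp
        simp only [Function.uncurry_def] at hne
        have h1 : ‖p.1 - b‖ ≤ R := by
          by_contra h; exact hne (by rw [cutoff_eq_zero_of_lt hR (not_le.1 h)]; ring)
        refine ⟨hball _ h1, abs_le.1 ?_⟩
        by_contra h
        exact hne (by rw [(hk.supp _ (not_le.1 h)).1]; ring)
  rw [hswap]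
  have hb : ∀ s : ℝ, |δ⁻¹ * (k s * ∫ x : ℂ, cutoff (‖x - b‖ ^ 2 / R ^ 2) * k (s + L x))| ≤
      δ⁻¹ * (M * (2 * M * Mg * min 1 ((δ / (R * ‖y - y'‖)) ^ 2) * volume.real Z)) := by
    intro s
    by_cases hs : 2 < |s|
    · rw [(hk.supp s hs).1, zero_mul, mul_zero, abs_zero]
      have : 0 ≤ min 1 ((δ / (R * ‖y - y'‖)) ^ 2) := by positivity
      positivity
    · rw [abs_mul, abs_mul, abs_of_pos (inv_pos.2 hδ)]
      have h1 := abs_integral_cutoff_mul_le hk hMg hg hδ hR b hy s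
      have h2 : volume.real {x : ℂ | ‖x - b‖ ≤ R ∧
          |s + (‖x - y'‖ ^ 2 - ‖x - y‖ ^ 2) / δ| ≤ 2} ≤ volume.real Z := by
        apply measureReal_mono _ hZt
        rintro x ⟨hx1, hx2⟩
        refine ⟨hx1, ?_⟩
        have h3 := abs_le.1 hx2
        have h4 := abs_le.1 (not_lt.1 hs)
        have h5 : |(‖x - y'‖ ^ 2 - ‖x - y‖ ^ 2) / δ| ≤ 4 := by
          rw [abs_le]; constructor <;> linarith [h3.1, h3.2, h4.1, h4.2]
        rwa [abs_div, abs_of_pos hδ, div_le_iff₀ hδ] at h5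
      have h6 : 0 ≤ min 1 ((δ / (R * ‖y - y'‖)) ^ 2) := by positivity
      have := (hk.bd s).1
      gcongr
      exact h1.trans (by gcongr)
  have hfin := abs_integral_le_of_support (μ := (volume : Measure ℝ)) (s := Set.Icc (-2 : ℝ) 2)
    (by simp) hb (fun s hs => by
      have : 2 < |s| := by
        by_contra h; exact hs (abs_le.1 (not_lt.1 h))
      rw [(hk.supp s this).1]; ring)
  refine hfin.trans (le_of_eq ?_)
  rw [Real.volume_real_Icc]
  norm_num
  field_simp
  ring

lemma volume_norm_sub_le (b : ℂ) {R : ℝ} (hR : 0 ≤ R) :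
    volume {x : ℂ | ‖x - b‖ ≤ R} = ENNReal.ofReal (Real.pi * R ^ 2) := by
  have : {x : ℂ | ‖x - b‖ ≤ R} = Metric.closedBall b R := by ext x; simp [dist_eq_norm]
  rw [this, Complex.volume_closedBall, mul_comm, ENNReal.ofReal_mul Real.pi_pos.le,
    ENNReal.ofReal_pow hR]
  congr 1
  rw [← NNReal.coe_real_pi, ENNReal.ofReal_coe_nnreal]

lemma measurableSet_norm_sub_le (b : ℂ) (R : ℝ) : MeasurableSet {x : ℂ | ‖x - b‖ ≤ R} :=
  (isClosed_le (by fun_prop) continuous_const).measurableSet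

lemma measurable_energyKernel {k : ℝ → ℝ} (hk : Continuous k) (δ R : ℝ) (b : ℂ) :
    Measurable fun q : ℂ × ℂ => energyKernel k δ R b q.1 q.2 := by
  have hgc := cutoff_contDiff.continuous
  unfold energyKernel
  have h1 : Continuous fun z : (ℂ × ℂ) × (ℂ × ℝ) => cutoff (‖z.2.1 - b‖ ^ 2 / R ^ 2) *
      ((δ⁻¹ * k ((‖z.2.1 - z.1.1‖ ^ 2 - z.2.2) / δ)) *
      (δ⁻¹ * k ((‖z.2.1 - z.1.2‖ ^ 2 - z.2.2) / δ))) := by fun_prop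
  exact (h1.measurable.stronglyMeasurable.integral_prod_right).measurable

lemma lintegral_energyKernel_le {k k₁ k₂ : ℝ → ℝ} {M Mg : ℝ} (hk : IsOscKernel k k₁ k₂ M)
    (hMg : 1 ≤ Mg) (hg : ∀ q, |deriv cutoff q| ≤ Mg ∧ |deriv (deriv cutoff) q| ≤ Mg)
    {δ R : ℝ} (hδ : 0 < δ) (hR : 0 < R) {b y : ℂ} (hy : 1 / 4 + R ≤ ‖y - b‖) :
    ∫⁻ y', ENNReal.ofReal |energyKernel k δ R b y y'| ≤
      ENNReal.ofReal (8 * M ^ 2 * Mg * (36 * Real.pi ^ 2) * (δ * √R)) := by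
  have hM := hk.nonneg
  have hpi := Real.pi_pos
  set Bs := {x : ℂ | ‖x - b‖ ≤ R} with hBs
  have hBm : MeasurableSet Bs := measurableSet_norm_sub_le b R
  set Φ : ℂ → ℂ → ℝ≥0∞ := fun x y' => Set.indicator {y' | |‖x - y'‖ ^ 2 - ‖x - y‖ ^ 2| ≤ 4 * δ}
      (fun y' => ENNReal.ofReal (min 1 ((δ / (R * ‖y - y'‖)) ^ 2))) y' with hΦ
  have hΦm : Measurable (Function.uncurry Φ) := by
    have : Function.uncurry Φ = Set.indicator {q : ℂ × ℂ | |‖q.1 - q.2‖ ^ 2 - ‖q.1 - y‖ ^ 2| ≤ 4 * δ}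
      (fun q => ENNReal.ofReal (min 1 ((δ / (R * ‖y - q.2‖)) ^ 2))) := by
      ext q
      by_cases h : |‖q.1 - q.2‖ ^ 2 - ‖q.1 - y‖ ^ 2| ≤ 4 * δ <;>
        simp [Function.uncurry_def, hΦ, Set.indicator, h]
    rw [this]
    apply Measurable.indicator
    · fun_prop
    · exact (isClosed_le (by fun_prop) continuous_const).measurableSet
  have hpt : ∀ y', y ≠ y' → ENNReal.ofReal |energyKernel k δ R b y y'| ≤
      ENNReal.ofReal (8 * M ^ 2 * Mg / δ) * ∫⁻ x in Bs, Φ x y' := by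
    intro y' hne
    have h := abs_energyKernel_le hk hMg hg hδ hR b hne
    have hZt : volume {x : ℂ | ‖x - b‖ ≤ R ∧ |‖x - y'‖ ^ 2 - ‖x - y‖ ^ 2| ≤ 4 * δ} ≠ ⊤ :=
      volume_strip_ne_top b R _
    have hm0 : 0 ≤ min 1 ((δ / (R * ‖y - y'‖)) ^ 2) := by positivity
    refine (ENNReal.ofReal_le_ofReal h).trans ?_
    rw [mul_assoc, ENNReal.ofReal_mul (by positivity), ENNReal.ofReal_mul hm0]
    refine mul_le_mul_right ?_ _
    have hΦ' : ∀ x, Φ x y' = Set.indicator {x | |‖x - y'‖ ^ 2 - ‖x - y‖ ^ 2| ≤ 4 * δ}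
        (fun _ => ENNReal.ofReal (min 1 ((δ / (R * ‖y - y'‖)) ^ 2))) x := by
      intro x
      by_cases h : |‖x - y'‖ ^ 2 - ‖x - y‖ ^ 2| ≤ 4 * δ <;> simp [hΦ, Set.indicator, h]
    simp only [hΦ']
    have hms : MeasurableSet {x : ℂ | |‖x - y'‖ ^ 2 - ‖x - y‖ ^ 2| ≤ 4 * δ} :=
      (isClosed_le (by fun_prop) continuous_const).measurableSet
    rw [lintegral_indicator_const hms, Measure.restrict_apply hms, measureReal_def,
      ENNReal.ofReal_toReal hZt]
    refine mul_le_mul_right (measure_mono ?_) _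
    rintro x ⟨h1, h2⟩
    exact ⟨h2, h1⟩
  calc _ ≤ ∫⁻ y', ENNReal.ofReal (8 * M ^ 2 * Mg / δ) * ∫⁻ x in Bs, Φ x y' := by
        refine lintegral_mono_ae ?_
        filter_upwards [Measure.ae_ne volume y] with y' hy'
        exact hpt y' (Ne.symm hy')
    _ = ENNReal.ofReal (8 * M ^ 2 * Mg / δ) * ∫⁻ x in Bs, ∫⁻ y', Φ x y' := by
        rw [lintegral_const_mul', lintegral_lintegral_swap]
        · exact (hΦm.comp measurable_swap).aemeasurable
        · exact ENNReal.ofReal_ne_top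
    _ ≤ ENNReal.ofReal (8 * M ^ 2 * Mg / δ) *
        ∫⁻ x in Bs, ENNReal.ofReal (36 * Real.pi * (δ ^ 2 / (R * √R))) := by
        refine mul_le_mul_right (setLIntegral_mono' hBm fun x hx => ?_) _
        refine lintegral_annulus_weight hδ hR ?_
        have : ‖y - b‖ ≤ ‖x - y‖ + ‖x - b‖ := by
          rw [norm_sub_rev x y]
          simpa using norm_sub_le_norm_sub_add_norm_sub y x b
        have hx' : ‖x - b‖ ≤ R := hx
        linarith
    _ = _ := by
        rw [setLIntegral_const, hBs, volume_norm_sub_le b hR.le, ← ENNReal.ofReal_mul (by positivity),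
          ← ENNReal.ofReal_mul (by positivity)]
        congr 1
        have hs : R = √R * √R := (Real.mul_self_sqrt hR.le).symm
        have hs0 : 0 < √R := Real.sqrt_pos.2 hR
        field_simp
        rw [Real.sq_sqrt hR.le]

lemma abs_annAvg_le {k k₁ k₂ : ℝ → ℝ} {M : ℝ} (hk : IsOscKernel k k₁ k₂ M) {f : ℂ → ℝ}
    (hf : IsNice f) {δ : ℝ} (hδ : 0 < δ) (w : ℝ) (x : ℂ) :
    |annAvg k δ w f x| ≤ δ⁻¹ * M * ∫ y, |f y| := by
  unfold annAvg
  rw [← integral_const_mul]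
  refine (abs_integral_le_integral_abs).trans ?_
  refine integral_mono_of_nonneg (Filter.Eventually.of_forall fun y => abs_nonneg _)
    (hf.integrable.abs.const_mul _) (Filter.Eventually.of_forall fun y => ?_)
  simp only
  rw [abs_mul, abs_mul, abs_of_pos (inv_pos.2 hδ)]
  have := (hk.bd ((‖x - y‖ ^ 2 - w) / δ)).1
  gcongr

lemma annAvg_support {k k₁ k₂ : ℝ → ℝ} {M : ℝ} (hk : IsOscKernel k k₁ k₂ M) {f : ℂ → ℝ} {Rf : ℝ}
    (hRf : ∀ x, Rf < ‖x‖ → f x = 0) {δ : ℝ} (hδ : 0 < δ) {w : ℝ} {x : ℂ}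
    (h : annAvg k δ w f x ≠ 0) : -(2 * δ) ≤ w ∧ w ≤ (‖x‖ + Rf) ^ 2 + 2 * δ := by
  by_contra hcon
  apply h
  unfold annAvg
  rw [← integral_zero ℂ ℝ (μ := volume)]
  refine integral_congr_ae (Filter.Eventually.of_forall fun y => ?_)
  simp only
  by_contra hne
  apply hcon
  have h1 : f y ≠ 0 := fun h => hne (by rw [h, mul_zero])
  have h2 : k ((‖x - y‖ ^ 2 - w) / δ) ≠ 0 := fun h => hne (by rw [h]; ring)
  have h3 := abs_le.1 (osc_arg_bound hk hδ h2)
  have h4 : ‖y‖ ≤ Rf := not_lt.1 fun h => h1 (hRf y h)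
  have h5 : ‖x - y‖ ≤ ‖x‖ + Rf := (norm_sub_le _ _).trans (by linarith)
  have h6 : ‖x - y‖ ^ 2 ≤ (‖x‖ + Rf) ^ 2 := by gcongr
  constructor
  · nlinarith [sq_nonneg ‖x - y‖]
  · linarith

/-- Local energy estimate: near a point staying away from the support of `f`, the annular averages
gain `δ √R` in `L²`. -/
lemma lintegral_annAvg_sq_le {k k₁ k₂ : ℝ → ℝ} {M Mg : ℝ} (hk : IsOscKernel k k₁ k₂ M)
    (hMg : 1 ≤ Mg) (hg : ∀ q, |deriv cutoff q| ≤ Mg ∧ |deriv (deriv cutoff) q| ≤ Mg)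
    {δ R : ℝ} (hδ : 0 < δ) (hR : 0 < R) {b : ℂ} {f : ℂ → ℝ} (hf : IsNice f)
    (hf0 : ∀ y, f y ≠ 0 → 1 / 4 + R ≤ ‖y - b‖) :
    ∫⁻ x in {x : ℂ | ‖x - b‖ ≤ R / 2}, ∫⁻ w : ℝ, ENNReal.ofReal (annAvg k δ w f x ^ 2) ≤
      2 * ENNReal.ofReal (8 * M ^ 2 * Mg * (36 * Real.pi ^ 2) * (δ * √R)) *
        ∫⁻ y, ENNReal.ofReal |f y| ^ 2 := by
  have hM := hk.nonneg
  have hgc := cutoff_contDiff.continuous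
  have hkc := hk.cont
  obtain ⟨Mf, hMf⟩ := hf.bdd
  obtain ⟨Rf, hRf⟩ := hf.supp
  have hAm := measurable_annAvg hkc hf.meas δ
  set γ : ℂ → ℝ := fun x => cutoff (‖x - b‖ ^ 2 / R ^ 2) with hγ
  have hγc : Continuous γ := by fun_prop
  have hball : ∀ x : ℂ, ‖x - b‖ ≤ R → ‖x‖ ≤ R + ‖b‖ := fun x hx => by
    have := norm_sub_norm_le x b
    linarith
  set I := ∫ y, |f y| with hI
  have hI0 : 0 ≤ I := integral_nonneg fun y => abs_nonneg _
  have hbs : Bornology.IsBounded ({x : ℂ | ‖x‖ ≤ R + ‖b‖} ×ˢ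
      Set.Icc (-(2 * δ)) ((R + ‖b‖ + |Rf|) ^ 2 + 2 * δ)) :=
    (isBounded_norm_le _).prod (Metric.isBounded_Icc _ _)
  have hRf' : ∀ x, |Rf| < ‖x‖ → f x = 0 := fun x hx => hRf x ((le_abs_self _).trans_lt hx)
  have hint : Integrable (fun p : ℂ × ℝ => γ p.1 * annAvg k δ p.2 f p.1 ^ 2)
      (volume.prod volume) := by
    refine integrable_of_bdd_support (M := 1 * (δ⁻¹ * M * I) ^ 2)
      ((hγc.measurable.comp measurable_fst).mul (hAm.pow_const 2)) (fun p => ?_) hbs (fun p hp => ?_)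
    · rw [abs_mul, abs_pow, abs_of_nonneg (cutoff_nonneg _)]
      have := abs_annAvg_le hk hf hδ p.2 p.1
      have := cutoff_le_one (‖p.1 - b‖ ^ 2 / R ^ 2)
      have := cutoff_nonneg (‖p.1 - b‖ ^ 2 / R ^ 2)
      gcongr
    · by_contra hne
      apply hp
      have h1 : ‖p.1 - b‖ ≤ R := by
        by_contra h
        exact hne (by simp only [hγ]; rw [cutoff_eq_zero_of_lt hR (not_le.1 h), zero_mul])
      have h2 : annAvg k δ p.2 f p.1 ≠ 0 := fun h => hne (by rw [h]; ring)
      have h3 := annAvg_support hk hRf' hδ h2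
      have h4 := hball _ h1
      refine ⟨h4, h3.1, h3.2.trans ?_⟩
      have := norm_nonneg p.1
      have := abs_nonneg Rf
      gcongr
  set κ : ℂ × ℝ → ℂ → ℝ := fun p y => δ⁻¹ * k ((‖p.1 - y‖ ^ 2 - p.2) / δ) with hκ
  have hexp : ∫ p : ℂ × ℝ, γ p.1 * annAvg k δ p.2 f p.1 ^ 2 =
      ∫ q : ℂ × ℂ, f q.1 * f q.2 * energyKernel k δ R b q.1 q.2 := by
    have h1 : ∀ p : ℂ × ℝ, γ p.1 * annAvg k δ p.2 f p.1 ^ 2 =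
        ∫ q : ℂ × ℂ, γ p.1 * ((κ p q.1 * f q.1) * (κ p q.2 * f q.2)) := by
      intro p
      rw [integral_const_mul, Measure.volume_eq_prod,
        integral_prod_mul (fun y => κ p y * f y) (fun y => κ p y * f y), sq]
      rfl
    simp only [h1]
    rw [integral_integral_swap]
    · refine integral_congr_ae (Filter.Eventually.of_forall fun q => ?_)
      simp only [energyKernel]
      rw [← integral_const_mul]
      refine integral_congr_ae (Filter.Eventually.of_forall fun p => ?_)
      simp only [hγ, hκ]
      ring
    · have hs2 : Bornology.IsBounded ((({x : ℂ | ‖x‖ ≤ R + ‖b‖} ×ˢ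
        Set.Icc (-(2 * δ)) ((R + ‖b‖ + |Rf|) ^ 2 + 2 * δ))) ×ˢ
        ({x : ℂ | ‖x‖ ≤ |Rf|} ×ˢ {x : ℂ | ‖x‖ ≤ |Rf|})) :=
        hbs.prod ((isBounded_norm_le _).prod (isBounded_norm_le _))
      have hfm := hf.meas
      refine integrable_of_bdd_support (M := 1 * ((δ⁻¹ * M * Mf) * (δ⁻¹ * M * Mf))) ?_
        (fun p => ?_) hs2 (fun p hp => ?_)
      · simp only [Function.uncurry_def, hκ, hγ]
        have c1 : Continuous fun a : (ℂ × ℝ) × ℂ × ℂ => cutoff (‖a.1.1 - b‖ ^ 2 / R ^ 2) := by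
          fun_prop
        have c2 : Continuous fun a : (ℂ × ℝ) × ℂ × ℂ =>
          δ⁻¹ * k ((‖a.1.1 - a.2.1‖ ^ 2 - a.1.2) / δ) := by fun_prop
        have c3 : Continuous fun a : (ℂ × ℝ) × ℂ × ℂ =>
          δ⁻¹ * k ((‖a.1.1 - a.2.2‖ ^ 2 - a.1.2) / δ) := by fun_prop
        exact c1.measurable.mul ((c2.measurable.mul (by fun_prop)).mul
          (c3.measurable.mul (by fun_prop)))
      · simp only [Function.uncurry_def, hκ, hγ]
        simp only [abs_mul]
        rw [abs_of_nonneg (cutoff_nonneg _), abs_of_pos (inv_pos.2 hδ)]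
        have := (hk.bd ((‖p.1.1 - p.2.1‖ ^ 2 - p.1.2) / δ)).1
        have := (hk.bd ((‖p.1.1 - p.2.2‖ ^ 2 - p.1.2) / δ)).1
        have := hMf p.2.1
        have := hMf p.2.2
        have := cutoff_le_one (‖p.1.1 - b‖ ^ 2 / R ^ 2)
        have := cutoff_nonneg (‖p.1.1 - b‖ ^ 2 / R ^ 2)
        have : 0 ≤ Mf := (abs_nonneg _).trans (hMf 0)
        gcongr
      · by_contra hne
        apply hp
        simp only [Function.uncurry_def, hκ, hγ] at hne
        have h1 : ‖p.1.1 - b‖ ≤ R := by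
          by_contra h; exact hne (by rw [cutoff_eq_zero_of_lt hR (not_le.1 h)]; ring)
        have h2 : ‖p.2.1‖ ≤ |Rf| := by
          by_contra h; exact hne (by rw [hRf' _ (not_le.1 h)]; ring)
        have h3 : ‖p.2.2‖ ≤ |Rf| := by
          by_contra h; exact hne (by rw [hRf' _ (not_le.1 h)]; ring)
        have h4 : k ((‖p.1.1 - p.2.1‖ ^ 2 - p.1.2) / δ) ≠ 0 := fun h => hne (by rw [h]; ring)
        have h5 := abs_le.1 (osc_arg_bound hk hδ h4)
        have h6 := hball _ h1
        have h7 : ‖p.1.1 - p.2.1‖ ≤ R + ‖b‖ + |Rf| := (norm_sub_le _ _).trans (by linarith)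
        have h8 : ‖p.1.1 - p.2.1‖ ^ 2 ≤ (R + ‖b‖ + |Rf|) ^ 2 := by gcongr
        exact ⟨⟨h6, by nlinarith [sq_nonneg ‖p.1.1 - p.2.1‖], by linarith⟩, h2, h3⟩
  have hEm := measurable_energyKernel hkc δ R b
  calc _ ≤ ∫⁻ x, ∫⁻ w : ℝ, ENNReal.ofReal (γ x * annAvg k δ w f x ^ 2) := by
        refine (setLIntegral_mono' (measurableSet_norm_sub_le b _) fun x hx => ?_).trans
          (setLIntegral_le_lintegral _ _)
        refine lintegral_mono fun w => ?_
        have hx' : ‖x - b‖ ≤ R / 2 := hx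
        have : γ x = 1 := by
          simp only [hγ]
          apply cutoff_of_le
          rw [div_le_iff₀ (by positivity)]
          have : ‖x - b‖ ^ 2 ≤ (R / 2) ^ 2 := by gcongr
          linarith
        rw [this, one_mul]
    _ = ∫⁻ p : ℂ × ℝ, ENNReal.ofReal (γ p.1 * annAvg k δ p.2 f p.1 ^ 2) := by
        rw [Measure.volume_eq_prod, lintegral_prod]
        exact (ENNReal.measurable_ofReal.comp
          ((hγc.measurable.comp measurable_fst).mul (hAm.pow_const 2))).aemeasurable
    _ = ENNReal.ofReal (∫ p : ℂ × ℝ, γ p.1 * annAvg k δ p.2 f p.1 ^ 2) := by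
        rw [ofReal_integral_eq_lintegral_ofReal]
        · exact hint
        · exact Filter.Eventually.of_forall fun p => mul_nonneg (cutoff_nonneg _) (sq_nonneg _)
    _ ≤ ∫⁻ q : ℂ × ℂ, ENNReal.ofReal |f q.1| * ENNReal.ofReal |f q.2| *
          ENNReal.ofReal |energyKernel k δ R b q.1 q.2| := by
        rw [hexp]
        refine (ENNReal.ofReal_le_ofReal (le_abs_self _)).trans ?_
        rw [← Real.norm_eq_abs, ofReal_norm]
        refine (enorm_integral_le_lintegral_enorm _).trans (lintegral_mono fun q => ?_)
        rw [enorm_mul, enorm_mul, ← ofReal_norm, ← ofReal_norm, ← ofReal_norm]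
        rfl
    _ ≤ _ := by
        refine lintegral_schur (h := fun y => ENNReal.ofReal |f y|)
          (N := fun y y' => ENNReal.ofReal |energyKernel k δ R b y y'|) ?_ ?_ ?_ ?_
        · have := hf.meas
          fun_prop
        · exact ENNReal.measurable_ofReal.comp (continuous_abs.measurable.comp hEm)
        · intro y y'
          congr 2
          unfold energyKernel
          refine integral_congr_ae (Filter.Eventually.of_forall fun p => ?_)
          simp only
          ring
        · intro y hy
          refine lintegral_energyKernel_le hk hMg hg hδ hR (hf0 y fun h => hy (by simp [h]))

/-! ### The local maximal inequality in `L²` -/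

lemma continuous_annAvg {k : ℝ → ℝ} (hk : Continuous k) {M : ℝ} (hM : ∀ s, |k s| ≤ M)
    {f : ℂ → ℝ} (hf : IsNice f) (δ : ℝ) :
    Continuous fun p : ℂ × ℝ => annAvg k δ p.2 f p.1 := by
  unfold annAvg
  have hfm := hf.meas
  refine continuous_of_dominated (bound := fun y => |δ⁻¹| * M * |f y|) (fun p => ?_)
    (fun p => Filter.Eventually.of_forall fun y => ?_) (hf.integrable.abs.const_mul _)
    (Filter.Eventually.of_forall fun y => by fun_prop)
  · have : Continuous fun y : ℂ => δ⁻¹ * k ((‖p.1 - y‖ ^ 2 - p.2) / δ) := by fun_prop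
    exact (this.measurable.mul hfm).aestronglyMeasurable
  · rw [Real.norm_eq_abs, abs_mul, abs_mul]
    have := hM ((‖p.1 - y‖ ^ 2 - p.2) / δ)
    gcongr

lemma hasDerivAt_annAvg {k k' : ℝ → ℝ} (hk : Continuous k) (hk' : Continuous k')
    (hd : ∀ s, HasDerivAt k (k' s) s) {M : ℝ} (hM : ∀ s, |k s| ≤ M) (hM' : ∀ s, |k' s| ≤ M)
    {f : ℂ → ℝ} (hf : IsNice f) (δ : ℝ) (w : ℝ) (x : ℂ) :
    HasDerivAt (fun w => annAvg k δ w f x) (-δ⁻¹ * annAvg k' δ w f x) w := by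
  have hfm := hf.meas
  unfold annAvg
  rw [← integral_const_mul]
  have hmeas : ∀ w (k : ℝ → ℝ), Continuous k → Measurable fun y : ℂ =>
      δ⁻¹ * k ((‖x - y‖ ^ 2 - w) / δ) * f y := by
    intro w k hk
    have : Continuous fun y : ℂ => δ⁻¹ * k ((‖x - y‖ ^ 2 - w) / δ) := by fun_prop
    exact this.measurable.mul hfm
  have hM0 : 0 ≤ M := (abs_nonneg _).trans (hM 0)
  refine (hasDerivAt_integral_of_dominated_loc_of_deriv_le (s := Set.univ) (μ := volume)
    (F := fun w y => δ⁻¹ * k ((‖x - y‖ ^ 2 - w) / δ) * f y)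
    (F' := fun w y => -δ⁻¹ * (δ⁻¹ * k' ((‖x - y‖ ^ 2 - w) / δ) * f y))
    (bound := fun y => |δ⁻¹| * (|δ⁻¹| * M * |f y|)) Filter.univ_mem
    (Filter.Eventually.of_forall fun w => (hmeas w k hk).aestronglyMeasurable) ?_
    ((hmeas w k' hk').const_mul _).aestronglyMeasurable
    (Filter.Eventually.of_forall fun y w _ => ?_)
    ((hf.integrable.abs.const_mul _).const_mul _)
    (Filter.Eventually.of_forall fun y w _ => ?_)).2
  · refine Integrable.mono' (g := fun y => |δ⁻¹| * M * |f y|) (hf.integrable.abs.const_mul _)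
      (hmeas w k hk).aestronglyMeasurable (Filter.Eventually.of_forall fun y => ?_)
    rw [Real.norm_eq_abs, abs_mul, abs_mul]
    have := hM ((‖x - y‖ ^ 2 - w) / δ)
    gcongr
  · rw [Real.norm_eq_abs, abs_mul, abs_mul, abs_mul, abs_neg]
    have := hM' ((‖x - y‖ ^ 2 - w) / δ)
    gcongr
  · have h1 : HasDerivAt (fun w : ℝ => (‖x - y‖ ^ 2 - w) / δ) (-1 / δ) w :=
      ((hasDerivAt_id w).const_sub _).div_const _
    refine (((hd _).comp w h1).const_mul δ⁻¹ |>.mul_const (f y)).congr_deriv ?_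
    ring

/-- A one-dimensional Sobolev inequality. -/
lemma ofReal_sq_le_of_hasDerivAt {F G : ℝ → ℝ} {δ : ℝ} (hδ : 0 < δ) (hF : Continuous F)
    (hG : Continuous G) (hd : ∀ w, HasDerivAt F (-δ⁻¹ * G w) w) {a : ℝ}
    (ha : ∀ w < a, F w = 0) (w : ℝ) :
    ENNReal.ofReal (F w ^ 2) ≤ ENNReal.ofReal δ⁻¹ *
      ((∫⁻ w, ENNReal.ofReal (F w ^ 2)) + ∫⁻ w, ENNReal.ofReal (G w ^ 2)) := by
  by_cases hw : w < a
  · simp [ha w hw]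
  have hle : a - 1 ≤ w := by linarith [not_lt.1 hw]
  have hdd : ∀ t, HasDerivAt (fun t => F t ^ 2) (2 * F t * (-δ⁻¹ * G t)) t := fun t => by
    refine ((hd t).pow 2).congr_deriv ?_
    simp
  have hcont : Continuous fun t => 2 * F t * (-δ⁻¹ * G t) := by fun_prop
  have h := intervalIntegral.integral_eq_sub_of_hasDerivAt (a := a - 1) (b := w)
    (fun t _ => hdd t) (hcont.intervalIntegrable _ _)
  rw [ha (a - 1) (by linarith)] at h
  have h' : F w ^ 2 = ∫ t in a - 1..w, 2 * F t * (-δ⁻¹ * G t) := by rw [h]; ring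
  have h2 : ENNReal.ofReal (F w ^ 2) ≤ ∫⁻ t, ENNReal.ofReal |2 * F t * (-δ⁻¹ * G t)| := by
    rw [h', intervalIntegral.integral_of_le hle]
    refine (ENNReal.ofReal_le_ofReal (le_abs_self _)).trans ?_
    rw [← Real.norm_eq_abs, ofReal_norm]
    refine (enorm_integral_le_lintegral_enorm _).trans
      ((setLIntegral_le_lintegral _ _).trans (lintegral_mono fun t => ?_))
    rw [← ofReal_norm, Real.norm_eq_abs]
  refine h2.trans ?_
  rw [← lintegral_add_left (by fun_prop), ← lintegral_const_mul _ (by fun_prop)]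
  refine lintegral_mono fun t => ?_
  simp only
  rw [← ENNReal.ofReal_add (sq_nonneg _) (sq_nonneg _), ← ENNReal.ofReal_mul (by positivity)]
  apply ENNReal.ofReal_le_ofReal
  rw [abs_mul, abs_mul, abs_mul, abs_neg, abs_of_pos (inv_pos.2 hδ), abs_two]
  have h3 : 2 * |F t| * |G t| ≤ F t ^ 2 + G t ^ 2 := by
    rw [← sq_abs (F t), ← sq_abs (G t)]
    exact two_mul_le_add_sq _ _
  calc _ = δ⁻¹ * (2 * |F t| * |G t|) := by ring
    _ ≤ _ := by gcongr

/-- The local maximal function of the annular averages over radii `√w ∈ [1, 2]`. -/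
def maxAvg (δ : ℝ) (f : ℂ → ℝ) (x : ℂ) : ℝ≥0∞ :=
  ⨆ w ∈ Set.Icc (1 : ℝ) 4, ENNReal.ofReal |annAvg osc δ w f x|

lemma le_maxAvg {w : ℝ} (hw : w ∈ Set.Icc (1 : ℝ) 4) (δ : ℝ) (f : ℂ → ℝ) (x : ℂ) :
    ENNReal.ofReal |annAvg osc δ w f x| ≤ maxAvg δ f x :=
  le_iSup₂ (f := fun w (_ : w ∈ Set.Icc (1 : ℝ) 4) => ENNReal.ofReal |annAvg osc δ w f x|) w hw

lemma continuous_annAvg_osc {f : ℂ → ℝ} (hf : IsNice f) (δ : ℝ) :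
    Continuous fun p : ℂ × ℝ => annAvg osc δ p.2 f p.1 := by
  obtain ⟨M, -, h, -⟩ := exists_osc_bound
  exact continuous_annAvg h.cont (fun s => (h.bd s).1) hf δ

lemma measurable_maxAvg {f : ℂ → ℝ} (hf : IsNice f) (δ : ℝ) : Measurable (maxAvg δ f) := by
  refine LowerSemicontinuous.measurable (lowerSemicontinuous_biSup fun w _ => ?_)
  have h := continuous_annAvg_osc hf δ
  exact (ENNReal.continuous_ofReal.comp (h.comp (continuous_id.prodMk
    continuous_const)).abs).lowerSemicontinuous

/-- `annAvg` at `x` only sees `f` near the circle of radius `√w`. -/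
lemma annAvg_congr {k k₁ k₂ : ℝ → ℝ} {M : ℝ} (hk : IsOscKernel k k₁ k₂ M) {f g : ℂ → ℝ} {δ : ℝ}
    (hδ : 0 < δ) {w : ℝ} {x : ℂ} (h : ∀ y, |‖x - y‖ ^ 2 - w| ≤ 2 * δ → f y = g y) :
    annAvg k δ w f x = annAvg k δ w g x := by
  unfold annAvg
  refine integral_congr_ae (Filter.Eventually.of_forall fun y => ?_)
  simp only
  by_cases h0 : k ((‖x - y‖ ^ 2 - w) / δ) = 0
  · simp [h0]
  · rw [h y (osc_arg_bound hk hδ h0)]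

lemma annulus_bound {δ w : ℝ} (hδ : δ ≤ 1 / 8) (hw : w ∈ Set.Icc (1 : ℝ) 4) {d : ℝ} (hd : 0 ≤ d)
    (h : |d ^ 2 - w| ≤ 2 * δ) : 5 / 8 ≤ d ∧ d ≤ 17 / 8 := by
  have := abs_le.1 h
  constructor
  · nlinarith [hw.1]
  · nlinarith [hw.2]

lemma exists_local_maxAvg_bound : ∃ C : ℝ, 0 < C ∧ ∀ (δ R : ℝ), 0 < δ → δ ≤ 1 / 8 → 0 < R →
    R ≤ 1 / 4 → ∀ (b : ℂ) (f : ℂ → ℝ), IsNice f →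
    ∫⁻ x in {x : ℂ | ‖x - b‖ ≤ R / 2}, maxAvg δ f x ^ 2 ≤
      ENNReal.ofReal (C * √R) * ∫⁻ y in {y : ℂ | ‖y - b‖ ≤ 5 / 2}, ENNReal.ofReal |f y| ^ 2 := by
  obtain ⟨M, hM, h1, h2⟩ := exists_osc_bound
  obtain ⟨Mg, hMg, hg⟩ := exists_cutoff_bound
  set C₀ := 8 * M ^ 2 * Mg * (36 * Real.pi ^ 2) with hC₀
  have hC₀0 : 0 < C₀ := by positivity
  refine ⟨4 * C₀, by positivity, fun δ R hδ hδ' hR hR' b f hf => ?_⟩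
  set S : Set ℂ := {y | 1 / 2 ≤ ‖y - b‖ ∧ ‖y - b‖ ≤ 5 / 2} with hS
  have hSm : MeasurableSet S := by
    have hc : Continuous fun y : ℂ => ‖y - b‖ := by fun_prop
    exact ((isClosed_le continuous_const hc).inter (isClosed_le hc continuous_const)).measurableSet
  set g := S.indicator f with hg'
  have hgn : IsNice g := hf.indicator hSm
  obtain ⟨Rg, hRg⟩ := hgn.supp
  have hg0 : ∀ y, g y ≠ 0 → 1 / 4 + R ≤ ‖y - b‖ := by
    intro y hy
    have : y ∈ S := Set.mem_of_indicator_ne_zero hy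
    linarith [this.1]
  have e1 := lintegral_annAvg_sq_le h1 hMg hg hδ hR hgn hg0
  have e2 := lintegral_annAvg_sq_le h2 hMg hg hδ hR hgn hg0
  have hpt : ∀ x ∈ {x : ℂ | ‖x - b‖ ≤ R / 2}, maxAvg δ f x ^ 2 ≤ ENNReal.ofReal δ⁻¹ *
      ((∫⁻ w : ℝ, ENNReal.ofReal (annAvg osc δ w g x ^ 2)) +
        ∫⁻ w : ℝ, ENNReal.ofReal (annAvg oscDeriv δ w g x ^ 2)) := by
    intro x hx
    have hx' : ‖x - b‖ ≤ R / 2 := hx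
    have hc1 : Continuous fun w : ℝ => annAvg osc δ w g x :=
      Continuous.comp (g := fun p : ℂ × ℝ => annAvg osc δ p.2 g p.1) (f := fun w => (x, w))
        (continuous_annAvg h1.cont (fun s => (h1.bd s).1) hgn δ)
        (continuous_const.prodMk continuous_id)
    have hc2 : Continuous fun w : ℝ => annAvg oscDeriv δ w g x :=
      Continuous.comp (g := fun p : ℂ × ℝ => annAvg oscDeriv δ p.2 g p.1) (f := fun w => (x, w))
        (continuous_annAvg h2.cont (fun s => (h2.bd s).1) hgn δ)
        (continuous_const.prodMk continuous_id)
    have hdv : ∀ w, HasDerivAt (fun w => annAvg osc δ w g x)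
        (-δ⁻¹ * annAvg oscDeriv δ w g x) w := fun w =>
      hasDerivAt_annAvg h1.cont h2.cont h2.d₁ (fun s => (h1.bd s).1)
        (fun s => (h2.bd s).1) hgn δ w x
    have hz : ∀ w < -(2 * δ), annAvg osc δ w g x = 0 := fun w hw => by
      by_contra hne
      exact absurd (annAvg_support h1 hRg hδ hne).1 (not_le.2 hw)
    have hsob := ofReal_sq_le_of_hasDerivAt hδ hc1 hc2 hdv hz
    have hle : ∀ w ∈ Set.Icc (1 : ℝ) 4, ENNReal.ofReal |annAvg osc δ w f x| ^ 2 ≤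
        ENNReal.ofReal δ⁻¹ * ((∫⁻ w : ℝ, ENNReal.ofReal (annAvg osc δ w g x ^ 2)) +
        ∫⁻ w : ℝ, ENNReal.ofReal (annAvg oscDeriv δ w g x ^ 2)) := by
      intro w hw
      have hfg : annAvg osc δ w f x = annAvg osc δ w g x := by
        refine annAvg_congr h1 hδ fun y hy => ?_
        have hb := annulus_bound hδ' hw (norm_nonneg _) hy
        have t1 : ‖y - b‖ ≤ ‖x - y‖ + ‖x - b‖ := by
          rw [norm_sub_rev x y]
          simpa using norm_sub_le_norm_sub_add_norm_sub y x b
        have t2 : ‖x - y‖ ≤ ‖x - b‖ + ‖y - b‖ := by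
          rw [norm_sub_rev y b]
          exact norm_sub_le_norm_sub_add_norm_sub x b y
        have : y ∈ S := ⟨by linarith, by linarith⟩
        rw [hg', Set.indicator_of_mem this]
      rw [hfg, ← ENNReal.ofReal_pow (abs_nonneg _), sq_abs]
      exact hsob w
    simp only [maxAvg, ENNReal.iSup_pow_of_ne_zero two_ne_zero]
    exact iSup₂_le hle
  have hm1 : Measurable fun x => ∫⁻ w : ℝ, ENNReal.ofReal (annAvg osc δ w g x ^ 2) :=
    Measurable.lintegral_prod_right' (f := fun p : ℂ × ℝ =>
      ENNReal.ofReal (annAvg osc δ p.2 g p.1 ^ 2))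
      (((continuous_annAvg_osc hgn δ).pow 2).measurable.ennreal_ofReal)
  calc _ ≤ ∫⁻ x in {x : ℂ | ‖x - b‖ ≤ R / 2}, ENNReal.ofReal δ⁻¹ *
      ((∫⁻ w : ℝ, ENNReal.ofReal (annAvg osc δ w g x ^ 2)) +
        ∫⁻ w : ℝ, ENNReal.ofReal (annAvg oscDeriv δ w g x ^ 2)) :=
        setLIntegral_mono' (measurableSet_norm_sub_le b _) hpt
    _ = ENNReal.ofReal δ⁻¹ * ((∫⁻ x in {x : ℂ | ‖x - b‖ ≤ R / 2},
          ∫⁻ w : ℝ, ENNReal.ofReal (annAvg osc δ w g x ^ 2)) +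
        ∫⁻ x in {x : ℂ | ‖x - b‖ ≤ R / 2},
          ∫⁻ w : ℝ, ENNReal.ofReal (annAvg oscDeriv δ w g x ^ 2)) := by
        rw [lintegral_const_mul' _ _ ENNReal.ofReal_ne_top, lintegral_add_left hm1]
    _ ≤ ENNReal.ofReal δ⁻¹ * (2 * ENNReal.ofReal (C₀ * (δ * √R)) * (∫⁻ y, ENNReal.ofReal |g y| ^ 2) +
        2 * ENNReal.ofReal (C₀ * (δ * √R)) * ∫⁻ y, ENNReal.ofReal |g y| ^ 2) := by
        gcongr
    _ = ENNReal.ofReal (4 * C₀ * √R) * ∫⁻ y, ENNReal.ofReal |g y| ^ 2 := by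
        have : ENNReal.ofReal (4 * C₀ * √R) =
            ENNReal.ofReal δ⁻¹ * (4 * ENNReal.ofReal (C₀ * (δ * √R))) := by
          rw [show (4 : ℝ≥0∞) = ENNReal.ofReal 4 by simp, ← ENNReal.ofReal_mul (by norm_num),
            ← ENNReal.ofReal_mul (by positivity)]
          congr 1
          field_simp
        rw [this]
        ring
    _ ≤ _ := by
        refine mul_le_mul_right ?_ _
        rw [← lintegral_indicator (measurableSet_norm_sub_le b _)]
        refine lintegral_mono fun y => ?_
        by_cases hy : y ∈ S
        · rw [Set.indicator_of_mem (show y ∈ {y : ℂ | ‖y - b‖ ≤ 5 / 2} from hy.2), hg',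
            Set.indicator_of_mem hy]
        · simp [hg', Set.indicator_of_notMem hy]

/-- Averaging local estimates over all centres. -/
lemma lintegral_le_of_local {u v : ℂ → ℝ≥0∞} (hu : Measurable u) (hv : Measurable v) {A : ℝ≥0∞}
    (hA : A ≠ ⊤) {r s : ℝ} (hr : 0 < r) (hs : 0 ≤ s)
    (h : ∀ b, ∫⁻ x in {x : ℂ | ‖x - b‖ ≤ r}, u x ≤ A * ∫⁻ y in {y : ℂ | ‖y - b‖ ≤ s}, v y) :
    ∫⁻ x, u x ≤ A * ENNReal.ofReal ((s / r) ^ 2) * ∫⁻ y, v y := by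
  have key : ∀ (r : ℝ) (u : ℂ → ℝ≥0∞), 0 ≤ r → Measurable u →
      ∫⁻ b, ∫⁻ x in {x : ℂ | ‖x - b‖ ≤ r}, u x = ENNReal.ofReal (Real.pi * r ^ 2) * ∫⁻ x, u x := by
    intro r u hr hu
    have h1 : ∀ b, ∫⁻ x in {x : ℂ | ‖x - b‖ ≤ r}, u x =
        ∫⁻ x, Set.indicator {p : ℂ × ℂ | ‖p.2 - p.1‖ ≤ r} (fun p => u p.2) (b, x) := by
      intro b
      rw [← lintegral_indicator (measurableSet_norm_sub_le b _)]
      refine lintegral_congr fun x => ?_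
      by_cases hx : ‖x - b‖ ≤ r <;> simp [Set.indicator, hx]
    have hm : Measurable (Set.indicator {p : ℂ × ℂ | ‖p.2 - p.1‖ ≤ r} (fun p => u p.2)) :=
      (hu.comp measurable_snd).indicator
        (isClosed_le (by fun_prop) continuous_const).measurableSet
    simp only [h1]
    rw [lintegral_lintegral_swap (f := fun b x =>
      Set.indicator {p : ℂ × ℂ | ‖p.2 - p.1‖ ≤ r} (fun p => u p.2) (b, x)) hm.aemeasurable, ← lintegral_const_mul _ hu]
    refine lintegral_congr fun x => ?_
    have h2 : ∀ b, Set.indicator {p : ℂ × ℂ | ‖p.2 - p.1‖ ≤ r} (fun p => u p.2) (b, x) =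
        Set.indicator {b : ℂ | ‖b - x‖ ≤ r} (fun _ => u x) b := by
      intro b
      by_cases hx : ‖x - b‖ ≤ r <;> simp [Set.indicator, hx, norm_sub_rev b x]
    simp only [h2]
    rw [lintegral_indicator_const (measurableSet_norm_sub_le x _), volume_norm_sub_le x hr, mul_comm]
  have h2 : ∫⁻ b, ∫⁻ x in {x : ℂ | ‖x - b‖ ≤ r}, u x ≤
      ∫⁻ b, A * ∫⁻ y in {y : ℂ | ‖y - b‖ ≤ s}, v y := lintegral_mono h
  rw [lintegral_const_mul' _ _ hA, key r u hr.le hu, key s v hs hv] at h2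
  have hpi := Real.pi_pos
  have h3 : ∀ t : ℝ≥0∞, ENNReal.ofReal (Real.pi * r ^ 2)⁻¹ *
      (ENNReal.ofReal (Real.pi * r ^ 2) * t) = t := by
    intro t
    rw [← mul_assoc, ← ENNReal.ofReal_mul (by positivity), inv_mul_cancel₀ (by positivity),
      ENNReal.ofReal_one, one_mul]
  calc _ = _ := (h3 _).symm
    _ ≤ _ := mul_le_mul_right h2 _
    _ = A * (ENNReal.ofReal (Real.pi * r ^ 2)⁻¹ * ENNReal.ofReal (Real.pi * s ^ 2)) *
        ∫⁻ y, v y := by ring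
    _ = _ := by
        rw [← ENNReal.ofReal_mul (by positivity)]
        congr 3
        field_simp

lemma exists_maxAvg_bound : ∃ C : ℝ, 0 < C ∧ ∀ δ : ℝ, 0 < δ → δ ≤ 1 / 8 →
    ∀ f : ℂ → ℝ, IsNice f →
    ∫⁻ x, maxAvg δ f x ^ 2 ≤ ENNReal.ofReal C * ∫⁻ y, ENNReal.ofReal |f y| ^ 2 := by
  obtain ⟨C, hC, h⟩ := exists_local_maxAvg_bound
  refine ⟨C * √(1 / 4) * (5 / 2 / (1 / 4 / 2)) ^ 2, by positivity, fun δ hδ hδ' f hf => ?_⟩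
  rw [ENNReal.ofReal_mul (by positivity)]
  have hfm := hf.meas
  exact lintegral_le_of_local ((measurable_maxAvg hf δ).pow_const 2) (by fun_prop)
    ENNReal.ofReal_ne_top (by norm_num) (by norm_num)
    fun b => h δ (1 / 4) hδ hδ' (by norm_num) le_rfl b f hf

/-- The adjoint average: `∫_E c(x) δ⁻¹ k((|x - y|² - w(x)) / δ) dx`. -/
def adjAvg (k : ℝ → ℝ) (δ : ℝ) (w c : ℂ → ℝ) (E : Set ℂ) (y : ℂ) : ℝ :=
  ∫ x in E, c x * (δ⁻¹ * k ((‖x - y‖ ^ 2 - w x) / δ))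

lemma measurable_adjAvg_kernel {k : ℝ → ℝ} (hk : Continuous k) (δ : ℝ) {w c : ℂ → ℝ}
    (hw : Measurable w) (hc : Measurable c) : Measurable fun q : ℂ × ℂ =>
      c q.1 * (δ⁻¹ * k ((‖q.1 - q.2‖ ^ 2 - w q.1) / δ)) := by
  have := hk.measurable
  fun_prop

lemma measurable_adjAvg {k : ℝ → ℝ} (hk : Continuous k) (δ : ℝ) {w c : ℂ → ℝ}
    (hw : Measurable w) (hc : Measurable c) (E : Set ℂ) : Measurable (adjAvg k δ w c E) :=
  ((measurable_adjAvg_kernel hk δ hw hc).stronglyMeasurable.integral_prod_left (μ := volume.restrict E)).measurable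

lemma abs_adjAvg_kernel_le {k k₁ k₂ : ℝ → ℝ} {M : ℝ} (hk : IsOscKernel k k₁ k₂ M) {δ : ℝ}
    (hδ : 0 < δ) {w c : ℂ → ℝ} (hc1 : ∀ x, |c x| ≤ 1) (x y : ℂ) :
    |c x * (δ⁻¹ * k ((‖x - y‖ ^ 2 - w x) / δ))| ≤ δ⁻¹ * M := by
  rw [abs_mul, abs_mul, abs_of_pos (inv_pos.2 hδ)]
  have h1 := (hk.bd ((‖x - y‖ ^ 2 - w x) / δ)).1
  have h2 := hc1 x
  have h3 := hk.nonneg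
  calc _ ≤ 1 * (δ⁻¹ * M) := by gcongr
    _ = _ := one_mul _

lemma isNice_adjAvg {k k₁ k₂ : ℝ → ℝ} {M : ℝ} (hk : IsOscKernel k k₁ k₂ M) {δ r : ℝ} (hδ : 0 < δ)
    {w c : ℂ → ℝ} (hw : Measurable w) (hc : Measurable c) (hw4 : ∀ x, w x ≤ 4)
    (hc1 : ∀ x, |c x| ≤ 1) {E : Set ℂ} {b : ℂ}
    (hEb : ∀ x ∈ E, ‖x - b‖ ≤ r) :
    IsNice (adjAvg k δ w c E) := by
  have hfin : volume E ≠ ⊤ := by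
    refine ((measure_mono (t := Metric.closedBall b r) fun x hx => ?_).trans_lt
      measure_closedBall_lt_top).ne
    rw [mem_closedBall_iff_norm]; exact hEb x hx
  refine ⟨measurable_adjAvg hk.cont δ hw hc E, ⟨δ⁻¹ * M * volume.real E, fun y => ?_⟩,
    ⟨‖b‖ + r + (4 + 2 * δ) + 1, fun y hy => ?_⟩⟩
  · have := norm_setIntegral_le_of_norm_le_const (μ := volume) (s := E)
      (f := fun x => c x * (δ⁻¹ * k ((‖x - y‖ ^ 2 - w x) / δ))) (C := δ⁻¹ * M)
      (lt_top_iff_ne_top.2 hfin) (fun x _ => abs_adjAvg_kernel_le hk hδ hc1 x y)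
    simpa [adjAvg] using this
  · unfold adjAvg
    rw [setIntegral_eq_zero_of_forall_eq_zero]
    intro x hx
    by_contra hne
    have h1 : k ((‖x - y‖ ^ 2 - w x) / δ) ≠ 0 := fun h => hne (by rw [h]; ring)
    have h2 := (abs_le.1 (osc_arg_bound hk hδ h1)).2
    have h3 := hw4 x
    have h4 := hEb x hx
    have h5 : ‖y‖ ≤ ‖x - y‖ + ‖x - b‖ + ‖b‖ := by
      have e : y = -(x - y) + (x - b) + b := by ring
      calc ‖y‖ = ‖-(x - y) + (x - b) + b‖ := by rw [← e]
        _ ≤ _ := (norm_add_le _ _).trans (add_le_add_left ((norm_add_le _ _).trans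
          (by rw [norm_neg])) _)
    have h6 : 4 + 2 * δ + 1 < ‖x - y‖ := by linarith
    nlinarith

lemma integral_mul_adjAvg {k k₁ k₂ : ℝ → ℝ} {M : ℝ} (hk : IsOscKernel k k₁ k₂ M) {δ : ℝ}
    (hδ : 0 < δ) {w c : ℂ → ℝ} (hw : Measurable w) (hc : Measurable c)
    (hc1 : ∀ x, |c x| ≤ 1) {E : Set ℂ} (hEt : volume E ≠ ⊤)
    {f : ℂ → ℝ} (hf : IsNice f) :
    ∫ y, f y * adjAvg k δ w c E y = ∫ x in E, c x * annAvg k δ (w x) f x := by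
  unfold adjAvg annAvg
  simp only [← integral_const_mul]
  have hfm := hf.meas
  have : IsFiniteMeasure (volume.restrict E) := ⟨by simpa using lt_top_iff_ne_top.2 hEt⟩
  rw [integral_integral_swap]
  · refine integral_congr_ae (Filter.Eventually.of_forall fun x => ?_)
    refine integral_congr_ae (Filter.Eventually.of_forall fun y => ?_)
    simp only
    ring
  · have h1 : Integrable (fun q : ℂ × ℂ => f q.1 * (δ⁻¹ * M))
        (volume.prod (volume.restrict E)) := hf.integrable.mul_prod (integrable_const (δ⁻¹ * M))
    refine h1.norm.mono' ?_ (Filter.Eventually.of_forall fun q => ?_)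
    · exact ((hfm.comp measurable_fst).mul ((measurable_adjAvg_kernel hk.cont δ hw hc).comp
        measurable_swap)).aestronglyMeasurable
    · have h2 := abs_adjAvg_kernel_le hk hδ (w := w) hc1 q.2 q.1
      have h3 : 0 ≤ δ⁻¹ * M := mul_nonneg (inv_pos.2 hδ).le hk.nonneg
      simp only [Function.uncurry_def]
      rw [norm_mul (f q.1), norm_mul (f q.1), Real.norm_eq_abs (δ⁻¹ * M), abs_of_nonneg h3]
      exact mul_le_mul_of_nonneg_left h2 (norm_nonneg _)

lemma exists_adjAvg_bound : ∃ C : ℝ, 0 < C ∧ ∀ (δ R : ℝ), 0 < δ → δ ≤ 1 / 8 → 0 < R →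
    R ≤ 1 / 4 → ∀ (b : ℂ) (w c : ℂ → ℝ) (E : Set ℂ), Measurable w → Measurable c →
    (∀ x, w x ∈ Set.Icc (1 : ℝ) 4) → (∀ x, |c x| ≤ 1) → MeasurableSet E →
    (∀ x ∈ E, ‖x - b‖ ≤ R / 2) →
    ∫ y, adjAvg osc δ w c E y ^ 2 ≤ C * √R * volume.real E := by
  obtain ⟨C, hC, hloc⟩ := exists_local_maxAvg_bound
  obtain ⟨M, hM, hk, -⟩ := exists_osc_bound
  refine ⟨C, hC, fun δ R hδ hδ' hR hR' b w c E hw hc hwI hc1 _ hEb => ?_⟩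
  set h := adjAvg osc δ w c E with hh
  have hn : IsNice h := isNice_adjAvg hk hδ hw hc (fun x => (hwI x).2) hc1 hEb
  have hEt : volume E ≠ ⊤ := by
    refine ((measure_mono (t := Metric.closedBall b (R / 2)) fun x hx => ?_).trans_lt
      measure_closedBall_lt_top).ne
    rw [mem_closedBall_iff_norm]; exact hEb x hx
  have hdual := integral_mul_adjAvg hk hδ hw hc hc1 hEt hn
  rw [← hh] at hdual
  set L := C * √R with hL
  have hR0 : 0 < √R := Real.sqrt_pos.2 hR
  have hL0 : 0 < L := by positivity
  have hsq : IsNice fun y => h y * h y := by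
    obtain ⟨A, hA⟩ := hn.bdd
    exact hn.mul hn.meas hA
  have hX0 : 0 ≤ ∫ y, h y * h y := integral_nonneg fun y => mul_self_nonneg _
  have hXe : ENNReal.ofReal (∫ y, h y * h y) = ∫⁻ y, ENNReal.ofReal |h y| ^ 2 := by
    rw [ofReal_integral_eq_lintegral_ofReal hsq.integrable
      (Filter.Eventually.of_forall fun y => mul_self_nonneg _)]
    refine lintegral_congr fun y => ?_
    rw [← ENNReal.ofReal_pow (abs_nonneg _), sq_abs, sq]
  have h1 : ENNReal.ofReal (∫ y, h y * h y) ≤ ∫⁻ x in E, maxAvg δ h x := by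
    rw [hdual]
    refine (ENNReal.ofReal_le_ofReal (le_abs_self _)).trans ?_
    rw [← Real.norm_eq_abs, ofReal_norm]
    refine (enorm_integral_le_lintegral_enorm _).trans (lintegral_mono fun x => ?_)
    refine le_trans ?_ (le_maxAvg (hwI x) δ h x)
    rw [← ofReal_norm]
    apply ENNReal.ofReal_le_ofReal
    rw [Real.norm_eq_abs, abs_mul]
    calc _ ≤ 1 * |annAvg osc δ (w x) h x| := by gcongr; exact hc1 x
      _ = _ := one_mul _
  have h2 : ∀ x, 2 * maxAvg δ h x ≤ ENNReal.ofReal L + ENNReal.ofReal L⁻¹ * maxAvg δ h x ^ 2 := by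
    intro x
    by_cases ht : maxAvg δ h x = ⊤
    · rw [ht]
      simp [ENNReal.mul_top, hL0]
    · obtain ⟨t, t0, e⟩ : ∃ t : ℝ, 0 ≤ t ∧ maxAvg δ h x = ENNReal.ofReal t :=
        ⟨_, ENNReal.toReal_nonneg, (ENNReal.ofReal_toReal ht).symm⟩
      rw [e, show (2 : ℝ≥0∞) = ENNReal.ofReal 2 by simp, ← ENNReal.ofReal_pow t0,
        ← ENNReal.ofReal_mul (by norm_num), ← ENNReal.ofReal_mul (by positivity),
        ← ENNReal.ofReal_add (by positivity) (by positivity)]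
      apply ENNReal.ofReal_le_ofReal
      have : 0 ≤ L⁻¹ * (L - t) ^ 2 := by positivity
      have e2 : L⁻¹ * (L - t) ^ 2 = L + L⁻¹ * t ^ 2 - 2 * t := by field_simp; ring
      linarith
  have hTm := measurable_maxAvg hn δ
  have h3 : 2 * ENNReal.ofReal (∫ y, h y * h y) ≤
      ENNReal.ofReal L * volume E + ENNReal.ofReal (∫ y, h y * h y) := by
    calc _ ≤ 2 * ∫⁻ x in E, maxAvg δ h x := mul_le_mul_right h1 _
      _ = ∫⁻ x in E, 2 * maxAvg δ h x := (lintegral_const_mul _ hTm).symm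
      _ ≤ ∫⁻ x in E, (ENNReal.ofReal L + ENNReal.ofReal L⁻¹ * maxAvg δ h x ^ 2) :=
          lintegral_mono h2
      _ = ENNReal.ofReal L * volume E + ENNReal.ofReal L⁻¹ * ∫⁻ x in E, maxAvg δ h x ^ 2 := by
          rw [lintegral_add_left measurable_const, setLIntegral_const,
            lintegral_const_mul _ (hTm.pow_const 2)]
      _ ≤ ENNReal.ofReal L * volume E + ENNReal.ofReal L⁻¹ *
          (ENNReal.ofReal L * ∫⁻ y, ENNReal.ofReal |h y| ^ 2) := by
          gcongr
          refine (lintegral_mono_set (t := {x : ℂ | ‖x - b‖ ≤ R / 2}) fun x hx => hEb x hx).trans ?_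
          exact (hloc δ R hδ hδ' hR hR' b h hn).trans
            (mul_le_mul_right (setLIntegral_le_lintegral _ _) _)
      _ = _ := by
          rw [← mul_assoc, ← ENNReal.ofReal_mul (by positivity), inv_mul_cancel₀ hL0.ne',
            ENNReal.ofReal_one, one_mul, hXe]
  have hVE : volume E = ENNReal.ofReal (volume.real E) := (ENNReal.ofReal_toReal hEt).symm
  rw [hVE, show (2 : ℝ≥0∞) = ENNReal.ofReal 2 by simp, ← ENNReal.ofReal_mul (by norm_num),
    ← ENNReal.ofReal_mul hL0.le, ← ENNReal.ofReal_add (by positivity) hX0,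
    ENNReal.ofReal_le_ofReal_iff (by positivity)] at h3
  simp only [sq]
  linarith

/-! ### Correlations of two annuli -/

lemma abs_integral_phase_le {k : ℝ → ℝ} {a : ℝ → ℝ} {A B θ₀ ε D : ℝ} (hB : 0 < B)
    (hθ₀ : |θ₀| ≤ Real.pi) (hD : 0 ≤ D)
    (hb : ∀ θ, |a θ * k θ| ≤ D) (h0 : ∀ θ, ε < |A - B * Real.cos (θ - θ₀)| → a θ * k θ = 0) :
    |∫ θ in Set.Ioo (-Real.pi) Real.pi, a θ * k θ| ≤ D * (4 * Real.pi * √(ε / B)) := by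
  have hpi := Real.pi_pos
  have hv := volume_phase_sublevel A ε hB hθ₀
  have hs : (volume.restrict (Set.Ioo (-Real.pi) Real.pi))
      {θ | |A - B * Real.cos (θ - θ₀)| ≤ ε} ≤ ENNReal.ofReal (4 * Real.pi * √(ε / B)) := by
    rw [Measure.restrict_apply (isClosed_le (by fun_prop) continuous_const).measurableSet]
    exact hv
  refine (abs_integral_le_of_support (ne_top_of_le_ne_top ENNReal.ofReal_ne_top hs) hb
    (fun θ hθ => h0 θ (not_le.1 hθ))).trans ?_
  refine mul_le_mul_of_nonneg_left ?_ hD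
  exact ENNReal.toReal_le_of_le_ofReal (by positivity) hs

/-- Two integrations by parts against a non-stationary phase `A - B cos (θ - θ₀)`. -/
lemma abs_integral_nonstationary_le {k k₁ k₂ : ℝ → ℝ} {M : ℝ} (hk : IsOscKernel k k₁ k₂ M)
    {a a₁ a₂ : ℝ → ℝ} {N A B θ₀ δ κ : ℝ} (hB : 0 < B) (hδ : 0 < δ) (hκ : 0 < κ) (hκ1 : κ ≤ 1)
    (hθ₀ : |θ₀| ≤ Real.pi)
    (ha₁ : ∀ θ, HasDerivAt a (a₁ θ) θ) (ha₂ : ∀ θ, HasDerivAt a₁ (a₂ θ) θ) (hac : Continuous a₂)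
    (hN : ∀ θ, |a θ| ≤ N ∧ |a₁ θ| ≤ N ∧ |a₂ θ| ≤ N)
    (hper : a Real.pi = a (-Real.pi)) (hper₁ : a₁ Real.pi = a₁ (-Real.pi))
    (hns : ∀ θ, |Real.sin (θ - θ₀)| < κ → (a θ = 0 ∧ a₁ θ = 0 ∧ a₂ θ = 0) ∨
      2 < |(A - B * Real.cos (θ - θ₀)) / δ|) :
    |∫ θ in Set.Ioo (-Real.pi) Real.pi, a θ * k ((A - B * Real.cos (θ - θ₀)) / δ)| ≤
      (δ / B) ^ 2 * (8 * N / κ ^ 4 * M) * (4 * Real.pi * √(2 * δ / B)) := by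
  have hpi := Real.pi_pos
  have hM := hk.nonneg
  have hN0 : 0 ≤ N := (abs_nonneg _).trans (hN 0).1
  set S : ℝ → ℝ := fun θ => Real.sin (θ - θ₀) with hS
  set C : ℝ → ℝ := fun θ => Real.cos (θ - θ₀) with hC
  set Φ : ℝ → ℝ := fun θ => (A - B * C θ) / δ with hΦ
  have hSc : Continuous S := by fun_prop
  have hCc : Continuous C := by fun_prop
  have hΦc : Continuous Φ := by fun_prop
  have hS' : ∀ θ, HasDerivAt S (C θ) θ := fun θ => by
    simpa using ((hasDerivAt_id θ).sub_const θ₀).sin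
  have hC' : ∀ θ, HasDerivAt C (-S θ) θ := fun θ => by
    simpa using ((hasDerivAt_id θ).sub_const θ₀).cos
  have hΦ' : ∀ θ, HasDerivAt Φ (B * S θ / δ) θ := fun θ => by
    refine ((((hC' θ).const_mul B).const_sub A).div_const δ).congr_deriv ?_
    ring
  set e : ℝ → ℝ := fun θ => a₂ θ / S θ ^ 2 - 3 * a₁ θ * C θ / S θ ^ 3 + a θ / S θ ^ 2 +
    3 * a θ * C θ ^ 2 / S θ ^ 4 with he
  set U : ℝ → ℝ := fun θ => (δ / B) * (k₁ (Φ θ) * (a θ / S θ)) -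
    (δ / B) ^ 2 * (k₂ (Φ θ) * (a₁ θ / S θ ^ 2 - a θ * C θ / S θ ^ 3)) with hU
  have hU' : ∀ θ, HasDerivAt U (a θ * k (Φ θ) - (δ / B) ^ 2 * (k₂ (Φ θ) * e θ)) θ := by
    intro θ
    by_cases hθ : |S θ| < κ
    · have hev : U =ᶠ[nhds θ] fun _ => 0 := by
        filter_upwards [(isOpen_lt hSc.abs continuous_const).mem_nhds hθ] with t ht
        rcases hns t ht with ⟨h1, h2, h3⟩ | h
        · simp [hU, h1, h2]
        · obtain ⟨-, h1, h2⟩ := hk.supp _ h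
          simp only [hU]
          rw [show k₁ (Φ t) = 0 from h1, show k₂ (Φ t) = 0 from h2]
          ring
      refine ((hasDerivAt_const θ (0 : ℝ)).congr_of_eventuallyEq hev).congr_deriv ?_
      rcases hns θ hθ with ⟨h1, h2, h3⟩ | h
      · simp [he, h1, h2, h3]
      · obtain ⟨h1, -, h2⟩ := hk.supp _ h
        rw [show k (Φ θ) = 0 from h1, show k₂ (Φ θ) = 0 from h2]
        ring
    · have hS0 : S θ ≠ 0 := fun h => hθ (by rw [h, abs_zero]; exact hκ)
      have d1 := ((hk.d₁ (Φ θ)).comp θ (hΦ' θ)).mul ((ha₁ θ).div (hS' θ) hS0)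
      have d2 := ((hk.d₂ (Φ θ)).comp θ (hΦ' θ)).mul
        (((ha₂ θ).div ((hS' θ).pow 2) (pow_ne_zero 2 hS0)).sub
        (((ha₁ θ).mul (hC' θ)).div ((hS' θ).pow 3) (pow_ne_zero 3 hS0)))
      refine ((d1.const_mul (δ / B)).sub (d2.const_mul ((δ / B) ^ 2))).congr_deriv ?_
      simp only [Function.comp_apply, Pi.mul_apply, Pi.div_apply, Pi.pow_apply, Pi.sub_apply, he]
      push_cast
      field_simp
      ring
  have hacont : Continuous a := continuous_iff_continuousAt.2 fun θ => (ha₁ θ).continuousAt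
  have ha1cont : Continuous a₁ := continuous_iff_continuousAt.2 fun θ => (ha₂ θ).continuousAt
  have hk2c := hk.continuous₂
  have hkc := hk.cont
  have hem : Measurable e := by
    have := hacont.measurable
    have := ha1cont.measurable
    have := hac.measurable
    have := hSc.measurable
    have := hCc.measurable
    fun_prop
  have hbd : ∀ θ, |k₂ (Φ θ) * e θ| ≤ 8 * N / κ ^ 4 * M := by
    intro θ
    by_cases hθ : |S θ| < κ
    · rcases hns θ hθ with ⟨h1, h2, h3⟩ | h
      · have : e θ = 0 := by simp [he, h1, h2, h3]
        rw [this, mul_zero, abs_zero]; positivity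
      · rw [show k₂ (Φ θ) = 0 from (hk.supp _ h).2.2, zero_mul, abs_zero]; positivity
    · have h1 : |k₂ (Φ θ)| ≤ M := (hk.bd _).2.2
      have hSκ : κ ≤ |S θ| := not_lt.1 hθ
      have hC1 : |C θ| ≤ 1 := Real.abs_cos_le_one _
      have hp : ∀ n : ℕ, n ≤ 4 → κ ^ 4 ≤ |S θ| ^ n := fun n hn =>
        (pow_le_pow_of_le_one hκ.le hκ1 hn).trans (by gcongr)
      obtain ⟨n0, n1, n2⟩ := hN θ
      have hκ4 : 0 < κ ^ 4 := by positivity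
      have e1 : |a₂ θ / S θ ^ 2| ≤ N / κ ^ 4 := by
        rw [abs_div, abs_pow]; exact div_le_div₀ hN0 n2 hκ4 (hp 2 (by norm_num))
      have e2 : |3 * a₁ θ * C θ / S θ ^ 3| ≤ 3 * N / κ ^ 4 := by
        rw [abs_div, abs_pow, abs_mul, abs_mul, abs_of_pos (three_pos : (0 : ℝ) < 3)]
        refine div_le_div₀ (by positivity) ?_ hκ4 (hp 3 (by norm_num))
        calc _ ≤ 3 * N * 1 := by gcongr
          _ = _ := mul_one _
      have e3 : |a θ / S θ ^ 2| ≤ N / κ ^ 4 := by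
        rw [abs_div, abs_pow]; exact div_le_div₀ hN0 n0 hκ4 (hp 2 (by norm_num))
      have e4 : |3 * a θ * C θ ^ 2 / S θ ^ 4| ≤ 3 * N / κ ^ 4 := by
        rw [abs_div, abs_pow, abs_mul, abs_mul, abs_of_pos (three_pos : (0 : ℝ) < 3), abs_pow]
        refine div_le_div₀ (by positivity) ?_ hκ4 (hp 4 le_rfl)
        calc _ ≤ 3 * N * 1 ^ 2 := by gcongr
          _ = _ := by ring
      have e5 : |e θ| ≤ 8 * N / κ ^ 4 := by
        calc |e θ| ≤ N / κ ^ 4 + 3 * N / κ ^ 4 + N / κ ^ 4 + 3 * N / κ ^ 4 :=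
              (abs_add_le _ _).trans (add_le_add ((abs_add_le _ _).trans
                (add_le_add ((abs_sub _ _).trans (add_le_add e1 e2)) e3)) e4)
          _ = _ := by ring
      rw [abs_mul, mul_comm]
      gcongr
  have hint1 : IntervalIntegrable (fun θ => a θ * k (Φ θ)) volume (-Real.pi) Real.pi :=
    Continuous.intervalIntegrable (by fun_prop) _ _
  have hint2 : IntervalIntegrable (fun θ => k₂ (Φ θ) * e θ) volume (-Real.pi) Real.pi := by
    rw [intervalIntegrable_iff_integrableOn_Ioc_of_le (by linarith)]
    refine Measure.integrableOn_of_bounded (M := 8 * N / κ ^ 4 * M) (by simp)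
      (((hk2c.comp hΦc).measurable.mul hem).aestronglyMeasurable)
      (Filter.Eventually.of_forall hbd)
  have hFTC := intervalIntegral.integral_eq_sub_of_hasDerivAt (a := -Real.pi) (b := Real.pi)
    (fun θ _ => hU' θ) (hint1.sub (hint2.const_mul _))
  have hUper : U Real.pi = U (-Real.pi) := by
    have s1 : S Real.pi = S (-Real.pi) := by
      simp only [hS]
      rw [← Real.sin_add_two_pi (-Real.pi - θ₀)]; congr 1; ring
    have s2 : C Real.pi = C (-Real.pi) := by
      simp only [hC]
      rw [← Real.cos_add_two_pi (-Real.pi - θ₀)]; congr 1; ring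
    simp only [hU, hΦ, s1, s2, hper, hper₁]
  rw [hUper, sub_self, intervalIntegral.integral_sub hint1 (hint2.const_mul _),
    intervalIntegral.integral_const_mul, sub_eq_zero] at hFTC
  rw [← integral_Ioc_eq_integral_Ioo, ← intervalIntegral.integral_of_le (by linarith)]
  rw [hFTC, abs_mul, abs_of_nonneg (sq_nonneg _), mul_assoc]
  refine mul_le_mul_of_nonneg_left ?_ (sq_nonneg _)
  rw [intervalIntegral.integral_of_le (by linarith), integral_Ioc_eq_integral_Ioo]
  refine abs_integral_phase_le (A := A) (θ₀ := θ₀) hB hθ₀ (by positivity) hbd (fun θ hθ => ?_)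
  have : 2 < |Φ θ| := by
    simp only [hΦ]
    rw [abs_div, abs_of_pos hδ, lt_div_iff₀ hδ]
    exact hθ
  rw [show k₂ (Φ θ) = 0 from (hk.supp _ this).2.2, zero_mul]

/-- A smooth bump equal to `1` on the ball of radius `ρ` about `q`. -/
def bump (ρ : ℝ) (q y : ℂ) : ℝ := cutoff (‖y - q‖ ^ 2 / (2 * ρ) ^ 2)

lemma continuous_bump (ρ : ℝ) (q : ℂ) : Continuous (bump ρ q) := by
  have := cutoff_contDiff.continuous
  unfold bump; fun_prop

lemma bump_nonneg (ρ : ℝ) (q y : ℂ) : 0 ≤ bump ρ q y := cutoff_nonneg _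

lemma abs_bump_le (ρ : ℝ) (q y : ℂ) : |bump ρ q y| ≤ 1 := by
  rw [abs_of_nonneg (bump_nonneg ρ q y)]; exact cutoff_le_one _

lemma bump_eq_one {ρ : ℝ} (hρ : 0 < ρ) {q y : ℂ} (h : ‖y - q‖ ≤ ρ) : bump ρ q y = 1 := by
  apply cutoff_of_le
  rw [div_le_iff₀ (by positivity)]
  nlinarith [norm_nonneg (y - q)]

/-- The correlation of two annular kernels over a bump. -/
def corr (k : ℝ → ℝ) (δ ρ : ℝ) (q x : ℂ) (w : ℝ) (x' : ℂ) (w' : ℝ) : ℝ :=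
  ∫ y, bump ρ q y * ((δ⁻¹ * k ((‖x - y‖ ^ 2 - w) / δ)) * (δ⁻¹ * k ((‖x' - y‖ ^ 2 - w') / δ)))

/-- Reduction of a correlation to integrals over circles centred at `x`. -/
lemma abs_corr_le_of_circle {k k₁ k₂ : ℝ → ℝ} {M : ℝ} (hk : IsOscKernel k k₁ k₂ M)
    {δ ρ : ℝ} (hδ : 0 < δ) (hδ' : δ ≤ 1 / 8) {q x x' : ℂ} {w w' D : ℝ}
    (hw : w ∈ Set.Icc (1 : ℝ) 4) (hD0 : 0 ≤ D)
    (hD : ∀ r : ℝ, 0 < r → |r ^ 2 - w| ≤ 2 * δ →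
      |∫ θ in Set.Ioo (-Real.pi) Real.pi,
        cutoff ((r ^ 2 + ‖q - x‖ ^ 2 - 2 * r * ‖q - x‖ * Real.cos (θ - (q - x).arg)) / (2 * ρ) ^ 2) *
        k ((r ^ 2 + ‖x' - x‖ ^ 2 - w' - 2 * r * ‖x' - x‖ * Real.cos (θ - (x' - x).arg)) / δ)| ≤ D) :
    |corr k δ ρ q x w x' w'| ≤ 9 * M / δ * D := by
  have hM := hk.nonneg
  have hkc := hk.cont
  have hbc := continuous_bump ρ q
  set F : ℂ → ℝ := fun u => bump ρ q (x + u) * ((δ⁻¹ * k ((‖x - (x + u)‖ ^ 2 - w) / δ)) *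
    (δ⁻¹ * k ((‖x' - (x + u)‖ ^ 2 - w') / δ))) with hF
  have hFc : Continuous F := by fun_prop
  have hxu : ∀ u : ℂ, ‖x - (x + u)‖ = ‖u‖ := fun u => by
    rw [show x - (x + u) = -u by ring, norm_neg]
  have hpol := integral_polar (f := F) hFc.measurable (M := 1 * ((δ⁻¹ * M) * (δ⁻¹ * M))) (R := 3)
    (fun u => by
      simp only [hF]
      rw [abs_mul, abs_mul, abs_mul, abs_mul, abs_of_pos (inv_pos.2 hδ)]
      have := abs_bump_le ρ q (x + u)
      have := (hk.bd ((‖x - (x + u)‖ ^ 2 - w) / δ)).1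
      have := (hk.bd ((‖x' - (x + u)‖ ^ 2 - w') / δ)).1
      gcongr)
    (fun u hu => by
      by_contra hne
      have h1 : k ((‖x - (x + u)‖ ^ 2 - w) / δ) ≠ 0 := fun h => hne (by simp only [hF]; rw [h]; ring)
      have h2 := osc_arg_bound hk hδ h1
      rw [hxu] at h2
      linarith [(annulus_bound hδ' hw (norm_nonneg _) h2).2])
  have hcorr : corr k δ ρ q x w x' w' = ∫ u, F u := by
    unfold corr
    rw [← integral_add_left_eq_self _ x]
  rw [hcorr, hpol]
  have hang : ∀ r : ℝ, 0 < r → r * ∫ θ in Set.Ioo (-Real.pi) Real.pi,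
      F (r * (Real.cos θ + Real.sin θ * Complex.I)) =
      r * (δ⁻¹ * k ((r ^ 2 - w) / δ) * δ⁻¹) * ∫ θ in Set.Ioo (-Real.pi) Real.pi,
        cutoff ((r ^ 2 + ‖q - x‖ ^ 2 - 2 * r * ‖q - x‖ * Real.cos (θ - (q - x).arg)) / (2 * ρ) ^ 2) *
        k ((r ^ 2 + ‖x' - x‖ ^ 2 - w' - 2 * r * ‖x' - x‖ * Real.cos (θ - (x' - x).arg)) / δ) := by
    intro r hr
    rw [mul_assoc r, ← integral_const_mul (δ⁻¹ * k ((r ^ 2 - w) / δ) * δ⁻¹)]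
    congr 1
    refine integral_congr_ae (Filter.Eventually.of_forall fun θ => ?_)
    simp only [hF, bump]
    rw [hxu, norm_polar r θ hr.le,
      show x' - (x + r * (Real.cos θ + Real.sin θ * Complex.I)) =
        (x' - x) - r * (Real.cos θ + Real.sin θ * Complex.I) by ring,
      norm_sub_rev (x + r * (Real.cos θ + Real.sin θ * Complex.I)) q,
      show q - (x + r * (Real.cos θ + Real.sin θ * Complex.I)) =
        (q - x) - r * (Real.cos θ + Real.sin θ * Complex.I) by ring,
      norm_sub_polar_sq, norm_sub_polar_sq]
    rw [show r ^ 2 + ‖x' - x‖ ^ 2 - 2 * r * ‖x' - x‖ * Real.cos (θ - (x' - x).arg) - w' =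
      r ^ 2 + ‖x' - x‖ ^ 2 - w' - 2 * r * ‖x' - x‖ * Real.cos (θ - (x' - x).arg) by ring]
    ring
  rw [setIntegral_congr_fun measurableSet_Ioi hang]
  have hs : (volume.restrict (Set.Ioi (0 : ℝ))) (Set.Icc (√w - 2 * δ) (√w + 2 * δ)) ≤
      ENNReal.ofReal (4 * δ) := by
    refine (Measure.restrict_apply_le _ _).trans ?_
    rw [Real.volume_Icc]
    exact ENNReal.ofReal_le_ofReal (by linarith)
  have hsupp : ∀ r : ℝ, 0 < r → |r ^ 2 - w| ≤ 2 * δ → r ∈ Set.Icc (√w - 2 * δ) (√w + 2 * δ) := by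
    intro r hr h
    have h1 : 1 ≤ √w := Real.one_le_sqrt.2 hw.1
    have h2 : √w ^ 2 = w := Real.sq_sqrt (by linarith [hw.1])
    have h3 := abs_le.1 h
    constructor
    · by_contra hc
      nlinarith
    · by_contra hc
      nlinarith
  rw [← integral_indicator measurableSet_Ioi]
  have hb := abs_integral_le_of_support (μ := volume) (s := Set.Icc (√w - 2 * δ) (√w + 2 * δ))
    (M := 9 / 4 * (δ⁻¹ * M * δ⁻¹) * D)
    (f := (Set.Ioi (0 : ℝ)).indicator fun r => r * (δ⁻¹ * k ((r ^ 2 - w) / δ) * δ⁻¹) *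
      ∫ θ in Set.Ioo (-Real.pi) Real.pi,
        cutoff ((r ^ 2 + ‖q - x‖ ^ 2 - 2 * r * ‖q - x‖ * Real.cos (θ - (q - x).arg)) / (2 * ρ) ^ 2) *
        k ((r ^ 2 + ‖x' - x‖ ^ 2 - w' - 2 * r * ‖x' - x‖ * Real.cos (θ - (x' - x).arg)) / δ))
    (by simp) ?_ ?_
  · refine hb.trans (le_of_eq ?_)
    rw [Real.volume_real_Icc, max_eq_left (by linarith)]
    field_simp
    ring
  · intro r
    by_cases hr : 0 < r
    · rw [Set.indicator_of_mem (show r ∈ Set.Ioi (0 : ℝ) from hr)]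
      by_cases h : |r ^ 2 - w| ≤ 2 * δ
      · rw [abs_mul, abs_mul, abs_mul, abs_mul, abs_of_pos (inv_pos.2 hδ), abs_of_pos hr]
        have h1 := hD r hr h
        have h2 := (hk.bd ((r ^ 2 - w) / δ)).1
        have h3 : r ≤ 9 / 4 := by linarith [(annulus_bound hδ' hw hr.le h).2]
        gcongr
      · have : k ((r ^ 2 - w) / δ) = 0 := by
          by_contra hne
          exact h (osc_arg_bound hk hδ hne)
        rw [this, mul_zero, zero_mul, mul_zero, zero_mul, abs_zero]
        positivity
    · rw [Set.indicator_of_notMem (show r ∉ Set.Ioi (0 : ℝ) from hr), abs_zero]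
      positivity
  · intro r hr'
    by_cases hr : 0 < r
    · rw [Set.indicator_of_mem (show r ∈ Set.Ioi (0 : ℝ) from hr)]
      have : k ((r ^ 2 - w) / δ) = 0 := by
        by_contra hne
        exact hr' (hsupp r hr (osc_arg_bound hk hδ hne))
      rw [this]; ring
    · rw [Set.indicator_of_notMem (show r ∉ Set.Ioi (0 : ℝ) from hr)]

lemma sqrt_phase_le {δ r z : ℝ} (hδ : 0 < δ) (hr : 5 / 8 ≤ r) (hz : 0 < z) :
    √(2 * δ / (2 * r * z)) ≤ √(2 * δ / z) := by
  apply Real.sqrt_le_sqrt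
  gcongr
  nlinarith

lemma abs_corr_le {k k₁ k₂ : ℝ → ℝ} {M : ℝ} (hk : IsOscKernel k k₁ k₂ M)
    {δ ρ : ℝ} (hδ : 0 < δ) (hδ' : δ ≤ 1 / 8) {q x x' : ℂ} {w w' : ℝ}
    (hw : w ∈ Set.Icc (1 : ℝ) 4) (hx : x ≠ x') :
    |corr k δ ρ q x w x' w'| ≤ 9 * M / δ * (M * (4 * Real.pi * √(2 * δ / ‖x' - x‖))) := by
  have hM := hk.nonneg
  have hpi := Real.pi_pos
  have hz : 0 < ‖x' - x‖ := norm_pos_iff.2 (sub_ne_zero.2 hx.symm)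
  refine abs_corr_le_of_circle hk hδ hδ' hw (by positivity) fun r hr hrw => ?_
  have hr5 := (annulus_bound hδ' hw hr.le hrw).1
  refine (abs_integral_phase_le (A := r ^ 2 + ‖x' - x‖ ^ 2 - w') (B := 2 * r * ‖x' - x‖)
    (θ₀ := (x' - x).arg) (ε := 2 * δ) (D := M) (by positivity) (abs_arg_le _) hM
    (fun θ => ?_) fun θ hθ => ?_).trans ?_
  · rw [abs_mul, abs_of_nonneg (cutoff_nonneg _)]
    calc _ ≤ 1 * M := mul_le_mul (cutoff_le_one _) (hk.bd _).1 (abs_nonneg _) zero_le_one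
      _ = M := one_mul M
  · have : 2 < |(r ^ 2 + ‖x' - x‖ ^ 2 - w' - 2 * r * ‖x' - x‖ * Real.cos (θ - (x' - x).arg)) / δ| := by
      rw [abs_div, abs_of_pos hδ, lt_div_iff₀ hδ]
      exact hθ
    rw [(hk.supp _ this).1, mul_zero]
  · have := sqrt_phase_le hδ hr5 hz
    gcongr

lemma im_conj_mul_polar (z : ℂ) (r θ : ℝ) :
    ((starRingEnd ℂ) z * (r * (Real.cos θ + Real.sin θ * Complex.I))).im =
      ‖z‖ * r * Real.sin (θ - z.arg) := by
  have h1 : ‖z‖ * Real.cos (Complex.arg z) = z.re := Complex.norm_mul_cos_arg z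
  have h2 : ‖z‖ * Real.sin (Complex.arg z) = z.im := Complex.norm_mul_sin_arg z
  rw [Real.sin_sub]
  simp only [Complex.mul_im, Complex.mul_re, Complex.add_re, Complex.add_im, Complex.ofReal_re,
    Complex.ofReal_im, Complex.I_re, Complex.I_im, Complex.conj_re, Complex.conj_im]
  linear_combination (-(r * Real.sin θ)) * h1 + (r * Real.cos θ) * h2

/-- The annuli about `x` and `x'` are tangent within the angle `κ` at some point near `q`. -/
def IsTangent (δ ρ κ : ℝ) (q x : ℂ) (w : ℝ) (x' : ℂ) (w' : ℝ) : Prop :=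
  ∃ y : ℂ, ‖y - q‖ ≤ 2 * ρ ∧ |‖x - y‖ ^ 2 - w| ≤ 2 * δ ∧ |‖x' - y‖ ^ 2 - w'| ≤ 2 * δ ∧
    |((starRingEnd ℂ) (x' - x) * (y - x)).im| < κ * (‖x' - x‖ * ‖y - x‖)

set_option maxHeartbeats 1000000 in
lemma abs_corr_le_of_not_isTangent {k k₁ k₂ : ℝ → ℝ} {M Mg : ℝ} (hk : IsOscKernel k k₁ k₂ M)
    (hMg : 1 ≤ Mg) (hg : ∀ q, |deriv cutoff q| ≤ Mg ∧ |deriv (deriv cutoff) q| ≤ Mg)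
    {δ ρ κ : ℝ} (hδ : 0 < δ) (hδ' : δ ≤ 1 / 8) (hρ : 0 < ρ) (hρ1 : ρ ≤ 1) (hκ : 0 < κ)
    (hκ1 : κ ≤ 1) {q x x' : ℂ} {w w' : ℝ} (hw : w ∈ Set.Icc (1 : ℝ) 4) (hx : x ≠ x')
    (hq : ‖q - x‖ ≤ 10) (hnt : ¬ IsTangent δ ρ κ q x w x' w') :
    |corr k δ ρ q x w x' w'| ≤ 9 * M / δ * ((δ / ‖x' - x‖) ^ 2 *
      (8 * (132 * Mg / ρ ^ 4) / κ ^ 4 * M) * (4 * Real.pi * √(2 * δ / ‖x' - x‖))) := by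
  have hM := hk.nonneg
  have hpi := Real.pi_pos
  have hz : 0 < ‖x' - x‖ := norm_pos_iff.2 (sub_ne_zero.2 hx.symm)
  refine abs_corr_le_of_circle hk hδ hδ' hw (by positivity) fun r hr hrw => ?_
  obtain ⟨hr5, hr17⟩ := annulus_bound hδ' hw hr.le hrw
  set B := 2 * r * ‖x' - x‖ with hBdef
  have hB : 0 < B := by positivity
  have hzB : ‖x' - x‖ ≤ B := by nlinarith
  set α := (r ^ 2 + ‖q - x‖ ^ 2) / (2 * ρ) ^ 2 with hα
  set β := 2 * r * ‖q - x‖ / (2 * ρ) ^ 2 with hβ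
  set θ₁ := (q - x).arg with hθ₁
  have hβ0 : 0 ≤ β := by positivity
  have hβ11 : β ≤ 11 / ρ ^ 2 := by
    rw [hβ, div_le_div_iff₀ (by positivity) (by positivity)]
    have : r * ‖q - x‖ ≤ 17 / 8 * 10 := by gcongr
    nlinarith [sq_nonneg ρ]
  have hρ2 : 1 ≤ 1 / ρ ^ 2 := by
    rw [le_div_iff₀ (by positivity), one_mul]
    exact pow_le_one₀ hρ.le hρ1
  have hN4 : 132 * Mg / ρ ^ 4 = Mg * (132 * (1 / ρ ^ 2) ^ 2) := by
    field_simp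
  set P := 1 / ρ ^ 2 with hP
  have hβP : β ≤ 11 * P := by rw [hP]; linarith [show 11 / ρ ^ 2 = 11 * (1 / ρ ^ 2) by ring]
  have hPP : P ≤ P ^ 2 := by nlinarith
  have hsq : β ^ 2 ≤ 121 * P ^ 2 :=
    (pow_le_pow_left₀ hβ0 hβP 2).trans (le_of_eq (by ring))
  have hphi : ∀ θ, HasDerivAt (fun θ => α - β * Real.cos (θ - θ₁)) (β * Real.sin (θ - θ₁)) θ := by
    intro θ
    refine HasDerivAt.congr_deriv
      (((((hasDerivAt_id θ).sub_const θ₁).cos).const_mul β).const_sub α) ?_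
    simp
  have hsin : ∀ θ, HasDerivAt (fun θ => β * Real.sin (θ - θ₁)) (β * Real.cos (θ - θ₁)) θ := by
    intro θ
    refine HasDerivAt.congr_deriv ((((hasDerivAt_id θ).sub_const θ₁).sin).const_mul β) ?_
    simp
  have hc1 := contDiff_deriv_top cutoff_contDiff
  have hc2 := contDiff_deriv_top hc1
  have hcont1 := hc1.continuous
  have hcont2 := hc2.continuous
  have hrew : ∀ θ, cutoff ((r ^ 2 + ‖q - x‖ ^ 2 - 2 * r * ‖q - x‖ * Real.cos (θ - θ₁)) / (2 * ρ) ^ 2) *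
      k ((r ^ 2 + ‖x' - x‖ ^ 2 - w' - B * Real.cos (θ - (x' - x).arg)) / δ) =
      cutoff (α - β * Real.cos (θ - θ₁)) *
      k (((r ^ 2 + ‖x' - x‖ ^ 2 - w') - B * Real.cos (θ - (x' - x).arg)) / δ) := by
    intro θ
    congr 2
    rw [hα, hβ]; ring
  simp only [hrew]
  refine (abs_integral_nonstationary_le hk (a := fun θ => cutoff (α - β * Real.cos (θ - θ₁)))
    (a₁ := fun θ => deriv cutoff (α - β * Real.cos (θ - θ₁)) * (β * Real.sin (θ - θ₁)))
    (a₂ := fun θ => deriv (deriv cutoff) (α - β * Real.cos (θ - θ₁)) * (β * Real.sin (θ - θ₁)) *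
      (β * Real.sin (θ - θ₁)) + deriv cutoff (α - β * Real.cos (θ - θ₁)) * (β * Real.cos (θ - θ₁)))
    (N := 132 * Mg / ρ ^ 4) hB hδ hκ hκ1 (abs_arg_le _) (fun θ => ?_) (fun θ => ?_) (by fun_prop)
    (fun θ => ?_) ?_ ?_ (fun θ hθ => ?_)).trans ?_
  · exact (hasDerivAt_of_contDiff_top cutoff_contDiff _).comp θ (hphi θ)
  · exact ((hasDerivAt_of_contDiff_top hc1 _).comp θ (hphi θ)).mul (hsin θ)
  · have hs := Real.abs_sin_le_one (θ - θ₁)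
    have hc := Real.abs_cos_le_one (θ - θ₁)
    obtain ⟨g1, g2⟩ := hg (α - β * Real.cos (θ - θ₁))
    have e1 : |β * Real.sin (θ - θ₁)| ≤ β := by
      rw [abs_mul, abs_of_nonneg hβ0]; exact mul_le_of_le_one_right hβ0 hs
    have e2 : |β * Real.cos (θ - θ₁)| ≤ β := by
      rw [abs_mul, abs_of_nonneg hβ0]; exact mul_le_of_le_one_right hβ0 hc
    have b1 : |deriv cutoff (α - β * Real.cos (θ - θ₁)) * (β * Real.sin (θ - θ₁))| ≤ Mg * β := by
      rw [abs_mul]; gcongr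
    have b3 : |deriv cutoff (α - β * Real.cos (θ - θ₁)) * (β * Real.cos (θ - θ₁))| ≤ Mg * β := by
      rw [abs_mul]; gcongr
    have b2 : |deriv (deriv cutoff) (α - β * Real.cos (θ - θ₁)) * (β * Real.sin (θ - θ₁)) *
      (β * Real.sin (θ - θ₁))| ≤ Mg * β * β := by
      rw [abs_mul, abs_mul]; gcongr
    rw [hN4]
    refine ⟨?_, b1.trans ?_, (abs_add_le _ _).trans ((add_le_add b2 b3).trans ?_)⟩
    · rw [abs_of_nonneg (cutoff_nonneg _)]
      refine (cutoff_le_one _).trans (hMg.trans (le_mul_of_one_le_right (by linarith) ?_))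
      linarith
    · gcongr; linarith
    · rw [show Mg * β * β + Mg * β = Mg * (β ^ 2 + β) by ring]
      gcongr; linarith
  · simp only [show (-Real.pi - θ₁) = (Real.pi - θ₁) - 2 * Real.pi by ring, Real.cos_sub_two_pi]
  · simp only [show (-Real.pi - θ₁) = (Real.pi - θ₁) - 2 * Real.pi by ring, Real.cos_sub_two_pi,
      Real.sin_sub_two_pi]
  · set u : ℂ := r * (Real.cos θ + Real.sin θ * Complex.I) with hu
    have hur : ‖u‖ = r := norm_polar r θ hr.le
    have hqu := norm_sub_polar_sq (q - x) r θ
    have hxu := norm_sub_polar_sq (x' - x) r θ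
    rw [← hu] at hqu hxu
    by_cases hball : ‖(x + u) - q‖ ≤ 2 * ρ
    · right
      by_contra hcon
      refine hnt ⟨x + u, hball, ?_, ?_, ?_⟩
      · rw [show x - (x + u) = -u by ring, norm_neg, hur]; exact hrw
      · rw [show x' - (x + u) = x' - x - u by ring, hxu, ← hBdef]
        rw [not_lt, abs_div, abs_of_pos hδ, div_le_iff₀ hδ] at hcon
        rwa [show r ^ 2 + ‖x' - x‖ ^ 2 - B * Real.cos (θ - (x' - x).arg) - w' =
          r ^ 2 + ‖x' - x‖ ^ 2 - w' - B * Real.cos (θ - (x' - x).arg) by ring]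
      · rw [show x + u - x = u by ring, hur, hu, im_conj_mul_polar, abs_mul,
          abs_of_pos (by positivity : 0 < ‖x' - x‖ * r), mul_comm]
        gcongr
    · left
      have h1 : 3 / 4 < α - β * Real.cos (θ - θ₁) := by
        have : α - β * Real.cos (θ - θ₁) = ‖q - x - u‖ ^ 2 / (2 * ρ) ^ 2 := by
          rw [hqu, hα, hβ]; ring
        rw [this, lt_div_iff₀ (by positivity)]
        rw [norm_sub_rev, show q - (x + u) = q - x - u by ring] at hball
        have h4 : (2 * ρ) ^ 2 < ‖q - x - u‖ ^ 2 :=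
          pow_lt_pow_left₀ (not_le.1 hball) (by positivity) two_ne_zero
        have h5 : 0 < (2 * ρ) ^ 2 := by positivity
        linarith
      rw [cutoff_of_ge h1.le, deriv_cutoff_zero h1, deriv_deriv_cutoff_zero h1]
      simp
  · have := sqrt_phase_le hδ hr5 hz
    gcongr

/-- The two bounds on the correlations of the kernel `osc`. -/
lemma exists_corr_bound : ∃ C : ℝ, 0 < C ∧ ∀ δ ρ κ d : ℝ, 0 < δ → δ ≤ 1 / 8 → 0 < ρ → ρ ≤ 1 →
    0 < κ → κ ≤ 1 → 0 < d → ∀ (q x x' : ℂ) (w w' : ℝ), w ∈ Set.Icc (1 : ℝ) 4 → d ≤ ‖x' - x‖ →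
    ‖q - x‖ ≤ 10 →
    |corr osc δ ρ q x w x' w'| ≤ C * √(δ / d) / δ ∧ (¬ IsTangent δ ρ κ q x w x' w' →
      |corr osc δ ρ q x w x' w'| ≤ C * √(δ / d) / δ * (δ / d) ^ 2 / (ρ ^ 4 * κ ^ 4)) := by
  obtain ⟨M, hM, hk, -⟩ := exists_osc_bound
  obtain ⟨Mg, hMg, hg⟩ := exists_cutoff_bound
  have hpi := Real.pi_pos
  refine ⟨9 * M * (M * (4 * Real.pi * √2)) * (8 * (132 * Mg)), by positivity, ?_⟩
  intro δ ρ κ d hδ hδ' hρ hρ1 hκ hκ1 hd q x x' w w' hw hdz hq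
  have hz : 0 < ‖x' - x‖ := hd.trans_le hdz
  have hx : x ≠ x' := fun h => by simp [h] at hz
  have hs : √(2 * δ / ‖x' - x‖) ≤ √2 * √(δ / d) := by
    rw [← Real.sqrt_mul (by norm_num), mul_div_assoc]
    gcongr
  have hs0 : 0 ≤ √(δ / d) := Real.sqrt_nonneg _
  constructor
  · refine (abs_corr_le hk hδ hδ' hw hx).trans ?_
    calc 9 * M / δ * (M * (4 * Real.pi * √(2 * δ / ‖x' - x‖)))
        ≤ 9 * M / δ * (M * (4 * Real.pi * (√2 * √(δ / d)))) := by gcongr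
      _ = 9 * M * (M * (4 * Real.pi * √2)) * √(δ / d) / δ * 1 := by ring
      _ ≤ 9 * M * (M * (4 * Real.pi * √2)) * √(δ / d) / δ * (8 * (132 * Mg)) := by
          gcongr; linarith
      _ = _ := by ring
  · intro hnt
    refine (abs_corr_le_of_not_isTangent hk hMg hg hδ hδ' hρ hρ1 hκ hκ1 hw hx hq hnt).trans ?_
    calc 9 * M / δ * ((δ / ‖x' - x‖) ^ 2 *
      (8 * (132 * Mg / ρ ^ 4) / κ ^ 4 * M) * (4 * Real.pi * √(2 * δ / ‖x' - x‖)))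
        ≤ 9 * M / δ * ((δ / d) ^ 2 *
      (8 * (132 * Mg / ρ ^ 4) / κ ^ 4 * M) * (4 * Real.pi * (√2 * √(δ / d)))) := by gcongr
      _ = _ := by field_simp

lemma norm_sub_le_of_normalized {u v ν : ℂ} {T D : ℝ} (hT : 0 < T) (hTu : ‖u‖ = T)
    (hν : ‖ν‖ = 1) (hv : v = ‖v‖ * ν) (h : ‖u - v‖ ≤ D) : ‖(T : ℂ)⁻¹ * u - ν‖ ≤ 2 * D / T := by
  have hTc : (T : ℂ) ≠ 0 := by exact_mod_cast hT.ne'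
  have h1 : (T : ℂ)⁻¹ * u - ν = (T : ℂ)⁻¹ * ((u - v) + ((‖v‖ - T : ℝ) : ℂ) * ν) := by
    rw [show u - v = u - ‖v‖ * ν by rw [← hv]]
    push_cast
    field_simp
    ring
  have h2 : |‖v‖ - T| ≤ D := by
    rw [← hTu]
    exact (abs_norm_sub_norm_le v u).trans (by rwa [norm_sub_rev])
  have h3 : ‖((‖v‖ - T : ℝ) : ℂ) * ν‖ ≤ D := by
    rw [norm_mul, hν, mul_one, Complex.norm_real]; exact h2
  rw [h1, norm_mul, norm_inv, Complex.norm_of_nonneg hT.le, inv_mul_eq_div]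
  gcongr
  linarith [norm_add_le (u - v) (((‖v‖ - T : ℝ) : ℂ) * ν)]

lemma abs_mul_of_pos {a b : ℝ} (hb : 0 < b) : |a| * b = |a * b| := by
  rw [abs_mul, abs_of_pos hb]

set_option maxHeartbeats 1000000 in
/-- Internally tangent annuli have nearby centres and radii on a common light cone. -/
lemma IsTangent.light_cone {δ ρ κ ε : ℝ} {q x x' a ν : ℂ} {w w' : ℝ}
    (h : IsTangent δ ρ κ q x w x' w') (hδ : 0 < δ) (hδ' : δ ≤ 1 / 8)
    (hκ : 0 < κ) (hw : w ∈ Set.Icc (1 : ℝ) 4) (hw' : w' ∈ Set.Icc (1 : ℝ) 4)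
    (hε : 4 * δ + κ ^ 2 ≤ ε) (hε1 : ε ≤ 1) (hν : ‖ν‖ = 1) (hqa : q - a = ‖q - a‖ * ν)
    (hxa : ‖x - a‖ ≤ 2 * ρ) (hz : ‖x' - x‖ ≤ 1 / 2) :
    |‖x' - x‖ ^ 2 - (√w - √w') ^ 2| ≤ 3 * ε ∧
      ‖x' - x - ((√w - √w' : ℝ) : ℂ) * ν‖ ≤ κ + ε + 16 * ρ * |√w - √w'| := by
  obtain ⟨y, hyq, hy1, hy2, hang⟩ := h
  obtain ⟨hT5, -⟩ := annulus_bound hδ' hw (norm_nonneg _) hy1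
  rw [norm_sub_rev] at hT5 hy1
  set T := ‖y - x‖ with hTdef
  have hT : 0 < T := by linarith
  have hTc : (T : ℂ) ≠ 0 := by exact_mod_cast hT.ne'
  set n : ℂ := (T : ℂ)⁻¹ * (y - x) with hn
  have hn1 : ‖n‖ = 1 := by
    rw [hn, norm_mul, norm_inv, Complex.norm_of_nonneg hT.le, ← hTdef, inv_mul_cancel₀ hT.ne']
  have hyx : y - x = T * n := by rw [hn]; field_simp
  set z := x' - x with hzdef
  set g : ℂ := (starRingEnd ℂ) z * n with hg
  have hgz : ‖g‖ = ‖z‖ := by rw [hg, norm_mul, hn1, mul_one, Complex.norm_conj]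
  have hgsq : g.re ^ 2 + g.im ^ 2 = ‖z‖ ^ 2 := by
    rw [← hgz, Complex.sq_norm, Complex.normSq_apply]; ring
  have hcn : (starRingEnd ℂ) n * n = 1 := by
    rw [← Complex.normSq_eq_conj_mul_self, Complex.normSq_eq_norm_sq, hn1]; simp
  have hrot : ∀ r : ℝ, ‖z - r * n‖ = ‖g - r‖ := by
    intro r
    have : g - r = (starRingEnd ℂ) (z - r * n) * n := by
      rw [map_sub, map_mul, Complex.conj_ofReal, sub_mul, mul_assoc, hcn, mul_one]
    rw [this, norm_mul, hn1, mul_one, Complex.norm_conj]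
  have hp : |g.im| ≤ κ * ‖z‖ := by
    have : (starRingEnd ℂ) z * (y - x) = T * g := by rw [hyx, hg]; ring
    rw [this, Complex.im_ofReal_mul, abs_mul, abs_of_pos hT] at hang
    nlinarith
  set p := g.im with hpdef
  set S := g.re with hS
  have hSz : |S| ≤ ‖z‖ := hgz ▸ Complex.abs_re_le_norm g
  have hp2 : p ^ 2 ≤ κ ^ 2 / 4 := by
    have : |p| ≤ κ * (1 / 2) := hp.trans (by gcongr)
    calc p ^ 2 = |p| ^ 2 := (sq_abs p).symm
      _ ≤ (κ * (1 / 2)) ^ 2 := by gcongr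
      _ = _ := by ring
  set t := √w with ht
  set t' := √w' with ht'
  have ht1 : 1 ≤ t := Real.one_le_sqrt.2 hw.1
  have ht1' : 1 ≤ t' := Real.one_le_sqrt.2 hw'.1
  have htsq : t ^ 2 = w := Real.sq_sqrt (by linarith [hw.1])
  have htsq' : t' ^ 2 = w' := Real.sq_sqrt (by linarith [hw'.1])
  have hy2' : |(S - T) ^ 2 + p ^ 2 - w'| ≤ 2 * δ := by
    have : ‖x' - y‖ ^ 2 = (S - T) ^ 2 + p ^ 2 := by
      rw [show x' - y = z - T * n by rw [← hyx, hzdef]; ring, hrot, Complex.sq_norm,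
        Complex.normSq_apply]
      simp [hS, hpdef]; ring
    rwa [this] at hy2
  have hTt : |T - t| ≤ 2 * δ := by
    have h1 : |T - t| * 1 ≤ |T - t| * (T + t) := by gcongr; linarith
    have h2 : |T - t| * (T + t) = |T ^ 2 - w| := by
      rw [← htsq, abs_mul_of_pos (by linarith : 0 < T + t)]
      ring_nf
    linarith
  have hTS : |T - S - t'| ≤ 2 * δ + κ ^ 2 / 4 := by
    have h0 : 0 < T - S + t' := by linarith [le_abs_self S]
    have h1 : |T - S - t'| * 1 ≤ |T - S - t'| * (T - S + t') := by
      gcongr; linarith [le_abs_self S]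
    have h2 : |T - S - t'| * (T - S + t') = |(S - T) ^ 2 - w'| := by
      rw [← htsq', abs_mul_of_pos h0]
      ring_nf
    have h3 : |(S - T) ^ 2 - w'| ≤ 2 * δ + p ^ 2 := by
      rw [abs_le] at hy2' ⊢
      constructor <;> linarith [sq_nonneg p]
    linarith
  have hSσ : |S - (t - t')| ≤ ε := by
    rw [abs_le] at hTt hTS ⊢
    constructor <;> linarith [sq_nonneg κ]
  have hε0 : 0 ≤ ε := (abs_nonneg _).trans hSσ
  refine ⟨?_, ?_⟩
  · have h1 : ‖z‖ ^ 2 - (t - t') ^ 2 = (S - (t - t')) * (2 * S - (S - (t - t'))) + p ^ 2 := by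
      rw [← hgsq]; ring
    have h2 : |2 * S - (S - (t - t'))| ≤ 2 := by
      rw [abs_le] at hSσ hSz ⊢
      constructor <;> linarith
    rw [h1]
    calc _ ≤ |S - (t - t')| * |2 * S - (S - (t - t'))| + |p ^ 2| := by
          rw [← abs_mul]; exact abs_add_le _ _
      _ ≤ ε * 2 + ε := by
          gcongr
          rw [abs_of_nonneg (sq_nonneg p)]
          linarith [sq_nonneg κ]
      _ = _ := by ring
  · have h1 : ‖z - ((t - t' : ℝ) : ℂ) * n‖ ≤ κ + ε := by
      rw [hrot]
      refine (Complex.norm_le_abs_re_add_abs_im _).trans ?_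
      rw [Complex.sub_re, Complex.sub_im, Complex.ofReal_re, Complex.ofReal_im, sub_zero, ← hS,
        ← hpdef]
      nlinarith
    have h2 : ‖n - ν‖ ≤ 16 * ρ := by
      have h4 : ‖(y - x) - (q - a)‖ ≤ 4 * ρ := by
        rw [show (y - x) - (q - a) = (y - q) - (x - a) by ring]
        exact (norm_sub_le _ _).trans (by linarith)
      refine (norm_sub_le_of_normalized hT rfl hν hqa h4).trans ?_
      have : 0 ≤ ρ := by linarith [norm_nonneg (x - a)]
      rw [div_le_iff₀ hT]
      nlinarith
    rw [show z - ((t - t' : ℝ) : ℂ) * ν = (z - ((t - t' : ℝ) : ℂ) * n) +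
      ((t - t' : ℝ) : ℂ) * (n - ν) by ring]
    refine (norm_add_le _ _).trans ?_
    rw [norm_mul, Complex.norm_real, Real.norm_eq_abs, mul_comm |t - t'|]
    gcongr

lemma abs_re_conj_mul_le (a b : ℂ) : |((starRingEnd ℂ) a * b).re| ≤ ‖a‖ * ‖b‖ := by
  refine (Complex.abs_re_le_norm _).trans ?_
  rw [norm_mul, Complex.norm_conj]

lemma abs_light_cone_sub_le {z z' ν : ℂ} {σ σ' ε η ρ d : ℝ} (hd : 0 < d)
    (h : |‖z‖ ^ 2 - σ ^ 2| ≤ 3 * ε) (h' : |‖z'‖ ^ 2 - σ' ^ 2| ≤ 3 * ε)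
    (hz : ‖z - σ * ν‖ ≤ η + 16 * ρ * |σ|) (hz' : ‖z' - σ' * ν‖ ≤ η + 16 * ρ * |σ'|)
    (hσ : |σ| + |σ'| = |σ + σ'|) (hdσ : d ≤ |σ + σ'|) (hη : η ≤ ρ * d) (hρ : 0 ≤ ρ) (hε : 0 ≤ ε) :
    |((starRingEnd ℂ) ν * (z' - z)).re - (σ' - σ)| ≤ 6 * ε / d + 18 * ρ * ‖z' - z‖ := by
  set L := |σ + σ'| with hL
  have hL0 : 0 < L := hd.trans_le hdσ
  set e : ℂ := (z - σ * ν) + (z' - σ' * ν) with he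
  have heb : ‖e‖ ≤ 18 * ρ * L := by
    refine (norm_add_le _ _).trans ?_
    have : ρ * d ≤ ρ * L := by gcongr
    nlinarith
  have hid : (σ + σ') * (((starRingEnd ℂ) ν * (z' - z)).re - (σ' - σ)) =
      (‖z'‖ ^ 2 - σ' ^ 2) - (‖z‖ ^ 2 - σ ^ 2) - ((starRingEnd ℂ) e * (z' - z)).re := by
    rw [Complex.sq_norm, Complex.sq_norm, Complex.normSq_apply, Complex.normSq_apply, he]
    simp only [Complex.mul_re, Complex.conj_re, Complex.conj_im, Complex.sub_re, Complex.sub_im,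
      Complex.add_re, Complex.add_im, Complex.mul_im, Complex.ofReal_re, Complex.ofReal_im]
    ring
  have h2 : L * |((starRingEnd ℂ) ν * (z' - z)).re - (σ' - σ)| ≤
      6 * ε + 18 * ρ * L * ‖z' - z‖ := by
    rw [hL, ← abs_mul, hid]
    have h3 := (abs_re_conj_mul_le e (z' - z)).trans
      (mul_le_mul_of_nonneg_right heb (norm_nonneg _))
    rw [abs_le] at h h' h3 ⊢
    constructor <;> linarith
  have h4 : L * |((starRingEnd ℂ) ν * (z' - z)).re - (σ' - σ)| ≤
      L * (6 * ε / d + 18 * ρ * ‖z' - z‖) := by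
    refine h2.trans ?_
    have : 6 * ε ≤ L * (6 * ε / d) := by
      rw [← mul_div_assoc, le_div_iff₀ hd]
      nlinarith
    nlinarith
  exact le_of_mul_le_mul_left h4 hL0

lemma norm_mul_norm_mul_norm_eq {u v s : ℂ} (hu : ‖u‖ = 1) (hv : ‖v‖ = 1) (hs : ‖s‖ = 1) :
    ‖u - v‖ * ‖u - s‖ * ‖v - s‖ = 2 * |((starRingEnd ℂ) (u - v) * (u - s)).im| := by
  have cj : ∀ {a : ℂ}, ‖a‖ = 1 → (starRingEnd ℂ) a = a⁻¹ := fun {a} ha => by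
    rw [Complex.inv_def, Complex.normSq_eq_norm_sq, ha]; simp
  have hu0 : u ≠ 0 := norm_ne_zero_iff.1 (by rw [hu]; exact one_ne_zero)
  have hv0 : v ≠ 0 := norm_ne_zero_iff.1 (by rw [hv]; exact one_ne_zero)
  have hs0 : s ≠ 0 := norm_ne_zero_iff.1 (by rw [hs]; exact one_ne_zero)
  set D := (starRingEnd ℂ) (u - v) * (u - s) with hD
  have h1 : D - (starRingEnd ℂ) D = (u - v) * (u - s) * (v - s) * (u * v * s)⁻¹ := by
    rw [hD]
    simp only [map_mul, map_sub, cj hu, cj hv, cj hs, inv_inv, map_inv₀]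
    field_simp
    ring
  have h2 : ‖D - (starRingEnd ℂ) D‖ = 2 * |D.im| := by
    rw [Complex.sub_conj]; simp
  rw [← h2, h1]
  simp [hu, hv, hs]

lemma norm_mul_pow_le_of_three {u v s V : ℂ} {m τ A : ℝ} (hu : ‖u‖ = 1) (hv : ‖v‖ = 1)
    (hs : ‖s‖ = 1) (hm : 0 ≤ m) (huv : m ≤ ‖u - v‖) (hus : m ≤ ‖u - s‖) (hvs : m ≤ ‖v - s‖)
    (h1 : |((starRingEnd ℂ) u * V).re - τ| ≤ A) (h2 : |((starRingEnd ℂ) v * V).re - τ| ≤ A)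
    (h3 : |((starRingEnd ℂ) s * V).re - τ| ≤ A) : ‖V‖ * m ^ 3 ≤ 16 * A := by
  have hA : 0 ≤ A := (abs_nonneg _).trans h1
  have hdet := norm_mul_norm_mul_norm_eq hu hv hs
  set a := u - v with ha
  set b := u - s with hb
  have hid : (((starRingEnd ℂ) a * b).im : ℂ) * V * Complex.I =
      ((((starRingEnd ℂ) a * V).re : ℝ) : ℂ) * b - ((((starRingEnd ℂ) b * V).re : ℝ) : ℂ) * a := by
    apply Complex.ext
    · simp; ring
    · simp; ring
  have haV : |((starRingEnd ℂ) a * V).re| ≤ 2 * A := by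
    rw [ha, map_sub, sub_mul, Complex.sub_re]
    rw [abs_le] at *
    constructor <;> linarith
  have hbV : |((starRingEnd ℂ) b * V).re| ≤ 2 * A := by
    rw [hb, map_sub, sub_mul, Complex.sub_re]
    rw [abs_le] at *
    constructor <;> linarith
  have ha2 : ‖a‖ ≤ 2 := (norm_sub_le _ _).trans (by rw [hu, hv]; norm_num)
  have hb2 : ‖b‖ ≤ 2 := (norm_sub_le _ _).trans (by rw [hu, hs]; norm_num)
  have hmain : |((starRingEnd ℂ) a * b).im| * ‖V‖ ≤ 8 * A := by
    have := congrArg norm hid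
    rw [norm_mul, norm_mul, Complex.norm_I, mul_one, Complex.norm_real, Real.norm_eq_abs] at this
    rw [this]
    refine (norm_sub_le _ _).trans ?_
    rw [norm_mul, norm_mul, Complex.norm_real, Complex.norm_real, Real.norm_eq_abs, Real.norm_eq_abs]
    nlinarith [mul_le_mul haV hb2 (norm_nonneg _) (by linarith),
      mul_le_mul hbV ha2 (norm_nonneg _) (by linarith)]
  have hm3 : m ^ 3 ≤ ‖a‖ * ‖b‖ * ‖v - s‖ := by
    rw [show m ^ 3 = m * m * m by ring]
    gcongr
  calc ‖V‖ * m ^ 3 ≤ ‖V‖ * (2 * |((starRingEnd ℂ) a * b).im|) := by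
        rw [← hdet]; gcongr
    _ = 2 * (|((starRingEnd ℂ) a * b).im| * ‖V‖) := by ring
    _ ≤ _ := by linarith

lemma abs_add_eq_of_same_sign {a b : ℝ} (h : 0 ≤ a ↔ 0 ≤ b) : |a| + |b| = |a + b| := by
  by_cases ha : 0 ≤ a
  · rw [abs_of_nonneg ha, abs_of_nonneg (h.1 ha), abs_of_nonneg (add_nonneg ha (h.1 ha))]
  · have hb : ¬ 0 ≤ b := fun hb => ha (h.2 hb)
    push Not at ha hb
    rw [abs_of_neg ha, abs_of_neg hb, abs_of_neg (by linarith)]; ring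

/-- The set of centres of annuli tangent to three given ones near separated points is small. -/
lemma volume_three_tangent_le {δ ρ κ ε d m : ℝ} (hδ : 0 < δ) (hδ' : δ ≤ 1 / 8) (hρ : 0 < ρ)
    (hρ' : ρ ≤ 1 / 8)
    (hκ : 0 < κ) (hκ1 : κ ≤ 1) (hε : 4 * δ + κ ^ 2 ≤ ε) (hd : 0 < d) (hdε : 4 * ε ≤ d ^ 2)
    (hε1 : ε ≤ 1)
    (hη : κ + ε ≤ ρ * d) (hm : 0 < m) (hρm : 576 * ρ ≤ m ^ 3) {a : ℂ} {q ν X : Fin 3 → ℂ}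
    {W : Fin 3 → ℝ} {w : ℂ → ℝ} (hw : ∀ x, w x ∈ Set.Icc (1 : ℝ) 4)
    (hW : ∀ l, W l ∈ Set.Icc (1 : ℝ) 4) (hν : ∀ l, ‖ν l‖ = 1)
    (hq : ∀ l, q l - a = ‖q l - a‖ * ν l) (hνm : ∀ i j, i ≠ j → m ≤ ‖ν i - ν j‖)
    (hX : ∀ l, ‖X l - a‖ ≤ 2 * ρ) :
    volume {x : ℂ | ‖x - a‖ ≤ 2 * ρ ∧ ∀ l, d ≤ ‖X l - x‖ ∧
      IsTangent δ ρ κ (q l) x (w x) (X l) (W l)} ≤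
      8 * ENNReal.ofReal (Real.pi * (192 * ε / (d * m ^ 3)) ^ 2) := by
  have hε0 : 0 ≤ ε := by nlinarith
  set S := {x : ℂ | ‖x - a‖ ≤ 2 * ρ ∧ ∀ l, d ≤ ‖X l - x‖ ∧
      IsTangent δ ρ κ (q l) x (w x) (X l) (W l)} with hS
  set P : (Fin 3 → Bool) → Set ℂ := fun s =>
    {x | x ∈ S ∧ ∀ l, (0 ≤ √(w x) - √(W l) ↔ s l = true)} with hP
  have hcov : S ⊆ ⋃ s, P s := by
    intro x hx
    refine Set.mem_iUnion.2 ⟨fun l => decide (0 ≤ √(w x) - √(W l)), hx, fun l => ?_⟩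
    simp
  have hone : ∀ s, volume (P s) ≤ ENNReal.ofReal (Real.pi * (192 * ε / (d * m ^ 3)) ^ 2) := by
    intro s
    rcases Set.eq_empty_or_nonempty (P s) with h | ⟨x₀, hx₀, hs₀⟩
    · rw [h]; simp
    · rw [← volume_norm_sub_le x₀ (by positivity)]
      refine measure_mono ?_
      rintro x ⟨hx, hs⟩
      have hfacts : ∀ x ∈ S, ∀ l, |‖X l - x‖ ^ 2 - (√(w x) - √(W l)) ^ 2| ≤ 3 * ε ∧
          ‖X l - x - ((√(w x) - √(W l) : ℝ) : ℂ) * ν l‖ ≤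
            (κ + ε) + 16 * ρ * |√(w x) - √(W l)| ∧ d / 2 ≤ |√(w x) - √(W l)| := by
        rintro x ⟨hxa, hx⟩ l
        have hz : ‖X l - x‖ ≤ 1 / 2 := by
          rw [show X l - x = (X l - a) - (x - a) by ring]
          exact (norm_sub_le _ _).trans (by linarith [hX l])
        obtain ⟨f1, f2⟩ := (hx l).2.light_cone hδ hδ' hκ (hw x) (hW l) hε hε1 (hν l) (hq l)
          hxa hz
        refine ⟨f1, f2, ?_⟩
        apply abs_le_of_sq_le_sq' _ (abs_nonneg _) |>.2
        rw [sq_abs]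
        have := (hx l).1
        have h1 := abs_le.1 f1
        have : d ^ 2 ≤ ‖X l - x‖ ^ 2 := by gcongr
        nlinarith
      have key : ∀ l, |((starRingEnd ℂ) (ν l) * (x₀ - x)).re - (√(w x) - √(w x₀))| ≤
          6 * ε / d + 18 * ρ * ‖x₀ - x‖ := by
        intro l
        obtain ⟨f1, f2, f3⟩ := hfacts x hx l
        obtain ⟨g1, g2, g3⟩ := hfacts x₀ hx₀ l
        have hsum := abs_add_eq_of_same_sign (((hs₀ l).trans (hs l).symm))
        have := abs_light_cone_sub_le hd g1 f1 g2 f2 hsum (by linarith) hη hρ.le hε0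
        rwa [show X l - x - (X l - x₀) = x₀ - x by ring,
          show √(w x) - √(W l) - (√(w x₀) - √(W l)) = √(w x) - √(w x₀) by ring] at this
      have h3 := norm_mul_pow_le_of_three (hν 0) (hν 1) (hν 2) hm.le (hνm 0 1 (by decide))
        (hνm 0 2 (by decide)) (hνm 1 2 (by decide)) (key 0) (key 1) (key 2)
      show ‖x - x₀‖ ≤ 192 * ε / (d * m ^ 3)
      rw [norm_sub_rev, le_div_iff₀ (by positivity)]
      have h4 : 576 * ρ * ‖x₀ - x‖ ≤ m ^ 3 * ‖x₀ - x‖ := by gcongr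
      have h5 : ‖x₀ - x‖ * m ^ 3 ≤ 192 * (ε / d) := by
        rw [mul_div_assoc] at h3
        linarith
      calc ‖x₀ - x‖ * (d * m ^ 3) = d * (‖x₀ - x‖ * m ^ 3) := by ring
        _ ≤ d * (192 * (ε / d)) := by gcongr
        _ = 192 * ε := by field_simp
  refine (measure_mono hcov).trans ((measure_iUnion_le _).trans ?_)
  rw [tsum_fintype]
  refine (Finset.sum_le_sum fun s _ => hone s).trans ?_
  rw [Finset.sum_const, nsmul_eq_mul]
  simp

lemma lintegral_le_sum_mul_measure {α ι : Type*} [MeasurableSpace α] {m : Measure α}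
    (s : Finset ι) {S : ι → Set α} {c : ι → ℝ≥0∞} {f : α → ℝ≥0∞}
    (h : ∀ x, f x ≤ ∑ i ∈ s, (S i).indicator (fun _ => c i) x) :
    ∫⁻ x, f x ∂m ≤ ∑ i ∈ s, c i * m (S i) := by
  calc ∫⁻ x, f x ∂m ≤ ∫⁻ x, ∑ i ∈ s, (toMeasurable m (S i)).indicator (fun _ => c i) x ∂m := by
        refine lintegral_mono fun x => (h x).trans (Finset.sum_le_sum fun i _ => ?_)
        exact Set.indicator_le_indicator_of_subset (subset_toMeasurable m (S i)) (fun _ => zero_le) x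
    _ = ∑ i ∈ s, c i * m (S i) := by
        rw [lintegral_finsetSum _ fun i _ =>
          measurable_const.indicator (measurableSet_toMeasurable m (S i))]
        refine Finset.sum_congr rfl fun i _ => ?_
        rw [lintegral_indicator_const (measurableSet_toMeasurable m (S i)), measure_toMeasurable]

/-- The correlation restricted to well-separated centres. -/
def farCorr (δ ρ d : ℝ) (q x : ℂ) (w : ℝ) (x' : ℂ) (w' : ℝ) : ℝ≥0∞ :=
  if d ≤ ‖x' - x‖ then ENNReal.ofReal |corr osc δ ρ q x w x' w'| else 0

lemma prod_three_le {f : Fin 3 → ℝ≥0∞} {H K : ℝ≥0∞} (hH : ∀ l, f l ≤ H) (h : ∃ l, f l ≤ K) :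
    ∏ l, f l ≤ H * H * K := by
  rw [Fin.prod_univ_three]
  obtain ⟨l, hl⟩ := h
  fin_cases l
  · calc f 0 * f 1 * f 2 ≤ K * H * H := by gcongr <;> first | exact hl | exact hH _
      _ = _ := by ring
  · calc f 0 * f 1 * f 2 ≤ H * K * H := by gcongr <;> first | exact hl | exact hH _
      _ = _ := by ring
  · gcongr <;> first | exact hl | exact hH _

lemma exists_trilinear_bound : ∃ C : ℝ, 0 < C ∧ ∀ ν ρ e m : ℝ, 0 < ν → ν ≤ 1 / 8 → 0 < ρ →
    ρ ≤ 1 / 8 → 0 < e → e ≤ 1 → 0 < m → m ≤ 1 → 576 * ρ ≤ m ^ 3 → 6 * ν ≤ ρ * e ^ 2 →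
    ∀ (a : ℂ) (q o X : Fin 3 → ℂ) (W : Fin 3 → ℝ) (w : ℂ → ℝ),
    (∀ x, w x ∈ Set.Icc (1 : ℝ) 4) → (∀ l, W l ∈ Set.Icc (1 : ℝ) 4) → (∀ l, ‖o l‖ = 1) →
    (∀ l, q l - a = ‖q l - a‖ * o l) → (∀ l, ‖q l - a‖ ≤ 9) →
    (∀ i j, i ≠ j → m ≤ ‖o i - o j‖) → (∀ l, ‖X l - a‖ ≤ 2 * ρ) →
    ∫⁻ x in {x | ‖x - a‖ ≤ 2 * ρ}, ∏ l, farCorr (ν ^ 10) ρ (e ^ 2) (q l) x (w x) (X l) (W l) ≤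
      ENNReal.ofReal (C * ν / (e ^ 11 * ρ ^ 4 * m ^ 6)) := by
  obtain ⟨C, hC, hcorr⟩ := exists_corr_bound
  have hpi := Real.pi_pos
  set V := 8 * Real.pi * 960 ^ 2 with hV
  have hV0 : 0 < V := by positivity
  refine ⟨5 * C ^ 3 * V, by positivity, ?_⟩
  intro ν ρ e m hν hν' hρ hρ' he he1 hm hm1 hρm hνρ a q o X W w hw hW ho hq hq9 hom hX
  set δ := ν ^ 10 with hδ
  have hδ0 : 0 < δ := by positivity
  have hpow : ∀ n : ℕ, ν ^ n ≤ 1 := fun n => pow_le_one₀ hν.le (by linarith)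
  have hδ' : δ ≤ 1 / 8 := by
    calc δ = ν ^ 9 * ν := by rw [hδ]; ring
      _ ≤ 1 * (1 / 8) := by gcongr; exact hpow 9
      _ = _ := one_mul _
  have hsqrt : √(δ / e ^ 2) = ν ^ 5 / e := by
    rw [show δ / e ^ 2 = (ν ^ 5 / e) ^ 2 by rw [hδ]; field_simp, Real.sqrt_sq (by positivity)]
  set H := C / (ν ^ 5 * e) with hH
  have hHeq : C * √(δ / e ^ 2) / δ = H := by rw [hsqrt, hH, hδ]; field_simp
  have hH0 : 0 < H := by positivity
  set K : ℕ → ℝ := fun i => H * (δ / e ^ 2) ^ 2 / (ρ ^ 4 * (ν ^ (i + 1)) ^ 4) with hK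
  set B := {x : ℂ | ‖x - a‖ ≤ 2 * ρ} with hB
  set S : ℕ → Set ℂ := fun i => {x : ℂ | ‖x - a‖ ≤ 2 * ρ ∧ ∀ l, e ^ 2 ≤ ‖X l - x‖ ∧
    (0 < i → IsTangent δ ρ (ν ^ i) (q l) x (w x) (X l) (W l))} with hS
  have hvol : ∀ i ≤ 4, volume (S i) ≤ ENNReal.ofReal (V * ν ^ (4 * i) / (e ^ 4 * m ^ 6)) := by
    intro i hi
    rcases Nat.eq_zero_or_pos i with rfl | hpos
    · have : S 0 ⊆ {x : ℂ | ‖x - a‖ ≤ 2 * ρ} := fun x hx => hx.1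
      refine (measure_mono this).trans ?_
      rw [volume_norm_sub_le a (by positivity)]
      apply ENNReal.ofReal_le_ofReal
      rw [mul_zero, pow_zero, mul_one, le_div_iff₀ (by positivity)]
      have h1 : e ^ 4 * m ^ 6 ≤ 1 * 1 :=
        mul_le_mul (pow_le_one₀ he.le he1) (pow_le_one₀ hm.le hm1) (by positivity) zero_le_one
      have h2 : (2 * ρ) ^ 2 ≤ 1 := pow_le_one₀ (by positivity) (by linarith)
      calc Real.pi * (2 * ρ) ^ 2 * (e ^ 4 * m ^ 6) ≤ Real.pi * 1 * (1 * 1) := by gcongr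
        _ ≤ V := by rw [hV]; linarith
    · have hκ : 0 < ν ^ i := by positivity
      have hκν : ν ^ i ≤ ν := by
        calc ν ^ i ≤ ν ^ 1 := pow_le_pow_of_le_one hν.le (by linarith) hpos
          _ = ν := pow_one ν
      have hδκ : δ ≤ (ν ^ i) ^ 2 := by
        rw [hδ, ← pow_mul]
        exact pow_le_pow_of_le_one hν.le (by linarith) (by omega)
      have hsq : (ν ^ i) ^ 2 ≤ ν * (1 / 8) := by rw [sq]; gcongr; linarith
      have hre : ρ * e ^ 2 ≤ 1 / 8 * e ^ 2 := by gcongr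
      have hν2 : ν ≤ e ^ 2 / 48 := by linarith
      have hsq2 : (ν ^ i) ^ 2 ≤ (e ^ 2 / 48) ^ 2 := by gcongr; linarith
      have he2 : 0 < e ^ 2 := by positivity
      have := volume_three_tangent_le (δ := δ) (ρ := ρ) (κ := ν ^ i) (ε := 5 * (ν ^ i) ^ 2)
        (d := e ^ 2) (m := m) (a := a) (q := q) (X := X) (W := W) (w := w) hδ0 hδ' hρ hρ' hκ
        (hpow i) (by linarith) he2 (by nlinarith) (by linarith) (by linarith) hm hρm hw hW ho hq
        hom hX
      have hset : S i = {x : ℂ | ‖x - a‖ ≤ 2 * ρ ∧ ∀ l, e ^ 2 ≤ ‖X l - x‖ ∧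
          IsTangent δ ρ (ν ^ i) (q l) x (w x) (X l) (W l)} := by
        simp only [hS, hpos, true_imp_iff]
      rw [hset]
      refine this.trans (le_of_eq ?_)
      rw [show (8 : ℝ≥0∞) = ENNReal.ofReal 8 by simp, ← ENNReal.ofReal_mul (by norm_num)]
      congr 1
      rw [hV, pow_mul']
      field_simp
      ring
  have hpt : ∀ x ∈ B, ∏ l, farCorr δ ρ (e ^ 2) (q l) x (w x) (X l) (W l) ≤
      ∑ i ∈ Finset.range 5, (S i).indicator (fun _ => if i < 4 then
        ENNReal.ofReal (H * H * K i) else ENNReal.ofReal (H * H * H)) x := by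
    intro x hx
    by_cases hfar : ∀ l, e ^ 2 ≤ ‖X l - x‖
    swap
    · push Not at hfar
      obtain ⟨l, hl⟩ := hfar
      rw [Finset.prod_eq_zero (Finset.mem_univ l)]
      · exact zero_le
      · rw [farCorr, if_neg (not_le.2 hl)]
    have hq10 : ∀ l, ‖q l - x‖ ≤ 10 := by
      intro l
      rw [show q l - x = (q l - a) - (x - a) by ring]
      have : ‖x - a‖ ≤ 2 * ρ := hx
      exact (norm_sub_le _ _).trans (by linarith [hq9 l])
    have hc := fun l i => hcorr δ ρ (ν ^ (i + 1)) (e ^ 2) hδ0 hδ' hρ (by linarith) (by positivity)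
      (hpow _) (by positivity) (q l) x (X l) (w x) (W l) (hw x) (hfar l) (hq10 l)
    simp only [hHeq] at hc
    have hHl : ∀ l, farCorr δ ρ (e ^ 2) (q l) x (w x) (X l) (W l) ≤ ENNReal.ofReal H := by
      intro l
      rw [farCorr, if_pos (hfar l)]
      exact ENNReal.ofReal_le_ofReal (hc l 0).1
    have h0 : x ∈ S 0 := ⟨hx, fun l => ⟨hfar l, fun h => absurd h (lt_irrefl 0)⟩⟩
    have hlevel : ∃ i < 5, x ∈ S i ∧ (i < 4 → x ∉ S (i + 1)) := by
      by_contra hcon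
      push Not at hcon
      have : ∀ i ≤ 4, x ∈ S i := by
        intro i
        induction i with
        | zero => exact fun _ => h0
        | succ i ih => exact fun hi => (hcon i (by omega) (ih (by omega))).2
      exact absurd (hcon 4 (by norm_num) (this 4 le_rfl)).1 (lt_irrefl 4)
    obtain ⟨i, hi5, hiS, hi⟩ := hlevel
    refine le_trans ?_ (Finset.single_le_sum
      (f := fun i => (S i).indicator (fun _ => if i < 4 then
        ENNReal.ofReal (H * H * K i) else ENNReal.ofReal (H * H * H)) x)
      (fun _ _ => zero_le) (Finset.mem_range.2 hi5))
    rw [Set.indicator_of_mem hiS]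
    split_ifs with h4
    · have : ∃ l, ¬ IsTangent δ ρ (ν ^ (i + 1)) (q l) x (w x) (X l) (W l) := by
        by_contra hcon
        push Not at hcon
        exact hi h4 ⟨hx, fun l => ⟨hfar l, fun _ => hcon l⟩⟩
      obtain ⟨l, hl⟩ := this
      refine (prod_three_le hHl (K := ENNReal.ofReal (K i)) ⟨l, ?_⟩).trans_eq ?_
      · rw [farCorr, if_pos (hfar l)]
        exact ENNReal.ofReal_le_ofReal ((hc l i).2 hl)
      · rw [ENNReal.ofReal_mul (by positivity), ENNReal.ofReal_mul (by positivity)]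
    · refine (prod_three_le hHl ⟨0, hHl 0⟩).trans_eq ?_
      rw [ENNReal.ofReal_mul (by positivity), ENNReal.ofReal_mul (by positivity)]
  have hBm : MeasurableSet B := measurableSet_norm_sub_le a _
  rw [← lintegral_indicator hBm]
  refine (lintegral_le_sum_mul_measure (Finset.range 5) (S := S) (c := fun i => if i < 4 then
    ENNReal.ofReal (H * H * K i) else ENNReal.ofReal (H * H * H)) ?_).trans ?_
  · intro x
    by_cases hx : x ∈ B
    · rw [Set.indicator_of_mem hx]; exact hpt x hx
    · rw [Set.indicator_of_notMem hx]; exact zero_le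
  have hterm : ∀ i ∈ Finset.range 5, (if i < 4 then
      ENNReal.ofReal (H * H * K i) else ENNReal.ofReal (H * H * H)) * volume (S i) ≤
      ENNReal.ofReal (C ^ 3 * V * ν / (e ^ 11 * ρ ^ 4 * m ^ 6)) := by
    intro i hi
    have hi5 := Finset.mem_range.1 hi
    split_ifs with h4
    · refine (mul_le_mul_right (hvol i (by omega)) _).trans ?_
      rw [← ENNReal.ofReal_mul (by positivity)]
      apply ENNReal.ofReal_le_ofReal
      apply le_of_eq
      rw [hK, hH, hδ]
      simp only
      rw [show (ν ^ (i + 1)) ^ 4 = ν ^ (4 * i) * ν ^ 4 by ring]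
      field_simp
    · refine (mul_le_mul_right (hvol i (by omega)) _).trans ?_
      rw [← ENNReal.ofReal_mul (by positivity)]
      apply ENNReal.ofReal_le_ofReal
      have : i = 4 := by omega
      subst this
      have h1 : H * H * H * (V * ν ^ (4 * 4) / (e ^ 4 * m ^ 6)) =
          C ^ 3 * V * ν / (e ^ 7 * m ^ 6) := by
        rw [hH]; field_simp
      rw [h1]
      have h2 : e ^ 4 * ρ ^ 4 ≤ 1 * 1 :=
        mul_le_mul (pow_le_one₀ he.le he1) (pow_le_one₀ hρ.le (by linarith)) (by positivity)
          zero_le_one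
      apply div_le_div_of_nonneg_left (by positivity) (by positivity)
      calc e ^ 11 * ρ ^ 4 * m ^ 6 = (e ^ 7 * m ^ 6) * (e ^ 4 * ρ ^ 4) := by ring
        _ ≤ (e ^ 7 * m ^ 6) * (1 * 1) := by gcongr
        _ = _ := by ring
  refine (Finset.sum_le_sum hterm).trans_eq ?_
  rw [Finset.sum_const, Finset.card_range, nsmul_eq_mul,
    show ((5 : ℕ) : ℝ≥0∞) = ENNReal.ofReal 5 by simp, ← ENNReal.ofReal_mul (by norm_num)]
  congr 1
  ring

lemma lintegral_prod_three_le {α : Type*} [MeasurableSpace α] {m : Measure α} [SFinite m]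
    {E : Set α} (hE : MeasurableSet E) {g : Fin 3 → α → α → ℝ≥0∞}
    (hg : ∀ l, Measurable (Function.uncurry (g l))) {B : ℝ≥0∞}
    (h2 : ∀ X : Fin 3 → α, (∀ l, X l ∈ E) → ∫⁻ x in E, ∏ l, g l x (X l) ∂m ≤ B) :
    ∫⁻ x in E, ∏ l, (∫⁻ y in E, g l x y ∂m) ∂m ≤ B * (m E * m E * m E) := by
  have hgx : ∀ l x, Measurable (g l x) := fun l x => (hg l).of_uncurry_left
  set n := m.restrict E with hn
  have h1 : ∀ x, ∏ l, (∫⁻ y, g l x y ∂n) =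
      ∫⁻ z, g 0 x z.1.1 * g 1 x z.1.2 * g 2 x z.2 ∂((n.prod n).prod n) := by
    intro x
    rw [lintegral_prod_mul (f := fun z : α × α => g 0 x z.1 * g 1 x z.2)
      (((hgx 0 x).comp measurable_fst).mul ((hgx 1 x).comp measurable_snd)).aemeasurable
      (hgx 2 x).aemeasurable,
      lintegral_prod_mul (hgx 0 x).aemeasurable (hgx 1 x).aemeasurable, Fin.prod_univ_three]
  simp_rw [h1]
  rw [lintegral_lintegral_swap]
  · have hp : (n.prod n).prod n = ((m.prod m).prod m).restrict ((E ×ˢ E) ×ˢ E) := by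
      rw [hn, Measure.prod_restrict, Measure.prod_restrict]
    rw [hp]
    calc _ ≤ ∫⁻ z in (E ×ˢ E) ×ˢ E, B ∂((m.prod m).prod m) := by
          refine setLIntegral_mono' ((hE.prod hE).prod hE) fun z hz => ?_
          refine le_trans (le_of_eq ?_) (h2 ![z.1.1, z.1.2, z.2] ?_)
          · refine lintegral_congr fun x => ?_
            rw [Fin.prod_univ_three]; rfl
          · intro l
            fin_cases l
            · exact hz.1.1
            · exact hz.1.2
            · exact hz.2
      _ = _ := by
          rw [setLIntegral_const, Measure.prod_prod, Measure.prod_prod]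
  · have a0 : Measurable fun p : α × ((α × α) × α) => g 0 p.1 p.2.1.1 :=
      (hg 0).comp (g := Function.uncurry (g 0)) (f := fun p : α × ((α × α) × α) => (p.1, p.2.1.1)) (by fun_prop)
    have a1 : Measurable fun p : α × ((α × α) × α) => g 1 p.1 p.2.1.2 :=
      (hg 1).comp (g := Function.uncurry (g 1)) (f := fun p : α × ((α × α) × α) => (p.1, p.2.1.2)) (by fun_prop)
    have a2 : Measurable fun p : α × ((α × α) × α) => g 2 p.1 p.2.2 :=
      (hg 2).comp (g := Function.uncurry (g 2)) (f := fun p : α × ((α × α) × α) => (p.1, p.2.2)) (by fun_prop)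
    exact ((a0.mul a1).mul a2).aemeasurable

/-- A set on which three bilinear forms are uniformly large, while their trilinear interaction
is small, has small measure. -/
lemma measure_le_of_trilinear {α : Type*} [MeasurableSpace α] {m : Measure α} [SFinite m]
    {E : Set α} (hE : MeasurableSet E) (hfin : m E ≠ ⊤) {g : Fin 3 → α → α → ℝ≥0∞}
    (hg : ∀ l, Measurable (Function.uncurry (g l))) {A β B : ℝ≥0∞} (hA : A ≠ ⊤)
    (h1 : ∀ l, ∀ E' ⊆ E, MeasurableSet E' →
      A * m E' ^ 2 ≤ β * m E' + ∫⁻ x in E', ∫⁻ y in E', g l x y ∂m ∂m)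
    (h2 : ∀ X : Fin 3 → α, (∀ l, X l ∈ E) → ∫⁻ x in E, ∏ l, g l x (X l) ∂m ≤ B) :
    A * m E ≤ 8 * β ∨ A ^ 3 * m E ≤ 2048 * B := by
  set M := m E with hM
  by_cases hM0 : M = 0
  · left; rw [hM0, mul_zero]; exact zero_le
  have hAM : A * M ≠ ⊤ := ENNReal.mul_ne_top hA hfin
  have hmeas : ∀ l, Measurable fun x => ∫⁻ y in E, g l x y ∂m := fun l =>
    (hg l).lintegral_prod_right'
  set F : Fin 3 → Set α := fun l => E ∩ {x | ∫⁻ y in E, g l x y ∂m < A * M / 8} with hF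
  have hFm : ∀ l, MeasurableSet (F l) := fun l =>
    hE.inter (measurableSet_lt (hmeas l) measurable_const)
  by_cases hbig : ∃ l, M ≤ 4 * m (F l)
  · left
    obtain ⟨l, hl⟩ := hbig
    set N := m (F l) with hN
    have hN0 : N ≠ 0 := by
      rintro h
      rw [h, mul_zero] at hl
      exact hM0 (le_antisymm hl zero_le)
    have hNt : N ≠ ⊤ := ne_top_of_le_ne_top hfin (measure_mono Set.inter_subset_left)
    have h3 := h1 l (F l) Set.inter_subset_left (hFm l)
    have h4 : ∫⁻ x in F l, ∫⁻ y in F l, g l x y ∂m ∂m ≤ A * M / 8 * N := by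
      rw [hN, ← setLIntegral_const]
      refine setLIntegral_mono' (hFm l) fun x hx => ?_
      exact (lintegral_mono_set Set.inter_subset_left).trans hx.2.le
    have h5 : N * (A * N) ≤ N * (β + A * M / 8) := by
      calc N * (A * N) = A * N ^ 2 := by ring
        _ ≤ β * N + A * M / 8 * N := h3.trans (by gcongr)
        _ = _ := by ring
    have h6 : A * N ≤ β + A * M / 8 := (ENNReal.mul_le_mul_iff_right hN0 hNt).1 h5
    have h7 : A * M ≤ 4 * β + A * M / 2 := by
      calc A * M ≤ A * (4 * N) := by gcongr
        _ = 4 * (A * N) := by ring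
        _ ≤ 4 * (β + A * M / 8) := by gcongr
        _ = 4 * β + A * M / 2 := by
            rw [mul_add]
            congr 1
            rw [div_eq_mul_inv, div_eq_mul_inv, mul_left_comm]
            congr 1
            rw [show (8 : ℝ≥0∞) = 4 * 2 by norm_num, ENNReal.mul_inv (by simp) (by simp),
              ← mul_assoc, ENNReal.mul_inv_cancel (by simp) (by simp), one_mul]
    have h8 : A * M / 2 + A * M / 2 ≤ 4 * β + A * M / 2 := by rwa [ENNReal.add_halves]
    have h9 : A * M / 2 ≤ 4 * β :=
      (ENNReal.add_le_add_iff_right (ENNReal.div_ne_top hAM (by simp))).1 h8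
    calc A * M = A * M / 2 + A * M / 2 := (ENNReal.add_halves _).symm
      _ ≤ 4 * β + 4 * β := by gcongr
      _ = 8 * β := by ring
  · right
    push Not at hbig
    set G := E \ ⋃ l, F l with hG
    have hGm : MeasurableSet G := hE.diff (MeasurableSet.iUnion hFm)
    have hcov : M ≤ m G + (m (F 0) + m (F 1) + m (F 2)) := by
      calc M ≤ m (G ∪ ⋃ l, F l) := measure_mono (by rw [hG, Set.sdiff_union_self]; simp)
        _ ≤ m G + m (⋃ l, F l) := measure_union_le _ _
        _ ≤ m G + ∑ l, m (F l) := by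
            gcongr; exact (measure_iUnion_le _).trans_eq (tsum_fintype _)
        _ = _ := by rw [Fin.sum_univ_three]
    have hquarter : M ≤ 4 * m G := by
      have h3 : M + 3 * M ≤ 4 * m G + 3 * M := by
        calc M + 3 * M = 4 * M := by ring
          _ ≤ 4 * (m G + (m (F 0) + m (F 1) + m (F 2))) := by gcongr
          _ = 4 * m G + (4 * m (F 0) + 4 * m (F 1) + 4 * m (F 2)) := by ring
          _ ≤ 4 * m G + (M + M + M) := by
              gcongr
              exacts [(hbig 0).le, (hbig 1).le, (hbig 2).le]
          _ = _ := by ring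
      exact (ENNReal.add_le_add_iff_right (ENNReal.mul_ne_top (by simp) hfin)).1 h3
    have hlow : (A * M / 8) ^ 3 * m G ≤ B * (M * M * M) := by
      refine le_trans ?_ (lintegral_prod_three_le hE hg h2)
      rw [← setLIntegral_const]
      refine (setLIntegral_mono' hGm fun x hx => ?_).trans (lintegral_mono_set Set.sdiff_subset)
      have : ∀ l, A * M / 8 ≤ ∫⁻ y in E, g l x y ∂m := by
        intro l
        by_contra hcon
        exact hx.2 (Set.mem_iUnion.2 ⟨l, hx.1, not_le.1 hcon⟩)
      calc (A * M / 8) ^ 3 = ∏ _l : Fin 3, A * M / 8 := by simp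
        _ ≤ _ := Finset.prod_le_prod' fun l _ => this l
    have h3 : (M * M * M) * (A ^ 3 * M) ≤ (M * M * M) * (2048 * B) := by
      have e8 : (A * M / 8) ^ 3 * 512 = (A * M) ^ 3 := by
        rw [show (512 : ℝ≥0∞) = 8 ^ 3 by norm_num, ← mul_pow, ENNReal.div_mul_cancel (by simp)
          (by simp)]
      calc (M * M * M) * (A ^ 3 * M) = (A * M) ^ 3 * M := by ring
        _ ≤ (A * M) ^ 3 * (4 * m G) := by gcongr
        _ = ((A * M / 8) ^ 3 * m G) * 2048 := by
            rw [← e8, show (2048 : ℝ≥0∞) = 512 * 4 by norm_num]; ring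
        _ ≤ (B * (M * M * M)) * 2048 := by gcongr
        _ = _ := by ring
    refine (ENNReal.mul_le_mul_iff_right ?_ ?_).1 h3
    · simp [hM0]
    · exact ENNReal.mul_ne_top (ENNReal.mul_ne_top hfin hfin) hfin

lemma isNice_mul_bump {ρ : ℝ} (hρ : 0 < ρ) (q : ℂ) {g : ℂ → ℝ} (hg : Measurable g) {M : ℝ}
    (hM : ∀ x, |g x| ≤ M) : IsNice fun y => g y * bump ρ q y := by
  refine IsNice.mul ⟨(continuous_bump ρ q).measurable, ⟨1, abs_bump_le ρ q⟩,
    ⟨‖q‖ + 2 * ρ, fun y hy => ?_⟩⟩ hg hM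
  refine cutoff_eq_zero_of_lt (by positivity) ?_
  have := norm_sub_norm_le y q
  linarith

lemma measurable_corr {k : ℝ → ℝ} (hk : Continuous k) (δ ρ : ℝ) (q : ℂ) :
    Measurable fun p : (ℂ × ℝ) × (ℂ × ℝ) => corr k δ ρ q p.1.1 p.1.2 p.2.1 p.2.2 := by
  have hb := continuous_bump ρ q
  have : Continuous fun p : ((ℂ × ℝ) × (ℂ × ℝ)) × ℂ => bump ρ q p.2 *
      ((δ⁻¹ * k ((‖p.1.1.1 - p.2‖ ^ 2 - p.1.1.2) / δ)) *
        (δ⁻¹ * k ((‖p.1.2.1 - p.2‖ ^ 2 - p.1.2.2) / δ))) := by fun_prop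
  exact (this.stronglyMeasurable.integral_prod_right).measurable

lemma corr_comm (k : ℝ → ℝ) (δ ρ : ℝ) (q x : ℂ) (w : ℝ) (x' : ℂ) (w' : ℝ) :
    corr k δ ρ q x w x' w' = corr k δ ρ q x' w' x w := by
  unfold corr
  simp only [mul_comm (δ⁻¹ * k ((‖x - _‖ ^ 2 - w) / δ))]

lemma farCorr_comm (δ ρ d : ℝ) (q x : ℂ) (w : ℝ) (x' : ℂ) (w' : ℝ) :
    farCorr δ ρ d q x w x' w' = farCorr δ ρ d q x' w' x w := by
  unfold farCorr
  rw [norm_sub_rev, corr_comm]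

lemma measurable_farCorr (δ ρ d : ℝ) (q : ℂ) {w : ℂ → ℝ} (hw : Measurable w) :
    Measurable (Function.uncurry fun x x' => farCorr δ ρ d q x (w x) x' (w x')) := by
  obtain ⟨M, hM, hk, -⟩ := exists_osc_bound
  have h1 : Measurable fun p : ℂ × ℂ => corr osc δ ρ q p.1 (w p.1) p.2 (w p.2) :=
    (measurable_corr hk.cont δ ρ q).comp (f := fun p : ℂ × ℂ => ((p.1, w p.1), (p.2, w p.2)))
      (by fun_prop)
  refine Measurable.ite (measurableSet_le measurable_const (by fun_prop)) ?_ measurable_const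
  have h2 : Measurable fun p : ℂ × ℂ => |corr osc δ ρ q p.1 (w p.1) p.2 (w p.2)| :=
    h1.abs
  exact h2.ennreal_ofReal

lemma integral_bump_mul_adjAvg {k k₁ k₂ : ℝ → ℝ} {M : ℝ} (hk : IsOscKernel k k₁ k₂ M) {δ ρ : ℝ}
    (hδ : 0 < δ) (hρ : 0 < ρ) (q : ℂ) {w c : ℂ → ℝ} (hw : Measurable w) (hc : Measurable c)
    (hc1 : ∀ x, |c x| ≤ 1) {E E' : Set ℂ} (hE : volume E ≠ ⊤) (hE' : volume E' ≠ ⊤)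
    (hnice : IsNice (adjAvg k δ w c E)) :
    ∫ y, bump ρ q y * adjAvg k δ w c E y * adjAvg k δ w c E' y =
      ∫ x' in E', c x' * ∫ x in E, c x * corr k δ ρ q x (w x) x' (w x') := by
  have hkc := hk.cont
  rw [integral_mul_adjAvg hk hδ hw hc hc1 hE'
    (hnice.mul (continuous_bump ρ q).measurable (abs_bump_le ρ q))]
  refine integral_congr_ae (Filter.Eventually.of_forall fun x' => ?_)
  simp only
  congr 1
  have h1 := integral_mul_adjAvg hk hδ hw hc hc1 hE
    (isNice_mul_bump hρ q (g := fun y => δ⁻¹ * k ((‖x' - y‖ ^ 2 - w x') / δ)) (M := δ⁻¹ * M)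
      (by fun_prop) (fun y => by
        rw [abs_mul, abs_of_pos (inv_pos.2 hδ)]
        have := (hk.bd ((‖x' - y‖ ^ 2 - w x') / δ)).1
        gcongr))
  calc annAvg k δ (w x') (fun x => bump ρ q x * adjAvg k δ w c E x) x' =
      ∫ y, δ⁻¹ * k ((‖x' - y‖ ^ 2 - w x') / δ) * bump ρ q y * adjAvg k δ w c E y := by
        unfold annAvg
        refine integral_congr_ae (Filter.Eventually.of_forall fun y => ?_)
        simp only; ring
    _ = _ := h1
    _ = _ := by
        refine integral_congr_ae (Filter.Eventually.of_forall fun x => ?_)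
        simp only [annAvg, corr]
        congr 1
        refine integral_congr_ae (Filter.Eventually.of_forall fun y => ?_)
        simp only; ring

lemma ofReal_abs_integral_bump_mul_adjAvg_le {δ ρ d : ℝ}
    (hδ : 0 < δ) (hρ : 0 < ρ) (q : ℂ) {w c : ℂ → ℝ} (hw : Measurable w) (hc : Measurable c)
    (hc1 : ∀ x, |c x| ≤ 1) {E E' : Set ℂ} (hE : volume E ≠ ⊤) (hE' : volume E' ≠ ⊤)
    (hEm : MeasurableSet E) (hEm' : MeasurableSet E')
    (hnice : IsNice (adjAvg osc δ w c E)) (hd : ∀ x ∈ E, ∀ x' ∈ E', d ≤ ‖x' - x‖) :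
    ENNReal.ofReal |∫ y, bump ρ q y * adjAvg osc δ w c E y * adjAvg osc δ w c E' y| ≤
      ∫⁻ x' in E', ∫⁻ x in E, farCorr δ ρ d q x (w x) x' (w x') := by
  obtain ⟨M, hM, hk, -⟩ := exists_osc_bound
  rw [integral_bump_mul_adjAvg hk hδ hρ q hw hc hc1 hE hE' hnice, ← Real.norm_eq_abs, ofReal_norm]
  refine (enorm_integral_le_lintegral_enorm _).trans (setLIntegral_mono' hEm' fun x' hx' => ?_)
  have hce : ∀ x, ‖c x‖ₑ ≤ 1 := fun x => by
    rw [← ofReal_norm, Real.norm_eq_abs]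
    exact ENNReal.ofReal_le_one.2 (hc1 x)
  rw [enorm_mul]
  refine (mul_le_mul_left (hce x') _).trans ?_
  rw [one_mul]
  refine (enorm_integral_le_lintegral_enorm _).trans (setLIntegral_mono' hEm fun x hx => ?_)
  rw [enorm_mul]
  refine (mul_le_mul_left (hce x) _).trans ?_
  rw [one_mul, farCorr, if_pos (hd x hx x' hx'), ← ofReal_norm, Real.norm_eq_abs]

lemma adjAvg_biUnion {k k₁ k₂ : ℝ → ℝ} {M : ℝ} (hk : IsOscKernel k k₁ k₂ M) {δ : ℝ}
    (hδ : 0 < δ) {w c : ℂ → ℝ} (hw : Measurable w) (hc : Measurable c)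
    (hc1 : ∀ x, |c x| ≤ 1) {ι : Type*} (I : Finset ι) {T : ι → Set ℂ}
    (hT : ∀ i ∈ I, MeasurableSet (T i)) (hTd : Set.PairwiseDisjoint (I : Set ι) T)
    (hTf : ∀ i ∈ I, volume (T i) ≠ ⊤) (y : ℂ) :
    adjAvg k δ w c (⋃ i ∈ I, T i) y = ∑ i ∈ I, adjAvg k δ w c (T i) y := by
  unfold adjAvg
  rw [integral_biUnion_finset I hT hTd]
  intro i hi
  have : IsFiniteMeasure (volume.restrict (T i)) := ⟨by simpa using lt_top_iff_ne_top.2 (hTf i hi)⟩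
  refine Integrable.of_bound
    (((measurable_adjAvg_kernel hk.cont δ hw hc).comp
      (measurable_id.prodMk measurable_const)).aestronglyMeasurable) (δ⁻¹ * M)
    (Filter.Eventually.of_forall fun x => ?_)
  exact abs_adjAvg_kernel_le hk hδ hc1 x y

/-- The energy of an adjoint average over a union of separated small pieces. -/
lemma exists_energy_bound : ∃ C : ℝ, 0 < C ∧ ∀ (δ ρ d R : ℝ), 0 < δ → δ ≤ 1 / 8 → 0 < ρ →
    0 < R → R ≤ 1 / 4 → ∀ {ι : Type} (I : Finset ι) (b : ι → ℂ) (T : ι → Set ℂ)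
    (q : ℂ) (w c : ℂ → ℝ), Measurable w → Measurable c →
    (∀ x, w x ∈ Set.Icc (1 : ℝ) 4) → (∀ x, |c x| ≤ 1) → (∀ i ∈ I, MeasurableSet (T i)) →
    Set.PairwiseDisjoint (I : Set ι) T → (∀ i ∈ I, ∀ x ∈ T i, ‖x - b i‖ ≤ R / 2) →
    (∀ i ∈ I, ∀ j ∈ I, i ≠ j → ∀ x ∈ T i, ∀ x' ∈ T j, d ≤ ‖x' - x‖) →
    ENNReal.ofReal (∫ y, bump ρ q y * adjAvg osc δ w c (⋃ i ∈ I, T i) y ^ 2) ≤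
      ENNReal.ofReal (C * √R) * volume (⋃ i ∈ I, T i) +
        ∫⁻ x in ⋃ i ∈ I, T i, ∫⁻ x' in ⋃ i ∈ I, T i, farCorr δ ρ d q x (w x) x' (w x') := by
  obtain ⟨C, hC, hdiag⟩ := exists_adjAvg_bound
  obtain ⟨M, hM, hk, -⟩ := exists_osc_bound
  refine ⟨C, hC, fun δ ρ d R hδ hδ' hρ hR hR' ι I b T q w c hw hc hwI hc1 hT hTd hTb hsep => ?_⟩
  classical
  have hTf : ∀ i ∈ I, volume (T i) ≠ ⊤ := fun i hi => by
    refine ((measure_mono (t := Metric.closedBall (b i) (R / 2)) fun x hx => ?_).trans_lt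
      measure_closedBall_lt_top).ne
    rw [mem_closedBall_iff_norm]; exact hTb i hi x hx
  have hn : ∀ i ∈ I, IsNice (adjAvg osc δ w c (T i)) := fun i hi =>
    isNice_adjAvg hk hδ hw hc (fun x => (hwI x).2) hc1 (hTb i hi)
  have hbm := (continuous_bump ρ q).measurable
  have hint : ∀ i ∈ I, ∀ j ∈ I, Integrable fun y =>
      bump ρ q y * adjAvg osc δ w c (T i) y * adjAvg osc δ w c (T j) y := by
    intro i hi j hj
    obtain ⟨B, hB⟩ := (hn j hj).bdd
    refine ((((hn i hi).mul hbm (abs_bump_le ρ q)).mul (hn j hj).meas hB).integrable).congr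
      (Filter.Eventually.of_forall fun y => ?_)
    simp only; ring
  have hexp : ∫ y, bump ρ q y * adjAvg osc δ w c (⋃ i ∈ I, T i) y ^ 2 =
      ∑ j ∈ I, ∑ i ∈ I, ∫ y, bump ρ q y * adjAvg osc δ w c (T i) y * adjAvg osc δ w c (T j) y := by
    calc ∫ y, bump ρ q y * adjAvg osc δ w c (⋃ i ∈ I, T i) y ^ 2 =
        ∫ y, ∑ j ∈ I, ∑ i ∈ I,
          bump ρ q y * adjAvg osc δ w c (T i) y * adjAvg osc δ w c (T j) y := by
          refine integral_congr_ae (Filter.Eventually.of_forall fun y => ?_)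
          simp only
          rw [adjAvg_biUnion hk hδ hw hc hc1 I hT hTd hTf y, sq, ← mul_assoc, Finset.mul_sum]
          refine Finset.sum_congr rfl fun j _ => ?_
          rw [Finset.mul_sum, Finset.sum_mul]
      _ = ∑ j ∈ I, ∫ y, ∑ i ∈ I,
          bump ρ q y * adjAvg osc δ w c (T i) y * adjAvg osc δ w c (T j) y :=
          integral_finsetSum _ fun j hj => integrable_finsetSum _ fun i hi => hint i hi j hj
      _ = _ := Finset.sum_congr rfl fun j hj => integral_finsetSum _ fun i hi => hint i hi j hj
  rw [hexp, lintegral_biUnion_finset hTd hT, measure_biUnion_finset hTd hT, Finset.mul_sum,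
    ← Finset.sum_add_distrib]
  refine (ENNReal.ofReal_le_ofReal (Finset.sum_le_sum fun j hj =>
    Finset.sum_le_sum fun i hi => le_abs_self _)).trans ?_
  rw [ENNReal.ofReal_sum_of_nonneg fun j _ => Finset.sum_nonneg fun i _ => abs_nonneg _]
  refine Finset.sum_le_sum fun j hj => ?_
  rw [ENNReal.ofReal_sum_of_nonneg fun i _ => abs_nonneg _, ← Finset.sum_erase_add _ _ hj,
    add_comm]
  refine add_le_add ?_ ?_
  · rw [← ENNReal.ofReal_toReal (hTf j hj), ← ENNReal.ofReal_mul (by positivity)]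
    apply ENNReal.ofReal_le_ofReal
    refine le_trans ?_ (hdiag δ R hδ hδ' hR hR' (b j) w c (T j) hw hc hwI hc1 (hT j hj) (hTb j hj))
    obtain ⟨B, hB⟩ := (hn j hj).bdd
    rw [← Real.norm_eq_abs]
    refine (norm_integral_le_integral_norm _).trans (integral_mono (hint j hj j hj).norm
      (((hn j hj).mul (hn j hj).meas hB).integrable.congr
        (Filter.Eventually.of_forall fun y => by simp only; ring)) fun y => ?_)
    simp only [Real.norm_eq_abs]
    rw [mul_assoc, abs_mul, ← sq, abs_of_nonneg (sq_nonneg (adjAvg osc δ w c (T j) y))]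
    exact mul_le_of_le_one_left (sq_nonneg _) (abs_bump_le ρ q y)
  · have hsub : (∑ i ∈ I.erase j, ∫⁻ x' in T j, ∫⁻ x in T i, farCorr δ ρ d q x (w x) x' (w x')) ≤
        ∫⁻ x in T j, ∫⁻ x' in ⋃ i ∈ I, T i, farCorr δ ρ d q x (w x) x' (w x') := by
      have hm := measurable_farCorr δ ρ d q hw
      have hm' := hm.comp measurable_swap
      have hmi : ∀ i, Measurable fun x' => ∫⁻ x in T i, farCorr δ ρ d q x (w x) x' (w x') :=
        fun i => hm'.lintegral_prod_right'
      rw [← lintegral_finsetSum _ fun i _ => hmi i]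
      refine lintegral_mono fun x => ?_
      simp only
      rw [lintegral_biUnion_finset hTd hT]
      refine le_trans (le_of_eq ?_) (Finset.sum_le_sum_of_subset (I.erase_subset j))
      refine Finset.sum_congr rfl fun i _ => lintegral_congr fun x' => ?_
      rw [farCorr_comm]
    refine le_trans (Finset.sum_le_sum fun i hi => ?_) hsub
    obtain ⟨hij, hi⟩ := Finset.mem_erase.1 hi
    exact ofReal_abs_integral_bump_mul_adjAvg_le hδ hρ q hw hc hc1 (hTf i hi) (hTf j hj) (hT i hi)
      (hT j hj) (hn i hi) (hsep i hi j hj hij)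

/-! ### Three transversal heavy pieces -/

lemma sq_integral_mul_le {g h b : ℂ → ℝ} (hg : IsNice g) (hh : IsNice h) (hb : Measurable b)
    (hb0 : ∀ y, 0 ≤ b y) (hb1 : ∀ y, |b y| ≤ 1) (hgb : ∀ y, g y ≠ 0 → b y = 1) {Φ : ℝ}
    (hΦ : 0 < Φ) (hgΦ : ∫ y, g y ^ 2 ≤ Φ) : (∫ y, g y * h y) ^ 2 / Φ ≤ ∫ y, b y * h y ^ 2 := by
  set J := ∫ y, g y * h y
  obtain ⟨Mg, hMg⟩ := hg.bdd
  obtain ⟨Mh, hMh⟩ := hh.bdd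
  have i1 : Integrable fun y => g y * h y := (hh.mul hg.meas hMg).integrable
  have i2 : Integrable fun y => g y ^ 2 :=
    (hg.mul hg.meas hMg).integrable.congr (Filter.Eventually.of_forall fun y => by simp only; ring)
  have i3 : Integrable fun y => b y * h y ^ 2 :=
    ((hh.mul hh.meas hMh).mul hb hb1).integrable.congr
      (Filter.Eventually.of_forall fun y => by simp only; ring)
  have key : ∫ y, 2 * (J / Φ) * (g y * h y) ≤ ∫ y, ((J / Φ) ^ 2 * g y ^ 2 + b y * h y ^ 2) := by
    refine integral_mono (i1.const_mul _) ((i2.const_mul _).add i3) fun y => ?_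
    simp only
    by_cases hy : g y = 0
    · rw [hy]
      have := mul_nonneg (hb0 y) (sq_nonneg (h y))
      simpa using this
    · rw [hgb y hy]
      linarith [sq_nonneg (J / Φ * g y - h y)]
  rw [integral_const_mul, integral_add (i2.const_mul _) i3, integral_const_mul] at key
  have h1 : (J / Φ) ^ 2 * ∫ y, g y ^ 2 ≤ (J / Φ) ^ 2 * Φ := by gcongr
  have h2 : (J / Φ) ^ 2 * Φ = J ^ 2 / Φ := by field_simp
  have h3 : 2 * (J / Φ) * J = 2 * (J ^ 2 / Φ) := by ring
  change 2 * (J / Φ) * J ≤ _ at key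
  linarith

lemma mul_measure_le_integral_mul_adjAvg {δ η : ℝ} (hδ : 0 < δ) {w c : ℂ → ℝ} (hw : Measurable w)
    (hc : Measurable c) (hc1 : ∀ x, |c x| ≤ 1) {E : Set ℂ} (hEm : MeasurableSet E)
    (hE : volume E ≠ ⊤) {g : ℂ → ℝ} (hg : IsNice g)
    (h : ∀ x ∈ E, η ≤ c x * annAvg osc δ (w x) g x) :
    η * volume.real E ≤ ∫ y, g y * adjAvg osc δ w c E y := by
  obtain ⟨M, hM, hk, -⟩ := exists_osc_bound
  rw [integral_mul_adjAvg hk hδ hw hc hc1 hE hg]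
  have hF : Measurable fun x => annAvg osc δ (w x) g x :=
    (continuous_annAvg_osc hg δ).measurable.comp (f := fun x => (x, w x))
      (measurable_id.prodMk hw)
  have : IsFiniteMeasure (volume.restrict E) := ⟨by simpa using lt_top_iff_ne_top.2 hE⟩
  have hint : Integrable (fun x => c x * annAvg osc δ (w x) g x) (volume.restrict E) := by
    refine Integrable.of_bound (hc.mul hF).aestronglyMeasurable (1 * (δ⁻¹ * M * ∫ y, |g y|))
      (Filter.Eventually.of_forall fun x => ?_)
    rw [Real.norm_eq_abs, abs_mul]
    exact mul_le_mul (hc1 x) (abs_annAvg_le hk hg hδ _ x) (abs_nonneg _) zero_le_one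
  calc η * volume.real E = ∫ x in E, η := by rw [setIntegral_const]; simp [mul_comm]
    _ ≤ _ := setIntegral_mono_on (integrable_const _) hint hEm h

/-- The measure of a set on which three transversal pieces all have a large annular average. -/
lemma exists_transversal_bound : ∃ C : ℝ, 0 < C ∧ ∀ ν ρ e m R Φ η : ℝ, 0 < ν → ν ≤ 1 / 8 →
    0 < ρ → ρ ≤ 1 / 8 → 0 < e → e ≤ 1 → 0 < m → m ≤ 1 → 576 * ρ ≤ m ^ 3 → 6 * ν ≤ ρ * e ^ 2 →
    0 < R → R ≤ 1 / 4 → 0 < Φ → 0 < η →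
    ∀ {ι : Type} (I : Finset ι) (b : ι → ℂ) (T : ι → Set ℂ) (a : ℂ) (q o : Fin 3 → ℂ)
    (w : ℂ → ℝ) (g : Fin 3 → ℂ → ℝ) (E : Set ℂ), Measurable w →
    (∀ x, w x ∈ Set.Icc (1 : ℝ) 4) → (∀ l, ‖o l‖ = 1) →
    (∀ l, q l - a = ‖q l - a‖ * o l) → (∀ l, ‖q l - a‖ ≤ 9) →
    (∀ i j, i ≠ j → m ≤ ‖o i - o j‖) → (∀ i ∈ I, MeasurableSet (T i)) →
    Set.PairwiseDisjoint (I : Set ι) T → (∀ i ∈ I, ∀ x ∈ T i, ‖x - b i‖ ≤ R / 2) →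
    (∀ i ∈ I, ∀ j ∈ I, i ≠ j → ∀ x ∈ T i, ∀ x' ∈ T j, e ^ 2 ≤ ‖x' - x‖) →
    (∀ l, IsNice (g l)) → (∀ l y, g l y ≠ 0 → ‖y - q l‖ ≤ ρ) → (∀ l, ∫ y, g l y ^ 2 ≤ Φ) →
    MeasurableSet E → E ⊆ ⋃ i ∈ I, T i → (∀ x ∈ E, ‖x - a‖ ≤ 2 * ρ) →
    (∀ l, ∀ x ∈ E, η ≤ |annAvg osc (ν ^ 10) (w x) (g l) x|) →
    ENNReal.ofReal (η ^ 2 / Φ) * volume E ≤ 8 * ENNReal.ofReal (C * √R) ∨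
      ENNReal.ofReal (η ^ 2 / Φ) ^ 3 * volume E ≤
        2048 * ENNReal.ofReal (C * ν / (e ^ 11 * ρ ^ 4 * m ^ 6)) := by
  obtain ⟨C₁, hC₁, henergy⟩ := exists_energy_bound
  obtain ⟨C₂, hC₂, htri⟩ := exists_trilinear_bound
  refine ⟨max C₁ C₂, lt_max_of_lt_left hC₁, ?_⟩
  intro ν ρ e m R Φ η hν hν8 hρ hρ8 he he1 hm hm1 hρm hνρ hR hR4 hΦ hη ι I b T a q o w g E hw hwI
    ho hq hq9 hom hT hTd hTb hsep hg hgq hgΦ hE hET hEa hbig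
  have hδ : 0 < ν ^ 10 := by positivity
  have hδ8 : ν ^ 10 ≤ 1 / 8 := by
    calc ν ^ 10 ≤ ν ^ 1 := pow_le_pow_of_le_one hν.le (by linarith) (by norm_num)
      _ ≤ 1 / 8 := by simpa using hν8
  have hEfin : volume E ≠ ⊤ := by
    refine ((measure_mono (t := Metric.closedBall a (2 * ρ)) fun x hx => ?_).trans_lt
      measure_closedBall_lt_top).ne
    rw [mem_closedBall_iff_norm]; exact hEa x hx
  obtain ⟨M, hM, hk, -⟩ := exists_osc_bound
  suffices h : ENNReal.ofReal (η ^ 2 / Φ) * volume E ≤ 8 * ENNReal.ofReal (C₁ * √R) ∨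
      ENNReal.ofReal (η ^ 2 / Φ) ^ 3 * volume E ≤
        2048 * ENNReal.ofReal (C₂ * ν / (e ^ 11 * ρ ^ 4 * m ^ 6)) by
    refine h.imp (fun h => h.trans ?_) (fun h => h.trans ?_)
    · gcongr; exact le_max_left _ _
    · gcongr; exact le_max_right _ _
  refine measure_le_of_trilinear (m := volume) hE hEfin
    (g := fun l x x' => farCorr (ν ^ 10) ρ (e ^ 2) (q l) x (w x) x' (w x'))
    (fun l => measurable_farCorr _ _ _ _ hw) ENNReal.ofReal_ne_top ?_ ?_
  · intro l E' hE' hEm'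
    have hEfin' : volume E' ≠ ⊤ := ((measure_mono hE').trans_lt (lt_top_iff_ne_top.2 hEfin)).ne
    have hF : Measurable fun x => annAvg osc (ν ^ 10) (w x) (g l) x :=
      (continuous_annAvg_osc (hg l) _).measurable.comp (f := fun x => (x, w x))
        (measurable_id.prodMk hw)
    set c : ℂ → ℝ := fun x => if 0 ≤ annAvg osc (ν ^ 10) (w x) (g l) x then 1 else -1 with hcdef
    have hc : Measurable c :=
      Measurable.ite (measurableSet_le measurable_const hF) measurable_const measurable_const
    have hc1 : ∀ x, |c x| ≤ 1 := fun x => by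
      simp only [hcdef]; split_ifs <;> simp
    have hcF : ∀ x, c x * annAvg osc (ν ^ 10) (w x) (g l) x =
        |annAvg osc (ν ^ 10) (w x) (g l) x| := fun x => by
      simp only [hcdef]
      split_ifs with h0
      · rw [one_mul, abs_of_nonneg h0]
      · rw [neg_one_mul, abs_of_neg (not_le.1 h0)]
    have h1 := mul_measure_le_integral_mul_adjAvg hδ hw hc hc1 hEm' hEfin' (hg l)
      fun x hx => (hbig l x (hE' hx)).trans_eq (hcF x).symm
    have hnice : IsNice (adjAvg osc (ν ^ 10) w c E') :=
      isNice_adjAvg hk hδ hw hc (fun x => (hwI x).2) hc1 fun x hx => hEa x (hE' hx)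
    have h2 := sq_integral_mul_le (hg l) hnice (continuous_bump ρ (q l)).measurable
      (bump_nonneg ρ (q l)) (abs_bump_le ρ (q l)) (fun y hy => bump_eq_one hρ (hgq l y hy)) hΦ
      (hgΦ l)
    have h3 := henergy (ν ^ 10) ρ (e ^ 2) R hδ hδ8 hρ hR hR4 I b (fun i => T i ∩ E') (q l) w c hw hc
      hwI hc1 (fun i hi => (hT i hi).inter hEm')
      (hTd.mono fun i => Set.inter_subset_left) (fun i hi x hx => hTb i hi x hx.1)
      (fun i hi j hj hij x hx x' hx' => hsep i hi j hj hij x hx.1 x' hx'.1)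
    have hU : (⋃ i ∈ I, T i ∩ E') = E' := by
      rw [← Set.iUnion₂_inter]
      exact Set.inter_eq_right.2 (hE'.trans hET)
    rw [hU] at h3
    refine le_trans ?_ h3
    rw [← ENNReal.ofReal_toReal hEfin', ← ENNReal.ofReal_pow ENNReal.toReal_nonneg,
      ← ENNReal.ofReal_mul (by positivity)]
    refine ENNReal.ofReal_le_ofReal (le_trans ?_ h2)
    change η ^ 2 / Φ * volume.real E' ^ 2 ≤ _
    rw [div_mul_eq_mul_div, ← mul_pow]
    have h0 : 0 ≤ η * volume.real E' := by positivity
    gcongr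
  · intro X hX
    refine (lintegral_mono_set (fun x hx => hEa x hx)).trans ?_
    exact htri ν ρ e m hν hν8 hρ hρ8 he he1 hm hm1 hρm hνρ a q o X (fun l => w (X l)) w hwI
      (fun l => hwI _) ho hq hq9 hom fun l => hEa _ (hX l)

/-! ### Averages of functions supported in small balls -/

lemma one_sub_cos_le_of_norm_sub_le {v : ℂ} {s θ r : ℝ} (hs : 5 / 8 ≤ s) (hv : 5 / 8 ≤ ‖v‖)
    (h : ‖v - s * (Real.cos θ + Real.sin θ * Complex.I)‖ ≤ 2 * r) :
    1 - Real.cos (θ - Complex.arg v) ≤ 9 * r ^ 2 := by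
  have h1 := norm_sub_polar_sq v s θ
  have h2 : ‖v - s * (Real.cos θ + Real.sin θ * Complex.I)‖ ^ 2 ≤ (2 * r) ^ 2 := by gcongr
  have h3 := Real.cos_le_one (θ - Complex.arg v)
  have h4 : 25 / 64 ≤ s * ‖v‖ := by nlinarith
  have h5 : 25 / 64 * (1 - Real.cos (θ - Complex.arg v)) ≤
      s * ‖v‖ * (1 - Real.cos (θ - Complex.arg v)) :=
    mul_le_mul_of_nonneg_right h4 (by linarith)
  have h6 := sq_nonneg (s - ‖v‖)
  have h7 := sq_nonneg r
  nlinarith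

lemma volume_annulus_inter_ball_le {δ w r : ℝ} (hδ : 0 < δ) (hδ8 : δ ≤ 1 / 8)
    (hw : w ∈ Set.Icc (1 : ℝ) 4) (hr : 0 < r) (x b : ℂ) :
    volume ({y : ℂ | |‖x - y‖ ^ 2 - w| ≤ 2 * δ} ∩ {y | ‖y - b‖ ≤ r}) ≤
      ENNReal.ofReal (102 * Real.pi * r * δ) := by
  have hpi := Real.pi_pos
  set S := {y : ℂ | |‖x - y‖ ^ 2 - w| ≤ 2 * δ} ∩ {y | ‖y - b‖ ≤ r} with hS
  have hSm : MeasurableSet S := by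
    refine MeasurableSet.inter (measurableSet_le ?_ measurable_const)
      (measurableSet_norm_sub_le b r)
    fun_prop
  rcases S.eq_empty_or_nonempty with h0 | ⟨y₀, hy₀, hy₀'⟩
  · rw [h0]; simp
  set v := y₀ - x with hv
  have hvn : 5 / 8 ≤ ‖v‖ := by
    rw [hv, norm_sub_rev]; exact (annulus_bound hδ8 hw (norm_nonneg _) hy₀).1
  rw [← lintegral_indicator_one hSm, ← lintegral_add_left_eq_self _ x,
    lintegral_polar (f := fun p => S.indicator 1 (x + p))
      ((measurable_one.indicator hSm).comp (measurable_const.add measurable_id))]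
  have hball : {s : ℝ | |s ^ 2 - w| ≤ 2 * δ} ∩ Set.Ioi 0 ⊆ Metric.closedBall (√w) (2 * δ) := by
    rintro s ⟨h1, h2⟩
    have h2 : 0 < s := h2
    have h3 : 1 ≤ √w := Real.one_le_sqrt.2 hw.1
    have h4 : s ^ 2 - w = (s - √w) * (s + √w) := by
      rw [← Real.sq_sqrt (by linarith [hw.1] : 0 ≤ w)]; rw [Real.sqrt_sq (Real.sqrt_nonneg _)]; ring
    have h5 : |s - √w| * 1 ≤ |s - √w| * (s + √w) := by gcongr; linarith
    rw [Metric.mem_closedBall, Real.dist_eq]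
    rw [Set.mem_ofPred_eq, h4, abs_mul, abs_of_pos (by linarith : 0 < s + √w)] at h1
    linarith
  have hpt : ∀ s ∈ Set.Ioi (0 : ℝ), ENNReal.ofReal s * ∫⁻ θ in Set.Ioo (-Real.pi) Real.pi,
      S.indicator 1 (x + s * (Real.cos θ + Real.sin θ * Complex.I)) ≤
      (Metric.closedBall (√w) (2 * δ)).indicator
        (fun _ => ENNReal.ofReal (17 / 8 * (4 * Real.pi * (3 * r)))) s := by
    intro s hs
    have hs : 0 < s := hs
    have hn : ∀ θ, ‖x - (x + s * (Real.cos θ + Real.sin θ * Complex.I))‖ = s := fun θ => by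
      rw [show x - (x + s * (Real.cos θ + Real.sin θ * Complex.I)) =
        -((s : ℂ) * (Real.cos θ + Real.sin θ * Complex.I)) by ring, norm_neg, norm_polar s θ hs.le]
    by_cases hsw : |s ^ 2 - w| ≤ 2 * δ
    · rw [Set.indicator_of_mem (hball ⟨hsw, hs⟩)]
      obtain ⟨h1, h2⟩ := annulus_bound hδ8 hw hs.le hsw
      rw [ENNReal.ofReal_mul (by norm_num)]
      refine mul_le_mul' (ENNReal.ofReal_le_ofReal h2) ?_
      have h3 := volume_phase_sublevel 1 (9 * r ^ 2) one_pos (abs_arg_le v)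
      rw [div_one, show 9 * r ^ 2 = (3 * r) ^ 2 by ring, Real.sqrt_sq (by positivity)] at h3
      refine le_trans ?_ h3
      have hm : MeasurableSet ({θ : ℝ | |1 - 1 * Real.cos (θ - Complex.arg v)| ≤ (3 * r) ^ 2}) :=
        measurableSet_le (by fun_prop) measurable_const
      rw [← Measure.restrict_apply hm, ← lintegral_indicator_one hm]
      refine lintegral_mono fun θ => ?_
      by_cases hθ : x + s * (Real.cos θ + Real.sin θ * Complex.I) ∈ S
      swap
      · rw [Set.indicator_of_notMem hθ]; exact zero_le
      rw [Set.indicator_of_mem hθ, Set.indicator_of_mem]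
      · simp
      have h5 : ‖v - s * (Real.cos θ + Real.sin θ * Complex.I)‖ ≤ 2 * r := by
        rw [show v - s * (Real.cos θ + Real.sin θ * Complex.I) = (y₀ - b) -
          ((x + s * (Real.cos θ + Real.sin θ * Complex.I)) - b) by rw [hv]; ring]
        refine (norm_sub_le _ _).trans ?_
        have h6 := hθ.2
        have h7 : ‖y₀ - b‖ ≤ r := hy₀'
        rw [Set.mem_ofPred_eq] at h6
        linarith
      have h6 := one_sub_cos_le_of_norm_sub_le h1 hvn h5
      rw [Set.mem_ofPred_eq, one_mul, abs_of_nonneg (by linarith [Real.cos_le_one (θ - v.arg)])]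
      linarith
    · have : ∀ θ, S.indicator (1 : ℂ → ℝ≥0∞) (x + s * (Real.cos θ + Real.sin θ * Complex.I)) = 0 :=
        fun θ => Set.indicator_of_notMem (fun h => hsw (by
          have := h.1; rw [Set.mem_ofPred_eq, hn θ] at this; exact this)) _
      simp only [this, lintegral_zero, mul_zero, zero_le]
  calc _ ≤ ∫⁻ s in Set.Ioi (0 : ℝ), (Metric.closedBall (√w) (2 * δ)).indicator
        (fun _ => ENNReal.ofReal (17 / 8 * (4 * Real.pi * (3 * r)))) s :=
        setLIntegral_mono' measurableSet_Ioi hpt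
    _ ≤ ∫⁻ s, (Metric.closedBall (√w) (2 * δ)).indicator
        (fun _ => ENNReal.ofReal (17 / 8 * (4 * Real.pi * (3 * r)))) s := setLIntegral_le_lintegral _ _
    _ = _ := by
        rw [lintegral_indicator_const measurableSet_closedBall, Real.volume_closedBall,
          ← ENNReal.ofReal_mul (by positivity)]
        congr 1; ring

lemma exists_abs_annAvg_ball_bound : ∃ C : ℝ, 0 < C ∧ ∀ δ w r B : ℝ, 0 < δ → δ ≤ 1 / 8 →
    w ∈ Set.Icc (1 : ℝ) 4 → 0 < r → ∀ (f : ℂ → ℝ) (x b : ℂ), (∀ y, |f y| ≤ B) →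
    (∀ y, |‖x - y‖ ^ 2 - w| ≤ 2 * δ → f y ≠ 0 → ‖y - b‖ ≤ r) →
    |annAvg osc δ w f x| ≤ C * r * B := by
  obtain ⟨M, hM, hk, -⟩ := exists_osc_bound
  have hpi := Real.pi_pos
  refine ⟨102 * Real.pi * M, by positivity, ?_⟩
  intro δ w r B hδ hδ8 hw hr f x b hf hsupp
  have hB : 0 ≤ B := (abs_nonneg _).trans (hf 0)
  set S := {y : ℂ | |‖x - y‖ ^ 2 - w| ≤ 2 * δ} ∩ {y | ‖y - b‖ ≤ r} with hS
  have hvol := volume_annulus_inter_ball_le hδ hδ8 hw hr x b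
  have h1 : annAvg osc δ w f x = ∫ y in S, δ⁻¹ * osc ((‖x - y‖ ^ 2 - w) / δ) * f y := by
    rw [setIntegral_eq_integral_of_forall_compl_eq_zero]
    · rfl
    · intro y hy
      by_contra hne
      have h2 := mul_ne_zero_iff.1 hne
      have h3 := osc_arg_bound hk hδ (mul_ne_zero_iff.1 h2.1).2
      exact hy ⟨h3, hsupp y h3 h2.2⟩
  rw [h1, ← Real.norm_eq_abs]
  refine (norm_setIntegral_le_of_norm_le_const (C := δ⁻¹ * M * B)
    (hvol.trans_lt ENNReal.ofReal_lt_top) fun y _ => ?_).trans ?_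
  · rw [Real.norm_eq_abs, abs_mul, abs_mul, abs_of_pos (inv_pos.2 hδ)]
    have := (hk.bd ((‖x - y‖ ^ 2 - w) / δ)).1
    have h2 := hf y
    gcongr
  · have h2 : volume.real S ≤ 102 * Real.pi * r * δ :=
      ENNReal.toReal_le_of_le_ofReal (by positivity) hvol
    calc δ⁻¹ * M * B * volume.real S ≤ δ⁻¹ * M * B * (102 * Real.pi * r * δ) := by gcongr
      _ = _ := by field_simp

/-- Annular averages are bounded by the supremum of the function. -/
lemma exists_abs_annAvg_sup_bound : ∃ C : ℝ, 0 < C ∧ ∀ δ w B : ℝ, 0 < δ → δ ≤ 1 / 8 →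
    w ∈ Set.Icc (1 : ℝ) 4 → ∀ (f : ℂ → ℝ) (x : ℂ), (∀ y, |f y| ≤ B) →
    |annAvg osc δ w f x| ≤ C * B := by
  obtain ⟨C, hC, h⟩ := exists_abs_annAvg_ball_bound
  refine ⟨C * (17 / 8), by positivity, fun δ w B hδ hδ8 hw f x hf => ?_⟩
  refine h δ w (17 / 8) B hδ hδ8 hw (by norm_num) f x x hf fun y hy _ => ?_
  rw [norm_sub_rev]
  exact (annulus_bound hδ8 hw (norm_nonneg _) hy).2

/-! ### Grids and measurable selection -/

/-- The index of the square of side `s` containing `z`. -/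
def cell (s : ℝ) (z : ℂ) : ℤ × ℤ := (⌊z.re / s⌋, ⌊z.im / s⌋)

/-- The lower left corner of a square of side `s`. -/
def corner (s : ℝ) (n : ℤ × ℤ) : ℂ := ⟨s * n.1, s * n.2⟩

lemma measurable_cell (s : ℝ) : Measurable (cell s) := by
  refine Measurable.prodMk ?_ ?_
  · exact Int.measurable_floor.comp (Complex.measurable_re.div_const s)
  · exact Int.measurable_floor.comp (Complex.measurable_im.div_const s)

lemma measurableSet_cell_mem (s : ℝ) (H : Set (ℤ × ℤ)) : MeasurableSet {z | cell s z ∈ H} :=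
  measurable_cell s (Set.to_countable H).measurableSet

lemma norm_sub_corner_le {s : ℝ} (hs : 0 < s) (z : ℂ) : ‖z - corner s (cell s z)‖ ≤ 2 * s := by
  have key : ∀ t : ℝ, |t - s * ⌊t / s⌋| ≤ s := fun t => by
    have h1 := Int.floor_le (t / s)
    have h2 := (Int.lt_floor_add_one (t / s)).le
    rw [le_div_iff₀ hs] at h1
    rw [div_le_iff₀ hs] at h2
    rw [abs_le]; constructor <;> linarith
  refine (Complex.norm_le_abs_re_add_abs_im _).trans ?_
  have h1 := key z.re
  have h2 := key z.im
  simp only [corner, cell, Complex.sub_re, Complex.sub_im]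
  linarith

lemma le_norm_sub_of_cell_ne {s : ℝ} (hs : 0 < s) {z z' : ℂ} (h : cell s z ≠ cell s z')
    (h1 : (cell s z).1 % 2 = (cell s z').1 % 2) (h2 : (cell s z).2 % 2 = (cell s z').2 % 2) :
    s ≤ ‖z - z'‖ := by
  have key : ∀ t t' : ℝ, ⌊t / s⌋ ≠ ⌊t' / s⌋ → ⌊t / s⌋ % 2 = ⌊t' / s⌋ % 2 → s ≤ |t - t'| := by
    intro t t' hne hmod
    wlog hlt : ⌊t / s⌋ < ⌊t' / s⌋ generalizing t t'
    · rw [abs_sub_comm]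
      exact this t' t hne.symm hmod.symm (lt_of_le_of_ne (not_lt.1 hlt) hne.symm)
    have h3 : ⌊t / s⌋ + 2 ≤ ⌊t' / s⌋ := by omega
    have h4 : (⌊t / s⌋ : ℝ) + 2 ≤ ⌊t' / s⌋ := by exact_mod_cast h3
    have h5 := Int.floor_le (t' / s)
    have h6 := (Int.lt_floor_add_one (t / s)).le
    have h7 : t / s + 1 ≤ t' / s := by linarith
    rw [div_add_one hs.ne', div_le_div_iff_of_pos_right hs] at h7
    rw [abs_sub_comm]
    exact (by linarith : s ≤ t' - t).trans (le_abs_self _)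
  by_cases hre : (cell s z).1 = (cell s z').1
  · have him : (cell s z).2 ≠ (cell s z').2 := fun him => h (Prod.ext hre him)
    exact (key z.im z'.im him h2).trans (by simpa using Complex.abs_im_le_norm (z - z'))
  · exact (key z.re z'.re hre h1).trans (by simpa using Complex.abs_re_le_norm (z - z'))

/-- The squares of side `s` meeting the ball of radius `r` about `a`. -/
def cells (s r : ℝ) (a : ℂ) : Finset (ℤ × ℤ) :=
  Finset.Icc ⌊(a.re - r) / s⌋ ⌊(a.re + r) / s⌋ ×ˢ Finset.Icc ⌊(a.im - r) / s⌋ ⌊(a.im + r) / s⌋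

lemma cell_mem_cells {s r : ℝ} (hs : 0 < s) {a z : ℂ} (h : ‖z - a‖ ≤ r) : cell s z ∈ cells s r a := by
  have h1 := abs_le.1 ((Complex.abs_re_le_norm (z - a)).trans h)
  have h2 := abs_le.1 ((Complex.abs_im_le_norm (z - a)).trans h)
  rw [Complex.sub_re] at h1
  rw [Complex.sub_im] at h2
  simp only [cells, cell, Finset.mem_product, Finset.mem_Icc]
  refine ⟨⟨?_, ?_⟩, ?_, ?_⟩ <;> exact Int.floor_le_floor (by gcongr; linarith)

lemma card_cells_le {s r : ℝ} (hs : 0 < s) (hr : 0 ≤ r) (a : ℂ) :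
    ((cells s r a).card : ℝ) ≤ (2 * r / s + 2) ^ 2 := by
  have key : ∀ t : ℝ, ((Finset.Icc ⌊(t - r) / s⌋ ⌊(t + r) / s⌋).card : ℝ) ≤ 2 * r / s + 2 := by
    intro t
    have h1 : ⌊(t - r) / s⌋ ≤ ⌊(t + r) / s⌋ := Int.floor_le_floor (by gcongr; linarith)
    rw [Int.card_Icc]
    have h2 : ((⌊(t + r) / s⌋ + 1 - ⌊(t - r) / s⌋).toNat : ℤ) =
      ⌊(t + r) / s⌋ + 1 - ⌊(t - r) / s⌋ := Int.toNat_of_nonneg (by omega)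
    have h3 : ((⌊(t + r) / s⌋ + 1 - ⌊(t - r) / s⌋).toNat : ℝ) =
      (⌊(t + r) / s⌋ : ℝ) + 1 - ⌊(t - r) / s⌋ := by exact_mod_cast h2
    rw [h3]
    have h4 := Int.floor_le ((t + r) / s)
    have h5 := (Int.lt_floor_add_one ((t - r) / s)).le
    have h6 : (t + r) / s - (t - r) / s = 2 * r / s := by ring
    linarith
  rw [cells, Finset.card_product, Nat.cast_mul, sq]
  exact mul_le_mul (key _) (key _) (Nat.cast_nonneg _) (by positivity)

lemma exists_measurable_selection {f : ℂ → ℝ} (hf : IsNice f) (δ μ : ℝ) :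
    ∃ w : ℂ → ℝ, Measurable w ∧ (∀ x, w x ∈ Set.Icc (1 : ℝ) 4) ∧
      ∀ x, ENNReal.ofReal μ < maxAvg δ f x → μ < |annAvg osc δ (w x) f x| := by
  classical
  have : Nonempty (Set.Icc (1 : ℝ) 4) := ⟨⟨1, by norm_num⟩⟩
  set u : ℕ → Set.Icc (1 : ℝ) 4 := TopologicalSpace.denseSeq _ with hu
  have hc := continuous_annAvg_osc hf δ
  set E : Set ℂ := {x | ∃ n, μ < |annAvg osc δ (u n) f x|} with hE
  have hm : ∀ n, MeasurableSet {x | μ < |annAvg osc δ (u n) f x|} := fun n =>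
    measurableSet_lt measurable_const
      (hc.comp (continuous_id.prodMk continuous_const)).abs.measurable
  have hEm : MeasurableSet E := by
    rw [hE, Set.ofPred_exists]
    exact MeasurableSet.iUnion hm
  have hex : ∀ x, ∃ n, μ < |annAvg osc δ (u n) f x| ∨ x ∉ E := fun x => by
    by_cases hx : x ∈ E
    · obtain ⟨n, hn⟩ := hx
      exact ⟨n, Or.inl hn⟩
    · exact ⟨0, Or.inr hx⟩
  refine ⟨fun x => (u (Nat.find (hex x)) : ℝ), ?_, fun x => (u _).2, fun x hx => ?_⟩
  · exact Measurable.find (f := fun n _ => (u n : ℝ))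
      (p := fun n x => μ < |annAvg osc δ (u n) f x| ∨ x ∉ E) (fun n => measurable_const)
      (fun n => (hm n).union hEm.compl) hex
  · have hxE : x ∈ E := by
      obtain ⟨w, hw⟩ := lt_iSup_iff.1 hx
      obtain ⟨hwI, hw⟩ := lt_iSup_iff.1 hw
      have h1 : μ < |annAvg osc δ w f x| := by
        by_contra hcon
        exact not_lt.2 (ENNReal.ofReal_le_ofReal (not_lt.1 hcon)) hw
      have ho : IsOpen {v : Set.Icc (1 : ℝ) 4 | μ < |annAvg osc δ v f x|} :=
        isOpen_lt continuous_const
          (hc.comp (continuous_const.prodMk continuous_subtype_val)).abs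
      obtain ⟨n, hn⟩ := (TopologicalSpace.denseRange_denseSeq (Set.Icc (1 : ℝ) 4)).exists_mem_open ho
        ⟨⟨w, hwI⟩, h1⟩
      exact ⟨n, hn⟩
    exact (Nat.find_spec (hex x)).resolve_right (not_not.2 hxE)

/-! ### Large averages come from three separated squares -/

lemma integrable_annAvg_kernel {f : ℂ → ℝ} (hf : IsNice f) (δ w : ℝ) (x : ℂ) :
    Integrable fun y => δ⁻¹ * osc ((‖x - y‖ ^ 2 - w) / δ) * f y := by
  obtain ⟨M, hM, hk, -⟩ := exists_osc_bound
  have hm : Measurable fun y : ℂ => δ⁻¹ * osc ((‖x - y‖ ^ 2 - w) / δ) := by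
    have := hk.cont
    fun_prop
  refine (hf.mul hm (M := |δ⁻¹| * M) fun y => ?_).integrable
  rw [abs_mul]
  exact mul_le_mul_of_nonneg_left (hk.bd _).1 (abs_nonneg _)

lemma annAvg_add {f g : ℂ → ℝ} (hf : IsNice f) (hg : IsNice g) (δ w : ℝ) (x : ℂ) :
    annAvg osc δ w (fun y => f y + g y) x = annAvg osc δ w f x + annAvg osc δ w g x := by
  unfold annAvg
  rw [← integral_add (integrable_annAvg_kernel hf δ w x) (integrable_annAvg_kernel hg δ w x)]
  simp only [mul_add]

lemma annAvg_zero (δ w : ℝ) (x : ℂ) : annAvg osc δ w (fun _ => 0) x = 0 := by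
  simp [annAvg]

lemma annAvg_indicator_union {f : ℂ → ℝ} (hf : IsNice f) {A B : Set ℂ} (hA : MeasurableSet A)
    (hB : MeasurableSet B) (h : Disjoint A B) (δ w : ℝ) (x : ℂ) :
    annAvg osc δ w ((A ∪ B).indicator f) x =
      annAvg osc δ w (A.indicator f) x + annAvg osc δ w (B.indicator f) x := by
  rw [Set.indicator_union_of_disjoint h, annAvg_add (hf.indicator hA) (hf.indicator hB)]

lemma annAvg_indicator_cells {f : ℂ → ℝ} (hf : IsNice f) (s : ℝ) (J : Finset (ℤ × ℤ)) (δ w : ℝ)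
    (x : ℂ) : annAvg osc δ w ({y | cell s y ∈ (J : Set (ℤ × ℤ))}.indicator f) x =
      ∑ n ∈ J, annAvg osc δ w ({y | cell s y = n}.indicator f) x := by
  classical
  induction J using Finset.induction_on with
  | empty => simpa using annAvg_zero δ w x
  | insert n J hn ih =>
    rw [Finset.sum_insert hn, ← ih, ← annAvg_indicator_union hf]
    · congr 2
      ext y; simp
    · exact measurableSet_cell_mem s {n}
    · exact measurableSet_cell_mem s J
    · rw [Set.disjoint_left]
      intro y hy hy'
      rw [Set.mem_ofPred_eq] at hy hy'
      rw [hy] at hy'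
      exact hn (by simpa using hy')

lemma exists_three_separated_or_cover {ι : Type*} (H : Finset ι) (p : ι → ℂ) {κ : ℝ} :
    (∃ n : Fin 3 → ι, (∀ l, n l ∈ H) ∧ ∀ i j, i ≠ j → κ ≤ ‖p (n i) - p (n j)‖) ∨
      ∃ b₁ b₂ : ℂ, ∀ n ∈ H, ‖p n - b₁‖ < κ ∨ ‖p n - b₂‖ < κ := by
  by_contra! h
  obtain ⟨h1, h2⟩ := h
  obtain ⟨n₁, hn₁, -⟩ := h2 0 0
  obtain ⟨n₂, hn₂, h21, -⟩ := h2 (p n₁) (p n₁)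
  obtain ⟨n₃, hn₃, h31, h32⟩ := h2 (p n₁) (p n₂)
  obtain ⟨i, j, hij, hlt⟩ := h1 ![n₁, n₂, n₃] (by
    intro l; fin_cases l <;> simp [hn₁, hn₂, hn₃])
  fin_cases i <;> fin_cases j <;> simp at hij hlt <;>
    first
    | linarith
    | (rw [norm_sub_rev] at hlt; linarith)

lemma exists_three_heavy : ∃ C : ℝ, 0 < C ∧ ∀ (δ w s r μ κ η : ℝ) (a : ℂ) (f : ℂ → ℝ) (x : ℂ),
    0 < δ → δ ≤ 1 / 8 → w ∈ Set.Icc (1 : ℝ) 4 → 0 < s → 0 < μ → 0 < κ → IsNice f → (∀ y, |f y| ≤ 1) →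
    (∀ y, f y ≠ 0 → ‖y - a‖ ≤ r) → (cells s r a).card * η ≤ μ / 4 → 0 ≤ η →
    C * (κ + 2 * s) ≤ μ / 4 → μ < |annAvg osc δ w f x| →
    ∃ n : Fin 3 → ℤ × ℤ, (∀ l, n l ∈ cells s r a) ∧
      (∀ i j, i ≠ j → κ ≤ ‖corner s (n i) - corner s (n j)‖) ∧
      ∀ l, η ≤ |annAvg osc δ w ({y | cell s y = n l}.indicator f) x| := by
  classical
  obtain ⟨C, hC, hball⟩ := exists_abs_annAvg_ball_bound
  refine ⟨C, hC, ?_⟩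
  intro δ w s r μ κ η a f x hδ hδ8 hw hs hμ hκ hf hf1 hfa hcard hη hCμ hbig
  set I := cells s r a
  set F : ℤ × ℤ → ℝ := fun n => annAvg osc δ w ({y | cell s y = n}.indicator f) x with hF
  set H := I.filter fun n => η ≤ |F n| with hH
  rcases exists_three_separated_or_cover H (corner s) (κ := κ) with ⟨n, hn, hsep⟩ | ⟨b₁, b₂, hcov⟩
  · exact ⟨n, fun l => (Finset.mem_filter.1 (hn l)).1, hsep, fun l => (Finset.mem_filter.1 (hn l)).2⟩
  exfalso
  set H₁ := H.filter fun n => ‖corner s n - b₁‖ < κ with hH₁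
  set H₂ := H.filter fun n => ¬ ‖corner s n - b₁‖ < κ with hH₂
  have hone : ∀ y, ∀ A : Set ℂ, |A.indicator f y| ≤ 1 := fun y A => by
    by_cases hy : y ∈ A
    · simpa [hy] using hf1 y
    · simp [hy]
  have hsmall : ∀ (J : Finset (ℤ × ℤ)) (b : ℂ), (∀ n ∈ J, ‖corner s n - b‖ < κ) →
      |annAvg osc δ w ({y | cell s y ∈ (J : Set (ℤ × ℤ))}.indicator f) x| ≤ μ / 4 := by
    intro J b hJ
    refine (hball δ w (κ + 2 * s) 1 hδ hδ8 hw (by positivity) _ x b (fun y => hone y _)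
      fun y _ hy => ?_).trans (by rw [mul_one]; exact hCμ)
    have hyJ := Set.mem_of_indicator_ne_zero hy
    have h1 := hJ _ hyJ
    have h2 := norm_sub_corner_le hs y
    have h3 := norm_add_le (y - corner s (cell s y)) (corner s (cell s y) - b)
    rw [sub_add_sub_cancel] at h3
    linarith
  have h1 := hsmall H₁ b₁ fun n hn => (Finset.mem_filter.1 hn).2
  have h2 := hsmall H₂ b₂ fun n hn => by
    obtain ⟨h3, h4⟩ := Finset.mem_filter.1 hn
    exact (hcov n h3).resolve_left h4
  have h3 : annAvg osc δ w f x = ∑ n ∈ I, F n := by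
    rw [hF, ← annAvg_indicator_cells hf]
    congr 1
    ext y
    by_cases hy : f y = 0
    · rw [Set.indicator_apply, hy, ite_self]
    · rw [Set.indicator_of_mem]
      exact cell_mem_cells hs (hfa y hy)
  rw [annAvg_indicator_cells hf] at h1 h2
  rw [h3, ← Finset.sum_filter_add_sum_filter_not I (fun n => η ≤ |F n|)] at hbig
  change μ < |∑ n ∈ H, F n + _| at hbig
  rw [← Finset.sum_filter_add_sum_filter_not H (fun n => ‖corner s n - b₁‖ < κ)] at hbig
  have h4 : |∑ n ∈ I with ¬ η ≤ |F n|, F n| ≤ μ / 4 := by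
    refine (Finset.abs_sum_le_sum_abs _ _).trans ((Finset.sum_le_card_nsmul _ _ η fun n hn => ?_).trans ?_)
    · exact (not_le.1 (Finset.mem_filter.1 hn).2).le
    · rw [nsmul_eq_mul]
      refine le_trans ?_ hcard
      gcongr
      exact Finset.filter_subset _ _
  have h5 := abs_add_le (∑ n ∈ H₁, F n + ∑ n ∈ H₂, F n) (∑ n ∈ I with ¬ η ≤ |F n|, F n)
  have h6 := abs_add_le (∑ n ∈ H₁, F n) (∑ n ∈ H₂, F n)
  linarith

/-! ### The contribution of one separated triple of squares -/

lemma le_norm_sub_unit {u v : ℂ} {t ρ κ : ℝ} (hu : |‖u‖ - t| ≤ 2 * ρ) (hv : |‖v‖ - t| ≤ 2 * ρ)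
    (hκ : κ ≤ ‖u - v‖) (hρ : 8 * ρ ≤ κ) (hu3 : ‖u‖ ≤ 3) (hu0 : u ≠ 0) (hv0 : v ≠ 0) :
    κ / 6 ≤ ‖u / ‖u‖ - v / ‖v‖‖ := by
  have hu' : (‖u‖ : ℂ) ≠ 0 := by exact_mod_cast norm_ne_zero_iff.2 hu0
  have hv' : (‖v‖ : ℂ) ≠ 0 := by exact_mod_cast norm_ne_zero_iff.2 hv0
  have h1 : u - v = ‖u‖ * (u / ‖u‖ - v / ‖v‖) + ((‖u‖ - ‖v‖ : ℝ) : ℂ) * (v / ‖v‖) := by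
    push_cast
    field_simp
    ring
  have h2 : ‖v / (‖v‖ : ℂ)‖ = 1 := by
    rw [norm_div, Complex.norm_of_nonneg (norm_nonneg v), div_self (norm_ne_zero_iff.2 hv0)]
  have h3 : |‖u‖ - ‖v‖| ≤ 4 * ρ := by
    have := abs_sub_le ‖u‖ t ‖v‖
    rw [abs_sub_comm t] at this
    linarith
  have h4 : ‖u - v‖ ≤ ‖u‖ * ‖u / ‖u‖ - v / ‖v‖‖ + |‖u‖ - ‖v‖| := by
    conv_lhs => rw [h1]
    refine (norm_add_le _ _).trans_eq ?_
    rw [norm_mul, norm_mul, h2, Complex.norm_of_nonneg (norm_nonneg u), Complex.norm_real,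
      Real.norm_eq_abs, mul_one]
  have h5 : ‖u‖ * ‖u / ‖u‖ - v / ‖v‖‖ ≤ 3 * ‖u / ‖u‖ - v / ‖v‖‖ := by gcongr
  linarith

lemma abs_sub_sqrt_le {δ w d : ℝ} (hw : 1 ≤ w) (hd : 0 ≤ d) (h : |d ^ 2 - w| ≤ 2 * δ) :
    |d - √w| ≤ 2 * δ := by
  have h3 : 1 ≤ √w := Real.one_le_sqrt.2 hw
  have h4 : d ^ 2 - w = (d - √w) * (d + √w) := by
    have := Real.sq_sqrt (by linarith : 0 ≤ w)
    linear_combination this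
  have h5 : |d - √w| * 1 ≤ |d - √w| * (d + √w) := by gcongr; linarith
  rw [h4, abs_mul, abs_of_pos (by linarith : 0 < d + √w)] at h
  linarith

lemma exists_triple_bound : ∃ C : ℝ, 0 < C ∧ ∀ ν ρ e κ Φ η : ℝ, 0 < ν → ν ≤ 1 / 8 →
    0 < ρ → ρ ≤ 1 / 8 → 0 < e → 16 * e ^ 2 ≤ 1 → 0 < κ → κ ≤ 6 → 576 * ρ ≤ (κ / 6) ^ 3 →
    6 * ν ≤ ρ * e ^ 2 → 8 * ρ ≤ κ → 2 * ν ^ 10 ≤ ρ → 0 < Φ → 0 < η →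
    ∀ (a : ℂ) (w : ℂ → ℝ) (f : ℂ → ℝ) (n : Fin 3 → ℤ × ℤ) (j : ℤ × ℤ), Measurable w →
    (∀ x, w x ∈ Set.Icc (1 : ℝ) 4) → IsNice f → ∫ y, f y ^ 2 ≤ Φ →
    (∀ i l, i ≠ l → κ ≤ ‖corner (ρ / 2) (n i) - corner (ρ / 2) (n l)‖) →
    ∀ E : Set ℂ, E = {x | ‖x - a‖ ≤ ρ ∧
      (∀ l, η ≤ |annAvg osc (ν ^ 10) (w x) ({y | cell (ρ / 2) y = n l}.indicator f) x|) ∧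
      (cell (e ^ 2) x).1 % 2 = j.1 ∧ (cell (e ^ 2) x).2 % 2 = j.2} →
    MeasurableSet E ∧
    (ENNReal.ofReal (η ^ 2 / Φ) * volume E ≤ 8 * ENNReal.ofReal (C * (2 * e)) ∨
      ENNReal.ofReal (η ^ 2 / Φ) ^ 3 * volume E ≤
        2048 * ENNReal.ofReal (C * ν / (e ^ 11 * ρ ^ 4 * (κ / 6) ^ 6))) := by
  obtain ⟨C, hC, htr⟩ := exists_transversal_bound
  obtain ⟨M, hM, hk, -⟩ := exists_osc_bound
  refine ⟨C, hC, ?_⟩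
  intro ν ρ e κ Φ η hν hν8 hρ hρ8 he he16 hκ hκ6 hρκ hνρ hρκ' hνρ' hΦ hη a w f n j hw hwI hf hfΦ
    hsep E hE
  set q : Fin 3 → ℂ := fun l => corner (ρ / 2) (n l) with hq
  set g : Fin 3 → ℂ → ℝ := fun l => {y | cell (ρ / 2) y = n l}.indicator f with hg
  have hcm : ∀ s n, MeasurableSet {y | cell s y = n} := fun s n => measurableSet_cell_mem s {n}
  have hgn : ∀ l, IsNice (g l) := fun l => hf.indicator (hcm _ _)
  have hEm : MeasurableSet E := by
    have h1 : ∀ l, MeasurableSet {x | η ≤ |annAvg osc (ν ^ 10) (w x) (g l) x|} := fun l =>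
      measurableSet_le measurable_const ((continuous_annAvg_osc (hgn l) _).measurable.comp
        (f := fun x => (x, w x)) (measurable_id.prodMk hw)).abs
    have h2 : E = {x | ‖x - a‖ ≤ ρ} ∩ ((⋂ l, {x | η ≤ |annAvg osc (ν ^ 10) (w x) (g l) x|}) ∩
        {x | cell (e ^ 2) x ∈ {i : ℤ × ℤ | i.1 % 2 = j.1 ∧ i.2 % 2 = j.2}}) := by
      rw [hE, hg]
      ext x
      simp only [Set.mem_inter_iff, Set.mem_iInter, Set.mem_ofPred_eq]
    rw [h2]
    exact (measurableSet_norm_sub_le a ρ).inter ((MeasurableSet.iInter h1).inter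
      (measurableSet_cell_mem _ _))
  refine ⟨hEm, ?_⟩
  rcases E.eq_empty_or_nonempty with h0 | ⟨x₀, hx₀⟩
  · left; rw [h0]; simp
  have hE' : ∀ x ∈ E, ‖x - a‖ ≤ ρ ∧ (∀ l, η ≤ |annAvg osc (ν ^ 10) (w x) (g l) x|) ∧
      (cell (e ^ 2) x).1 % 2 = j.1 ∧ (cell (e ^ 2) x).2 % 2 = j.2 := fun x hx => by
    rw [hE] at hx; exact hx
  clear_value q g
  have hδ : 0 < ν ^ 10 := by positivity
  have hgq : ∀ l y, g l y ≠ 0 → ‖y - q l‖ ≤ ρ := fun l y hy => by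
    rw [hg] at hy
    have hy' : y ∈ {y | cell (ρ / 2) y = n l} := Set.mem_of_indicator_ne_zero hy
    have h1 : cell (ρ / 2) y = n l := hy'
    have h2 := norm_sub_corner_le (half_pos hρ) y
    rw [h1] at h2
    rw [hq]; linarith
  have hdist : ∀ l, |‖q l - x₀‖ - √(w x₀)| ≤ 2 * ρ := by
    intro l
    obtain ⟨y, hy, hy0⟩ : ∃ y, |‖x₀ - y‖ ^ 2 - w x₀| ≤ 2 * ν ^ 10 ∧ g l y ≠ 0 := by
      by_contra! hcon
      have h1 := (hE' x₀ hx₀).2.1 l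
      rw [annAvg_congr hk hδ hcon, annAvg_zero, abs_zero] at h1
      linarith
    have h1 := abs_sub_sqrt_le (hwI x₀).1 (norm_nonneg _) hy
    have h2 := hgq l y hy0
    have h3 : |‖q l - x₀‖ - ‖x₀ - y‖| ≤ ‖y - q l‖ := by
      rw [norm_sub_rev x₀ y, norm_sub_rev y (q l)]
      refine (abs_norm_sub_norm_le _ _).trans_eq ?_
      congr 1; ring
    have h4 := abs_sub_le ‖q l - x₀‖ ‖x₀ - y‖ √(w x₀)
    linarith
  have hw1 : 1 ≤ √(w x₀) := Real.one_le_sqrt.2 (hwI x₀).1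
  have hw2 : √(w x₀) ≤ 2 := by
    rw [Real.sqrt_le_left (by norm_num)]; linarith [(hwI x₀).2]
  have hlow : ∀ l, 3 / 4 ≤ ‖q l - x₀‖ ∧ ‖q l - x₀‖ ≤ 3 := fun l => by
    have := abs_le.1 (hdist l)
    constructor <;> linarith
  have hne : ∀ l, q l - x₀ ≠ 0 := fun l => norm_pos_iff.1 (by linarith [(hlow l).1])
  have hsq : √(4 * e ^ 2) = 2 * e := by
    rw [show 4 * e ^ 2 = (2 * e) ^ 2 by ring, Real.sqrt_sq (by positivity)]
  rw [← hsq]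
  refine htr ν ρ e (κ / 6) (4 * e ^ 2) Φ η hν hν8 hρ hρ8 he (by nlinarith) (by positivity) (by linarith)
    hρκ hνρ (by positivity) (by linarith) hΦ hη
    ((cells (e ^ 2) ρ a).filter fun i => i.1 % 2 = j.1 ∧ i.2 % 2 = j.2)
    (corner (e ^ 2)) (fun i => {x | cell (e ^ 2) x = i}) x₀ q (fun l => (q l - x₀) / ‖q l - x₀‖) w g E
    hw hwI ?_ ?_ (fun l => by linarith [(hlow l).2]) ?_ (fun i _ => hcm _ _) ?_ ?_ ?_ hgn hgq ?_ hEm ?_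
    ?_ (fun l x hx => (hE' x hx).2.1 l)
  · intro l
    rw [norm_div, Complex.norm_of_nonneg (norm_nonneg _), div_self (norm_ne_zero_iff.2 (hne l))]
  · intro l
    rw [mul_div_cancel₀]
    exact_mod_cast norm_ne_zero_iff.2 (hne l)
  · intro i l hil
    refine le_norm_sub_unit (hdist i) (hdist l) ?_ hρκ' (hlow i).2 (hne i) (hne l)
    rw [sub_sub_sub_cancel_right, hq]
    exact hsep i l hil
  · intro i _ l _ hil
    refine Set.disjoint_left.2 fun x hx hx' => hil ?_
    rw [← (show cell (e ^ 2) x = i from hx), ← (show cell (e ^ 2) x = l from hx')]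
  · intro i _ x hx
    have h1 := norm_sub_corner_le (by positivity : 0 < e ^ 2) x
    rw [show cell (e ^ 2) x = i from hx] at h1
    linarith
  · intro i hi l hl hil x hx x' hx'
    obtain ⟨-, hi1, hi2⟩ := Finset.mem_filter.1 hi
    obtain ⟨-, hl1, hl2⟩ := Finset.mem_filter.1 hl
    have h1 : cell (e ^ 2) x = i := hx
    have h2 : cell (e ^ 2) x' = l := hx'
    rw [norm_sub_rev]
    refine le_norm_sub_of_cell_ne (by positivity) ?_ ?_ ?_
    · rw [h1, h2]; exact hil
    · rw [h1, h2, hi1, hl1]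
    · rw [h1, h2, hi2, hl2]
  · intro l
    refine le_trans ?_ hfΦ
    obtain ⟨B, hB⟩ := hf.bdd
    have hi : ∀ h : ℂ → ℝ, IsNice h → Integrable fun y => h y ^ 2 := fun h hh => by
      obtain ⟨B, hB⟩ := hh.bdd
      exact (hh.mul hh.meas hB).integrable.congr (Filter.Eventually.of_forall fun y => by simp only; ring)
    refine integral_mono (hi _ (hgn l)) (hi _ hf) fun y => ?_
    rw [hg]
    simp only
    by_cases hy : y ∈ {y | cell (ρ / 2) y = n l}
    · rw [Set.indicator_of_mem hy]
    · rw [Set.indicator_of_notMem hy]; nlinarith [sq_nonneg (f y)]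
  · intro x hx
    obtain ⟨h1, -, h3⟩ := hE' x hx
    simp only [Set.mem_iUnion]
    exact ⟨cell (e ^ 2) x, Finset.mem_filter.2 ⟨cell_mem_cells (by positivity) h1, h3⟩, rfl⟩
  · intro x hx
    have h1 := (hE' x hx).1
    have h2 := (hE' x₀ hx₀).1
    have h3 := norm_sub_le (x - a) (x₀ - a)
    rw [sub_sub_sub_cancel_right] at h3
    linarith

/-! ### The restricted estimate at a fixed scale -/

lemma measure_le_of_alternative {V : ℝ≥0∞} {A a b β : ℝ} (hA : 0 < A)
    (h : ENNReal.ofReal A * V ≤ 8 * ENNReal.ofReal a ∨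
      ENNReal.ofReal A ^ 3 * V ≤ 2048 * ENNReal.ofReal b)
    (ha : 8 * a ≤ A * β) (hb : 2048 * b ≤ A ^ 3 * β) : V ≤ ENNReal.ofReal β := by
  have key : ∀ D c : ℝ, 0 < D → ENNReal.ofReal D * V ≤ ENNReal.ofReal c → c ≤ D * β →
      V ≤ ENNReal.ofReal β := by
    intro D c hD h1 h2
    have h3 : ENNReal.ofReal D * V ≤ ENNReal.ofReal D * ENNReal.ofReal β := by
      rw [← ENNReal.ofReal_mul hD.le]
      exact h1.trans (ENNReal.ofReal_le_ofReal h2)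
    exact (ENNReal.mul_le_mul_iff_right (by simpa using hD) ENNReal.ofReal_ne_top).1 h3
  rcases h with h | h
  · refine key A (8 * a) hA ?_ ha
    rwa [ENNReal.ofReal_mul (by norm_num), show ENNReal.ofReal 8 = 8 by norm_num]
  · refine key (A ^ 3) (2048 * b) (by positivity) ?_ hb
    rwa [ENNReal.ofReal_mul (by norm_num), show ENNReal.ofReal 2048 = 2048 by norm_num,
      ENNReal.ofReal_pow hA.le]

lemma annAvg_ball_indicator {δ : ℝ} (hδ : 0 < δ) (hδ8 : δ ≤ 1 / 8) {w : ℝ}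
    (hw : w ∈ Set.Icc (1 : ℝ) 4) (f : ℂ → ℝ) {a x : ℂ} {r : ℝ} (h : ‖x - a‖ + 17 / 8 ≤ r) :
    annAvg osc δ w ({y | ‖y - a‖ ≤ r}.indicator f) x = annAvg osc δ w f x := by
  obtain ⟨M, hM, hk, -⟩ := exists_osc_bound
  refine annAvg_congr hk hδ fun y hy => ?_
  rw [Set.indicator_of_mem]
  have h1 := (annulus_bound hδ8 hw (norm_nonneg _) hy).2
  have h2 := norm_sub_le (x - a) (x - y)
  rw [sub_sub_sub_cancel_left] at h2
  rw [Set.mem_ofPred_eq]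
  linarith

lemma exists_local_level_bound : ∃ C N : ℝ, 0 < C ∧ 1 ≤ N ∧ ∀ μ : ℝ, 0 < μ → N * μ ≤ 1 →
    ∀ f : ℂ → ℝ, IsNice f → (∀ y, |f y| ≤ 1) → ∀ a : ℂ,
    volume ({x | ENNReal.ofReal μ < maxAvg (μ ^ 9000) f x} ∩ {x | ‖x - a‖ ≤ μ ^ 5}) ≤
      ENNReal.ofReal (C * μ ^ 12 * ∫ y in {y | ‖y - a‖ ≤ 5}, f y ^ 2) := by
  classical
  obtain ⟨C₁, hC₁, hheavy⟩ := exists_three_heavy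
  obtain ⟨C₂, hC₂, htriple⟩ := exists_triple_bound
  set D := max C₁ 1 with hD
  have hD1 : 1 ≤ D := le_max_right _ _
  have hDC : C₁ ≤ D := le_max_left _ _
  set C₃ := 16 * C₂ + 2048 * C₂ * (48 * D) ^ 6 * 10 ^ 4 with hC₃
  have hC₃0 : 0 < C₃ := by positivity
  refine ⟨4 * 484 ^ 3 * C₃, 576 * (48 * D) ^ 3 + 1936, by positivity, ?_, ?_⟩
  · have : 0 < (48 * D) ^ 3 := by positivity
    linarith
  intro μ hμ hNμ f hf hf1 a
  have hD3 : D ≤ (48 * D) ^ 3 := by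
    calc D ≤ D ^ 3 := le_self_pow₀ hD1 (by norm_num)
      _ ≤ (48 * D) ^ 3 := by gcongr; linarith
  have hDμ : 576 * (48 * D) ^ 3 * μ ≤ 1 := by nlinarith
  have hDμ' : 576 * (D * μ) ≤ 1 := by
    have : D * μ ≤ (48 * D) ^ 3 * μ := by gcongr
    linarith
  have hμ' : 1936 * μ ≤ 1 := by
    have : 0 ≤ 576 * (48 * D) ^ 3 * μ := by positivity
    linarith
  have hμ1 : μ ≤ 1 := by linarith
  have hpow : ∀ k : ℕ, k ≠ 0 → μ ^ k ≤ μ := fun k hk => pow_le_of_le_one hμ.le hμ1 hk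
  set ρ := μ ^ 5 with hρ
  have hρ0 : 0 < ρ := by positivity
  have hρμ : ρ ≤ μ := hpow 5 (by norm_num)
  set κ := μ / (8 * D) with hκ
  have hκ0 : 0 < κ := by positivity
  have hν : (μ ^ 900) ^ 10 = μ ^ 9000 := by rw [← pow_mul]
  set δ := μ ^ 9000 with hδ
  have hδ0 : 0 < δ := by positivity
  have hδμ : δ ≤ μ := hpow 9000 (by norm_num)
  have hδ8 : δ ≤ 1 / 8 := by linarith
  have hBm := measurableSet_norm_sub_le a 5
  set F := {y : ℂ | ‖y - a‖ ≤ 5}.indicator f with hF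
  have hFn : IsNice F := hf.indicator hBm
  have hF1 : ∀ y, |F y| ≤ 1 := fun y => by
    by_cases hy : y ∈ {y : ℂ | ‖y - a‖ ≤ 5}
    · rw [hF, Set.indicator_of_mem hy]; exact hf1 y
    · rw [hF, Set.indicator_of_notMem hy]; simp
  have hFΦ : ∫ y, F y ^ 2 = ∫ y in {y | ‖y - a‖ ≤ 5}, f y ^ 2 := by
    rw [← integral_indicator hBm]
    refine integral_congr_ae (Filter.Eventually.of_forall fun y => ?_)
    by_cases hy : y ∈ {y : ℂ | ‖y - a‖ ≤ 5} <;> simp only [hF, Set.indicator_of_mem,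
      Set.indicator_of_notMem, hy, not_false_eq_true, ne_eq, OfNat.ofNat_ne_zero, zero_pow]
  have hF2i : Integrable fun y => F y ^ 2 := by
    obtain ⟨B, hB⟩ := hFn.bdd
    exact (hFn.mul hFn.meas hB).integrable.congr
      (Filter.Eventually.of_forall fun y => by simp only; ring)
  rw [← hFΦ]
  obtain ⟨w, hw, hwI, hsel⟩ := exists_measurable_selection hf δ μ
  have hbig : ∀ x ∈ {x | ENNReal.ofReal μ < maxAvg δ f x} ∩ {x | ‖x - a‖ ≤ ρ},
      μ < |annAvg osc δ (w x) F x| := by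
    rintro x ⟨hx, hxa⟩
    rw [hF, annAvg_ball_indicator hδ0 hδ8 (hwI x) f]
    · exact hsel x hx
    · have : ‖x - a‖ ≤ ρ := hxa
      linarith
  set Φ := ∫ y, F y ^ 2 with hΦ
  rcases (integral_nonneg fun y => sq_nonneg (F y) : 0 ≤ Φ).eq_or_lt with h0 | hΦ0
  · have hae : F =ᵐ[volume] 0 := by
      have := (integral_eq_zero_iff_of_nonneg (fun y => sq_nonneg (F y)) hF2i).1 h0.symm
      filter_upwards [this] with y hy
      exact pow_eq_zero_iff (two_ne_zero) |>.1 hy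
    rw [Set.eq_empty_of_forall_notMem (s := {x | ENNReal.ofReal μ < maxAvg δ f x} ∩ _)]
    · simp
    · intro x hx
      have h1 := hbig x hx
      have h2 : annAvg osc δ (w x) F x = 0 := by
        unfold annAvg
        rw [integral_eq_zero_of_ae]
        filter_upwards [hae] with y hy
        simp [hy]
      rw [h2, abs_zero] at h1
      linarith
  have hΦ100 : Φ ≤ 100 := by
    rw [hFΦ]
    have hvol : volume {y : ℂ | ‖y - a‖ ≤ 5} = ENNReal.ofReal (Real.pi * 5 ^ 2) :=
      volume_norm_sub_le a (by norm_num)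
    have := norm_setIntegral_le_of_norm_le_const (μ := volume) (s := {y : ℂ | ‖y - a‖ ≤ 5}) (C := 1)
      (f := fun y => f y ^ 2) (by rw [hvol]; exact ENNReal.ofReal_lt_top) fun y _ => by
        rw [Real.norm_eq_abs, abs_pow]; exact pow_le_one₀ (abs_nonneg _) (hf1 y)
    rw [one_mul, Measure.real, hvol, ENNReal.toReal_ofReal (by positivity)] at this
    have h2 := (le_abs_self _).trans this
    linarith [Real.pi_lt_four]
  set I := cells (ρ / 2) 5 a with hI
  have hcard : (I.card : ℝ) ≤ 484 / μ ^ 10 := by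
    refine (card_cells_le (half_pos hρ0) (by norm_num) a).trans ?_
    have h1 : 2 * 5 / (ρ / 2) + 2 ≤ 22 / ρ := by
      rw [le_div_iff₀ hρ0]
      field_simp
      linarith
    calc (2 * 5 / (ρ / 2) + 2) ^ 2 ≤ (22 / ρ) ^ 2 := by gcongr
      _ = 484 / μ ^ 10 := by rw [hρ, div_pow, ← pow_mul]; norm_num
  set E : (Fin 3 → ℤ × ℤ) × (ℤ × ℤ) → Set ℂ := fun p => {x | ‖x - a‖ ≤ ρ ∧
      (∀ l, μ ^ 12 ≤ |annAvg osc ((μ ^ 900) ^ 10) (w x)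
        ({y | cell (ρ / 2) y = p.1 l}.indicator F) x|) ∧
      (cell ((μ ^ 66) ^ 2) x).1 % 2 = p.2.1 ∧ (cell ((μ ^ 66) ^ 2) x).2 % 2 = p.2.2} with hE
  set P := ((Fintype.piFinset fun _ : Fin 3 => I).filter fun n => ∀ i l, i ≠ l →
    κ ≤ ‖corner (ρ / 2) (n i) - corner (ρ / 2) (n l)‖) ×ˢ
      (({0, 1} : Finset ℤ) ×ˢ ({0, 1} : Finset ℤ)) with hP
  have hPcard : (P.card : ℝ) ≤ (484 / μ ^ 10) ^ 3 * 4 := by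
    rw [hP, Finset.card_product, Nat.cast_mul]
    refine mul_le_mul ?_ (by simp) (by positivity) (by positivity)
    calc _ ≤ ((Fintype.piFinset fun _ : Fin 3 => I).card : ℝ) := by
          exact_mod_cast Finset.card_filter_le _ _
      _ = (I.card : ℝ) ^ 3 := by rw [Fintype.card_piFinset]; simp
      _ ≤ _ := by gcongr
  have hcover : {x | ENNReal.ofReal μ < maxAvg δ f x} ∩ {x | ‖x - a‖ ≤ ρ} ⊆ ⋃ p ∈ P, E p := by
    intro x hx
    obtain ⟨n, hnI, hsep, hn⟩ := hheavy δ (w x) (ρ / 2) 5 μ κ (μ ^ 12) a F x hδ0 hδ8 (hwI x)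
      (half_pos hρ0) hμ hκ0 hFn hF1 (fun y hy => by
        have hy' : y ∈ {y : ℂ | ‖y - a‖ ≤ 5} := Set.mem_of_indicator_ne_zero hy
        exact hy') (by
        calc (I.card : ℝ) * μ ^ 12 ≤ 484 / μ ^ 10 * μ ^ 12 := by gcongr
          _ = 484 * μ ^ 2 := by field_simp
          _ ≤ μ / 4 := by nlinarith) (by positivity) (by
        have h1 : D * κ = μ / 8 := by rw [hκ]; field_simp
        have h2 : ρ ≤ μ * μ := by
          rw [hρ]
          calc μ ^ 5 ≤ μ ^ 2 := pow_le_pow_of_le_one hμ.le hμ1 (by norm_num)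
            _ = μ * μ := sq μ
        have h3 : D * ρ ≤ μ / 8 := by
          calc D * ρ ≤ D * (μ * μ) := by gcongr
            _ = D * μ * μ := by ring
            _ ≤ 1 / 8 * μ := by gcongr; linarith
            _ = μ / 8 := by ring
        calc C₁ * (κ + 2 * (ρ / 2)) ≤ D * (κ + 2 * (ρ / 2)) := by gcongr
          _ = D * κ + D * ρ := by ring
          _ ≤ μ / 4 := by linarith) (hbig x hx)
    simp only [Set.mem_iUnion]
    refine ⟨(n, ((cell ((μ ^ 66) ^ 2) x).1 % 2, (cell ((μ ^ 66) ^ 2) x).2 % 2)), ?_, hx.2, ?_, rfl,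
      rfl⟩
    · rw [hP, Finset.mem_product, Finset.mem_product, Finset.mem_filter, Fintype.mem_piFinset]
      refine ⟨⟨hnI, hsep⟩, ?_, ?_⟩
      · simpa using Int.emod_two_eq_zero_or_one _
      · simpa using Int.emod_two_eq_zero_or_one _
    · rw [hν]; exact hn
  have hEvol : ∀ p ∈ P, volume (E p) ≤ ENNReal.ofReal (C₃ * μ ^ 42 * Φ) := by
    intro p hp
    rw [hP, Finset.mem_product, Finset.mem_filter] at hp
    have hsq : (μ ^ 66) ^ 2 = μ ^ 132 := by rw [← pow_mul]
    have h1 := (htriple (μ ^ 900) ρ (μ ^ 66) κ Φ (μ ^ 12) (by positivity)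
      (by have := hpow 900 (by norm_num); linarith) hρ0 (by linarith) (by positivity)
      (by rw [hsq]; have := hpow 132 (by norm_num); linarith) hκ0 (by
        rw [hκ, div_le_iff₀ (by positivity)]; linarith) (by
        rw [hκ, hρ, show μ / (8 * D) / 6 = μ / (48 * D) by field_simp; norm_num, div_pow,
          le_div_iff₀ (by positivity)]
        calc 576 * μ ^ 5 * (48 * D) ^ 3 = (576 * (48 * D) ^ 3 * μ) * μ * μ ^ 3 := by ring
          _ ≤ 1 * 1 * μ ^ 3 := by gcongr
          _ = μ ^ 3 := by ring) (by
        rw [hsq, hρ, ← pow_add]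
        calc 6 * μ ^ 900 = (6 * μ ^ 763) * μ ^ 137 := by ring
          _ ≤ 1 * μ ^ 137 := by gcongr; have := hpow 763 (by norm_num); linarith
          _ = _ := by ring) (by
        rw [hκ, hρ, le_div_iff₀ (by positivity)]
        calc 8 * μ ^ 5 * (8 * D) = (64 * (D * μ)) * μ ^ 3 * μ := by ring
          _ ≤ 1 * 1 * μ := by
            gcongr
            · linarith
            · exact pow_le_one₀ hμ.le hμ1
          _ = μ := by ring) (by
        rw [hν, hδ, hρ]
        calc 2 * μ ^ 9000 = (2 * μ ^ 8995) * μ ^ 5 := by ring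
          _ ≤ 1 * μ ^ 5 := by gcongr; have := hpow 8995 (by norm_num); linarith
          _ = _ := one_mul _) hΦ0 (by positivity) a w F p.1 p.2 hw hwI hFn le_rfl hp.1.2 (E p) rfl).2
    refine measure_le_of_alternative (by positivity) h1 ?_ ?_
    · have h2 : (μ ^ 12) ^ 2 / Φ * (C₃ * μ ^ 42 * Φ) = C₃ * μ ^ 66 := by
        calc _ = C₃ * μ ^ 66 * (Φ / Φ) := by ring
          _ = _ := by rw [div_self hΦ0.ne', mul_one]
      rw [h2, hC₃]
      have : 0 ≤ 2048 * C₂ * (48 * D) ^ 6 * 10 ^ 4 * μ ^ 66 := by positivity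
      linarith
    · have h2 : ((μ ^ 12) ^ 2 / Φ) ^ 3 * (C₃ * μ ^ 42 * Φ) = C₃ * μ ^ 114 / Φ ^ 2 := by
        have := hΦ0.ne'
        field_simp
      have h3 : μ ^ 900 / ((μ ^ 66) ^ 11 * ρ ^ 4 * (κ / 6) ^ 6) = (48 * D) ^ 6 * μ ^ 148 := by
        rw [hκ, hρ]; field_simp; norm_num
      rw [h2, mul_div_assoc, h3, le_div_iff₀ (by positivity), hC₃]
      have h4 : Φ ^ 2 ≤ 10 ^ 4 := by nlinarith
      have h5 : μ ^ 148 ≤ μ ^ 114 := pow_le_pow_of_le_one hμ.le hμ1 (by norm_num)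
      calc 2048 * (C₂ * ((48 * D) ^ 6 * μ ^ 148)) * Φ ^ 2 ≤
          2048 * (C₂ * ((48 * D) ^ 6 * μ ^ 114)) * 10 ^ 4 := by gcongr
        _ = 2048 * C₂ * (48 * D) ^ 6 * 10 ^ 4 * μ ^ 114 := by ring
        _ ≤ _ := by
          gcongr
          have : 0 ≤ 16 * C₂ := by positivity
          linarith
  calc _ ≤ ∑ p ∈ P, volume (E p) := (measure_mono hcover).trans (measure_biUnion_finset_le _ _)
    _ ≤ P.card • ENNReal.ofReal (C₃ * μ ^ 42 * Φ) := Finset.sum_le_card_nsmul _ _ _ hEvol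
    _ = ENNReal.ofReal (P.card * (C₃ * μ ^ 42 * Φ)) := by
        rw [nsmul_eq_mul, ENNReal.ofReal_mul (Nat.cast_nonneg _), ENNReal.ofReal_natCast]
    _ ≤ _ := by
        apply ENNReal.ofReal_le_ofReal
        calc (P.card : ℝ) * (C₃ * μ ^ 42 * Φ) ≤ (484 / μ ^ 10) ^ 3 * 4 * (C₃ * μ ^ 42 * Φ) := by
              gcongr
          _ = _ := by field_simp

/-- The restricted weak type bound with a gain. -/
lemma exists_level_bound : ∃ N : ℝ, 8 ≤ N ∧ ∀ μ : ℝ, 0 < μ → N * μ ≤ 1 →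
    ∀ f : ℂ → ℝ, IsNice f → (∀ y, |f y| ≤ 1) →
    volume {x | ENNReal.ofReal μ < maxAvg (μ ^ 9000) f x} ≤
      ENNReal.ofReal μ * ∫⁻ y, ENNReal.ofReal |f y| ^ 2 := by
  obtain ⟨C, N, hC, hN, h⟩ := exists_local_level_bound
  refine ⟨max 8 (max N (25 * C)), le_max_left _ _, fun μ hμ hNμ f hf hf1 => ?_⟩
  have hm : ∀ A, A ≤ max 8 (max N (25 * C)) → A * μ ≤ 1 := fun A hA => by
    have : A * μ ≤ max 8 (max N (25 * C)) * μ := by gcongr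
    linarith
  have h1 := hm N (le_max_of_le_right (le_max_left _ _))
  have h2 := hm (25 * C) (le_max_of_le_right (le_max_right _ _))
  have hS : MeasurableSet {x | ENNReal.ofReal μ < maxAvg (μ ^ 9000) f x} :=
    measurableSet_lt measurable_const (measurable_maxAvg hf _)
  have hloc := lintegral_le_of_local (u := Set.indicator _ 1) (v := fun y => ENNReal.ofReal |f y| ^ 2)
    (measurable_one.indicator hS) (hf.meas.abs.ennreal_ofReal.pow_const 2)
    (A := ENNReal.ofReal (C * μ ^ 12)) ENNReal.ofReal_ne_top (r := μ ^ 5) (s := 5) (by positivity)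
    (by norm_num) (fun b => by
      rw [lintegral_indicator_one hS, Measure.restrict_apply hS]
      refine (h μ hμ h1 f hf hf1 b).trans_eq ?_
      rw [ENNReal.ofReal_mul (by positivity), ofReal_integral_eq_lintegral_ofReal]
      · congr 1
        refine lintegral_congr fun y => ?_
        rw [← ENNReal.ofReal_pow (abs_nonneg _), sq_abs]
      · obtain ⟨B, hB⟩ := hf.bdd
        exact ((hf.mul hf.meas hB).integrable.congr
          (Filter.Eventually.of_forall fun y => by simp only; ring)).integrableOn
      · exact Filter.Eventually.of_forall fun y => sq_nonneg _)
  rw [lintegral_indicator_one hS] at hloc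
  refine hloc.trans ?_
  gcongr
  rw [← ENNReal.ofReal_mul (by positivity)]
  apply ENNReal.ofReal_le_ofReal
  calc C * μ ^ 12 * (5 / μ ^ 5) ^ 2 = 25 * C * μ * μ := by field_simp; norm_num
    _ ≤ 1 * μ := by gcongr
    _ = μ := one_mul _

/-! ### Interpolation -/

lemma lintegral_Ioo_rpow {a r : ℝ} (ha : 0 ≤ a) (hr : -1 < r) :
    ∫⁻ t in Set.Ioo (0 : ℝ) a, ENNReal.ofReal (t ^ r) =
      ENNReal.ofReal (a ^ (r + 1) / (r + 1)) := by
  have h1 : IntegrableOn (fun t : ℝ => t ^ r) (Set.Ioo 0 a) :=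
    (intervalIntegrable_iff_integrableOn_Ioo_of_le ha).1 (intervalIntegral.intervalIntegrable_rpow' hr)
  rw [← ofReal_integral_eq_lintegral_ofReal h1]
  · rw [← integral_Ioc_eq_integral_Ioo, ← intervalIntegral.integral_of_le ha,
      integral_rpow (Or.inl hr), Real.zero_rpow (by linarith), sub_zero]
  · filter_upwards [ae_restrict_mem measurableSet_Ioo] with t ht
    exact Real.rpow_nonneg ht.1.le _

lemma lintegral_level_eq {p q b : ℝ} (hq : 0 < q) (hqp : q < p) (hb : 0 < b) {g : ℂ → ℝ}
    (hg : Measurable g) :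
    ∫⁻ t in Set.Ioi (0 : ℝ), (∫⁻ y in {y | b * t < |g y|}, ENNReal.ofReal |g y| ^ q) *
        ENNReal.ofReal (t ^ (p - q - 1)) =
      ENNReal.ofReal (b ^ (-(p - q)) / (p - q)) * ∫⁻ y, ENNReal.ofReal |g y| ^ p := by
  have hset : MeasurableSet {z : ℝ × ℂ | b * z.1 < |g z.2|} :=
    measurableSet_lt (by fun_prop) (by fun_prop)
  have h1 : ∀ t : ℝ, (∫⁻ y in {y | b * t < |g y|}, ENNReal.ofReal |g y| ^ q) *
      ENNReal.ofReal (t ^ (p - q - 1)) = ∫⁻ y, {z : ℝ × ℂ | b * z.1 < |g z.2|}.indicator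
        (fun z => ENNReal.ofReal |g z.2| ^ q * ENNReal.ofReal (z.1 ^ (p - q - 1))) (t, y) := by
    intro t
    rw [← lintegral_mul_const' _ _ ENNReal.ofReal_ne_top,
      ← lintegral_indicator (measurableSet_lt (by fun_prop) (by fun_prop))]
    rfl
  simp_rw [h1]
  rw [lintegral_lintegral_swap, ← lintegral_const_mul' _ _ ENNReal.ofReal_ne_top]
  · congr 1 with y
    have h2 : ∀ t : ℝ, {z : ℝ × ℂ | b * z.1 < |g z.2|}.indicator
        (fun z => ENNReal.ofReal |g z.2| ^ q * ENNReal.ofReal (z.1 ^ (p - q - 1))) (t, y) =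
        (Set.Iio (|g y| / b)).indicator (fun t => ENNReal.ofReal |g y| ^ q *
          ENNReal.ofReal (t ^ (p - q - 1))) t := by
      intro t
      simp only [Set.indicator, Set.mem_ofPred_eq, Set.mem_Iio, lt_div_iff₀ hb, mul_comm b]
    simp_rw [h2]
    rw [lintegral_indicator measurableSet_Iio, Measure.restrict_restrict measurableSet_Iio,
      Set.inter_comm, Set.Ioi_inter_Iio, lintegral_const_mul' _ _ (by
        exact ENNReal.rpow_ne_top_of_nonneg hq.le ENNReal.ofReal_ne_top),
      lintegral_Ioo_rpow (by positivity) (by linarith), sub_add_cancel,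
      ENNReal.ofReal_rpow_of_nonneg (abs_nonneg _) hq.le,
      ENNReal.ofReal_rpow_of_nonneg (abs_nonneg _) (by linarith),
      ← ENNReal.ofReal_mul (by positivity), ← ENNReal.ofReal_mul (by
        have : 0 < p - q := by linarith
        positivity)]
    congr 1
    rw [Real.div_rpow (abs_nonneg _) hb.le, Real.rpow_neg hb.le]
    rcases (abs_nonneg (g y)).eq_or_lt with h | h
    · rw [← h, Real.zero_rpow hq.ne', Real.zero_rpow (hq.trans hqp).ne']; ring
    · rw [show p = q + (p - q) by ring, Real.rpow_add h]; ring_nf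
  · refine ((Measurable.indicator ?_ hset)).aemeasurable
    fun_prop

/-- The layer cake form of Marcinkiewicz interpolation. -/
lemma lintegral_rpow_le_of_level {p q b₁ b₂ : ℝ} (hq : 0 < q) (hqp : q < p) (hb₁ : 0 < b₁)
    (hb₂ : 0 < b₂) {g : ℂ → ℝ} (hg : Measurable g) {F : ℂ → ℝ≥0∞} (hF : Measurable F)
    (hFtop : ∀ x, F x ≠ ⊤) (K₁ K₂ : ℝ≥0∞)
    (h : ∀ t : ℝ, 0 < t → volume {x | ENNReal.ofReal t < F x} ≤ ENNReal.ofReal (t ^ (-q)) *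
      (K₁ * (∫⁻ y in {y | b₁ * t < |g y|}, ENNReal.ofReal |g y| ^ q) +
        K₂ * ∫⁻ y in {y | b₂ * t < |g y|}, ENNReal.ofReal |g y| ^ q)) :
    ∫⁻ x, F x ^ p ≤ ENNReal.ofReal p * (K₁ * ENNReal.ofReal (b₁ ^ (-(p - q)) / (p - q)) +
      K₂ * ENNReal.ofReal (b₂ ^ (-(p - q)) / (p - q))) * ∫⁻ y, ENNReal.ofReal |g y| ^ p := by
  have hp : 0 < p := hq.trans hqp
  have hlay := lintegral_rpow_eq_lintegral_meas_lt_mul (volume : Measure ℂ)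
    (f := fun x => (F x).toReal) (Filter.Eventually.of_forall fun x => ENNReal.toReal_nonneg)
    hF.ennreal_toReal.aemeasurable hp
  have hcut : ∀ b : ℝ, 0 < b → Measurable fun t : ℝ =>
      (∫⁻ y in {y | b * t < |g y|}, ENNReal.ofReal |g y| ^ q) *
        ENNReal.ofReal (t ^ (p - q - 1)) := by
    intro b hb
    refine Measurable.mul ?_ (by fun_prop)
    have hset : MeasurableSet {z : ℝ × ℂ | b * z.1 < |g z.2|} :=
      measurableSet_lt (by fun_prop) (by fun_prop)
    have h1 : ∀ t : ℝ, (∫⁻ y in {y | b * t < |g y|}, ENNReal.ofReal |g y| ^ q) =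
        ∫⁻ y, {z : ℝ × ℂ | b * z.1 < |g z.2|}.indicator
          (fun z => ENNReal.ofReal |g z.2| ^ q) (t, y) := by
      intro t
      rw [← lintegral_indicator (measurableSet_lt (by fun_prop) (by fun_prop))]
      rfl
    simp_rw [h1]
    refine Measurable.lintegral_prod_right' (f := fun z : ℝ × ℂ =>
      {z : ℝ × ℂ | b * z.1 < |g z.2|}.indicator (fun z => ENNReal.ofReal |g z.2| ^ q) z) ?_
    exact Measurable.indicator (by fun_prop) hset
  calc ∫⁻ x, F x ^ p = ∫⁻ x, ENNReal.ofReal ((F x).toReal ^ p) := by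
        congr 1 with x
        rw [← ENNReal.ofReal_rpow_of_nonneg ENNReal.toReal_nonneg hp.le,
          ENNReal.ofReal_toReal (hFtop x)]
    _ = _ := hlay
    _ ≤ ENNReal.ofReal p * ∫⁻ t in Set.Ioi (0 : ℝ),
        (K₁ * ((∫⁻ y in {y | b₁ * t < |g y|}, ENNReal.ofReal |g y| ^ q) *
          ENNReal.ofReal (t ^ (p - q - 1))) +
        K₂ * ((∫⁻ y in {y | b₂ * t < |g y|}, ENNReal.ofReal |g y| ^ q) *
          ENNReal.ofReal (t ^ (p - q - 1)))) := by
        gcongr ENNReal.ofReal p * ?_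
        refine setLIntegral_mono' measurableSet_Ioi fun t ht => ?_
        have ht0 : (0 : ℝ) < t := ht
        have hpow : ENNReal.ofReal (t ^ (p - q - 1)) =
            ENNReal.ofReal (t ^ (-q)) * ENNReal.ofReal (t ^ (p - 1)) := by
          rw [← ENNReal.ofReal_mul (by positivity), ← Real.rpow_add ht0]
          congr 2; ring
        have hset : {a | t < (F a).toReal} = {x | ENNReal.ofReal t < F x} := by
          ext x
          simp only [Set.mem_ofPred_eq]
          rw [ENNReal.ofReal_lt_iff_lt_toReal ht0.le (hFtop x)]
        rw [hset, hpow]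
        calc _ ≤ _ := mul_le_mul_left (h t ht0) _
          _ = _ := by ring
    _ = _ := by
        rw [lintegral_add_left ((hcut b₁ hb₁).const_mul _), lintegral_const_mul _ (hcut b₁ hb₁),
          lintegral_const_mul _ (hcut b₂ hb₂), lintegral_level_eq hq hqp hb₁ hg,
          lintegral_level_eq hq hqp hb₂ hg]
        ring

lemma maxAvg_add_le {f g : ℂ → ℝ} (hf : IsNice f) (hg : IsNice g) (δ : ℝ) (x : ℂ) :
    maxAvg δ (fun y => f y + g y) x ≤ maxAvg δ f x + maxAvg δ g x := by
  refine iSup₂_le fun w hw => ?_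
  rw [annAvg_add hf hg]
  calc _ ≤ ENNReal.ofReal (|annAvg osc δ w f x| + |annAvg osc δ w g x|) :=
        ENNReal.ofReal_le_ofReal (abs_add_le _ _)
    _ ≤ _ := by
        rw [ENNReal.ofReal_add (abs_nonneg _) (abs_nonneg _)]
        exact add_le_add (le_maxAvg hw δ f x) (le_maxAvg hw δ g x)

lemma maxAvg_const_mul (c δ : ℝ) (f : ℂ → ℝ) (x : ℂ) :
    maxAvg δ (fun y => c * f y) x = ENNReal.ofReal |c| * maxAvg δ f x := by
  unfold maxAvg
  rw [ENNReal.mul_iSup]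
  congr 1 with w
  rw [ENNReal.mul_iSup]
  congr 1 with hw
  rw [← ENNReal.ofReal_mul (abs_nonneg _), ← abs_mul]
  congr 2
  unfold annAvg
  rw [← integral_const_mul]
  congr 1 with y
  ring

lemma maxAvg_ne_top {f : ℂ → ℝ} (hf : IsNice f) {δ : ℝ} (hδ : 0 < δ) (x : ℂ) :
    maxAvg δ f x ≠ ⊤ := by
  obtain ⟨M, -, h, -⟩ := exists_osc_bound
  refine ne_top_of_le_ne_top (b := ENNReal.ofReal (δ⁻¹ * M * ∫ y, |f y|)) ENNReal.ofReal_ne_top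
    (iSup₂_le fun w _ => ENNReal.ofReal_le_ofReal (abs_annAvg_le h hf hδ w x))

/-- The single scale estimate with a power gain. -/
lemma exists_maxAvg_rpow_bound {p : ℝ} (hp : 2 < p) : ∃ C N : ℝ, 0 < C ∧ 8 ≤ N ∧ ∀ μ : ℝ, 0 < μ →
    N * μ ≤ 1 → ∀ f : ℂ → ℝ, IsNice f → ∫⁻ x, maxAvg (μ ^ 9000) f x ^ p ≤
      ENNReal.ofReal (C * (μ ^ 3 + μ ^ (p - 2))) * ∫⁻ y, ENNReal.ofReal |f y| ^ p := by
  obtain ⟨C₁, hC₁, hsup⟩ := exists_abs_annAvg_sup_bound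
  obtain ⟨C₂, hC₂, hL2⟩ := exists_maxAvg_bound
  obtain ⟨N, hN, hlev⟩ := exists_level_bound
  set c := (4 * (C₁ + 1))⁻¹ with hc
  have hc0 : 0 < c := by positivity
  have hp2 : 0 < p - 2 := by linarith
  refine ⟨p * (9 * (c ^ (-(p - 2)) / (p - 2)) + 9 * C₂ * (3 ^ (p - 2) / (p - 2))), N,
    by positivity, hN, fun μ hμ hNμ f hf => ?_⟩
  have hμ8 : μ ≤ 1 / 8 := by nlinarith
  have hδ0 : 0 < μ ^ 9000 := by positivity
  have hδ8 : μ ^ 9000 ≤ 1 / 8 :=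
    (pow_le_of_le_one hμ.le (by linarith) (by norm_num)).trans hμ8
  have hA0 : 0 < (3 * μ)⁻¹ := by positivity
  have hmain := lintegral_rpow_le_of_level (p := p) (q := 2) (by norm_num) hp hc0 hA0 hf.meas
    (measurable_maxAvg hf (μ ^ 9000)) (maxAvg_ne_top hf hδ0) (ENNReal.ofReal (9 * μ ^ 3))
    (ENNReal.ofReal (9 * C₂)) ?_
  · refine hmain.trans ?_
    gcongr ?_ * _
    rw [← ENNReal.ofReal_mul (by positivity), ← ENNReal.ofReal_mul (by positivity),
      ← ENNReal.ofReal_add (by positivity) (by positivity), ← ENNReal.ofReal_mul (by linarith)]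
    apply ENNReal.ofReal_le_ofReal
    have h1 : (3 * μ)⁻¹ ^ (-(p - 2)) = 3 ^ (p - 2) * μ ^ (p - 2) := by
      rw [Real.inv_rpow (by positivity), Real.rpow_neg (by positivity), inv_inv,
        Real.mul_rpow (by norm_num) hμ.le]
    rw [h1]
    have e1 : 0 ≤ p * (9 * (c ^ (-(p - 2)) / (p - 2))) * μ ^ (p - 2) := by positivity
    have e2 : 0 ≤ p * (9 * C₂ * (3 ^ (p - 2) / (p - 2))) * μ ^ 3 := by positivity
    calc _ = p * (9 * (c ^ (-(p - 2)) / (p - 2))) * μ ^ 3 +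
          p * (9 * C₂ * (3 ^ (p - 2) / (p - 2))) * μ ^ (p - 2) := by ring
      _ ≤ _ := by linarith
  intro t ht
  set δ := μ ^ 9000 with hδ
  set A := (3 * μ)⁻¹ with hA
  have hsm : MeasurableSet {y | c * t < |f y|} := measurableSet_lt measurable_const hf.meas.abs
  have hsA : MeasurableSet {y | A * t < |f y|} := measurableSet_lt measurable_const hf.meas.abs
  set S := {y | c * t < |f y|} with hS
  set B := {y | A * t < |f y|} with hB
  set f₁ := Sᶜ.indicator f with hf₁
  set f₂ := (S \ B).indicator f with hf₂
  set f₃ := (S ∩ B).indicator f with hf₃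
  have n₁ : IsNice f₁ := hf.indicator hsm.compl
  have n₂ : IsNice f₂ := hf.indicator (hsm.diff hsA)
  have n₃ : IsNice f₃ := hf.indicator (hsm.inter hsA)
  have n₁₂ : IsNice fun y => f₁ y + f₂ y := by
    have : (fun y => f₁ y + f₂ y) = (Sᶜ ∪ (S \ B)).indicator f := by
      rw [Set.indicator_union_of_disjoint]
      exact Set.disjoint_left.2 fun y h1 h2 => h1 h2.1
    rw [this]
    exact hf.indicator (hsm.compl.union (hsm.diff hsA))
  have hsum : f = fun y => (f₁ y + f₂ y) + f₃ y := by
    ext y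
    by_cases h1 : y ∈ S <;> by_cases h2 : y ∈ B <;> simp [hf₁, hf₂, hf₃, h1, h2]
  have hsub : {x | ENNReal.ofReal t < maxAvg δ f x} ⊆
      {x | ENNReal.ofReal (t / 3) < maxAvg δ f₂ x} ∪
        {x | ENNReal.ofReal (t / 3) < maxAvg δ f₃ x} := by
    intro x hx
    by_contra hcon
    rw [Set.mem_union, not_or] at hcon
    have h2 : maxAvg δ f₂ x ≤ ENNReal.ofReal (t / 3) := not_lt.1 hcon.1
    have h3 : maxAvg δ f₃ x ≤ ENNReal.ofReal (t / 3) := not_lt.1 hcon.2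
    have h1 : maxAvg δ f₁ x ≤ ENNReal.ofReal (t / 3) := by
      refine iSup₂_le fun w hw => ENNReal.ofReal_le_ofReal ?_
      refine (hsup δ w (c * t) hδ0 hδ8 hw f₁ x fun y => ?_).trans ?_
      · by_cases h : y ∈ S
        · simp only [hf₁, Set.indicator, Set.mem_compl_iff, h, not_true_eq_false, if_false, abs_zero]
          positivity
        · simp only [hf₁, Set.indicator, Set.mem_compl_iff, h, not_false_eq_true, if_true]
          exact not_lt.1 h
      · rw [hc, ← mul_assoc, ← div_eq_mul_inv]
        have : C₁ / (4 * (C₁ + 1)) ≤ 1 / 3 := by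
          rw [div_le_div_iff₀ (by positivity) (by norm_num)]; linarith
        calc _ ≤ 1 / 3 * t := by gcongr
          _ = _ := by ring
    have hx' : ENNReal.ofReal t < maxAvg δ f x := hx
    refine absurd hx' (not_lt.2 ?_)
    calc maxAvg δ f x = maxAvg δ (fun y => (f₁ y + f₂ y) + f₃ y) x := by rw [← hsum]
      _ ≤ maxAvg δ f₁ x + maxAvg δ f₂ x + maxAvg δ f₃ x :=
          (maxAvg_add_le n₁₂ n₃ δ x).trans (by gcongr; exact maxAvg_add_le n₁ n₂ δ x)
      _ ≤ ENNReal.ofReal (t / 3) + ENNReal.ofReal (t / 3) + ENNReal.ofReal (t / 3) := by gcongr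
      _ = ENNReal.ofReal t := by
          rw [← ENNReal.ofReal_add (by positivity) (by positivity),
            ← ENNReal.ofReal_add (by positivity) (by positivity)]
          congr 1; ring
  have hind : ∀ E ⊆ S, MeasurableSet E → ∫⁻ y, ENNReal.ofReal |E.indicator f y| ^ 2 =
      ∫⁻ y in E, ENNReal.ofReal |f y| ^ 2 := by
    intro E _ hE
    rw [← lintegral_indicator hE]
    congr 1 with y
    by_cases h : y ∈ E <;> simp [h]
  have hmid : volume {x | ENNReal.ofReal (t / 3) < maxAvg δ f₂ x} ≤
      ENNReal.ofReal (9 * μ ^ 3) * ENNReal.ofReal (t ^ (-(2 : ℝ))) *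
        ∫⁻ y in S, ENNReal.ofReal |f y| ^ 2 := by
    have hAt : 0 < A * t := by positivity
    have h := hlev μ hμ hNμ (fun y => (A * t)⁻¹ * f₂ y) (n₂.mul measurable_const
      (M := |(A * t)⁻¹|) fun _ => le_rfl) fun y => by
        rw [abs_mul, abs_of_pos (inv_pos.2 hAt), inv_mul_le_iff₀ hAt, mul_one]
        by_cases h : y ∈ S \ B
        · simp only [hf₂, Set.indicator, h, if_true]
          exact not_lt.1 h.2
        · simp only [hf₂, Set.indicator, h, if_false, abs_zero]
          exact hAt.le
    have hset : {x | ENNReal.ofReal (t / 3) < maxAvg δ f₂ x} =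
        {x | ENNReal.ofReal μ < maxAvg δ (fun y => (A * t)⁻¹ * f₂ y) x} := by
      ext x
      simp only [Set.mem_ofPred_eq]
      rw [maxAvg_const_mul, abs_of_pos (inv_pos.2 hAt), ENNReal.ofReal_inv_of_pos hAt,
        mul_comm _ (maxAvg δ f₂ x), ← div_eq_mul_inv, ENNReal.lt_div_iff_mul_lt
        (Or.inl (ENNReal.ofReal_pos.2 hAt).ne') (Or.inl ENNReal.ofReal_ne_top),
        ← ENNReal.ofReal_mul hμ.le]
      rw [show μ * (A * t) = t / 3 by rw [hA]; field_simp]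
    rw [hset]
    refine h.trans ?_
    have h4 : ∀ y, ENNReal.ofReal |(A * t)⁻¹ * f₂ y| ^ 2 =
        ENNReal.ofReal (9 * μ ^ 2 * t ^ (-(2 : ℝ))) * ENNReal.ofReal |f₂ y| ^ 2 := by
      intro y
      rw [abs_mul, ENNReal.ofReal_mul (abs_nonneg _), mul_pow, ← ENNReal.ofReal_pow (abs_nonneg _),
        sq_abs]
      congr 2
      rw [hA, Real.rpow_neg ht.le, Real.rpow_two]
      field_simp
      norm_num
    simp_rw [h4]
    rw [lintegral_const_mul' _ _ ENNReal.ofReal_ne_top, hind _ Set.sdiff_subset (hsm.diff hsA),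
      ← mul_assoc, ← ENNReal.ofReal_mul hμ.le, ← ENNReal.ofReal_mul (by positivity)]
    rw [show μ * (9 * μ ^ 2 * t ^ (-(2 : ℝ))) = 9 * μ ^ 3 * t ^ (-(2 : ℝ)) by ring]
    gcongr
    exact Set.sdiff_subset
  have hbig : volume {x | ENNReal.ofReal (t / 3) < maxAvg δ f₃ x} ≤
      ENNReal.ofReal (9 * C₂) * ENNReal.ofReal (t ^ (-(2 : ℝ))) *
        ∫⁻ y in B, ENNReal.ofReal |f y| ^ 2 := by
    have ht3 : 0 < t / 3 := by positivity
    have h := mul_meas_ge_le_lintegral₀ (μ := (volume : Measure ℂ))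
      ((measurable_maxAvg n₃ δ).pow_const 2).aemeasurable (ENNReal.ofReal (t / 3) ^ 2)
    have h5 : volume {x | ENNReal.ofReal (t / 3) < maxAvg δ f₃ x} ≤
        volume {x | ENNReal.ofReal (t / 3) ^ 2 ≤ maxAvg δ f₃ x ^ 2} := by
      refine measure_mono fun x hx => ?_
      have hx' : ENNReal.ofReal (t / 3) < maxAvg δ f₃ x := hx
      exact pow_le_pow_left₀ zero_le hx'.le 2
    have h6 := (mul_le_mul_right h5 (ENNReal.ofReal (t / 3) ^ 2)).trans
      (h.trans (hL2 δ hδ0 hδ8 f₃ n₃))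
    rw [hind _ Set.inter_subset_left (hsm.inter hsA), ← ENNReal.ofReal_pow ht3.le] at h6
    have h7 : ENNReal.ofReal (9 * t ^ (-(2 : ℝ))) * ENNReal.ofReal ((t / 3) ^ 2) = 1 := by
      rw [← ENNReal.ofReal_mul (by positivity), Real.rpow_neg ht.le, Real.rpow_two,
        show 9 * (t ^ 2)⁻¹ * (t / 3) ^ 2 = 1 by field_simp; norm_num, ENNReal.ofReal_one]
    calc _ = ENNReal.ofReal (9 * t ^ (-(2 : ℝ))) * (ENNReal.ofReal ((t / 3) ^ 2) *
          volume {x | ENNReal.ofReal (t / 3) < maxAvg δ f₃ x}) := by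
          rw [← mul_assoc, h7, one_mul]
      _ ≤ ENNReal.ofReal (9 * t ^ (-(2 : ℝ))) * (ENNReal.ofReal C₂ *
          ∫⁻ y in S ∩ B, ENNReal.ofReal |f y| ^ 2) := by gcongr
      _ ≤ ENNReal.ofReal (9 * t ^ (-(2 : ℝ))) * (ENNReal.ofReal C₂ *
          ∫⁻ y in B, ENNReal.ofReal |f y| ^ 2) := by gcongr; exact Set.inter_subset_right
      _ = _ := by
          rw [← mul_assoc, ← ENNReal.ofReal_mul (by positivity),
            ← ENNReal.ofReal_mul (by positivity)]
          congr 2; ring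
  simp_rw [ENNReal.rpow_two]
  calc _ ≤ _ := (measure_mono hsub).trans (measure_union_le _ _)
    _ ≤ _ := add_le_add hmid hbig
    _ = _ := by ring

/-! ### Averages over grids of squares -/

lemma lintegral_mul_rpow_le {α : Type*} [MeasurableSpace α] {ν : Measure α} {p : ℝ} (hp : 1 < p)
    {K g : α → ℝ≥0∞} (hK : AEMeasurable K ν) (hg : AEMeasurable g ν) :
    (∫⁻ y, K y * g y ∂ν) ^ p ≤ (∫⁻ y, K y ∂ν) ^ (p - 1) * ∫⁻ y, K y * g y ^ p ∂ν := by
  have hp0 : 0 < p := by linarith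
  have hpq : p.HolderConjugate (p / (p - 1)) := Real.HolderConjugate.conjExponent hp
  have h := ENNReal.lintegral_mul_le_Lp_mul_Lq ν hpq.symm (hK.pow_const ((p - 1) / p))
    ((hK.pow_const (1 / p)).mul hg)
  have h1 : ∀ y, ((fun y => K y ^ ((p - 1) / p)) * fun y => K y ^ (1 / p) * g y) y =
      K y * g y := fun y => by
    simp only [Pi.mul_apply]
    rw [← mul_assoc, ← ENNReal.rpow_add_of_nonneg _ _ (div_nonneg (by linarith) hp0.le)
      (by positivity), ← add_div, sub_add_cancel, div_self hp0.ne', ENNReal.rpow_one]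
  have h2 : ∀ y, (K y ^ ((p - 1) / p)) ^ (p / (p - 1)) = K y := fun y => by
    rw [← ENNReal.rpow_mul, div_mul_div_cancel₀ hp0.ne', div_self (by linarith), ENNReal.rpow_one]
  have h3 : ∀ y, (K y ^ (1 / p) * g y) ^ p = K y * g y ^ p := fun y => by
    rw [ENNReal.mul_rpow_of_nonneg _ _ hp0.le, ← ENNReal.rpow_mul, one_div_mul_cancel hp0.ne',
      ENNReal.rpow_one]
  change ∫⁻ y, ((fun y => K y ^ ((p - 1) / p)) * fun y => K y ^ (1 / p) * g y) y ∂ν ≤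
    (∫⁻ y, (K y ^ ((p - 1) / p)) ^ (p / (p - 1)) ∂ν) ^ (1 / (p / (p - 1))) *
      (∫⁻ y, (K y ^ (1 / p) * g y) ^ p ∂ν) ^ (1 / p) at h
  simp_rw [h1, h2, h3] at h
  calc _ ≤ _ := ENNReal.rpow_le_rpow h hp0.le
    _ = _ := by
      rw [ENNReal.mul_rpow_of_nonneg _ _ hp0.le, ← ENNReal.rpow_mul, ← ENNReal.rpow_mul,
        one_div_mul_cancel hp0.ne', ENNReal.rpow_one, one_div_div, div_mul_cancel₀ _ hp0.ne']

/-- Schur's test on `L^p`. -/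
lemma lintegral_rpow_schur {p : ℝ} (hp : 1 < p) {K : ℂ → ℂ → ℝ≥0∞}
    (hK : Measurable (Function.uncurry K)) {A B : ℝ≥0∞} (hA : ∀ x, ∫⁻ y, K x y ≤ A)
    (hB : ∀ y, ∫⁻ x, K x y ≤ B) {g : ℂ → ℝ≥0∞} (hg : Measurable g) :
    ∫⁻ x, (∫⁻ y, K x y * g y) ^ p ≤ A ^ (p - 1) * B * ∫⁻ y, g y ^ p := by
  have hm : Measurable fun z : ℂ × ℂ => K z.1 z.2 * g z.2 ^ p :=
    hK.mul ((hg.comp measurable_snd).pow_const p)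
  calc _ ≤ ∫⁻ x, A ^ (p - 1) * ∫⁻ y, K x y * g y ^ p := by
        refine lintegral_mono fun x => ?_
        refine (lintegral_mul_rpow_le hp (hK.comp measurable_prodMk_left).aemeasurable
          hg.aemeasurable).trans ?_
        exact mul_le_mul_left (ENNReal.rpow_le_rpow (hA x) (by linarith)) _
    _ = A ^ (p - 1) * ∫⁻ y, ∫⁻ x, K x y * g y ^ p := by
        rw [lintegral_const_mul _ hm.lintegral_prod_right', lintegral_lintegral_swap hm.aemeasurable]
    _ = A ^ (p - 1) * ∫⁻ y, (∫⁻ x, K x y) * g y ^ p := by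
        congr 2 with y
        exact lintegral_mul_const _ (hK.comp measurable_prodMk_right)
    _ ≤ A ^ (p - 1) * ∫⁻ y, B * g y ^ p := by
        gcongr with y
        exact hB y
    _ = _ := by rw [lintegral_const_mul _ (hg.pow_const p), mul_assoc]

lemma cell_eq_iff {s : ℝ} (hs : 0 < s) (y : ℂ) (n : ℤ × ℤ) : cell s y = n ↔
    y ∈ Set.Ico (s * n.1) (s * n.1 + s) ×ℂ Set.Ico (s * n.2) (s * n.2 + s) := by
  have key : ∀ (t : ℝ) (m : ℤ), ⌊t / s⌋ = m ↔ t ∈ Set.Ico (s * m) (s * m + s) := by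
    intro t m
    rw [Int.floor_eq_iff, le_div_iff₀ hs, div_lt_iff₀ hs, Set.mem_Ico, mul_comm s,
      add_mul, one_mul]
  rw [Complex.mem_reProdIm, ← key, ← key, Prod.ext_iff]
  rfl

lemma volume_reProdIm_Ico (a b : ℝ) {l : ℝ} (hl : 0 ≤ l) :
    volume (Set.Ico a (a + l) ×ℂ Set.Ico b (b + l)) = ENNReal.ofReal (l ^ 2) := by
  have h := Complex.volume_preserving_equiv_real_prod.measure_preimage
    ((measurableSet_Ico (a := a) (b := a + l)).prod
      (measurableSet_Ico (a := b) (b := b + l))).nullMeasurableSet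
  rw [Measure.volume_eq_prod, Measure.prod_prod, Real.volume_Ico, Real.volume_Ico,
    add_sub_cancel_left, add_sub_cancel_left, ← ENNReal.ofReal_mul hl, ← sq] at h
  exact h

lemma volume_cell_eq {s : ℝ} (hs : 0 < s) (n : ℤ × ℤ) :
    volume {y | cell s y = n} = ENNReal.ofReal (s ^ 2) := by
  have : {y | cell s y = n} =
      Set.Ico (s * n.1) (s * n.1 + s) ×ℂ Set.Ico (s * n.2) (s * n.2 + s) := by
    ext y; exact cell_eq_iff hs y n
  rw [this, volume_reProdIm_Ico _ _ hs.le]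

lemma norm_sub_le_of_cell_eq {s : ℝ} (hs : 0 < s) {y z : ℂ} (h : cell s y = cell s z) :
    ‖y - z‖ ≤ 4 * s := by
  have h1 := norm_sub_corner_le hs y
  have h2 := norm_sub_corner_le hs z
  rw [h] at h1
  calc ‖y - z‖ = ‖(y - corner s (cell s z)) - (z - corner s (cell s z))‖ := by congr 1; ring
    _ ≤ _ := (norm_sub_le _ _).trans (by linarith)

lemma cell_eq_of_cell_half {s : ℝ} {y z : ℂ} (h : cell (s / 2) y = cell (s / 2) z) :
    cell s y = cell s z := by
  have key : ∀ t : ℝ, ⌊t / s⌋ = ⌊t / (s / 2)⌋ / 2 := by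
    intro t
    have h := Int.floor_div_natCast (t / (s / 2)) 2
    rw [← Nat.cast_ofNat (R := ℤ), ← h]
    congr 1
    push_cast
    rw [div_div, div_mul_cancel₀ _ (two_ne_zero)]
  rw [cell, cell, Prod.mk.injEq] at h ⊢
  exact ⟨by rw [key, h.1, ← key], by rw [key, h.2, ← key]⟩

lemma cell_smul {s c : ℝ} (hc : 0 < c) (z : ℂ) : cell (c * s) (c * z) = cell s z := by
  simp only [cell, Complex.re_ofReal_mul, Complex.im_ofReal_mul, mul_div_mul_left _ _ hc.ne']

/-- The kernel of the averages over squares of side `s`. -/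
def gridKer (s : ℝ) (x y : ℂ) : ℝ := if cell s y = cell s x then (s ^ 2)⁻¹ else 0

/-- The average of `f` over the square of side `s` containing `x`. -/
def gridAvg (s : ℝ) (f : ℂ → ℝ) (x : ℂ) : ℝ := ∫ y, gridKer s x y * f y

lemma gridKer_comm (s : ℝ) (x y : ℂ) : gridKer s x y = gridKer s y x := by
  simp only [gridKer, eq_comm]

lemma gridKer_nonneg (s : ℝ) (x y : ℂ) : 0 ≤ gridKer s x y := by
  unfold gridKer; split_ifs <;> positivity

lemma gridKer_le (s : ℝ) (x y : ℂ) : gridKer s x y ≤ (s ^ 2)⁻¹ := by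
  unfold gridKer; split_ifs <;> first | positivity | exact le_rfl

lemma gridKer_congr {s : ℝ} {x x' : ℂ} (h : cell s x = cell s x') (y : ℂ) :
    gridKer s x y = gridKer s x' y := by
  simp only [gridKer, h]

lemma measurable_gridKer (s : ℝ) : Measurable (Function.uncurry (gridKer s)) := by
  refine Measurable.ite ?_ measurable_const measurable_const
  exact measurableSet_eq_fun ((measurable_cell s).comp measurable_snd)
    ((measurable_cell s).comp measurable_fst)

lemma isNice_gridKer {s : ℝ} (hs : 0 < s) (x : ℂ) : IsNice (gridKer s x) := by
  refine ⟨(measurable_gridKer s).comp measurable_prodMk_left, ⟨(s ^ 2)⁻¹, fun y => ?_⟩,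
    ⟨‖x‖ + 4 * s, fun y hy => ?_⟩⟩
  · rw [abs_of_nonneg (gridKer_nonneg s x y)]; exact gridKer_le s x y
  · unfold gridKer
    rw [if_neg]
    intro h
    have h1 := norm_sub_le_of_cell_eq hs h
    have h2 := norm_sub_norm_le y x
    linarith

lemma lintegral_gridKer {s : ℝ} (hs : 0 < s) (x : ℂ) :
    ∫⁻ y, ENNReal.ofReal (gridKer s x y) = 1 := by
  have h : ∀ y, ENNReal.ofReal (gridKer s x y) =
      {y | cell s y = cell s x}.indicator (fun _ => ENNReal.ofReal (s ^ 2)⁻¹) y := fun y => by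
    by_cases hy : cell s y = cell s x <;> simp [gridKer, Set.indicator, hy]
  simp_rw [h]
  have hm : MeasurableSet {y | cell s y = cell s x} := measurableSet_cell_mem s {cell s x}
  rw [lintegral_indicator hm, setLIntegral_const, volume_cell_eq hs,
    ← ENNReal.ofReal_mul (by positivity), inv_mul_cancel₀ (by positivity), ENNReal.ofReal_one]

lemma integral_gridKer {s : ℝ} (hs : 0 < s) (x : ℂ) : ∫ y, gridKer s x y = 1 := by
  rw [integral_eq_lintegral_of_nonneg_ae (Filter.Eventually.of_forall fun y => gridKer_nonneg s x y)
    (isNice_gridKer hs x).meas.aestronglyMeasurable, lintegral_gridKer hs, ENNReal.toReal_one]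

lemma IsNice.add {f g : ℂ → ℝ} (hf : IsNice f) (hg : IsNice g) : IsNice fun x => f x + g x := by
  obtain ⟨M, hM⟩ := hf.bdd
  obtain ⟨R, hR⟩ := hf.supp
  obtain ⟨M', hM'⟩ := hg.bdd
  obtain ⟨R', hR'⟩ := hg.supp
  refine ⟨hf.meas.add hg.meas, ⟨M + M', fun x => ?_⟩, ⟨max R R', fun x hx => ?_⟩⟩
  · exact (abs_add_le _ _).trans (add_le_add (hM x) (hM' x))
  · simp only [hR x ((le_max_left _ _).trans_lt hx), hR' x ((le_max_right _ _).trans_lt hx),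
      add_zero]

lemma IsNice.const_mul {f : ℂ → ℝ} (hf : IsNice f) (c : ℝ) : IsNice fun x => c * f x :=
  hf.mul measurable_const (M := |c|) fun _ => le_rfl

lemma IsNice.sub {f g : ℂ → ℝ} (hf : IsNice f) (hg : IsNice g) : IsNice fun x => f x - g x := by
  have h := hf.add (hg.const_mul (-1))
  simpa [sub_eq_add_neg] using h

lemma IsNice.integrable_mul {f g : ℂ → ℝ} (hf : IsNice f) (hg : IsNice g) :
    Integrable fun x => g x * f x := by
  obtain ⟨M, hM⟩ := hg.bdd
  exact (hf.mul hg.meas hM).integrable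

lemma gridAvg_congr {s : ℝ} (f : ℂ → ℝ) {x x' : ℂ} (h : cell s x = cell s x') :
    gridAvg s f x = gridAvg s f x' := by
  simp only [gridAvg, gridKer_congr h]

lemma abs_gridAvg_le {s : ℝ} (hs : 0 < s) {f : ℂ → ℝ} {M : ℝ} (hM : ∀ x, |f x| ≤ M) (x : ℂ) :
    |gridAvg s f x| ≤ M := by
  calc |gridAvg s f x| ≤ ∫ y, gridKer s x y * M := by
        refine abs_integral_le_integral_abs.trans (integral_mono_of_nonneg
          (Filter.Eventually.of_forall fun y => abs_nonneg _)
          ((isNice_gridKer hs x).integrable.mul_const M) (Filter.Eventually.of_forall fun y => ?_))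
        simp only [abs_mul, abs_of_nonneg (gridKer_nonneg s x y)]
        exact mul_le_mul_of_nonneg_left (hM y) (gridKer_nonneg s x y)
    _ = M := by rw [integral_mul_const, integral_gridKer hs, one_mul]

lemma abs_gridAvg_le_integral (s : ℝ) {f : ℂ → ℝ} (hf : IsNice f) (x : ℂ) :
    |gridAvg s f x| ≤ (s ^ 2)⁻¹ * ∫ y, |f y| := by
  rw [← integral_const_mul]
  refine abs_integral_le_integral_abs.trans (integral_mono_of_nonneg
    (Filter.Eventually.of_forall fun y => abs_nonneg _) (hf.integrable.abs.const_mul _)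
    (Filter.Eventually.of_forall fun y => ?_))
  simp only [abs_mul, abs_of_nonneg (gridKer_nonneg s x y)]
  exact mul_le_mul_of_nonneg_right (gridKer_le s x y) (abs_nonneg _)

lemma IsNice.gridAvg {f : ℂ → ℝ} (hf : IsNice f) {s : ℝ} (hs : 0 < s) : IsNice (gridAvg s f) := by
  obtain ⟨M, hM⟩ := hf.bdd
  obtain ⟨R, hR⟩ := hf.supp
  refine ⟨?_, ⟨M, abs_gridAvg_le hs hM⟩, ⟨R + 4 * s, fun x hx => ?_⟩⟩
  · have hm : Measurable fun z : ℂ × ℂ => gridKer s z.1 z.2 * f z.2 :=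
      (measurable_gridKer s).mul (hf.meas.comp measurable_snd)
    exact (hm.stronglyMeasurable.integral_prod_right').measurable
  · rw [_root_.gridAvg, ← integral_zero ℂ ℝ (μ := volume)]
    congr 1 with y
    by_cases h : cell s y = cell s x
    · have h1 := norm_sub_le_of_cell_eq hs h.symm
      have h2 := norm_sub_norm_le x y
      rw [hR y (by linarith), mul_zero]
    · rw [gridKer, if_neg h, zero_mul]

lemma gridAvg_eq_self {s : ℝ} (hs : 0 < s) {f : ℂ → ℝ}
    (h : ∀ x y, cell s x = cell s y → f x = f y) (x : ℂ) : gridAvg s f x = f x := by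
  have : ∀ y, gridKer s x y * f y = gridKer s x y * f x := fun y => by
    by_cases hy : cell s y = cell s x
    · rw [h y x hy]
    · rw [gridKer, if_neg hy, zero_mul, zero_mul]
  rw [gridAvg]
  simp_rw [this]
  rw [integral_mul_const, integral_gridKer hs, one_mul]

lemma gridAvg_sub {f g : ℂ → ℝ} (hf : IsNice f) (hg : IsNice g) {s : ℝ} (hs : 0 < s) (x : ℂ) :
    gridAvg s (fun y => f y - g y) x = gridAvg s f x - gridAvg s g x := by
  unfold gridAvg
  rw [← integral_sub (hf.integrable_mul (isNice_gridKer hs x))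
    (hg.integrable_mul (isNice_gridKer hs x))]
  simp only [mul_sub]

lemma gridAvg_add {f g : ℂ → ℝ} (hf : IsNice f) (hg : IsNice g) {s : ℝ} (hs : 0 < s) (x : ℂ) :
    gridAvg s (fun y => f y + g y) x = gridAvg s f x + gridAvg s g x := by
  unfold gridAvg
  rw [← integral_add (hf.integrable_mul (isNice_gridKer hs x))
    (hg.integrable_mul (isNice_gridKer hs x))]
  simp only [mul_add]

lemma gridAvg_const_mul (c s : ℝ) (f : ℂ → ℝ) (x : ℂ) :
    gridAvg s (fun y => c * f y) x = c * gridAvg s f x := by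
  unfold gridAvg
  rw [← integral_const_mul]
  congr 1 with y
  ring

/-- Averaging over a grid is self-adjoint. -/
lemma integral_mul_gridAvg {f h : ℂ → ℝ} (hf : IsNice f) (hh : IsNice h) (s : ℝ) :
    ∫ x, h x * gridAvg s f x = ∫ y, gridAvg s h y * f y := by
  have hint : Integrable (fun z : ℂ × ℂ => h z.1 * (gridKer s z.1 z.2 * f z.2))
      ((volume : Measure ℂ).prod volume) := by
    have h1 : Integrable (fun z : ℂ × ℂ => h z.1 * f z.2) ((volume : Measure ℂ).prod volume) :=
      hh.integrable.mul_prod hf.integrable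
    have h2 : (fun z : ℂ × ℂ => h z.1 * (gridKer s z.1 z.2 * f z.2)) =
        fun z => gridKer s z.1 z.2 * (h z.1 * f z.2) := by ext z; ring
    rw [h2]
    refine h1.bdd_mul (c := (s ^ 2)⁻¹) (measurable_gridKer s).aestronglyMeasurable
      (Filter.Eventually.of_forall fun z => ?_)
    rw [Real.norm_eq_abs, abs_of_nonneg (gridKer_nonneg s _ _)]
    exact gridKer_le s _ _
  calc ∫ x, h x * gridAvg s f x = ∫ x, ∫ y, h x * (gridKer s x y * f y) := by
        congr 1 with x
        rw [gridAvg, integral_const_mul]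
    _ = ∫ y, ∫ x, h x * (gridKer s x y * f y) := integral_integral_swap hint
    _ = _ := by
        congr 1 with y
        rw [gridAvg, ← integral_mul_const]
        congr 1 with x
        rw [gridKer_comm]
        ring

lemma gridAvg_gridAvg_half {f : ℂ → ℝ} (hf : IsNice f) {s : ℝ} (hs : 0 < s) (x : ℂ) :
    gridAvg s (gridAvg (s / 2) f) x = gridAvg s f x := by
  rw [gridAvg, integral_mul_gridAvg hf (isNice_gridKer hs x) (s / 2)]
  congr 1 with y
  rw [gridAvg_eq_self (half_pos hs) fun u v huv => ?_]
  rw [gridKer, gridKer, cell_eq_of_cell_half huv]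

lemma gridAvg_gridAvg {f : ℂ → ℝ} {s : ℝ} (hs : 0 < s) (x : ℂ) :
    gridAvg s (gridAvg s f) x = gridAvg s f x :=
  gridAvg_eq_self hs (fun _ _ h => gridAvg_congr f h) x

lemma ofReal_abs_integral_le (f : ℂ → ℝ) :
    ENNReal.ofReal |∫ y, f y| ≤ ∫⁻ y, ENNReal.ofReal |f y| := by
  rw [← Real.norm_eq_abs, ofReal_norm]
  refine (enorm_integral_le_lintegral_enorm _).trans (le_of_eq ?_)
  congr 1 with y
  rw [← Real.norm_eq_abs, ofReal_norm]

/-- Averaging over a grid contracts `L^p`. -/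
lemma lintegral_gridAvg_rpow_le {p : ℝ} (hp : 1 < p) {f : ℂ → ℝ} (hf : Measurable f) {s : ℝ}
    (hs : 0 < s) : ∫⁻ x, ENNReal.ofReal |gridAvg s f x| ^ p ≤ ∫⁻ x, ENNReal.ofReal |f x| ^ p := by
  have h := lintegral_rpow_schur hp (K := fun x y => ENNReal.ofReal (gridKer s x y))
    (measurable_gridKer s).ennreal_ofReal (A := 1) (B := 1)
    (fun x => (lintegral_gridKer hs x).le)
    (fun y => by simp_rw [gridKer_comm s _ y]; exact (lintegral_gridKer hs y).le)
    hf.abs.ennreal_ofReal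
  rw [ENNReal.one_rpow, one_mul, one_mul] at h
  refine (lintegral_mono fun x => ?_).trans h
  refine ENNReal.rpow_le_rpow ?_ (by linarith)
  refine (ofReal_abs_integral_le _).trans (lintegral_mono fun y => ?_)
  rw [abs_mul, abs_of_nonneg (gridKer_nonneg s x y), ENNReal.ofReal_mul (gridKer_nonneg s x y)]

lemma clarkson_scalar {p : ℝ} (hp : 2 ≤ p) (u v : ℝ) :
    |(u + v) / 2| ^ p + |(u - v) / 2| ^ p ≤ (|u| ^ p + |v| ^ p) / 2 := by
  have hpow : ∀ a : ℝ, |a| ^ p = (a ^ 2) ^ (p / 2) := fun a => by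
    rw [← sq_abs, ← Real.rpow_natCast, ← Real.rpow_mul (abs_nonneg _)]
    congr 1; push_cast; ring
  rw [hpow, hpow, hpow, hpow]
  have hp2 : 1 ≤ p / 2 := by linarith
  have h1 : (((u + v) / 2) ^ 2) ^ (p / 2) + (((u - v) / 2) ^ 2) ^ (p / 2) ≤
      (((u + v) / 2) ^ 2 + ((u - v) / 2) ^ 2) ^ (p / 2) :=
    Real.add_rpow_le_rpow_add (sq_nonneg _) (sq_nonneg _) hp2
  have h2 := (convexOn_rpow hp2).2 (Set.mem_Ici.2 (sq_nonneg u)) (Set.mem_Ici.2 (sq_nonneg v))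
    (by norm_num : (0 : ℝ) ≤ 1 / 2) (by norm_num : (0 : ℝ) ≤ 1 / 2) (by norm_num)
  simp only [smul_eq_mul] at h2
  refine h1.trans ?_
  rw [show ((u + v) / 2) ^ 2 + ((u - v) / 2) ^ 2 = 1 / 2 * u ^ 2 + 1 / 2 * v ^ 2 by ring]
  linarith

/-- The martingale difference between the grids of sides `s / 2` and `s`. -/
def gridDiff (s : ℝ) (f : ℂ → ℝ) (x : ℂ) : ℝ := gridAvg (s / 2) f x - gridAvg s f x

lemma IsNice.gridDiff {f : ℂ → ℝ} (hf : IsNice f) {s : ℝ} (hs : 0 < s) : IsNice (gridDiff s f) :=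
  (hf.gridAvg (half_pos hs)).sub (hf.gridAvg hs)

lemma gridAvg_gridDiff {f : ℂ → ℝ} (hf : IsNice f) {s : ℝ} (hs : 0 < s) (x : ℂ) :
    gridAvg s (gridDiff s f) x = 0 := by
  have h := gridAvg_sub (hf.gridAvg (half_pos hs)) (hf.gridAvg hs) hs x
  rw [gridAvg_gridAvg_half hf hs, gridAvg_gridAvg hs, sub_self] at h
  exact h

lemma gridDiff_congr {s : ℝ} (f : ℂ → ℝ) {x x' : ℂ} (h : cell (s / 2) x = cell (s / 2) x') :
    gridDiff s f x = gridDiff s f x' := by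
  rw [gridDiff, gridDiff, gridAvg_congr f h, gridAvg_congr f (cell_eq_of_cell_half h)]

lemma IsNice.lintegral_rpow_ne_top {f : ℂ → ℝ} (hf : IsNice f) {p : ℝ} (hp : 0 < p) :
    ∫⁻ x, ENNReal.ofReal |f x| ^ p ≠ ⊤ := by
  obtain ⟨M, hM⟩ := hf.bdd
  obtain ⟨R, hR⟩ := hf.supp
  have hb := (isBounded_norm_le R).measure_lt_top (μ := volume)
  refine ne_top_of_le_ne_top (b := ENNReal.ofReal M ^ p * volume {x : ℂ | ‖x‖ ≤ R})
    (ENNReal.mul_ne_top (ENNReal.rpow_ne_top_of_nonneg hp.le ENNReal.ofReal_ne_top) hb.ne) ?_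
  rw [← setLIntegral_const, ← lintegral_indicator (measurableSet_le measurable_norm measurable_const)]
  refine lintegral_mono fun x => ?_
  by_cases hx : ‖x‖ ≤ R
  · simp only [Set.indicator, Set.mem_ofPred_eq, hx, if_true]
    gcongr
    exact hM x
  · simp [hR x (not_le.1 hx), ENNReal.zero_rpow_of_pos hp]

lemma lintegral_gridDiff_rpow_le {p : ℝ} (hp : 2 ≤ p) {f : ℂ → ℝ} (hf : IsNice f) {s : ℝ}
    (hs : 0 < s) :
    (∫⁻ x, ENNReal.ofReal |gridAvg s f x| ^ p) +
        ENNReal.ofReal (2 ^ (1 - p)) * ∫⁻ x, ENNReal.ofReal |gridDiff s f x| ^ p ≤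
      ∫⁻ x, ENNReal.ofReal |gridAvg (s / 2) f x| ^ p := by
  have hp0 : 0 < p := by linarith
  set u := gridAvg (s / 2) f with hu
  set v := gridAvg s f with hv
  have nu : IsNice u := hf.gridAvg (half_pos hs)
  have nv : IsNice v := hf.gridAvg hs
  have nm : IsNice fun x => (1 / 2 : ℝ) * (u x + v x) := (nu.add nv).const_mul _
  have hmid : ∫⁻ x, ENNReal.ofReal |v x| ^ p ≤
      ∫⁻ x, ENNReal.ofReal |(1 / 2 : ℝ) * (u x + v x)| ^ p := by
    refine le_trans (le_of_eq ?_) (lintegral_gridAvg_rpow_le (by linarith) nm.meas hs)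
    congr 1 with x
    congr 3
    rw [gridAvg_const_mul, gridAvg_add nu nv hs, hu, gridAvg_gridAvg_half hf hs, hv,
      gridAvg_gridAvg hs]
    ring
  have hpt : ∀ x, ENNReal.ofReal |(1 / 2 : ℝ) * (u x + v x)| ^ p +
      ENNReal.ofReal (2 ^ (-p)) * ENNReal.ofReal |gridDiff s f x| ^ p ≤
      ENNReal.ofReal (1 / 2) * ENNReal.ofReal |u x| ^ p +
        ENNReal.ofReal (1 / 2) * ENNReal.ofReal |v x| ^ p := by
    intro x
    simp only [ENNReal.ofReal_rpow_of_nonneg (abs_nonneg _) hp0.le]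
    rw [← ENNReal.ofReal_mul (by positivity), ← ENNReal.ofReal_mul (by positivity),
      ← ENNReal.ofReal_mul (by positivity), ← ENNReal.ofReal_add (by positivity) (by positivity),
      ← ENNReal.ofReal_add (by positivity) (by positivity)]
    apply ENNReal.ofReal_le_ofReal
    have h := clarkson_scalar hp (u x) (v x)
    have h2 : |(u x - v x) / 2| ^ p = 2 ^ (-p) * |gridDiff s f x| ^ p := by
      rw [abs_div, Real.div_rpow (abs_nonneg _) (abs_nonneg _), abs_two, Real.rpow_neg (by norm_num),
        div_eq_inv_mul]
      rfl
    rw [h2, show (u x + v x) / 2 = 1 / 2 * (u x + v x) by ring] at h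
    linarith
  have hint := lintegral_mono (μ := (volume : Measure ℂ)) hpt
  have m1 : Measurable fun x => ENNReal.ofReal |(1 / 2 : ℝ) * (u x + v x)| ^ p :=
    (nm.meas.abs.ennreal_ofReal).pow_const p
  have m2 : Measurable fun x => ENNReal.ofReal |u x| ^ p :=
    (nu.meas.abs.ennreal_ofReal).pow_const p
  rw [lintegral_add_left m1, lintegral_const_mul' _ _ ENNReal.ofReal_ne_top,
    lintegral_add_left (m2.const_mul _), lintegral_const_mul' _ _ ENNReal.ofReal_ne_top,
    lintegral_const_mul' _ _ ENNReal.ofReal_ne_top] at hint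
  have hfin : ∫⁻ x, ENNReal.ofReal |v x| ^ p ≠ ⊤ := nv.lintegral_rpow_ne_top hp0
  set V := ∫⁻ x, ENNReal.ofReal |v x| ^ p
  set U := ∫⁻ x, ENNReal.ofReal |u x| ^ p
  set D := ∫⁻ x, ENNReal.ofReal |gridDiff s f x| ^ p
  have h3 : V + ENNReal.ofReal (2 ^ (-p)) * D ≤
      ENNReal.ofReal (1 / 2) * U + ENNReal.ofReal (1 / 2) * V := by
    refine le_trans ?_ hint
    gcongr
  have h4 : ENNReal.ofReal 2 * ENNReal.ofReal (1 / 2) = 1 := by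
    rw [← ENNReal.ofReal_mul (by norm_num)]; norm_num
  have h5 : ENNReal.ofReal 2 * ENNReal.ofReal (2 ^ (-p)) = ENNReal.ofReal (2 ^ (1 - p)) := by
    rw [← ENNReal.ofReal_mul (by norm_num), sub_eq_add_neg, Real.rpow_add (by norm_num),
      Real.rpow_one]
  have h6 : V + (V + ENNReal.ofReal (2 ^ (1 - p)) * D) ≤ V + U := by
    calc _ = ENNReal.ofReal 2 * (V + ENNReal.ofReal (2 ^ (-p)) * D) := by
          rw [mul_add, ← mul_assoc, h5, ← add_assoc, ← two_mul]; norm_num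
      _ ≤ ENNReal.ofReal 2 * (ENNReal.ofReal (1 / 2) * U + ENNReal.ofReal (1 / 2) * V) := by gcongr
      _ = _ := by rw [mul_add, ← mul_assoc, ← mul_assoc, h4, one_mul, one_mul, add_comm]
  exact (ENNReal.add_le_add_iff_left hfin).1 h6

/-- The `L^p` square function estimate for martingale differences. -/
lemma tsum_lintegral_gridDiff_le {p : ℝ} (hp : 2 ≤ p) {f : ℂ → ℝ} (hf : IsNice f) :
    ∑' n : ℤ, ∫⁻ x, ENNReal.ofReal |gridDiff (2 ^ n) f x| ^ p ≤
      ENNReal.ofReal (2 ^ (p - 1)) * ∫⁻ x, ENNReal.ofReal |f x| ^ p := by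
  have hp0 : 0 < p := by linarith
  set a : ℤ → ℝ≥0∞ := fun n => ∫⁻ x, ENNReal.ofReal |gridAvg (2 ^ n) f x| ^ p with ha
  set d : ℤ → ℝ≥0∞ := fun n => ∫⁻ x, ENNReal.ofReal |gridDiff (2 ^ n) f x| ^ p with hd
  have hstep : ∀ n : ℤ, a (n + 1) + ENNReal.ofReal (2 ^ (1 - p)) * d (n + 1) ≤ a n := by
    intro n
    have h := lintegral_gridDiff_rpow_le hp hf (s := (2 : ℝ) ^ (n + 1)) (by positivity)
    have e : (2 : ℝ) ^ (n + 1) / 2 = 2 ^ n := by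
      rw [zpow_add_one₀ two_ne_zero]; field_simp
    rw [e] at h
    exact h
  have hsum : ∀ (m : ℤ) (k : ℕ), a (m + k) + ENNReal.ofReal (2 ^ (1 - p)) *
      ∑ n ∈ Finset.Ioc m (m + k), d n ≤ a m := by
    intro m k
    induction k with
    | zero => simp
    | succ k ih =>
      have e : Finset.Ioc m (m + (k + 1 : ℕ)) = insert (m + k + 1) (Finset.Ioc m (m + k)) := by
        ext i; simp only [Finset.mem_Ioc, Finset.mem_insert]; push_cast; omega
      rw [e, Finset.sum_insert (by simp), mul_add, ← add_assoc]
      refine le_trans ?_ ih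
      gcongr
      have := hstep (m + k)
      push_cast
      rwa [← add_assoc]
  have hbound : ENNReal.ofReal (2 ^ (1 - p)) * ∑' n, d n ≤ ∫⁻ x, ENNReal.ofReal |f x| ^ p := by
    rw [← ENNReal.tsum_mul_left, ENNReal.tsum_eq_iSup_sum]
    refine iSup_le fun S => ?_
    obtain ⟨m, hm⟩ := S.bddAbove
    obtain ⟨M, hM⟩ := S.bddBelow
    set l : ℤ := M - 1
    have hsub : S ⊆ Finset.Ioc l (l + (m - l).toNat) := by
      intro i hi
      have h1 : i ≤ m := hm hi
      have h2 : M ≤ i := hM hi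
      rw [Finset.mem_Ioc]
      have h3 : l = M - 1 := rfl
      omega
    calc _ ≤ ∑ n ∈ Finset.Ioc l (l + (m - l).toNat), ENNReal.ofReal (2 ^ (1 - p)) * d n :=
          Finset.sum_le_sum_of_subset hsub
      _ ≤ a l := by
          rw [← Finset.mul_sum]
          exact le_add_self.trans (hsum l _)
      _ ≤ _ := lintegral_gridAvg_rpow_le (by linarith) hf.meas (by positivity)
  have h1 : ENNReal.ofReal (2 ^ (p - 1)) * ENNReal.ofReal (2 ^ (1 - p)) = 1 := by
    rw [← ENNReal.ofReal_mul (by positivity), ← Real.rpow_add (by norm_num)]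
    norm_num
  calc _ = ENNReal.ofReal (2 ^ (p - 1)) * (ENNReal.ofReal (2 ^ (1 - p)) * ∑' n, d n) := by
        rw [← mul_assoc, h1, one_mul]
    _ ≤ _ := by gcongr

/-! ### Gains from cancellation -/

lemma integral_radial {k : ℝ → ℝ} (hk : Measurable k) {M R : ℝ} (hM : ∀ s, |k s| ≤ M)
    (hR : ∀ s, R < s → k s = 0) {F : ℂ → ℝ} (hF : Measurable F) {B : ℝ} (hB : ∀ y, |F y| ≤ B) :
    ∫ y : ℂ, k (‖y‖ ^ 2) * F y = (1 / 2) * ∫ u in Set.Ioi (0 : ℝ), k u *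
      ∫ θ in Set.Ioo (-Real.pi) Real.pi,
        F (Real.sqrt u * (Real.cos θ + Real.sin θ * Complex.I)) := by
  have hsub := integral_comp_rpow_Ioi_of_pos (g := fun u : ℝ => k u *
      ∫ θ in Set.Ioo (-Real.pi) Real.pi,
        F (Real.sqrt u * (Real.cos θ + Real.sin θ * Complex.I))) (p := 2) (by norm_num)
  have hmeas : Measurable fun y : ℂ => k (‖y‖ ^ 2) * F y :=
    (hk.comp (by fun_prop : Measurable fun y : ℂ => ‖y‖ ^ 2)).mul hF
  rw [integral_polar hmeas (M := M * B) (R := max 1 R) (fun x => by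
      rw [abs_mul]
      exact mul_le_mul (hM _) (hB _) (abs_nonneg _) ((abs_nonneg _).trans (hM 0))) (fun x hx => by
      have h1 := (le_max_left 1 R).trans_lt hx
      have h2 := (le_max_right 1 R).trans_lt hx
      rw [hR _ (by nlinarith), zero_mul]),
    ← hsub, ← integral_const_mul]
  refine setIntegral_congr_fun measurableSet_Ioi fun r hr => ?_
  have hr0 : (0 : ℝ) < r := hr
  have h1 : ∀ θ : ℝ, ‖(r : ℂ) * (Real.cos θ + Real.sin θ * Complex.I)‖ ^ 2 = r ^ 2 := by
    intro θ
    rw [norm_mul, Complex.ofReal_cos, Complex.ofReal_sin, Complex.norm_cos_add_sin_mul_I,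
      Complex.norm_real, mul_one, Real.norm_eq_abs, sq_abs]
  simp only [h1, Real.rpow_two, Real.sqrt_sq hr0.le, smul_eq_mul]
  rw [integral_const_mul, show (2 : ℝ) - 1 = 1 by norm_num, Real.rpow_one]
  ring

lemma integrable_mollifier : Integrable mollifier :=
  mollifier_contDiff.continuous.integrable_of_hasCompactSupport
    (HasCompactSupport.of_support_subset_isCompact (isCompact_Icc (a := (-1 : ℝ)) (b := 1))
      fun _ hs => abs_le.1 (not_lt.1 fun h => hs (mollifier_zero h)))

lemma integral_osc : ∫ s, osc s = 0 := by
  simp_rw [osc_eq]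
  rw [integral_sub integrable_mollifier ((integrable_mollifier.comp_div two_ne_zero).const_mul _),
    integral_const_mul, Measure.integral_comp_div, integral_mollifier]
  norm_num

lemma integral_Ioi_scaled {k : ℝ → ℝ} (hk : ∀ s, 2 < |s| → k s = 0) {δ w : ℝ} (hδ : 0 < δ)
    (hw : 2 * δ < w) : ∫ u in Set.Ioi (0 : ℝ), δ⁻¹ * k ((u - w) / δ) = ∫ s, k s := by
  have h1 : ∫ u in Set.Ioi (0 : ℝ), δ⁻¹ * k ((u - w) / δ) = ∫ u : ℝ, δ⁻¹ * k ((u - w) / δ) := by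
    refine setIntegral_eq_integral_of_forall_compl_eq_zero fun u hu => ?_
    have hu' : u ≤ 0 := not_lt.1 hu
    rw [hk, mul_zero]
    rw [abs_div, abs_of_pos hδ, lt_div_iff₀ hδ, abs_sub_comm]
    exact (by linarith : 2 * δ < w - u).trans_le (le_abs_self _)
  rw [h1, integral_const_mul, integral_sub_right_eq_self (fun u => k (u / δ)) w,
    Measure.integral_comp_div, abs_of_pos hδ, smul_eq_mul, inv_mul_cancel_left₀ hδ.ne']

lemma isNice_kernel {k k₁ k₂ : ℝ → ℝ} {M : ℝ} (hk : IsOscKernel k k₁ k₂ M) {δ : ℝ} (hδ : 0 < δ)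
    {w : ℝ} (hδ8 : δ ≤ 1 / 8) (hw : w ∈ Set.Icc (1 : ℝ) 4) (x : ℂ) :
    IsNice fun y => δ⁻¹ * k ((‖x - y‖ ^ 2 - w) / δ) := by
  refine ⟨?_, ⟨δ⁻¹ * M, fun y => ?_⟩, ⟨‖x‖ + 3, fun y hy => ?_⟩⟩
  · exact (hk.cont.measurable.comp (by fun_prop)).const_mul _
  · rw [abs_mul, abs_of_pos (inv_pos.2 hδ)]
    exact mul_le_mul_of_nonneg_left (hk.bd _).1 (inv_pos.2 hδ).le
  · by_contra h
    have h1 := osc_arg_bound hk hδ (right_ne_zero_of_mul h)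
    have h2 := (annulus_bound hδ8 hw (norm_nonneg _) h1).2
    have h3 := norm_sub_norm_le y x
    rw [norm_sub_rev] at h3
    linarith

lemma integral_osc_kernel {δ w : ℝ} (hδ : 0 < δ) (hδ8 : δ ≤ 1 / 8) (hw : w ∈ Set.Icc (1 : ℝ) 4)
    (x : ℂ) : ∫ y, δ⁻¹ * osc ((‖x - y‖ ^ 2 - w) / δ) = 0 := by
  obtain ⟨M, hM0, hM, -⟩ := exists_osc_bound
  rw [integral_sub_left_eq_self (fun y : ℂ => δ⁻¹ * osc ((‖y‖ ^ 2 - w) / δ)) volume x]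
  have h := integral_radial (k := fun u => δ⁻¹ * osc ((u - w) / δ)) (M := δ⁻¹ * M) (R := w + 2 * δ)
    ((hM.cont.measurable.comp (by fun_prop)).const_mul _) (fun s => by
      rw [abs_mul, abs_of_pos (inv_pos.2 hδ)]
      exact mul_le_mul_of_nonneg_left (hM.bd _).1 (inv_pos.2 hδ).le) (fun s hs => by
      rw [osc_zero, mul_zero]
      rw [abs_div, abs_of_pos hδ, lt_div_iff₀ hδ]
      exact (by linarith : 2 * δ < s - w).trans_le (le_abs_self _))
    (F := fun _ => 1) measurable_const (B := 1) (fun _ => by simp)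
  simp only [mul_one] at h
  rw [h, integral_mul_const, integral_Ioi_scaled (fun s hs => osc_zero hs) hδ (by
    linarith [hw.1]), integral_osc]
  ring

lemma abs_osc_sub_le {M : ℝ}
    (h' : IsOscKernel oscDeriv osc osc1 M) (a b : ℝ) : |osc a - osc b| ≤ M * |a - b| := by
  have := convex_univ.norm_image_sub_le_of_norm_hasDerivWithin_le (f := osc) (f' := oscDeriv)
    (C := M) (x := b) (y := a) (s := Set.univ) (fun s _ => (h'.d₁ s).hasDerivWithinAt)
    (fun s _ => (h'.bd s).1) (Set.mem_univ _) (Set.mem_univ _)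
  exact this

lemma lintegral_ball_rpow_le {p : ℝ} (hp : 1 < p) {R : ℝ} (hR : 0 ≤ R) {g : ℂ → ℝ≥0∞}
    (hg : Measurable g) : ∫⁻ x, (∫⁻ y in {y : ℂ | ‖x - y‖ ≤ R}, g y) ^ p ≤
      ENNReal.ofReal (Real.pi * R ^ 2) ^ p * ∫⁻ y, g y ^ p := by
  have hset : MeasurableSet {z : ℂ × ℂ | ‖z.1 - z.2‖ ≤ R} :=
    measurableSet_le (by fun_prop) measurable_const
  have hs : ∀ x : ℂ, MeasurableSet {y : ℂ | ‖x - y‖ ≤ R} := fun x =>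
    measurableSet_le (by fun_prop) measurable_const
  have hind : ∀ x y : ℂ, {z : ℂ × ℂ | ‖z.1 - z.2‖ ≤ R}.indicator (fun _ => (1 : ℝ≥0∞)) (x, y) =
      {y : ℂ | ‖x - y‖ ≤ R}.indicator 1 y := fun x y => rfl
  have hind' : ∀ x y : ℂ, {z : ℂ × ℂ | ‖z.1 - z.2‖ ≤ R}.indicator (fun _ => (1 : ℝ≥0∞)) (x, y) =
      {x : ℂ | ‖x - y‖ ≤ R}.indicator 1 x := fun x y => rfl
  have h := lintegral_rpow_schur hp
    (K := fun x y => {z : ℂ × ℂ | ‖z.1 - z.2‖ ≤ R}.indicator (fun _ => (1 : ℝ≥0∞)) (x, y))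
    (measurable_const.indicator hset) (A := ENNReal.ofReal (Real.pi * R ^ 2))
    (B := ENNReal.ofReal (Real.pi * R ^ 2))
    (fun x => by
      simp_rw [hind]
      rw [lintegral_indicator_one (hs x)]
      simp_rw [norm_sub_rev x]
      exact (volume_norm_sub_le x hR).le)
    (fun y => by
      simp_rw [hind']
      rw [lintegral_indicator_one (measurableSet_norm_sub_le y R)]
      exact (volume_norm_sub_le y hR).le) hg
  have h1 : ENNReal.ofReal (Real.pi * R ^ 2) ^ (p - 1) * ENNReal.ofReal (Real.pi * R ^ 2) =
      ENNReal.ofReal (Real.pi * R ^ 2) ^ p := by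
    nth_rewrite 2 [← ENNReal.rpow_one (ENNReal.ofReal (Real.pi * R ^ 2))]
    rw [← ENNReal.rpow_add_of_nonneg _ _ (by linarith) (by norm_num), sub_add_cancel]
  rw [h1] at h
  refine le_trans (le_of_eq ?_) h
  congr 1 with x
  rw [← lintegral_indicator (hs x)]
  congr 2 with y
  rw [hind]
  by_cases hy : y ∈ {y : ℂ | ‖x - y‖ ≤ R}
  · rw [Set.indicator_of_mem hy, Set.indicator_of_mem hy, Pi.one_apply, one_mul]
  · rw [Set.indicator_of_notMem hy, Set.indicator_of_notMem hy, zero_mul]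

lemma isNice_osc_kernel {δ w : ℝ} (hδ : 0 < δ) (hδ8 : δ ≤ 1 / 8) (hw : w ∈ Set.Icc (1 : ℝ) 4)
    (x : ℂ) : IsNice fun y => δ⁻¹ * osc ((‖x - y‖ ^ 2 - w) / δ) := by
  obtain ⟨M, -, hM, -⟩ := exists_osc_bound
  exact isNice_kernel hM hδ hδ8 hw x

lemma annAvg_eq_integral (k : ℝ → ℝ) (δ w : ℝ) (f : ℂ → ℝ) (x : ℂ) :
    annAvg k δ w f x = ∫ y, (δ⁻¹ * k ((‖x - y‖ ^ 2 - w) / δ)) * f y := rfl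

/-- Smoothness of the kernel against functions with mean zero on small squares. -/
lemma exists_maxAvg_fine_bound {p : ℝ} (hp : 1 < p) : ∃ C : ℝ, 0 < C ∧ ∀ δ s : ℝ, 0 < δ → δ ≤ 1 / 8 →
    0 < s → s ≤ 1 → ∀ g : ℂ → ℝ, IsNice g → (∀ x, gridAvg s g x = 0) →
    ∫⁻ x, maxAvg δ g x ^ p ≤ ENNReal.ofReal (C * (s / δ ^ 2) ^ p) * ∫⁻ y, ENNReal.ofReal |g y| ^ p := by
  obtain ⟨M, hM0, hM, hM'⟩ := exists_osc_bound
  refine ⟨(72 * M * (Real.pi * 7 ^ 2)) ^ p, by positivity, fun δ s hδ hδ8 hs hs1 g hg hg0 => ?_⟩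
  set c := 72 * M * (s / δ ^ 2) with hc
  have hc0 : 0 < c := by positivity
  have hker : ∀ w ∈ Set.Icc (1 : ℝ) 4, ∀ x y y' : ℂ, cell s y' = cell s y →
      |δ⁻¹ * osc ((‖x - y‖ ^ 2 - w) / δ) - δ⁻¹ * osc ((‖x - y'‖ ^ 2 - w) / δ)| ≤
        if ‖x - y‖ ≤ 7 then c else 0 := by
    intro w hw x y y' hy
    have h1 := norm_sub_le_of_cell_eq hs hy
    have h2 : |‖x - y‖ - ‖x - y'‖| ≤ ‖y' - y‖ := by
      have := abs_norm_sub_norm_le (x - y) (x - y')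
      rwa [show x - y - (x - y') = y' - y by ring] at this
    have h2' := abs_le.1 h2
    split_ifs with h7
    · rw [← mul_sub, abs_mul, abs_of_pos (inv_pos.2 hδ)]
      calc _ ≤ δ⁻¹ * (M * |(‖x - y‖ ^ 2 - w) / δ - (‖x - y'‖ ^ 2 - w) / δ|) := by
            gcongr; exact abs_osc_sub_le hM' _ _
        _ = δ⁻¹ * (M * (|‖x - y‖ - ‖x - y'‖| * (‖x - y‖ + ‖x - y'‖) / δ)) := by
            rw [← sub_div, abs_div, abs_of_pos hδ, show ‖x - y‖ ^ 2 - w - (‖x - y'‖ ^ 2 - w) =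
              (‖x - y‖ - ‖x - y'‖) * (‖x - y‖ + ‖x - y'‖) by ring, abs_mul,
              abs_of_nonneg (add_nonneg (norm_nonneg (x - y)) (norm_nonneg (x - y')))]
        _ ≤ δ⁻¹ * (M * ((4 * s) * 18 / δ)) := by
            gcongr
            · linarith
            · linarith
        _ = c := by rw [hc]; field_simp; ring
    · have hz : ∀ z : ℂ, 3 < ‖x - z‖ → osc ((‖x - z‖ ^ 2 - w) / δ) = 0 := by
        intro z hz
        by_contra h
        have h3 := (annulus_bound hδ8 hw (norm_nonneg _) (osc_arg_bound hM hδ h)).2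
        linarith
      rw [hz y (by linarith), hz y' (by linarith)]
      simp
  have hpt : ∀ x, maxAvg δ g x ≤
      ENNReal.ofReal c * ∫⁻ y in {y : ℂ | ‖x - y‖ ≤ 7}, ENNReal.ofReal |g y| := by
    intro x
    refine iSup₂_le fun w hw => ?_
    set h := fun y => δ⁻¹ * osc ((‖x - y‖ ^ 2 - w) / δ) with hh
    have nh : IsNice h := isNice_osc_kernel hδ hδ8 hw x
    have h0 : ∫ y, gridAvg s h y * g y = 0 := by
      rw [← integral_mul_gridAvg hg nh s]
      simp [hg0]
    have h1 : annAvg osc δ w g x = ∫ y, (h y - gridAvg s h y) * g y := by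
      rw [annAvg_eq_integral]
      simp_rw [sub_mul]
      rw [integral_sub (hg.integrable_mul nh) (hg.integrable_mul (nh.gridAvg hs)), h0, sub_zero]
    have h2 : ∀ y, |h y - gridAvg s h y| ≤ if ‖x - y‖ ≤ 7 then c else 0 := by
      intro y
      have e : h y - gridAvg s h y = ∫ y', gridKer s y y' * (h y - h y') := by
        simp_rw [mul_sub]
        rw [integral_sub ((isNice_gridKer hs y).integrable.mul_const _)
          (nh.integrable_mul (isNice_gridKer hs y)), integral_mul_const, integral_gridKer hs, one_mul]
        rfl
      rw [e]
      calc _ ≤ ∫ y', gridKer s y y' * (if ‖x - y‖ ≤ 7 then c else 0) := by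
            refine abs_integral_le_integral_abs.trans (integral_mono_of_nonneg
              (Filter.Eventually.of_forall fun y => abs_nonneg _)
              ((isNice_gridKer hs y).integrable.mul_const _)
              (Filter.Eventually.of_forall fun y' => ?_))
            simp only [abs_mul, abs_of_nonneg (gridKer_nonneg s y y')]
            by_cases hy : cell s y' = cell s y
            · exact mul_le_mul_of_nonneg_left (hker w hw x y y' hy) (gridKer_nonneg s y y')
            · rw [gridKer, if_neg hy, zero_mul, zero_mul]
        _ = _ := by rw [integral_mul_const, integral_gridKer hs, one_mul]
    rw [h1, ← lintegral_const_mul' _ _ ENNReal.ofReal_ne_top, ← lintegral_indicator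
      (measurableSet_le (by fun_prop) measurable_const)]
    refine (ofReal_abs_integral_le _).trans (lintegral_mono fun y => ?_)
    rw [abs_mul, ENNReal.ofReal_mul (abs_nonneg _)]
    have h3 := h2 y
    by_cases hy : ‖x - y‖ ≤ 7
    · rw [if_pos hy] at h3
      rw [Set.indicator_of_mem (show y ∈ {y : ℂ | ‖x - y‖ ≤ 7} from hy)]
      gcongr
    · rw [if_neg hy] at h3
      rw [le_antisymm h3 (abs_nonneg _)]
      simp
  calc _ ≤ ∫⁻ x, ENNReal.ofReal c ^ p *
        (∫⁻ y in {y : ℂ | ‖x - y‖ ≤ 7}, ENNReal.ofReal |g y|) ^ p := by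
        refine lintegral_mono fun x => ?_
        rw [← ENNReal.mul_rpow_of_nonneg _ _ (by linarith)]
        exact ENNReal.rpow_le_rpow (hpt x) (by linarith)
    _ ≤ ENNReal.ofReal c ^ p * (ENNReal.ofReal (Real.pi * 7 ^ 2) ^ p *
        ∫⁻ y, ENNReal.ofReal |g y| ^ p) := by
        rw [lintegral_const_mul' _ _ (ENNReal.rpow_ne_top_of_nonneg (by linarith)
          ENNReal.ofReal_ne_top)]
        gcongr
        exact lintegral_ball_rpow_le hp (by norm_num) hg.meas.abs.ennreal_ofReal
    _ = _ := by
        rw [← mul_assoc, ← ENNReal.mul_rpow_of_nonneg _ _ (by linarith),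
          ← ENNReal.ofReal_mul hc0.le, ENNReal.ofReal_rpow_of_nonneg (by positivity) (by linarith),
          ← Real.mul_rpow (by positivity) (by positivity)]
        congr 3
        rw [hc]; ring

/-- The points whose distance to the boundary of their square is at most `3`. -/
def nearBoundary (r : ℝ) : Set ℂ :=
  {x | ¬((r * ⌊x.re / r⌋ + 3 ≤ x.re ∧ x.re < r * ⌊x.re / r⌋ + r - 3) ∧
    (r * ⌊x.im / r⌋ + 3 ≤ x.im ∧ x.im < r * ⌊x.im / r⌋ + r - 3))}

lemma measurableSet_nearBoundary (r : ℝ) : MeasurableSet (nearBoundary r) := by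
  have h : ∀ {u : ℂ → ℝ}, Measurable u → Measurable fun x => (⌊u x / r⌋ : ℝ) := fun hu =>
    measurable_from_top.comp (Int.measurable_floor.comp (hu.div_const r))
  have h1 := h Complex.measurable_re
  have h2 := h Complex.measurable_im
  have h3 : ∀ {u v : ℂ → ℝ}, Measurable u → Measurable v →
      MeasurableSet {x | r * v x + 3 ≤ u x ∧ u x < r * v x + r - 3} := fun hu hv =>
    (measurableSet_le ((hv.const_mul r).add_const 3) hu).inter
      (measurableSet_lt hu (((hv.const_mul r).add_const r).sub_const 3))
  exact ((h3 Complex.measurable_re h1).inter (h3 Complex.measurable_im h2)).compl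

lemma mem_nearBoundary {r : ℝ} (hr : 0 < r) {x y : ℂ} (h : ‖x - y‖ ≤ 3)
    (hne : cell r y ≠ cell r x) : x ∈ nearBoundary r := by
  by_contra hx
  rw [nearBoundary, Set.mem_ofPred_eq, not_not] at hx
  apply hne
  have h1 := abs_le.1 ((Complex.abs_re_le_norm (x - y)).trans h)
  have h2 := abs_le.1 ((Complex.abs_im_le_norm (x - y)).trans h)
  rw [Complex.sub_re] at h1
  rw [Complex.sub_im] at h2
  rw [cell_eq_iff hr, Complex.mem_reProdIm]
  refine ⟨⟨?_, ?_⟩, ⟨?_, ?_⟩⟩ <;> simp only [cell] <;> linarith [hx.1.1, hx.1.2, hx.2.1, hx.2.2]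

lemma volume_cell_inter_nearBoundary {r : ℝ} (hr : 0 < r) (n : ℤ × ℤ) :
    volume ({y | cell r y = n} ∩ nearBoundary r) ≤ ENNReal.ofReal (12 * r) := by
  rcases le_or_gt r 6 with h6 | h6
  · refine (measure_mono Set.inter_subset_left).trans ?_
    rw [volume_cell_eq hr]
    exact ENNReal.ofReal_le_ofReal (by nlinarith)
  · set I := Set.Ico (r * n.1 + 3) (r * n.1 + 3 + (r - 6)) ×ℂ
      Set.Ico (r * n.2 + 3) (r * n.2 + 3 + (r - 6)) with hI
    have hIm : MeasurableSet I := 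
      (measurableSet_Ico.preimage Complex.measurable_re).inter
        (measurableSet_Ico.preimage Complex.measurable_im)
    have hvI : volume I = ENNReal.ofReal ((r - 6) ^ 2) := volume_reProdIm_Ico _ _ (by linarith)
    have hIs : I ⊆ {y | cell r y = n} := by
      intro y hy
      rw [hI, Complex.mem_reProdIm] at hy
      change cell r y = n
      rw [cell_eq_iff hr, Complex.mem_reProdIm]
      refine ⟨⟨?_, ?_⟩, ⟨?_, ?_⟩⟩ <;> linarith [hy.1.1, hy.1.2, hy.2.1, hy.2.2]
    have hsub : {y | cell r y = n} ∩ nearBoundary r ⊆ {y | cell r y = n} \ I := by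
      rintro y ⟨hy, hyb⟩
      refine ⟨hy, fun hyI => hyb ?_⟩
      have hy' : cell r y = n := hy
      have e1 : ⌊y.re / r⌋ = n.1 := congrArg Prod.fst hy'
      have e2 : ⌊y.im / r⌋ = n.2 := congrArg Prod.snd hy'
      rw [hI, Complex.mem_reProdIm] at hyI
      rw [e1, e2]
      refine ⟨⟨?_, ?_⟩, ⟨?_, ?_⟩⟩ <;> linarith [hyI.1.1, hyI.1.2, hyI.2.1, hyI.2.2]
    refine (measure_mono hsub).trans ?_
    rw [measure_sdiff hIs hIm.nullMeasurableSet (by rw [hvI]; exact ENNReal.ofReal_ne_top),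
      volume_cell_eq hr, hvI, ← ENNReal.ofReal_sub _ (sq_nonneg _)]
    exact ENNReal.ofReal_le_ofReal (by nlinarith)

/-- A function that is constant on large squares has little mass near their boundaries. -/
lemma setLIntegral_nearBoundary_le {r : ℝ} (hr : 0 < r) {u : ℂ → ℝ≥0∞} (hu : Measurable u)
    (h : ∀ x y, cell r x = cell r y → u x = u y) :
    ∫⁻ x in nearBoundary r, u x ≤ ENNReal.ofReal (12 / r) * ∫⁻ x, u x := by
  have hm : Measurable fun z : ℂ × ℂ => ENNReal.ofReal (gridKer r z.1 z.2) * u z.2 :=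
    (measurable_gridKer r).ennreal_ofReal.mul (hu.comp measurable_snd)
  have h1 : ∀ x, u x = ∫⁻ y, ENNReal.ofReal (gridKer r x y) * u y := by
    intro x
    have : ∀ y, ENNReal.ofReal (gridKer r x y) * u y = ENNReal.ofReal (gridKer r x y) * u x := by
      intro y
      by_cases hy : cell r y = cell r x
      · rw [h y x hy]
      · rw [gridKer, if_neg hy]; simp
    simp_rw [this]
    rw [lintegral_mul_const _ (isNice_gridKer hr x).meas.ennreal_ofReal, lintegral_gridKer hr,
      one_mul]
  calc _ = ∫⁻ x in nearBoundary r, ∫⁻ y, ENNReal.ofReal (gridKer r x y) * u y := by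
        congr 1 with x
        exact h1 x
    _ = ∫⁻ y, ∫⁻ x in nearBoundary r, ENNReal.ofReal (gridKer r x y) * u y :=
        lintegral_lintegral_swap hm.aemeasurable
    _ ≤ ∫⁻ y, ENNReal.ofReal (12 / r) * u y := by
        refine lintegral_mono fun y => ?_
        have hy : ∀ x, ENNReal.ofReal (gridKer r x y) =
            {x | cell r x = cell r y}.indicator (fun _ => ENNReal.ofReal (r ^ 2)⁻¹) x := fun x => by
          by_cases hx : cell r x = cell r y
          · simp [gridKer, Set.indicator, hx]
          · simp [gridKer, Set.indicator, hx, Ne.symm hx]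
        have hcm : MeasurableSet {x | cell r x = cell r y} := measurableSet_cell_mem r {cell r y}
        simp_rw [hy]
        rw [lintegral_mul_const _ (measurable_const.indicator hcm), lintegral_indicator hcm,
          setLIntegral_const, Measure.restrict_apply hcm]
        gcongr
        calc _ ≤ ENNReal.ofReal (r ^ 2)⁻¹ * ENNReal.ofReal (12 * r) := by
              gcongr; exact volume_cell_inter_nearBoundary hr _
          _ = _ := by
              rw [← ENNReal.ofReal_mul (by positivity)]
              congr 1; field_simp
    _ = _ := lintegral_const_mul' _ _ ENNReal.ofReal_ne_top

/-- Cancellation of the kernel against functions that are constant on large squares. -/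
lemma exists_maxAvg_coarse_bound {p : ℝ} (hp : 1 < p) : ∃ C : ℝ, 0 < C ∧ ∀ δ r : ℝ, 0 < δ →
    δ ≤ 1 / 8 → 0 < r → ∀ g : ℂ → ℝ, IsNice g → (∀ x y, cell r x = cell r y → g x = g y) →
    ∫⁻ x, maxAvg δ g x ^ p ≤ ENNReal.ofReal (C * δ⁻¹ ^ p / r) * ∫⁻ y, ENNReal.ofReal |g y| ^ p := by
  obtain ⟨M, hM0, hM, -⟩ := exists_osc_bound
  refine ⟨12 * (2 * M * (Real.pi * 3 ^ 2)) ^ p, by positivity,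
    fun δ r hδ hδ8 hr g hg hgc => ?_⟩
  set c := δ⁻¹ * M with hc
  have hc0 : 0 < c := by positivity
  set h : ℂ → ℝ≥0∞ := (nearBoundary r).indicator (fun y => ENNReal.ofReal |g y|) with hh
  have hgm : Measurable fun y => ENNReal.ofReal |g y| := hg.meas.abs.ennreal_ofReal
  have hm : Measurable h := hgm.indicator (measurableSet_nearBoundary r)
  have hball : ∀ x : ℂ, MeasurableSet {y : ℂ | ‖x - y‖ ≤ 3} := fun x =>
    measurableSet_le (by fun_prop) measurable_const
  have hvol : ∀ x : ℂ, volume {y : ℂ | ‖x - y‖ ≤ 3} = ENNReal.ofReal (Real.pi * 3 ^ 2) := by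
    intro x
    simp_rw [norm_sub_rev x]
    exact volume_norm_sub_le x (by norm_num)
  have hpt : ∀ x, maxAvg δ g x ≤ ENNReal.ofReal c *
      ((∫⁻ y in {y : ℂ | ‖x - y‖ ≤ 3}, h y) + ENNReal.ofReal (Real.pi * 3 ^ 2) * h x) := by
    intro x
    refine iSup₂_le fun w hw => ?_
    set k := fun y => δ⁻¹ * osc ((‖x - y‖ ^ 2 - w) / δ) with hk
    have nk : IsNice k := isNice_osc_kernel hδ hδ8 hw x
    have h1 : annAvg osc δ w g x = ∫ y, k y * (g y - g x) := by
      simp_rw [mul_sub]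
      rw [integral_sub (hg.integrable_mul nk) (nk.integrable.mul_const _), integral_mul_const,
        integral_osc_kernel hδ hδ8 hw x, zero_mul, sub_zero, annAvg_eq_integral]
    have h2 : ∀ y, ‖x - y‖ ≤ 3 → ENNReal.ofReal |g y - g x| ≤ h y + h x := by
      intro y hy
      by_cases hxy : cell r y = cell r x
      · rw [hgc y x hxy]; simp
      · rw [hh, Set.indicator_of_mem (mem_nearBoundary hr hy hxy), Set.indicator_of_mem
          (mem_nearBoundary hr (by rwa [norm_sub_rev]) (Ne.symm hxy)),
          ← ENNReal.ofReal_add (abs_nonneg _) (abs_nonneg _)]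
        exact ENNReal.ofReal_le_ofReal (abs_sub _ _)
    have h3 : ENNReal.ofReal |annAvg osc δ w g x| ≤
        ∫⁻ y in {y : ℂ | ‖x - y‖ ≤ 3}, ENNReal.ofReal c * (h y + h x) := by
      rw [h1, ← lintegral_indicator (hball x)]
      refine (ofReal_abs_integral_le _).trans (lintegral_mono fun y => ?_)
      rw [abs_mul, ENNReal.ofReal_mul (abs_nonneg _)]
      by_cases hy : ‖x - y‖ ≤ 3
      · rw [Set.indicator_of_mem (show y ∈ {y : ℂ | ‖x - y‖ ≤ 3} from hy)]
        gcongr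
        · rw [hk, abs_mul, abs_of_pos (inv_pos.2 hδ)]
          exact mul_le_mul_of_nonneg_left (hM.bd _).1 (inv_pos.2 hδ).le
        · exact h2 y hy
      · have : k y = 0 := by
          by_contra h0
          have := (annulus_bound hδ8 hw (norm_nonneg _)
            (osc_arg_bound hM hδ (right_ne_zero_of_mul h0))).2
          linarith
        rw [this]; simp
    refine h3.trans (le_of_eq ?_)
    rw [lintegral_const_mul' _ _ ENNReal.ofReal_ne_top, lintegral_add_right _ measurable_const,
      setLIntegral_const, hvol, mul_comm (h x)]
  have hadd : ∀ a b : ℝ≥0∞, (a + b) ^ p ≤ 2 ^ (p - 1) * (a ^ p + b ^ p) := fun a b =>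
    ENNReal.rpow_add_le_mul_rpow_add_rpow a b hp.le
  have hp0 : 0 ≤ p := by linarith
  set V := ENNReal.ofReal (Real.pi * 3 ^ 2) with hV
  have hnear : ∫⁻ y, h y ^ p ≤ ENNReal.ofReal (12 / r) * ∫⁻ y, ENNReal.ofReal |g y| ^ p := by
    refine le_trans (le_of_eq ?_) (setLIntegral_nearBoundary_le hr (hgm.pow_const p)
      (fun x y hxy => by rw [hgc x y hxy]))
    rw [← lintegral_indicator (measurableSet_nearBoundary r)]
    congr 1 with y
    by_cases hy : y ∈ nearBoundary r
    · rw [hh, Set.indicator_of_mem hy, Set.indicator_of_mem hy]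
    · rw [hh, Set.indicator_of_notMem hy, Set.indicator_of_notMem hy,
        ENNReal.zero_rpow_of_pos (by linarith)]
  calc _ ≤ ∫⁻ x, ENNReal.ofReal c ^ p * (2 ^ (p - 1) *
        ((∫⁻ y in {y : ℂ | ‖x - y‖ ≤ 3}, h y) ^ p + V ^ p * h x ^ p)) := by
        refine lintegral_mono fun x => ?_
        refine (ENNReal.rpow_le_rpow (hpt x) hp0).trans ?_
        rw [ENNReal.mul_rpow_of_nonneg _ _ hp0, ← ENNReal.mul_rpow_of_nonneg V _ hp0]
        gcongr
        exact hadd _ _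
    _ = ENNReal.ofReal c ^ p * (2 ^ (p - 1) *
        ((∫⁻ x, (∫⁻ y in {y : ℂ | ‖x - y‖ ≤ 3}, h y) ^ p) + V ^ p * ∫⁻ x, h x ^ p)) := by
        rw [lintegral_const_mul' _ _ (ENNReal.rpow_ne_top_of_nonneg hp0 ENNReal.ofReal_ne_top),
          lintegral_const_mul' _ _ (ENNReal.rpow_ne_top_of_nonneg (by linarith) (by norm_num)),
          lintegral_add_right _ ((hm.pow_const p).const_mul _),
          lintegral_const_mul _ (hm.pow_const p)]
    _ ≤ ENNReal.ofReal c ^ p * (2 ^ (p - 1) * (V ^ p * (∫⁻ x, h x ^ p) +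
        V ^ p * ∫⁻ x, h x ^ p)) := by
        gcongr
        exact lintegral_ball_rpow_le hp (by norm_num) hm
    _ = (ENNReal.ofReal c * 2 * V) ^ p * ∫⁻ x, h x ^ p := by
        have : (2 : ℝ≥0∞) ^ p = 2 ^ (p - 1) * 2 := by
          nth_rewrite 3 [← ENNReal.rpow_one 2]
          rw [← ENNReal.rpow_add _ _ (by norm_num) (by norm_num), sub_add_cancel]
        rw [ENNReal.mul_rpow_of_nonneg _ _ hp0, ENNReal.mul_rpow_of_nonneg _ _ hp0, this]
        ring
    _ ≤ (ENNReal.ofReal c * 2 * V) ^ p *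
        (ENNReal.ofReal (12 / r) * ∫⁻ y, ENNReal.ofReal |g y| ^ p) := by gcongr
    _ = _ := by
        rw [← mul_assoc, hV, show (2 : ℝ≥0∞) = ENNReal.ofReal 2 by simp,
          ← ENNReal.ofReal_mul hc0.le, ← ENNReal.ofReal_mul (by positivity),
          ENNReal.ofReal_rpow_of_nonneg (by positivity) hp0, ← ENNReal.ofReal_mul (by positivity)]
        congr 2
        rw [hc, show δ⁻¹ * M * 2 * (Real.pi * 3 ^ 2) = (2 * M * (Real.pi * 3 ^ 2)) * δ⁻¹ by ring,
          Real.mul_rpow (by positivity) (by positivity)]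
        ring

lemma min_le_rpow_mul_rpow {a b θ : ℝ} (ha : 0 < a) (hb : 0 < b) (h0 : 0 ≤ θ) (h1 : θ ≤ 1) :
    min a b ≤ a ^ (1 - θ) * b ^ θ := by
  have hm : 0 < min a b := lt_min ha hb
  calc min a b = min a b ^ (1 - θ) * min a b ^ θ := by
        rw [← Real.rpow_add hm, sub_add_cancel, Real.rpow_one]
    _ ≤ _ := mul_le_mul (Real.rpow_le_rpow hm.le (min_le_left _ _) (by linarith))
        (Real.rpow_le_rpow hm.le (min_le_right _ _) h0) (by positivity) (by positivity)

/-- Decay of the maximal operator in the frequency of the kernel and in the distance between the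
scale of the kernel and that of the function. -/
lemma exists_maxAvg_gridDiff_bound {p : ℝ} (hp : 2 < p) : ∃ C a θ N : ℝ, 0 < C ∧ 0 < a ∧ 0 < θ ∧
    8 ≤ N ∧ ∀ μ : ℝ, 0 < μ → N * μ ≤ 1 → ∀ i : ℤ, ∀ f : ℂ → ℝ, IsNice f →
    ∫⁻ x, maxAvg (μ ^ 9000) (gridDiff (2 ^ i) f) x ^ p ≤
      ENNReal.ofReal (C * (μ ^ a * 2 ^ (-(θ * |(i : ℝ)|)))) *
        ∫⁻ y, ENNReal.ofReal |gridDiff (2 ^ i) f y| ^ p := by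
  obtain ⟨C₁, N, hC₁, hN, hmax⟩ := exists_maxAvg_rpow_bound hp
  obtain ⟨C₂, hC₂, hfine⟩ := exists_maxAvg_fine_bound (p := p) (by linarith)
  obtain ⟨C₃, hC₃, hcoarse⟩ := exists_maxAvg_coarse_bound (p := p) (by linarith)
  set e := min 3 (p - 2) with he
  have he0 : 0 < e := lt_min (by norm_num) (by linarith)
  set D := 18000 * p with hD
  have hD0 : 0 < D := by positivity
  set θ := e / (2 * (e + D)) with hθ
  have hθ0 : 0 < θ := by positivity
  have hθ1 : θ ≤ 1 := by rw [hθ, div_le_one (by positivity)]; linarith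
  have hθe : e * (1 - θ) - D * θ = e / 2 := by rw [hθ]; field_simp; ring
  set C₄ := C₂ + 2 * C₃ with hC₄
  have hC₄0 : 0 < C₄ := by positivity
  refine ⟨(2 * C₁) ^ (1 - θ) * C₄ ^ θ, e / 2, θ, N, by positivity, by positivity, hθ0, hN,
    fun μ hμ hNμ i f hf => ?_⟩
  have hμ8 : μ ≤ 1 / 8 := by
    by_contra h
    have := not_le.1 h
    nlinarith
  have hμ1 : μ ≤ 1 := by linarith
  have hδ : μ ^ 9000 ≤ 1 / 8 := (pow_le_of_le_one hμ.le hμ1 (by norm_num)).trans hμ8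
  have h2i : (0 : ℝ) < 2 ^ i := by positivity
  have hg := hf.gridDiff h2i
  set X := ∫⁻ x, maxAvg (μ ^ 9000) (gridDiff (2 ^ i) f) x ^ p with hX
  set I := ∫⁻ y, ENNReal.ofReal |gridDiff (2 ^ i) f y| ^ p with hI
  have hA : X ≤ ENNReal.ofReal (2 * C₁ * μ ^ e) * I := by
    refine (hmax μ hμ hNμ _ hg).trans ?_
    refine mul_le_mul_left (ENNReal.ofReal_le_ofReal ?_) _
    have h3 : μ ^ 3 ≤ μ ^ e := by
      rw [← Real.rpow_natCast]
      exact Real.rpow_le_rpow_of_exponent_ge hμ hμ1 (by push_cast; exact min_le_left _ _)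
    have h4 : μ ^ (p - 2) ≤ μ ^ e := Real.rpow_le_rpow_of_exponent_ge hμ hμ1 (min_le_right _ _)
    nlinarith
  have hμD : μ ^ (-D) = ((μ ^ 9000) ^ 2)⁻¹ ^ p := by
    rw [Real.inv_rpow (by positivity), ← pow_mul, ← Real.rpow_natCast, ← Real.rpow_mul hμ.le,
      Real.rpow_neg hμ.le]
    norm_num [hD]
  have hB : X ≤ ENNReal.ofReal (C₄ * (μ ^ (-D) * 2 ^ (-|(i : ℝ)|))) * I := by
    rcases le_total 0 i with hi | hi
    · refine (hcoarse (μ ^ 9000) (2 ^ i / 2) (by positivity) hδ (by positivity) _ hg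
        fun x y hxy => gridDiff_congr f hxy).trans ?_
      refine mul_le_mul_left (ENNReal.ofReal_le_ofReal ?_) _
      have hi' : (0 : ℝ) ≤ i := by exact_mod_cast hi
      have e1 : (2 : ℝ) ^ (-|(i : ℝ)|) = (2 ^ i)⁻¹ := by
        rw [abs_of_nonneg hi', Real.rpow_neg (by norm_num), Real.rpow_intCast]
      have e2 : (μ ^ 9000)⁻¹ ^ p ≤ μ ^ (-D) := by
        rw [hμD]
        refine Real.rpow_le_rpow (by positivity) (inv_anti₀ (by positivity) ?_) (by linarith)
        exact pow_le_of_le_one (by positivity) (by linarith) (by norm_num)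
      rw [e1]
      calc C₃ * (μ ^ 9000)⁻¹ ^ p / (2 ^ i / 2) = 2 * C₃ * ((μ ^ 9000)⁻¹ ^ p * (2 ^ i)⁻¹) := by
            field_simp
        _ ≤ C₄ * (μ ^ (-D) * (2 ^ i)⁻¹) := by gcongr; linarith
    · have hi' : (i : ℝ) ≤ 0 := by exact_mod_cast hi
      have hs1 : (2 : ℝ) ^ i ≤ 1 := zpow_le_one_of_nonpos₀ (by norm_num) hi
      refine (hfine (μ ^ 9000) (2 ^ i) (by positivity) hδ (by positivity) hs1 _ hg
        fun x => gridAvg_gridDiff hf h2i x).trans ?_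
      refine mul_le_mul_left (ENNReal.ofReal_le_ofReal ?_) _
      have e1 : (2 : ℝ) ^ (-|(i : ℝ)|) = 2 ^ i := by
        rw [abs_of_nonpos hi', neg_neg, Real.rpow_intCast]
      have e2 : ((2 : ℝ) ^ i) ^ p ≤ 2 ^ i :=
        (Real.rpow_le_rpow_of_exponent_ge h2i hs1 (by linarith : (1 : ℝ) ≤ p)).trans_eq
          (Real.rpow_one _)
      rw [e1, div_eq_mul_inv, Real.mul_rpow (by positivity) (by positivity), ← hμD,
        mul_comm (((2 : ℝ) ^ i) ^ p)]
      gcongr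
      linarith
  have hμe : (μ ^ e) ^ (1 - θ) * (μ ^ (-D)) ^ θ = μ ^ (e / 2) := by
    rw [← Real.rpow_mul hμ.le, ← Real.rpow_mul hμ.le, ← Real.rpow_add hμ, ← hθe]
    congr 1; ring
  have h2 : ((2 : ℝ) ^ (-|(i : ℝ)|)) ^ θ = 2 ^ (-(θ * |(i : ℝ)|)) := by
    rw [← Real.rpow_mul (by norm_num)]
    congr 1; ring
  have hmin : X ≤ ENNReal.ofReal (min (2 * C₁ * μ ^ e) (C₄ * (μ ^ (-D) * 2 ^ (-|(i : ℝ)|)))) * I := by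
    rcases min_choice (2 * C₁ * μ ^ e) (C₄ * (μ ^ (-D) * 2 ^ (-|(i : ℝ)|))) with h | h
    · rw [h]; exact hA
    · rw [h]; exact hB
  refine hmin.trans ?_
  refine mul_le_mul_left (ENNReal.ofReal_le_ofReal ?_) _
  refine (min_le_rpow_mul_rpow (by positivity) (by positivity) hθ0.le hθ1).trans_eq ?_
  rw [Real.mul_rpow (x := 2 * C₁) (by positivity) (by positivity),
    Real.mul_rpow (x := C₄) (by positivity) (by positivity),
    Real.mul_rpow (x := μ ^ (-D)) (by positivity) (by positivity), h2, ← hμe]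
  ring

lemma lintegral_tsum_rpow_le {ι α : Type*} [Countable ι] [MeasurableSpace α] (m : Measure α)
    {p : ℝ} (hp : 0 < p) {u : ι → α → ℝ≥0∞} (hu : ∀ n, Measurable (u n)) {r : ι → ℝ≥0∞}
    (hr0 : ∀ n, r n ≠ 0) (hr : ∀ n, r n ≠ ⊤) :
    ∫⁻ x, (∑' n, u n x) ^ p ∂m ≤ (∑' n, r n) ^ p * ∑' n, (r n)⁻¹ ^ p * ∫⁻ x, u n x ^ p ∂m := by
  have hm : Measurable fun x => ∑' n, ((r n)⁻¹ * u n x) ^ p :=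
    Measurable.tsum fun n => ((hu n).const_mul _).pow_const p
  have hpt : ∀ x, (∑' n, u n x) ^ p ≤ (∑' n, r n) ^ p * ∑' n, ((r n)⁻¹ * u n x) ^ p := by
    intro x
    set S := ∑' n, ((r n)⁻¹ * u n x) ^ p with hS
    have h1 : ∀ n, u n x ≤ r n * S ^ (1 / p) := by
      intro n
      have h2 : (r n)⁻¹ * u n x ≤ S ^ (1 / p) := by
        rw [← ENNReal.rpow_le_rpow_iff hp, ← ENNReal.rpow_mul, one_div_mul_cancel hp.ne',
          ENNReal.rpow_one]
        exact ENNReal.le_tsum (f := fun n => ((r n)⁻¹ * u n x) ^ p) n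
      calc u n x = r n * ((r n)⁻¹ * u n x) := by
            rw [← mul_assoc, ENNReal.mul_inv_cancel (hr0 n) (hr n), one_mul]
        _ ≤ _ := by gcongr
    calc _ ≤ ((∑' n, r n) * S ^ (1 / p)) ^ p := by
          refine ENNReal.rpow_le_rpow ?_ hp.le
          rw [← ENNReal.tsum_mul_right]
          exact ENNReal.tsum_le_tsum h1
      _ = _ := by
          rw [ENNReal.mul_rpow_of_nonneg _ _ hp.le, ← ENNReal.rpow_mul, one_div_mul_cancel hp.ne',
            ENNReal.rpow_one]
  refine (lintegral_mono hpt).trans (le_of_eq ?_)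
  rw [lintegral_const_mul _ hm, lintegral_tsum fun n => (((hu n).const_mul _).pow_const p).aemeasurable]
  congr 1
  congr 1 with n
  simp_rw [ENNReal.mul_rpow_of_nonneg _ _ hp.le]
  rw [lintegral_const_mul _ ((hu n).pow_const p)]

lemma tsum_two_rpow_ne_top {a b : ℝ} (ha : 0 < a) (hb : 0 < b) :
    ∑' n : ℕ × ℤ, ENNReal.ofReal (2 ^ (-(a * n.1)) * 2 ^ (-(b * |(n.2 : ℝ)|))) ≠ ⊤ := by
  have geo : ∀ {c : ℝ}, 0 < c → Summable fun n : ℕ => (2 : ℝ) ^ (-(c * n)) := fun {c} hc => by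
    have : ∀ n : ℕ, (2 : ℝ) ^ (-(c * n)) = ((2 : ℝ) ^ (-c)) ^ n := fun n => by
      rw [← Real.rpow_natCast, ← Real.rpow_mul (by norm_num)]
      congr 1; ring
    simp_rw [this]
    exact summable_geometric_of_lt_one (by positivity)
      (Real.rpow_lt_one_of_one_lt_of_neg (by norm_num) (by linarith))
  have hz : Summable fun i : ℤ => (2 : ℝ) ^ (-(b * |(i : ℝ)|)) := by
    refine Summable.of_nat_of_neg ?_ ?_
    · simpa using geo hb
    · simpa using geo hb
  have := (geo ha).mul_of_nonneg hz (fun n => by positivity) (fun n => by positivity)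
  exact this.tsum_ofReal_ne_top

/-! ### Dilations and the sum over scales -/

/-- The dilation of `f` by `c`. -/
def dilate (c : ℝ) (f : ℂ → ℝ) (x : ℂ) : ℝ := f (c * x)

lemma IsNice.dilate {f : ℂ → ℝ} (hf : IsNice f) {c : ℝ} (hc : 0 < c) : IsNice (dilate c f) := by
  obtain ⟨M, hM⟩ := hf.bdd
  obtain ⟨R, hR⟩ := hf.supp
  refine ⟨hf.meas.comp (by fun_prop), ⟨M, fun x => hM _⟩, ⟨R / c, fun x hx => hR _ ?_⟩⟩
  rw [norm_mul, Complex.norm_real, Real.norm_eq_abs, abs_of_pos hc]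
  rwa [div_lt_iff₀' hc] at hx

lemma lintegral_comp_mul_left {c : ℝ} (hc : 0 < c) (f : ℂ → ℝ≥0∞) :
    ∫⁻ x : ℂ, f (c * x) = ENNReal.ofReal (c ^ 2)⁻¹ * ∫⁻ x, f x := by
  have h := lintegral_map_equiv (μ := (volume : Measure ℂ)) f
    (Homeomorph.smulOfNeZero c hc.ne').toMeasurableEquiv
  have h2 : Measure.map (⇑(Homeomorph.smulOfNeZero c hc.ne' : ℂ ≃ₜ ℂ).toMeasurableEquiv)
      (volume : Measure ℂ) = ENNReal.ofReal (c ^ 2)⁻¹ • volume := by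
    have := Measure.map_addHaar_smul (volume : Measure ℂ) hc.ne'
    rw [Complex.finrank_real_complex, abs_of_pos (by positivity)] at this
    exact this
  rw [h2, lintegral_smul_measure] at h
  rw [smul_eq_mul] at h
  rw [h]
  congr 1 with x

lemma integral_comp_mul_left {c : ℝ} (hc : 0 < c) (f : ℂ → ℝ) :
    ∫ x : ℂ, f (c * x) = (c ^ 2)⁻¹ * ∫ x, f x := by
  have h := Measure.integral_comp_smul (volume : Measure ℂ) f c
  rw [Complex.finrank_real_complex, abs_of_pos (by positivity)] at h
  simpa using h

lemma gridAvg_dilate {c : ℝ} (hc : 0 < c) (s : ℝ) (f : ℂ → ℝ) (x : ℂ) :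
    gridAvg s (dilate c f) x = gridAvg (c * s) f (c * x) := by
  have h := integral_comp_mul_left hc fun y => gridKer (c * s) (c * x) y * f y
  have h1 : ∀ y : ℂ, gridKer (c * s) (c * x) (c * y) = (c ^ 2)⁻¹ * gridKer s x y := by
    intro y
    simp only [gridKer, cell_smul hc, mul_pow, mul_inv, mul_ite, mul_zero]
  simp_rw [h1, mul_assoc] at h
  rw [integral_const_mul] at h
  exact mul_left_cancel₀ (by positivity) h

lemma gridDiff_dilate {c : ℝ} (hc : 0 < c) (s : ℝ) (f : ℂ → ℝ) (x : ℂ) :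
    gridDiff s (dilate c f) x = gridDiff (c * s) f (c * x) := by
  rw [gridDiff, gridDiff, gridAvg_dilate hc, gridAvg_dilate hc, mul_div_assoc]

/-- The estimate for the sum over all frequencies and scales. -/
lemma exists_dyadic_bound {p : ℝ} (hp : 2 < p) : ∃ C : ℝ≥0∞, C ≠ ⊤ ∧ ∃ J : ℕ, 3 ≤ J ∧
    ∀ f : ℂ → ℝ, IsNice f → ∃ F : ℂ → ℝ≥0∞, Measurable F ∧
      ∫⁻ x, F x ^ p ≤ C * ∫⁻ y, ENNReal.ofReal |f y| ^ p ∧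
      ∀ (k : ℤ) (x : ℂ), ∑' n : ℕ × ℤ, maxAvg ((1 / 2) ^ (J + n.1))
        (gridDiff (2 ^ n.2) (dilate (2 ^ k) f)) (((2 ^ (-k) : ℝ) : ℂ) * x) ≤ F x := by
  obtain ⟨C₀, a, θ, N, hC₀, ha, hθ, hN, hmain⟩ := exists_maxAvg_gridDiff_bound hp
  obtain ⟨m, hm⟩ := pow_unbounded_of_one_lt N (by norm_num : (1 : ℝ) < 2)
  have hp0 : 0 < p := by linarith
  set α := a / 9000 with hα
  have hα0 : 0 < α := by positivity
  set ρ : ℝ → ℕ × ℤ → ℝ := fun e n =>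
    2 ^ (-(α * e * n.1)) * 2 ^ (-(θ * e * |(n.2 : ℝ)|)) with hρ
  have hρ0 : ∀ e n, 0 < ρ e n := fun e n => by positivity
  have hsum : ∀ e, 0 < e → ∑' n, ENNReal.ofReal (ρ e n) ≠ ⊤ := fun e he =>
    tsum_two_rpow_ne_top (mul_pos hα0 he) (mul_pos hθ he)
  have hρadd : ∀ e e' n, ρ (e + e') n = ρ e n * ρ e' n := by
    intro e e' n
    simp only [hρ]
    rw [show -(α * (e + e') * (n.1 : ℝ)) = -(α * e * n.1) + -(α * e' * n.1) by ring,
      show -(θ * (e + e') * |(n.2 : ℝ)|) = -(θ * e * |(n.2 : ℝ)|) + -(θ * e' * |(n.2 : ℝ)|) by ring,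
      Real.rpow_add (by norm_num), Real.rpow_add (by norm_num)]
    ring
  have hρpow : ∀ e n, ρ e n ^ p = ρ (e * p) n := by
    intro e n
    simp only [hρ]
    rw [Real.mul_rpow (by positivity) (by positivity), ← Real.rpow_mul (by norm_num),
      ← Real.rpow_mul (by norm_num)]
    congr 2 <;> ring
  set r : ℕ × ℤ → ℝ≥0∞ := fun n => ENNReal.ofReal (ρ (1 / (2 * p)) n) with hr
  have hr0 : ∀ n, r n ≠ 0 := fun n => (ENNReal.ofReal_pos.2 (hρ0 _ n)).ne'
  have hrt : ∀ n, r n ≠ ⊤ := fun n => ENNReal.ofReal_ne_top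
  have hrp : ∀ n, (r n)⁻¹ ^ p * ENNReal.ofReal (ρ 1 n) = ENNReal.ofReal (ρ (1 / 2) n) := by
    intro n
    have h1 : ρ 1 n = ρ (1 / (2 * p)) n ^ p * ρ (1 / 2) n := by
      rw [hρpow, ← hρadd]
      congr 1
      field_simp
      norm_num
    rw [h1, ENNReal.ofReal_mul (by positivity), ← ENNReal.ofReal_rpow_of_nonneg (hρ0 _ n).le hp0.le,
      ← mul_assoc, ← ENNReal.mul_rpow_of_nonneg _ _ hp0.le, ENNReal.inv_mul_cancel (hr0 n) (hrt n),
      ENNReal.one_rpow, one_mul]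
  set A := (∑' n, r n) ^ p * ((∑' n, ENNReal.ofReal (ρ (1 / 2) n)) *
    (ENNReal.ofReal C₀ * ENNReal.ofReal (2 ^ (p - 1)))) with hA
  refine ⟨A, ?_, 9000 * m, ?_, fun f hf => ?_⟩
  · refine ENNReal.mul_ne_top (ENNReal.rpow_ne_top_of_nonneg hp0.le (hsum _ (by positivity)))
      (ENNReal.mul_ne_top (hsum _ (by norm_num)) (ENNReal.mul_ne_top ENNReal.ofReal_ne_top
        ENNReal.ofReal_ne_top))
  · rcases m with _ | m
    · norm_num at hm; linarith
    · omega
  set I := ∫⁻ y, ENNReal.ofReal |f y| ^ p with hI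
  set u : ℤ → ℕ × ℤ → ℂ → ℝ≥0∞ := fun k n x => maxAvg ((1 / 2) ^ (9000 * m + n.1))
    (gridDiff (2 ^ n.2) (dilate (2 ^ k) f)) (((2 ^ (-k) : ℝ) : ℂ) * x) with hu
  have h2 : ∀ k : ℤ, (0 : ℝ) < 2 ^ k := fun k => by positivity
  have hum : ∀ k n, Measurable (u k n) := fun k n =>
    (measurable_maxAvg ((hf.dilate (h2 k)).gridDiff (h2 n.2)) _).comp (by fun_prop)
  have hone : ∀ k n, ∫⁻ x, u k n x ^ p ≤ ENNReal.ofReal (C₀ * ρ 1 n) *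
      ∫⁻ x, ENNReal.ofReal |gridDiff (2 ^ (k + n.2)) f x| ^ p := by
    intro k n
    set μ : ℝ := (1 / 2) ^ m * 2 ^ (-((n.1 : ℝ) / 9000)) with hμ
    have hμ0 : 0 < μ := by positivity
    have hle : (2 : ℝ) ^ (-((n.1 : ℝ) / 9000)) ≤ 1 :=
      Real.rpow_le_one_of_one_le_of_nonpos (by norm_num) (by
        have : (0 : ℝ) ≤ (n.1 : ℝ) / 9000 := by positivity
        linarith)
    have hNμ : N * μ ≤ 1 := by
      calc N * μ ≤ 2 ^ m * ((1 / 2) ^ m * 1) := by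
            rw [hμ]; gcongr
        _ = 1 := by rw [mul_one, ← mul_pow]; norm_num
    have hpow : μ ^ 9000 = (1 / 2) ^ (9000 * m + n.1) := by
      rw [hμ, mul_pow, ← pow_mul, mul_comm m, pow_add]
      congr 1
      rw [← Real.rpow_natCast, ← Real.rpow_mul (by norm_num), ← Real.rpow_natCast (1 / 2),
        one_div, Real.inv_rpow (by norm_num), ← Real.rpow_neg (by norm_num)]
      congr 1
      push_cast
      field_simp
    have hμa : μ ^ a ≤ 2 ^ (-(α * 1 * n.1)) := by
      calc μ ^ a ≤ (2 ^ (-((n.1 : ℝ) / 9000))) ^ a := by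
            refine Real.rpow_le_rpow hμ0.le ?_ ha.le
            rw [hμ]
            exact mul_le_of_le_one_left (by positivity) (pow_le_one₀ (by norm_num) (by norm_num))
        _ = _ := by
            rw [← Real.rpow_mul (by norm_num)]
            congr 1; rw [hα]; ring
    have h3 := hmain μ hμ0 hNμ n.2 (dilate (2 ^ k) f) (hf.dilate (h2 k))
    rw [hpow] at h3
    have h4 := lintegral_comp_mul_left (h2 (-k)) fun x => maxAvg ((1 / 2) ^ (9000 * m + n.1))
      (gridDiff (2 ^ n.2) (dilate (2 ^ k) f)) x ^ p
    have h5 := lintegral_comp_mul_left (h2 k) fun x =>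
      ENNReal.ofReal |gridDiff (2 ^ (k + n.2)) f x| ^ p
    have h6 : ∀ x, gridDiff (2 ^ n.2) (dilate (2 ^ k) f) x =
        gridDiff (2 ^ (k + n.2)) f (((2 ^ k : ℝ) : ℂ) * x) := fun x => by
      rw [gridDiff_dilate (h2 k), ← zpow_add₀ (by norm_num)]
    have h7 : ∫⁻ x, ENNReal.ofReal |gridDiff (2 ^ n.2) (dilate (2 ^ k) f) x| ^ p =
        ENNReal.ofReal (((2 : ℝ) ^ k) ^ 2)⁻¹ *
          ∫⁻ x, ENNReal.ofReal |gridDiff (2 ^ (k + n.2)) f x| ^ p := by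
      simp_rw [h6]
      exact h5
    rw [h7] at h3
    calc _ = ENNReal.ofReal (((2 : ℝ) ^ (-k)) ^ 2)⁻¹ * ∫⁻ x, maxAvg ((1 / 2) ^ (9000 * m + n.1))
          (gridDiff (2 ^ n.2) (dilate (2 ^ k) f)) x ^ p := h4
      _ ≤ ENNReal.ofReal (((2 : ℝ) ^ (-k)) ^ 2)⁻¹ * (ENNReal.ofReal (C₀ * ρ 1 n) *
          (ENNReal.ofReal (((2 : ℝ) ^ k) ^ 2)⁻¹ *
            ∫⁻ x, ENNReal.ofReal |gridDiff (2 ^ (k + n.2)) f x| ^ p)) := by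
          gcongr
          refine h3.trans (mul_le_mul_left (ENNReal.ofReal_le_ofReal ?_) _)
          refine mul_le_mul_of_nonneg_left ?_ hC₀.le
          simp only [hρ, mul_one] at hμa ⊢
          gcongr
      _ = (ENNReal.ofReal (((2 : ℝ) ^ (-k)) ^ 2)⁻¹ * ENNReal.ofReal (((2 : ℝ) ^ k) ^ 2)⁻¹) *
          (ENNReal.ofReal (C₀ * ρ 1 n) *
            ∫⁻ x, ENNReal.ofReal |gridDiff (2 ^ (k + n.2)) f x| ^ p) := by ring
      _ = _ := by
          rw [← ENNReal.ofReal_mul (by positivity), zpow_neg, inv_pow, inv_inv, mul_inv_cancel₀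
            (by positivity), ENNReal.ofReal_one, one_mul]
  set U : ℕ × ℤ → ℂ → ℝ≥0∞ := fun n x => (∑' k, u k n x ^ p) ^ (1 / p) with hU
  have hUm : ∀ n, Measurable (U n) := fun n =>
    (Measurable.tsum fun k => (hum k n).pow_const p).pow_const _
  have hUp : ∀ n x, U n x ^ p = ∑' k, u k n x ^ p := fun n x => by
    simp only [hU]
    rw [← ENNReal.rpow_mul, one_div_mul_cancel hp0.ne', ENNReal.rpow_one]
  have hUle : ∀ k n x, u k n x ≤ U n x := by
    intro k n x
    rw [← ENNReal.rpow_le_rpow_iff hp0, hUp]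
    exact ENNReal.le_tsum (f := fun k => u k n x ^ p) k
  have hUint : ∀ n, ∫⁻ x, U n x ^ p ≤
      ENNReal.ofReal (ρ 1 n) * (ENNReal.ofReal C₀ * ENNReal.ofReal (2 ^ (p - 1)) * I) := by
    intro n
    simp_rw [hUp]
    rw [lintegral_tsum fun k => ((hum k n).pow_const p).aemeasurable]
    calc _ ≤ ∑' k : ℤ, ENNReal.ofReal (C₀ * ρ 1 n) *
          ∫⁻ x, ENNReal.ofReal |gridDiff (2 ^ (k + n.2)) f x| ^ p :=
          ENNReal.tsum_le_tsum fun k => hone k n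
      _ = ENNReal.ofReal (C₀ * ρ 1 n) *
          ∑' k : ℤ, ∫⁻ x, ENNReal.ofReal |gridDiff (2 ^ k) f x| ^ p := by
          rw [ENNReal.tsum_mul_left]
          congr 1
          exact (Equiv.addRight n.2).tsum_eq fun k : ℤ =>
            ∫⁻ x, ENNReal.ofReal |gridDiff (2 ^ k) f x| ^ p
      _ ≤ ENNReal.ofReal (C₀ * ρ 1 n) * (ENNReal.ofReal (2 ^ (p - 1)) * I) := by
          gcongr
          exact tsum_lintegral_gridDiff_le hp.le hf
      _ = _ := by rw [ENNReal.ofReal_mul hC₀.le]; ring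
  refine ⟨fun x => ∑' n, U n x, Measurable.tsum hUm, ?_,
    fun k x => ENNReal.tsum_le_tsum fun n => hUle k n x⟩
  refine (lintegral_tsum_rpow_le volume hp0 hUm hr0 hrt).trans ?_
  rw [hA, mul_assoc]
  gcongr
  calc _ ≤ ∑' n, ENNReal.ofReal (ρ (1 / 2) n) *
        (ENNReal.ofReal C₀ * ENNReal.ofReal (2 ^ (p - 1)) * I) := by
        refine ENNReal.tsum_le_tsum fun n => ?_
        rw [← hrp, mul_assoc]
        gcongr
        exact hUint n
    _ = _ := by rw [ENNReal.tsum_mul_right]; ring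

/-! ### The Hardy-Littlewood maximal function over balls of dyadic radii -/

/-- The maximal function of `f` over the balls of radius `3 * 2 ^ k`. -/
def ballMax (f : ℂ → ℝ) (x : ℂ) : ℝ≥0∞ :=
  ⨆ k : ℤ, ENNReal.ofReal (((2 : ℝ) ^ k) ^ 2)⁻¹ *
    ∫⁻ y in {y : ℂ | ‖x - y‖ ≤ 3 * 2 ^ k}, ENNReal.ofReal |f y|

lemma measurableSet_norm_sub_le' (x : ℂ) (R : ℝ) : MeasurableSet {y : ℂ | ‖x - y‖ ≤ R} :=
  measurableSet_le (by fun_prop) measurable_const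

lemma volume_norm_sub_le' (x : ℂ) {R : ℝ} (hR : 0 ≤ R) :
    volume {y : ℂ | ‖x - y‖ ≤ R} = ENNReal.ofReal (Real.pi * R ^ 2) := by
  simp_rw [norm_sub_rev x]
  exact volume_norm_sub_le x hR

lemma measurable_ballMax {f : ℂ → ℝ} (hf : IsNice f) : Measurable (ballMax f) := by
  refine Measurable.iSup fun k => Measurable.const_mul ?_ _
  have hm : Measurable fun z : ℂ × ℂ => {z : ℂ × ℂ | ‖z.1 - z.2‖ ≤ 3 * 2 ^ k}.indicator
      (fun z => ENNReal.ofReal |f z.2|) z :=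
    (hf.meas.comp measurable_snd).abs.ennreal_ofReal.indicator
      (measurableSet_le (by fun_prop) measurable_const)
  convert hm.lintegral_prod_right' (ν := (volume : Measure ℂ)) using 2 with x
  rw [← lintegral_indicator (measurableSet_norm_sub_le' x _)]
  rfl

lemma ballMax_ne_top {f : ℂ → ℝ} (hf : IsNice f) (x : ℂ) : ballMax f x ≠ ⊤ := by
  obtain ⟨M, hM⟩ := hf.bdd
  refine ne_top_of_le_ne_top (b := ENNReal.ofReal (9 * Real.pi * M)) ENNReal.ofReal_ne_top
    (iSup_le fun k => ?_)
  calc _ ≤ ENNReal.ofReal (((2 : ℝ) ^ k) ^ 2)⁻¹ *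
        ∫⁻ _ in {y : ℂ | ‖x - y‖ ≤ 3 * 2 ^ k}, ENNReal.ofReal M := by
        gcongr with y
        exact hM y
    _ = _ := by
        rw [setLIntegral_const, volume_norm_sub_le' x (by positivity),
          ← ENNReal.ofReal_mul' (by positivity), ← ENNReal.ofReal_mul (by positivity)]
        congr 1
        field_simp
        ring

lemma volume_ballMax_le {f : ℂ → ℝ} (hf : IsNice f) {t : ℝ} (ht : 0 < t) :
    volume {x | ENNReal.ofReal t < ballMax f x} ≤ ENNReal.ofReal (450 * Real.pi / t) *
      ∫⁻ y in {y | (18 * Real.pi)⁻¹ * t < |f y|}, ENNReal.ofReal |f y| := by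
  set b := (18 * Real.pi)⁻¹ * t with hb
  have hb0 : 0 < b := by positivity
  set S := {y | b < |f y|} with hS
  have hSm : MeasurableSet S := measurableSet_lt measurable_const hf.meas.abs
  set g : ℂ → ℝ≥0∞ := S.indicator fun y => ENNReal.ofReal |f y| with hg
  have hfm : Measurable fun y => ENNReal.ofReal |f y| := hf.meas.abs.ennreal_ofReal
  have hgI : ∫⁻ y, g y = ∫⁻ y in S, ENNReal.ofReal |f y| := lintegral_indicator hSm _
  have hgt : ∫⁻ y, g y ≠ ⊤ := ne_top_of_le_ne_top hf.integrable.abs.lintegral_lt_top.ne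
    (lintegral_mono fun y => Set.indicator_le_self _ _ y)
  set L := (∫⁻ y, g y).toReal with hL
  have hgL : ∫⁻ y, g y = ENNReal.ofReal L := (ENNReal.ofReal_toReal hgt).symm
  have hL0 : 0 ≤ L := ENNReal.toReal_nonneg
  have hball : ∀ (x : ℂ) (R : ℝ), Metric.closedBall x R = {y : ℂ | ‖x - y‖ ≤ R} := fun x R => by
    ext y
    rw [Metric.mem_closedBall, dist_comm, dist_eq_norm]
    rfl
  set T : Set (ℂ × ℤ) := {a | ENNReal.ofReal (t / 2 * (2 ^ a.2) ^ 2) ≤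
    ∫⁻ y in Metric.closedBall a.1 (3 * 2 ^ a.2), g y} with hT
  have hTR : ∀ a ∈ T, 3 * (2 : ℝ) ^ a.2 ≤ 3 * (1 + 2 * L / t) := by
    intro a ha
    have ha' : ENNReal.ofReal (t / 2 * (2 ^ a.2) ^ 2) ≤
      ∫⁻ y in Metric.closedBall a.1 (3 * 2 ^ a.2), g y := ha
    have h1 := ha'.trans (setLIntegral_le_lintegral _ _)
    rw [hgL, ENNReal.ofReal_le_ofReal_iff hL0] at h1
    have h2 : ((2 : ℝ) ^ a.2) ^ 2 ≤ 2 * L / t := by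
      rw [le_div_iff₀ ht]; linarith
    have h3 : (2 : ℝ) ^ a.2 ≤ 1 + ((2 : ℝ) ^ a.2) ^ 2 := by
      nlinarith [sq_nonneg ((2 : ℝ) ^ a.2 - 1)]
    linarith
  obtain ⟨u, huT, hdisj, hcov⟩ := Vitali.exists_disjoint_subfamily_covering_enlargement_closedBall
    T Prod.fst (fun a => 3 * (2 : ℝ) ^ a.2) _ hTR 5 (by norm_num)
  have hcount : u.Countable := hdisj.countable_of_nonempty_interior fun a _ =>
    ⟨a.1, Metric.ball_subset_interior_closedBall (Metric.mem_ball_self (by positivity))⟩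
  have hE : {x | ENNReal.ofReal t < ballMax f x} ⊆
      ⋃ a ∈ u, Metric.closedBall a.1 (5 * (3 * (2 : ℝ) ^ a.2)) := by
    intro x hx
    have hx' : ENNReal.ofReal t < ballMax f x := hx
    obtain ⟨k, hk⟩ := lt_iSup_iff.1 hx'
    have h2k : (0 : ℝ) < 2 ^ k := by positivity
    have hxT : (x, k) ∈ T := by
      change ENNReal.ofReal (t / 2 * (2 ^ k) ^ 2) ≤ ∫⁻ y in Metric.closedBall x (3 * 2 ^ k), g y
      rw [hball]
      set G := ∫⁻ y in {y : ℂ | ‖x - y‖ ≤ 3 * 2 ^ k}, g y with hG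
      have h1 : ∫⁻ y in {y : ℂ | ‖x - y‖ ≤ 3 * 2 ^ k}, ENNReal.ofReal |f y| ≤
          G + ENNReal.ofReal (t / 2 * (2 ^ k) ^ 2) := by
        calc _ ≤ ∫⁻ y in {y : ℂ | ‖x - y‖ ≤ 3 * 2 ^ k}, (g y + ENNReal.ofReal b) := by
              refine lintegral_mono fun y => ?_
              by_cases hy : y ∈ S
              · rw [hg, Set.indicator_of_mem hy]
                exact le_self_add
              · rw [hg, Set.indicator_of_notMem hy, zero_add]
                exact ENNReal.ofReal_le_ofReal (not_lt.1 hy)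
          _ = _ := by
              rw [lintegral_add_right _ measurable_const, setLIntegral_const,
                volume_norm_sub_le' x (by positivity), ← ENNReal.ofReal_mul hb0.le]
              congr 2
              rw [hb]
              field_simp
              ring
      have h2 : ENNReal.ofReal (t * (2 ^ k) ^ 2) <
          G + ENNReal.ofReal (t / 2 * (2 ^ k) ^ 2) := by
        refine lt_of_lt_of_le ?_ h1
        rw [mul_comm t, ENNReal.ofReal_mul (by positivity)]
        have h4 : ENNReal.ofReal ((2 ^ k) ^ 2) * ENNReal.ofReal (((2 : ℝ) ^ k) ^ 2)⁻¹ = 1 := by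
          rw [← ENNReal.ofReal_mul (by positivity), mul_inv_cancel₀ (by positivity),
            ENNReal.ofReal_one]
        have h3 := (ENNReal.mul_lt_mul_iff_right (a := ENNReal.ofReal ((2 ^ k) ^ 2))
          (ENNReal.ofReal_pos.2 (by positivity)).ne' ENNReal.ofReal_ne_top).2 hk
        rwa [← mul_assoc, h4, one_mul] at h3
      rw [show t * ((2 : ℝ) ^ k) ^ 2 = t / 2 * (2 ^ k) ^ 2 + t / 2 * (2 ^ k) ^ 2 by ring,
        ENNReal.ofReal_add (by positivity) (by positivity)] at h2
      exact (ENNReal.add_lt_add_iff_right ENNReal.ofReal_ne_top).1 h2 |>.le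
    obtain ⟨a, hau, ha⟩ := hcov _ hxT
    exact Set.mem_biUnion hau (ha (Metric.mem_closedBall_self (by positivity)))
  have hone : ∀ a ∈ u, volume (Metric.closedBall a.1 (5 * (3 * (2 : ℝ) ^ a.2))) ≤
      ENNReal.ofReal (450 * Real.pi / t) * ∫⁻ y in Metric.closedBall a.1 (3 * 2 ^ a.2), g y := by
    intro a ha
    have ha' : ENNReal.ofReal (t / 2 * (2 ^ a.2) ^ 2) ≤
      ∫⁻ y in Metric.closedBall a.1 (3 * 2 ^ a.2), g y := huT ha
    refine le_trans ?_ (mul_le_mul_right ha' _)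
    rw [hball, volume_norm_sub_le' _ (by positivity), ← ENNReal.ofReal_mul (by positivity)]
    refine le_of_eq ?_
    congr 1
    field_simp
    ring
  calc _ ≤ ∑' a : u, volume (Metric.closedBall a.1.1 (5 * (3 * (2 : ℝ) ^ a.1.2))) :=
        (measure_mono hE).trans (measure_biUnion_le _ hcount _)
    _ ≤ ∑' a : u, ENNReal.ofReal (450 * Real.pi / t) *
        ∫⁻ y in Metric.closedBall a.1.1 (3 * 2 ^ a.1.2), g y :=
        ENNReal.tsum_le_tsum fun a => hone a.1 a.2
    _ = ENNReal.ofReal (450 * Real.pi / t) *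
        ∫⁻ y in ⋃ a ∈ u, Metric.closedBall a.1 (3 * 2 ^ a.2), g y := by
        rw [ENNReal.tsum_mul_left, lintegral_biUnion hcount
          (fun a _ => Metric.isClosed_closedBall.measurableSet) hdisj]
    _ ≤ _ := by
        rw [← hgI]
        exact mul_le_mul_right (setLIntegral_le_lintegral _ _) _

lemma exists_ballMax_rpow_bound {p : ℝ} (hp : 1 < p) : ∃ C : ℝ≥0∞, C ≠ ⊤ ∧ ∀ f : ℂ → ℝ, IsNice f →
    ∫⁻ x, ballMax f x ^ p ≤ C * ∫⁻ y, ENNReal.ofReal |f y| ^ p := by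
  refine ⟨_, ?_, fun f hf => lintegral_rpow_le_of_level one_pos hp (b₁ := (18 * Real.pi)⁻¹)
    (b₂ := 1) (by positivity) one_pos hf.meas (measurable_ballMax hf) (ballMax_ne_top hf)
    (ENNReal.ofReal (450 * Real.pi)) 0 fun t ht => ?_⟩
  · rw [zero_mul, add_zero]
    exact ENNReal.mul_ne_top ENNReal.ofReal_ne_top
      (ENNReal.mul_ne_top ENNReal.ofReal_ne_top ENNReal.ofReal_ne_top)
  · refine (volume_ballMax_le hf ht).trans (le_of_eq ?_)
    simp only [ENNReal.rpow_one, zero_mul, add_zero]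
    rw [← mul_assoc, ← ENNReal.ofReal_mul (by positivity), Real.rpow_neg_one, mul_comm t⁻¹,
      div_eq_mul_inv]

/-! ### Telescoping in the function and in the kernel -/

lemma exists_maxAvg_sup_bound : ∃ C : ℝ, 0 < C ∧ ∀ δ B : ℝ, 0 < δ → δ ≤ 1 / 8 → ∀ (f : ℂ → ℝ) (x : ℂ),
    (∀ y, |f y| ≤ B) → maxAvg δ f x ≤ ENNReal.ofReal (C * B) := by
  obtain ⟨C, hC, h⟩ := exists_abs_annAvg_sup_bound
  exact ⟨C, hC, fun δ B hδ hδ8 f x hB => iSup₂_le fun w hw =>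
    ENNReal.ofReal_le_ofReal (h δ w B hδ hδ8 hw f x hB)⟩

lemma maxAvg_gridAvg_sub_le {f : ℂ → ℝ} (hf : IsNice f) {δ : ℝ} (hδ : 0 < δ) (hδ8 : δ ≤ 1 / 8)
    (a : ℤ) (m : ℕ) (x : ℂ) :
    maxAvg δ (fun y => gridAvg (2 ^ a) f y - gridAvg (2 ^ (a + m)) f y) x ≤
      ∑ i ∈ Finset.range m, maxAvg δ (gridDiff (2 ^ (a + 1 + i)) f) x := by
  obtain ⟨C, -, hC⟩ := exists_maxAvg_sup_bound
  have h2 : ∀ i : ℤ, (0 : ℝ) < 2 ^ i := fun i => by positivity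
  induction m with
  | zero =>
    refine (hC δ 0 hδ hδ8 _ x fun y => ?_).trans ?_ <;> simp
  | succ m ih =>
    rw [Finset.sum_range_succ]
    have h := maxAvg_add_le ((hf.gridAvg (h2 a)).sub (hf.gridAvg (h2 (a + m))))
      (hf.gridDiff (h2 (a + 1 + m))) δ x
    refine le_trans (le_of_eq ?_) (h.trans (add_le_add_left ih _))
    congr 1
    funext y
    have e : (2 : ℝ) ^ (a + 1 + m) / 2 = 2 ^ (a + m) := by
      rw [show a + 1 + (m : ℤ) = (a + m) + 1 by ring, zpow_add_one₀ (by norm_num)]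
      ring
    rw [gridDiff, e]
    push_cast
    rw [show a + ((m : ℤ) + 1) = a + 1 + m by ring]
    ring

lemma abs_sub_gridAvg_le {f : ℂ → ℝ} (hf : IsNice f) {s ε : ℝ} (hs : 0 < s)
    (h : ∀ x y, ‖x - y‖ ≤ 4 * s → |f x - f y| ≤ ε) (x : ℂ) : |f x - gridAvg s f x| ≤ ε := by
  have e : f x - gridAvg s f x = ∫ y, gridKer s x y * (f x - f y) := by
    simp_rw [mul_sub]
    rw [integral_sub ((isNice_gridKer hs x).integrable.mul_const _)
      (hf.integrable_mul (isNice_gridKer hs x)), integral_mul_const, integral_gridKer hs, one_mul]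
    rfl
  rw [e]
  calc _ ≤ ∫ y, gridKer s x y * ε := by
        refine abs_integral_le_integral_abs.trans (integral_mono_of_nonneg
          (Filter.Eventually.of_forall fun y => abs_nonneg _)
          ((isNice_gridKer hs x).integrable.mul_const _)
          (Filter.Eventually.of_forall fun y => ?_))
        simp only [abs_mul, abs_of_nonneg (gridKer_nonneg s x y)]
        by_cases hy : cell s y = cell s x
        · exact mul_le_mul_of_nonneg_left (h x y (norm_sub_le_of_cell_eq hs hy.symm))
            (gridKer_nonneg s x y)
        · rw [gridKer, if_neg hy, zero_mul, zero_mul]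
    _ = _ := by rw [integral_mul_const, integral_gridKer hs, one_mul]

lemma maxAvg_le_tsum {f : ℂ → ℝ} (hf : IsNice f) (hfu : UniformContinuous f) {δ : ℝ} (hδ : 0 < δ)
    (hδ8 : δ ≤ 1 / 8) (x : ℂ) : maxAvg δ f x ≤ ∑' i : ℤ, maxAvg δ (gridDiff (2 ^ i) f) x := by
  obtain ⟨C, hC0, hC⟩ := exists_maxAvg_sup_bound
  have h2 : ∀ i : ℤ, (0 : ℝ) < 2 ^ i := fun i => by positivity
  refine ENNReal.le_of_forall_pos_le_add fun ε hε _ => ?_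
  have hε0 : (0 : ℝ) < ε := hε
  set η : ℝ := ε / (2 * C) with hη
  have hη0 : 0 < η := by positivity
  obtain ⟨d, hd, hfd⟩ := Metric.uniformContinuous_iff.1 hfu η hη0
  obtain ⟨n, hn⟩ := exists_pow_lt_of_lt_one (by positivity : 0 < d / 4)
    (by norm_num : (1 / 2 : ℝ) < 1)
  set L := ∫ y, |f y| with hL
  have hL0 : 0 ≤ L := integral_nonneg fun y => abs_nonneg _
  obtain ⟨m, hm⟩ := pow_unbounded_of_one_lt (L / η) (by norm_num : (1 : ℝ) < 2)
  have hfine : ∀ y, |f y - gridAvg (2 ^ (-(n : ℤ))) f y| ≤ η := by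
    refine abs_sub_gridAvg_le hf (h2 _) fun y z hyz => ?_
    have : dist y z < d := by
      rw [dist_eq_norm]
      refine hyz.trans_lt ?_
      rw [zpow_neg, zpow_natCast, ← inv_pow, ← one_div]
      linarith
    exact (hfd this).le
  have hcoarse : ∀ y, |gridAvg (2 ^ (-(n : ℤ) + ((n + m : ℕ) : ℤ))) f y| ≤ η := by
    intro y
    refine (abs_gridAvg_le_integral _ hf y).trans ?_
    rw [show -(n : ℤ) + ((n + m : ℕ) : ℤ) = (m : ℤ) by push_cast; ring, zpow_natCast]
    have h1 : (1 : ℝ) ≤ 2 ^ m := one_le_pow₀ (by norm_num)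
    rw [div_lt_iff₀ hη0] at hm
    rw [inv_mul_le_iff₀ (by positivity)]
    nlinarith
  set g := fun y => gridAvg (2 ^ (-(n : ℤ))) f y - gridAvg (2 ^ (-(n : ℤ) + ((n + m : ℕ) : ℤ))) f y
    with hg
  have ng : IsNice g := (hf.gridAvg (h2 _)).sub (hf.gridAvg (h2 _))
  have hfg : ∀ y, |f y - g y| ≤ 2 * η := by
    intro y
    calc |f y - g y| = |(f y - gridAvg (2 ^ (-(n : ℤ))) f y) +
          gridAvg (2 ^ (-(n : ℤ) + ((n + m : ℕ) : ℤ))) f y| := by rw [hg]; ring_nf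
      _ ≤ η + η := (abs_add_le _ _).trans (add_le_add (hfine y) (hcoarse y))
      _ = 2 * η := by ring
  have h3 := maxAvg_add_le ng (hf.sub ng) δ x
  simp only [add_sub_cancel] at h3
  refine h3.trans (add_le_add ?_ ?_)
  · refine (maxAvg_gridAvg_sub_le hf hδ hδ8 _ _ x).trans ?_
    refine (ENNReal.sum_le_tsum _).trans (ENNReal.tsum_comp_le_tsum_of_injective
      (f := fun i : ℕ => -(n : ℤ) + 1 + i) (fun i j hij => by simpa using hij)
      fun i : ℤ => maxAvg δ (gridDiff (2 ^ i) f) x)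
  · refine (hC δ (2 * η) hδ hδ8 _ x hfg).trans (le_of_eq ?_)
    rw [show C * (2 * η) = ε by rw [hη]; field_simp, ENNReal.ofReal_coe_nnreal]

lemma exists_mollifier_bound : ∃ M : ℝ, 0 < M ∧ ∀ s, |mollifier s| ≤ M := by
  have hc : HasCompactSupport mollifier :=
    HasCompactSupport.of_support_subset_isCompact (isCompact_Icc (a := (-1 : ℝ)) (b := 1))
      fun _ hs => abs_le.1 (not_lt.1 fun h => hs (mollifier_zero h))
  obtain ⟨M, hM⟩ := hc.exists_bound_of_continuous mollifier_contDiff.continuous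
  exact ⟨max M 1, lt_max_of_lt_right one_pos, fun s => (hM s).trans (le_max_left _ _)⟩

lemma mollifier_arg_bound {δ w a : ℝ} (hδ : 0 < δ) (h : mollifier ((a - w) / δ) ≠ 0) :
    |a - w| ≤ δ := by
  by_contra hlt
  apply h
  apply mollifier_zero
  rw [abs_div, abs_of_pos hδ, lt_div_iff₀ hδ, one_mul]
  exact not_le.1 hlt

lemma isNice_mollifier_kernel {δ w : ℝ} (hδ : 0 < δ) (hδ8 : δ ≤ 1 / 8) (hw : w ∈ Set.Icc (1 : ℝ) 4)
    (x : ℂ) : IsNice fun y => δ⁻¹ * mollifier ((‖x - y‖ ^ 2 - w) / δ) := by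
  obtain ⟨M, -, hM⟩ := exists_mollifier_bound
  refine ⟨?_, ⟨δ⁻¹ * M, fun y => ?_⟩, ⟨‖x‖ + 3, fun y hy => ?_⟩⟩
  · exact (mollifier_contDiff.continuous.measurable.comp (by fun_prop)).const_mul _
  · rw [abs_mul, abs_of_pos (inv_pos.2 hδ)]
    exact mul_le_mul_of_nonneg_left (hM _) (inv_pos.2 hδ).le
  · by_contra h
    have h1 := mollifier_arg_bound hδ (right_ne_zero_of_mul h)
    have h2 := (annulus_bound hδ8 hw (norm_nonneg _) (h1.trans (by linarith))).2
    have h3 := norm_sub_norm_le y x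
    rw [norm_sub_rev] at h3
    linarith

lemma annAvg_osc_eq {f : ℂ → ℝ} (hf : IsNice f) {δ w : ℝ} (hδ : 0 < δ) (hδ8 : 2 * δ ≤ 1 / 8)
    (hw : w ∈ Set.Icc (1 : ℝ) 4) (x : ℂ) :
    annAvg osc δ w f x = annAvg mollifier δ w f x - annAvg mollifier (2 * δ) w f x := by
  unfold annAvg
  rw [← integral_sub (hf.integrable_mul (isNice_mollifier_kernel hδ (by linarith) hw x))
    (hf.integrable_mul (isNice_mollifier_kernel (by positivity) hδ8 hw x))]
  congr 1 with y
  rw [osc_eq, div_div, mul_comm δ 2, mul_inv]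
  ring

lemma exists_annAvg_mollifier_le_ballMax : ∃ M : ℝ, 0 < M ∧ ∀ δ : ℝ, 0 < δ → δ ≤ 1 / 8 →
    ∀ w ∈ Set.Icc (1 : ℝ) 4, ∀ (f : ℂ → ℝ) (k : ℤ) (x : ℂ),
    ENNReal.ofReal |annAvg mollifier δ w (dilate (2 ^ k) f) (((2 ^ (-k) : ℝ) : ℂ) * x)| ≤
      ENNReal.ofReal (δ⁻¹ * M) * ballMax f x := by
  obtain ⟨M, hM0, hM⟩ := exists_mollifier_bound
  refine ⟨M, hM0, fun δ hδ hδ8 w hw f k x => ?_⟩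
  have h2k : (0 : ℝ) < 2 ^ k := by positivity
  set G : ℂ → ℝ≥0∞ := {y : ℂ | ‖x - y‖ ≤ 3 * 2 ^ k}.indicator fun y => ENNReal.ofReal |f y| with hG
  have hpt : ∀ y : ℂ, ENNReal.ofReal |δ⁻¹ * mollifier ((‖((2 ^ (-k) : ℝ) : ℂ) * x - y‖ ^ 2 - w) / δ) *
      dilate (2 ^ k) f y| ≤ ENNReal.ofReal (δ⁻¹ * M) * G (((2 ^ k : ℝ) : ℂ) * y) := by
    intro y
    by_cases h0 : mollifier ((‖((2 ^ (-k) : ℝ) : ℂ) * x - y‖ ^ 2 - w) / δ) = 0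
    · rw [h0]; simp
    have h1 := (annulus_bound hδ8 hw (norm_nonneg _)
      ((mollifier_arg_bound hδ h0).trans (by linarith))).2
    have h3 : ‖x - ((2 ^ k : ℝ) : ℂ) * y‖ ≤ 3 * 2 ^ k := by
      have e : x - ((2 ^ k : ℝ) : ℂ) * y = ((2 ^ k : ℝ) : ℂ) * (((2 ^ (-k) : ℝ) : ℂ) * x - y) := by
        rw [mul_sub, ← mul_assoc, ← Complex.ofReal_mul, ← zpow_add₀ (by norm_num), add_neg_cancel,
          zpow_zero, Complex.ofReal_one, one_mul]
      rw [e, norm_mul, Complex.norm_real, Real.norm_eq_abs, abs_of_pos h2k]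
      nlinarith
    rw [hG, Set.indicator_of_mem (show _ ∈ {y : ℂ | ‖x - y‖ ≤ 3 * 2 ^ k} from h3), abs_mul,
      ENNReal.ofReal_mul (abs_nonneg _)]
    refine mul_le_mul_left (ENNReal.ofReal_le_ofReal ?_) _
    rw [abs_mul, abs_of_pos (inv_pos.2 hδ)]
    exact mul_le_mul_of_nonneg_left (hM _) (inv_pos.2 hδ).le
  refine (ofReal_abs_integral_le _).trans ((lintegral_mono hpt).trans ?_)
  rw [lintegral_const_mul' _ _ ENNReal.ofReal_ne_top, lintegral_comp_mul_left h2k,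
    lintegral_indicator (measurableSet_norm_sub_le' x _)]
  refine mul_le_mul_right ?_ _
  exact le_iSup (fun k : ℤ => ENNReal.ofReal (((2 : ℝ) ^ k) ^ 2)⁻¹ *
    ∫⁻ y in {y : ℂ | ‖x - y‖ ≤ 3 * 2 ^ k}, ENNReal.ofReal |f y|) k

/-- The averages over thin annuli of all radii are controlled by a single function. -/
lemma exists_annulus_majorant {p : ℝ} (hp : 2 < p) : ∃ C : ℝ≥0∞, C ≠ ⊤ ∧ ∃ J : ℕ, 3 ≤ J ∧
    ∀ f : ℂ → ℝ, IsNice f → UniformContinuous f → ∃ F : ℂ → ℝ≥0∞,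
      ∫⁻ x, F x ^ p ≤ C * ∫⁻ y, ENNReal.ofReal |f y| ^ p ∧
      ∀ (k : ℤ) (x : ℂ), ∀ w ∈ Set.Icc (1 : ℝ) 4, ∀ n : ℕ,
        ENNReal.ofReal |annAvg mollifier ((1 / 2) ^ (J + n)) w (dilate (2 ^ k) f)
          (((2 ^ (-k) : ℝ) : ℂ) * x)| ≤ F x := by
  obtain ⟨C₁, hC₁, J, hJ, hdy⟩ := exists_dyadic_bound hp
  obtain ⟨C₂, hC₂, hbm⟩ := exists_ballMax_rpow_bound (p := p) (by linarith)
  obtain ⟨M, hM0, hlow⟩ := exists_annAvg_mollifier_le_ballMax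
  have hp0 : 0 ≤ p := by linarith
  have hδ8 : ∀ n : ℕ, (1 / 2 : ℝ) ^ (J + n) ≤ 1 / 8 := fun n => by
    calc (1 / 2 : ℝ) ^ (J + n) ≤ (1 / 2) ^ 3 :=
          pow_le_pow_of_le_one (by norm_num) (by norm_num) (by omega)
      _ = 1 / 8 := by norm_num
  set B := ENNReal.ofReal (((1 / 2 : ℝ) ^ J)⁻¹ * M) with hB
  refine ⟨2 ^ (p - 1) * (B ^ p * C₂ + C₁), ?_, J, hJ, fun f hf hfu => ?_⟩
  · exact ENNReal.mul_ne_top (ENNReal.rpow_ne_top_of_nonneg (by linarith) (by norm_num))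
      (ENNReal.add_ne_top.2 ⟨ENNReal.mul_ne_top (ENNReal.rpow_ne_top_of_nonneg hp0
        ENNReal.ofReal_ne_top) hC₂, hC₁⟩)
  obtain ⟨F, hFm, hFp, hF⟩ := hdy f hf
  refine ⟨fun x => B * ballMax f x + F x, ?_, fun k x w hw n => ?_⟩
  · calc _ ≤ ∫⁻ x, 2 ^ (p - 1) * (B ^ p * ballMax f x ^ p + F x ^ p) := by
          refine lintegral_mono fun x => ?_
          rw [← ENNReal.mul_rpow_of_nonneg _ _ hp0]
          exact ENNReal.rpow_add_le_mul_rpow_add_rpow _ _ (by linarith)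
      _ = 2 ^ (p - 1) * (B ^ p * (∫⁻ x, ballMax f x ^ p) + ∫⁻ x, F x ^ p) := by
          rw [lintegral_const_mul' _ _ (ENNReal.rpow_ne_top_of_nonneg (by linarith) (by norm_num)),
            lintegral_add_right _ (hFm.pow_const p), lintegral_const_mul _
              ((measurable_ballMax hf).pow_const p)]
      _ ≤ 2 ^ (p - 1) * (B ^ p * (C₂ * ∫⁻ y, ENNReal.ofReal |f y| ^ p) +
          C₁ * ∫⁻ y, ENNReal.ofReal |f y| ^ p) := by
          gcongr
          exact hbm f hf
      _ = _ := by ring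
  · have h2k : (0 : ℝ) < 2 ^ k := by positivity
    set z := ((2 ^ (-k) : ℝ) : ℂ) * x with hz
    set g := dilate (2 ^ k) f with hg
    have ng : IsNice g := hf.dilate h2k
    have hgu : UniformContinuous g := hfu.comp (uniformContinuous_const_smul ((2 : ℝ) ^ k) |>.congr
      fun y => by simp)
    have hstep : ENNReal.ofReal |annAvg mollifier ((1 / 2) ^ (J + n)) w g z| ≤
        B * ballMax f x + ∑ j ∈ Finset.range n, maxAvg ((1 / 2) ^ (J + (j + 1))) g z := by
      induction n with
      | zero =>
        rw [Finset.range_zero, Finset.sum_empty, add_zero, add_zero]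
        exact hlow ((1 / 2) ^ J) (by positivity) (hδ8 0) w hw f k x
      | succ n ih =>
        rw [Finset.sum_range_succ, ← add_assoc (B * ballMax f x)]
        have h3 : (2 : ℝ) * (1 / 2) ^ (J + (n + 1)) = (1 / 2) ^ (J + n) := by
          rw [← add_assoc, pow_succ]; ring
        have h4 := annAvg_osc_eq ng (δ := (1 / 2) ^ (J + (n + 1))) (by positivity)
          (by rw [h3]; exact hδ8 n) hw z
        rw [h3] at h4
        have h5 : annAvg mollifier ((1 / 2) ^ (J + (n + 1))) w g z =
            annAvg mollifier ((1 / 2) ^ (J + n)) w g z +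
              annAvg osc ((1 / 2) ^ (J + (n + 1))) w g z := by rw [h4]; ring
        rw [h5]
        refine (ENNReal.ofReal_le_ofReal (abs_add_le _ _)).trans ?_
        rw [ENNReal.ofReal_add (abs_nonneg _) (abs_nonneg _)]
        exact add_le_add ih (le_maxAvg hw _ g z)
    refine hstep.trans (add_le_add_right ?_ _)
    refine le_trans ?_ (hF k x)
    calc _ ≤ ∑' j : ℕ, maxAvg ((1 / 2) ^ (J + (j + 1))) g z := ENNReal.sum_le_tsum _
      _ ≤ ∑' j : ℕ, maxAvg ((1 / 2) ^ (J + j)) g z :=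
          ENNReal.tsum_comp_le_tsum_of_injective (f := fun j : ℕ => j + 1)
            (add_left_injective 1) fun j => maxAvg ((1 / 2) ^ (J + j)) g z
      _ ≤ ∑' j : ℕ, ∑' i : ℤ, maxAvg ((1 / 2) ^ (J + j)) (gridDiff (2 ^ i) g) z :=
          ENNReal.tsum_le_tsum fun j => maxAvg_le_tsum ng hgu (by positivity) (hδ8 j) z
      _ = _ := (ENNReal.tsum_prod (f := fun (j : ℕ) (i : ℤ) =>
          maxAvg ((1 / 2) ^ (J + j)) (gridDiff (2 ^ i) g) z)).symm

/-- The integral of `g` over the circle of radius `s` around `y`, in the angular variable. -/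
def circInt (g : ℂ → ℝ) (y : ℂ) (s : ℝ) : ℝ :=
  ∫ θ in (-Real.pi)..Real.pi, g (y - s * (Real.cos θ + Real.sin θ * Complex.I))

lemma continuous_circInt {g : ℂ → ℝ} (hg : Continuous g) (y : ℂ) : Continuous (circInt g y) :=
  intervalIntegral.continuous_parametric_intervalIntegral_of_continuous' (by fun_prop) _ _

lemma annAvg_mollifier_eq {g : ℂ → ℝ} (ng : IsNice g) {δ w : ℝ} (hδ : 0 < δ) (y : ℂ) :
    annAvg mollifier δ w g y = (1 / 2) *
      ∫ u in Set.Ioi (0 : ℝ), δ⁻¹ * mollifier ((u - w) / δ) * circInt g y (Real.sqrt u) := by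
  obtain ⟨M, hM0, hM⟩ := exists_mollifier_bound
  obtain ⟨B, hB⟩ := ng.bdd
  have h1 : annAvg mollifier δ w g y =
      ∫ z : ℂ, δ⁻¹ * mollifier ((‖z‖ ^ 2 - w) / δ) * g (y - z) := by
    rw [← integral_sub_left_eq_self
      (fun z : ℂ => δ⁻¹ * mollifier ((‖z‖ ^ 2 - w) / δ) * g (y - z)) volume y]
    simp only [sub_sub_cancel]
    rfl
  rw [h1, integral_radial (k := fun u => δ⁻¹ * mollifier ((u - w) / δ)) (M := δ⁻¹ * M)
    (R := w + 2 * δ) ((mollifier_contDiff.continuous.measurable.comp (by fun_prop)).const_mul _)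
    (fun s => by
      rw [abs_mul, abs_of_pos (inv_pos.2 hδ)]
      exact mul_le_mul_of_nonneg_left (hM _) (inv_pos.2 hδ).le)
    (fun s hs => by
      by_contra h
      linarith [(abs_le.1 (mollifier_arg_bound hδ (right_ne_zero_of_mul h))).2])
    (F := fun z => g (y - z)) (ng.meas.comp (by fun_prop)) (fun z => hB _)]
  congr 2 with u
  rw [circInt, intervalIntegral.integral_of_le (by linarith [Real.pi_pos]),
    integral_Ioc_eq_integral_Ioo]

lemma exists_abs_mollified_sub_le {G : ℝ → ℝ} (hG : Continuous G) {w : ℝ} (hw : 1 ≤ w) {ε : ℝ}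
    (hε : 0 < ε) : ∃ δ₀ > 0, ∀ δ, 0 < δ → δ < δ₀ →
      |(∫ u in Set.Ioi (0 : ℝ), δ⁻¹ * mollifier ((u - w) / δ) * G u) - G w| ≤ ε := by
  obtain ⟨M, hM0, hM⟩ := exists_mollifier_bound
  obtain ⟨δ₁, hδ₁, h⟩ := Metric.continuous_iff.1 hG w (ε / (2 * M)) (by positivity)
  refine ⟨min δ₁ (1 / 8), by positivity, fun δ hδ hlt => ?_⟩
  have hδ1 := hlt.trans_le (min_le_left _ _)
  have hδ8 := hlt.trans_le (min_le_right _ _)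
  have hm := mollifier_contDiff.continuous
  have hint : ∀ H : ℝ → ℝ, Continuous H →
      Integrable fun u => δ⁻¹ * mollifier ((u - w) / δ) * H u := fun H hH =>
    Continuous.integrable_of_hasCompactSupport (by fun_prop)
      (HasCompactSupport.of_support_subset_isCompact (isCompact_Icc (a := w - δ) (b := w + δ))
        fun u hu => by
          have := abs_le.1 (mollifier_arg_bound hδ
            (right_ne_zero_of_mul (left_ne_zero_of_mul hu)))
          exact ⟨by linarith, by linarith⟩)
  have h0 : G w = ∫ u in Set.Ioi (0 : ℝ), δ⁻¹ * mollifier ((u - w) / δ) * G w := by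
    rw [integral_mul_const, integral_Ioi_scaled (k := mollifier) (fun s hs => mollifier_zero (by linarith)) hδ
      (by linarith), integral_mollifier, one_mul]
  rw [h0]
  rw [← integral_sub (hint G hG).integrableOn (hint _ continuous_const).integrableOn]
  simp_rw [← mul_sub]
  rw [setIntegral_eq_of_subset_of_forall_sdiff_eq_zero (s := Set.Icc (w - δ) (w + δ))
    measurableSet_Ioi (fun u hu => by have := hu.1; exact Set.mem_Ioi.2 (by linarith))
    (fun u hu => by
      by_contra h1
      have := abs_le.1 (mollifier_arg_bound hδ
            (right_ne_zero_of_mul (left_ne_zero_of_mul h1)))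
      exact hu.2 ⟨by linarith, by linarith⟩)]
  have h2 := norm_setIntegral_le_of_norm_le_const (μ := volume) (s := Set.Icc (w - δ) (w + δ))
    (f := fun u => δ⁻¹ * mollifier ((u - w) / δ) * (G u - G w)) (C := δ⁻¹ * M * (ε / (2 * M)))
    isCompact_Icc.measure_lt_top (fun u hu => by
      have h3 := h u (by
        rw [Real.dist_eq]
        exact (abs_le.2 ⟨by linarith [hu.1], by linarith [hu.2]⟩ : |u - w| ≤ δ).trans_lt hδ1)
      rw [Real.dist_eq] at h3
      rw [Real.norm_eq_abs, abs_mul, abs_mul, abs_of_pos (inv_pos.2 hδ)]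
      exact mul_le_mul (mul_le_mul_of_nonneg_left (hM _) (inv_pos.2 hδ).le) h3.le
        (abs_nonneg _) (by positivity))
  refine h2.trans (le_of_eq ?_)
  rw [measureReal_def, Real.volume_Icc, ENNReal.toReal_ofReal (by linarith)]
  field_simp
  ring

lemma ofReal_circInt_le {g : ℂ → ℝ} (ng : IsNice g) (hg : Continuous g) {w : ℝ} (hw : 1 ≤ w)
    {y : ℂ} {J : ℕ} {A : ℝ≥0∞}
    (h : ∀ n : ℕ, ENNReal.ofReal |annAvg mollifier ((1 / 2) ^ (J + n)) w g y| ≤ A) :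
    ENNReal.ofReal (circInt g y (Real.sqrt w)) ≤ 2 * A := by
  refine ENNReal.le_of_forall_pos_le_add fun ε hε _ => ?_
  obtain ⟨δ₀, hδ₀, hlim⟩ := exists_abs_mollified_sub_le
    (G := fun u => circInt g y (Real.sqrt u))
    ((continuous_circInt hg y).comp Real.continuous_sqrt) hw (ε := (ε : ℝ)) hε
  obtain ⟨n, hn⟩ := exists_pow_lt_of_lt_one hδ₀ (by norm_num : (1 / 2 : ℝ) < 1)
  have hle : (1 / 2 : ℝ) ^ (J + n) ≤ (1 / 2) ^ n :=
    pow_le_pow_of_le_one (by norm_num) (by norm_num) (by omega)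
  have h1 := hlim _ (by positivity) (hle.trans_lt hn)
  have h2 := annAvg_mollifier_eq ng (δ := (1 / 2) ^ (J + n)) (w := w) (by positivity) y
  have h3 : circInt g y (Real.sqrt w) ≤
      2 * |annAvg mollifier ((1 / 2) ^ (J + n)) w g y| + ε := by
    have h4 := (abs_le.1 h1).1
    have h5 := le_abs_self (annAvg mollifier ((1 / 2) ^ (J + n)) w g y)
    linarith
  refine (ENNReal.ofReal_le_ofReal h3).trans ?_
  rw [ENNReal.ofReal_add (mul_nonneg zero_le_two (abs_nonneg _)) ε.coe_nonneg, ENNReal.ofReal_mul (by norm_num),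
    ENNReal.ofReal_coe_nnreal]
  refine add_le_add_left ?_ _
  rw [ENNReal.ofReal_ofNat]
  exact mul_le_mul_right (h n) _

lemma circInt_dilate (f : ℂ → ℝ) {c : ℝ} (hc : 0 < c) (x : ℂ) (t : ℝ) :
    circInt (dilate c f) (((c⁻¹ : ℝ) : ℂ) * x) (t / c) = circInt f x t := by
  have hc' : (c : ℂ) ≠ 0 := by exact_mod_cast hc.ne'
  simp only [circInt, dilate]
  congr 1 with θ
  congr 1
  push_cast
  field_simp

/-- The circular maximal function of a uniformly continuous function of bounded support is
majorised by a function whose `L^p` norm is controlled. -/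
lemma exists_circInt_majorant {p : ℝ} (hp : 2 < p) : ∃ C : ℝ≥0∞, C ≠ ⊤ ∧
    ∀ f : ℂ → ℝ, IsNice f → UniformContinuous f → ∃ F : ℂ → ℝ≥0∞,
      ∫⁻ y, F y ^ p ≤ C * ∫⁻ y, ENNReal.ofReal |f y| ^ p ∧
      ∀ (x : ℂ) (t : ℝ), 0 < t → ENNReal.ofReal (circInt f x t) ≤ 2 * F x := by
  obtain ⟨C, hC, J, -, h⟩ := exists_annulus_majorant hp
  refine ⟨C, hC, fun f nf hf => ?_⟩
  obtain ⟨F, hF, hFm⟩ := h f nf hf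
  refine ⟨F, hF, fun x t ht => ?_⟩
  obtain ⟨k, hk⟩ := exists_mem_Ico_zpow ht (by norm_num : (1 : ℝ) < 2)
  have h2k : (0 : ℝ) < 2 ^ k := by positivity
  have h1 : 1 ≤ t / 2 ^ k := (one_le_div h2k).2 hk.1
  have h2 : t / 2 ^ k ≤ 2 := by
    rw [div_le_iff₀ h2k, ← zpow_one_add₀ two_ne_zero, add_comm]
    exact hk.2.le
  have hw : (t / 2 ^ k) ^ 2 ∈ Set.Icc (1 : ℝ) 4 := ⟨by nlinarith, by nlinarith⟩
  have hcont : Continuous (dilate (2 ^ k) f) :=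
    hf.continuous.comp (continuous_const.mul continuous_id)
  have h3 := ofReal_circInt_le (nf.dilate h2k) hcont hw.1 (hFm k x _ hw)
  rw [Real.sqrt_sq (by linarith), zpow_neg, circInt_dilate f h2k] at h3
  exact h3

lemma repr_circle (θ : ℝ) :
    Complex.orthonormalBasisOneI.repr (Real.cos θ + Real.sin θ * Complex.I) = circleVec θ := by
  ext i
  rw [Complex.orthonormalBasisOneI_repr_apply]
  fin_cases i <;> simp [circleVec, -Complex.ofReal_cos, -Complex.ofReal_sin]

lemma norm_circAvg_le (f : V2 → ℂ) (t : ℝ) (x : ℂ) :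
    ‖circAvg t f (Complex.orthonormalBasisOneI.repr x)‖ ≤
      circInt (fun z => ‖f (Complex.orthonormalBasisOneI.repr z)‖) x t / 2 := by
  have hpi := Real.pi_pos
  have hper : Function.Periodic
      (fun θ => ‖f (Complex.orthonormalBasisOneI.repr x - t • circleVec θ)‖) (2 * Real.pi) := by
    intro θ
    simp only [circleVec, Real.cos_add_two_pi, Real.sin_add_two_pi]
  have h1 : circInt (fun z => ‖f (Complex.orthonormalBasisOneI.repr z)‖) x t =
      ∫ θ in (0 : ℝ)..(2 * Real.pi),
        ‖f (Complex.orthonormalBasisOneI.repr x - t • circleVec θ)‖ := by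
    have h2 := hper.intervalIntegral_add_eq (-Real.pi) 0
    rw [zero_add, show -Real.pi + 2 * Real.pi = Real.pi by ring] at h2
    rw [← h2, circInt]
    congr 1 with θ
    rw [map_sub, ← repr_circle, ← Complex.real_smul, map_smul]
  rw [h1, circAvg, norm_mul, Complex.norm_real, Real.norm_eq_abs, abs_of_pos (by positivity),
    div_eq_inv_mul]
  refine mul_le_mul ?_ (intervalIntegral.norm_integral_le_integral_norm (by positivity))
    (norm_nonneg _) (by norm_num)
  exact inv_anti₀ two_pos (by linarith [Real.pi_gt_three])

lemma isNice_norm {f : V2 → ℂ} (hf : Continuous f) (hs : HasCompactSupport f) :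
    IsNice fun z => ‖f (Complex.orthonormalBasisOneI.repr z)‖ := by
  refine ⟨by fun_prop, ?_, ?_⟩
  · obtain ⟨M, hM⟩ := hs.exists_bound_of_continuous hf
    exact ⟨M, fun x => by rw [abs_norm]; exact hM _⟩
  · obtain ⟨R, hR⟩ := hs.isBounded.subset_closedBall 0
    refine ⟨R, fun x hx => ?_⟩
    rw [norm_eq_zero]
    by_contra h
    have h1 := hR (subset_tsupport f h)
    rw [mem_closedBall_zero_iff, LinearIsometryEquiv.norm_map] at h1
    exact absurd hx (not_lt.2 h1)

/-- Bourgain's circular maximal function theorem: for every `p > 2`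
there is a constant `C` with
`(∫_{ℝ²} sup_{t>0}|A_t f(x)|^p dx)^{1/p} ≤ C‖f‖_{L^p(ℝ²)}` for every continuous
compactly supported `f : ℝ² → ℂ`. -/
theorem bourgain_circular_maximal (p : ℝ) (hp : 2 < p) :
    ∃ C : ℝ, ∀ f : V2 → ℂ, Continuous f → HasCompactSupport f →
      (∫⁻ x : V2, (⨆ t : {t : ℝ // 0 < t}, (‖circAvg (t : ℝ) f x‖₊ : ℝ≥0∞)) ^ p) ^ (1 / p)
        ≤ ENNReal.ofReal C * eLpNorm f (ENNReal.ofReal p) volume := by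
  have hp0 : 0 < p := by linarith
  obtain ⟨C, hC, h⟩ := exists_circInt_majorant hp
  refine ⟨(C ^ (1 / p)).toReal, fun f hf hs => ?_⟩
  rw [ENNReal.ofReal_toReal (ENNReal.rpow_ne_top_of_nonneg (by positivity) hC),
    eLpNorm_eq_lintegral_rpow_enorm_toReal (by simpa using hp0) ENNReal.ofReal_ne_top,
    ENNReal.toReal_ofReal hp0.le, ← ENNReal.mul_rpow_of_nonneg _ _ (by positivity : 0 ≤ 1 / p)]
  refine ENNReal.rpow_le_rpow ?_ (by positivity)
  have nf := isNice_norm hf hs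
  have hu : UniformContinuous fun z => ‖f (Complex.orthonormalBasisOneI.repr z)‖ :=
    (uniformContinuous_norm.comp (hs.uniformContinuous_of_continuous hf)).comp
      Complex.orthonormalBasisOneI.repr.isometry.uniformContinuous
  obtain ⟨F, hF, hFm⟩ := h _ nf hu
  have hmp := Complex.orthonormalBasisOneI.measurePreserving_repr
  have hemb : MeasurableEmbedding Complex.orthonormalBasisOneI.repr :=
    Complex.orthonormalBasisOneI.repr.toHomeomorph.measurableEmbedding
  rw [← hmp.lintegral_comp_emb hemb, ← hmp.lintegral_comp_emb hemb]
  calc _ ≤ ∫⁻ z, F z ^ p := ?_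
    _ ≤ _ := hF
    _ = _ := by simp_rw [abs_norm, ofReal_norm]
  refine lintegral_mono fun z => ENNReal.rpow_le_rpow (iSup_le fun t => ?_) hp0.le
  have h1 : ENNReal.ofReal (circInt (fun z => ‖f (Complex.orthonormalBasisOneI.repr z)‖) z t / 2)
      ≤ F z := by
    rw [ENNReal.ofReal_div_of_pos two_pos, ENNReal.ofReal_ofNat]
    exact ENNReal.div_le_of_le_mul' (hFm z t t.2)
  refine le_trans ?_ h1
  rw [← enorm_eq_nnnorm, ← ofReal_norm]
  exact ENNReal.ofReal_le_ofReal (norm_circAvg_le f t z)
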